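/- Let λ, μ ∈ ℝ with μ > 0 and 3λ + 2μ > 0, let r₀, E₀ > 0, D₀ > 1, and let α > 2, β ≥ 3 with α < β. There exists a constant c > 0, depending only on λ, μ, α, β, r₀, E₀, D₀, such that for every C³ cavity C with parameters r₀, E₀, D₀, every bounded open set Q ⊂ ℝ³₋ whose boundary is of class C³ with constants r₀, E₀ and which satisfies closure(B⁻_{αD₀}(0)) ⊂ Q̄ ⊂ closure(B⁻_{βD₀}(0)), every p > 0, and every weak solution u of the direct problem in Ω = ℝ³₋ \ C̄: u and ∇u extend continuously to Q̄ \ C and sup_{Q̄\C} |u| + sup_{Q̄\C} |∇u| + sup_{x≠y ∈ Q̄\C} |∇u(x) − ∇u(y)|/|x − y|^{1/2} ≤ c p. -/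

import Mathlib

open MeasureTheory Metric Set

noncomputable section

abbrev E3 := EuclideanSpace ℝ (Fin 3)
abbrev E2 := EuclideanSpace ℝ (Fin 2)

/-- The open lower half-space `{x : x₃ < 0}`. -/
def lowerHalf : Set E3 := {x | x 2 < 0}

/-- The lower half-ball `B⁻_r(0) = {|x| < r, x₃ < 0}`. -/
def negBall (r : ℝ) : Set E3 := {x | ‖x‖ < r ∧ x 2 < 0}

/-- Jacobian matrix of a vector field: `(jac u x) i j = ∂uᵢ/∂xⱼ (x)`. -/
def jac (u : E3 → E3) (x : E3) : Matrix (Fin 3) (Fin 3) ℝ :=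
  fun i j => fderiv ℝ u x (EuclideanSpace.single j 1) i

/-- Symmetric part of the Jacobian (strain tensor) `∇̂u`. -/
def strain (u : E3 → E3) (x : E3) : Matrix (Fin 3) (Fin 3) ℝ :=
  fun i j => (jac u x i j + jac u x j i) / 2

/-- Squared Frobenius norm of a 3×3 matrix. -/
def frob2 (M : Matrix (Fin 3) (Fin 3) ℝ) : ℝ := ∑ i, ∑ j, (M i j)^2

/-- Divergence of a vector field. -/
def divg (u : E3 → E3) (x : E3) : ℝ := ∑ i, jac u x i i

/-- Projection on the first two coordinates. -/
def proj12 (x : E3) : E2 :=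
  (x 0) • EuclideanSpace.single 0 1 + (x 1) • EuclideanSpace.single 1 1

/-- Embedding of the plane `{x₃ = 0}` into `ℝ³`: `x' ↦ (x'₁, x'₂, 0)`. -/
def emb2 (x' : E2) : E3 :=
  (x' 0) • EuclideanSpace.single 0 1 + (x' 1) • EuclideanSpace.single 1 1

/-- Partial derivative of a scalar field in the k-th coordinate direction. -/
def pd (f : E3 → ℝ) (k : Fin 3) (x : E3) : ℝ := fderiv ℝ f x (EuclideanSpace.single k 1)

/-- `S` has boundary of Lipschitz class with constants r₀, E₀: at each boundary point `P`,
after a rigid change of coordinates sending `P` to `0`, the set is locally the open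
epigraph of a Lipschitz function `ψ` with `ψ 0 = 0` and Lipschitz constant at most `E₀`. -/
def HasLipschitzBoundary (r₀ E₀ : ℝ) (S : Set E3) : Prop :=
  ∀ P ∈ frontier S, ∃ (φ : E3 ≃ᵢ E3) (ψ : E2 → ℝ),
    φ P = 0 ∧ ψ 0 = 0 ∧ LipschitzOnWith (Real.toNNReal E₀) ψ (Metric.ball 0 r₀) ∧
    (φ '' S) ∩ Metric.ball 0 r₀ = {x ∈ Metric.ball (0 : E3) r₀ | ψ (proj12 x) < x 2}

/-- `S` has boundary of class C³ with constants r₀, E₀. -/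
def HasC3Boundary (r₀ E₀ : ℝ) (S : Set E3) : Prop :=
  ∀ P ∈ frontier S, ∃ (φ : E3 ≃ᵢ E3) (ψ : E2 → ℝ),
    φ P = 0 ∧ ψ 0 = 0 ∧ ContDiff ℝ 3 ψ ∧ fderiv ℝ ψ 0 = 0 ∧
    (∀ x' ∈ Metric.ball (0 : E2) r₀, ∀ k : ℕ, k ≤ 3 → ‖iteratedFDeriv ℝ k ψ x'‖ ≤ E₀) ∧
    (φ '' S) ∩ Metric.ball 0 r₀ = {x ∈ Metric.ball (0 : E3) r₀ | ψ (proj12 x) < x 2}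

/-- Geometric a priori assumptions on a cavity: bounded open set, closure inside the lower
half-space, connected complement in the half-space, contained in `B⁻_{2D₀}(0)`, at distance
at least `D₀` from the plane `{x₃ = 0}`, with diameter less than `D₀`. -/
def IsCavity (D₀ : ℝ) (C : Set E3) : Prop :=
  IsOpen C ∧ Bornology.IsBounded C ∧ closure C ⊆ lowerHalf ∧
  IsConnected (lowerHalf \ closure C) ∧ C ⊆ negBall (2*D₀) ∧
  (∀ x ∈ C, x 2 ≤ -D₀) ∧ Metric.diam C < D₀

/-- Lipschitz cavity with parameters r₀, E₀, D₀. -/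
def IsLipschitzCavity (r₀ E₀ D₀ : ℝ) (C : Set E3) : Prop :=
  IsCavity D₀ C ∧ HasLipschitzBoundary r₀ E₀ C

/-- C³ cavity with parameters r₀, E₀, D₀. -/
def IsC3Cavity (r₀ E₀ D₀ : ℝ) (C : Set E3) : Prop :=
  IsCavity D₀ C ∧ HasC3Boundary r₀ E₀ C

/-- Weak solution of the direct problem: `u` is C¹ on `Ω = ℝ³₋ \ C̄`, lies in the weighted
class, and satisfies the variational identity
`∫_Ω ℂ∇̂u : ∇̂v = −p ∫_C div v` for all smooth compactly supported test fields `v`. -/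
def IsWeakSolution (lam mu p : ℝ) (C : Set E3) (u : E3 → E3) : Prop :=
  ContDiffOn ℝ 1 u (lowerHalf \ closure C) ∧
  IntegrableOn (fun x => ‖u x‖^2 / (1 + ‖x‖^2)) (lowerHalf \ closure C) ∧
  IntegrableOn (fun x => frob2 (jac u x)) (lowerHalf \ closure C) ∧
  ∀ v : E3 → E3, ContDiff ℝ (⊤ : ℕ∞) v → HasCompactSupport v →
    ∫ x in lowerHalf \ closure C,
        (lam * divg u x * divg v x + 2 * mu * ∑ i, ∑ j, strain u x i j * strain v x i j)
      = -p * ∫ x in C, divg v x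

set_option linter.all false
open Filter Topology
open scoped ENNReal NNReal InnerProductSpace
local notation "Df" => fderiv ℝ
local notation "o3" => (0 : E3)
local notation "eO" => ENNReal.ofReal
local notation "u01" => Icc (0:ℝ) 1
local notation "L3" => E3 →L[ℝ] E3
variable {V : Type*} [NormedAddCommGroup V] [NormedSpace ℝ V] {f : E3 → V} {lam mu : ℝ} {x y : E3} {u : E3 → E3} {O C D : Set E3} {θ : E3 → ℝ} {a : Fin 3}
lemma lint_affine (h : E3 → ℝ≥0∞) (a : E3) {t : ℝ} (ht : 0 < t) :
    ∫⁻ x, h (a + t • x) = eO (t^3)⁻¹ * ∫⁻ x, h x := by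
  have e1 : ∫⁻ x, h (a + t • x) = ∫⁻ x, h (a + x) ∂(Measure.map (fun x : E3 => t • x) volume) := by
    exact ((Homeomorph.smulOfNeZero t ht.ne').measurableEmbedding.lintegral_map
      (fun x => h (a + x))).symm
  rw [e1, Measure.map_addHaar_smul _ ht.ne', lintegral_smul_measure, lintegral_add_left_eq_self h a]
  simp [abs_of_pos ht]
lemma lint_half (h : E3 → ℝ≥0∞) (a : E3) {t : ℝ} (ht : 1/2 ≤ t) :
    ∫⁻ x, h (a + t • (x - a)) ≤ 8 * ∫⁻ x, h x := by
  have h0 : 0 < t := by linarith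
  have : ∀ x, a + t • (x - a) = (a - t • a) + t • x := fun x => by rw [smul_sub]; abel
  simp_rw [this]
  rw [lint_affine h _ h0]
  gcongr
  rw [show (8:ℝ≥0∞) = eO 8 by norm_num]
  apply ENNReal.ofReal_le_ofReal
  rw [inv_le_comm₀ (by positivity) (by norm_num)]
  have : (1/2:ℝ)^3 ≤ t^3 := by gcongr
  norm_num at this ⊢; linarith
lemma lint_seg (h : E3 → ℝ≥0∞) (hm : Measurable h) (P B : Set E3) {t : ℝ} :
    ∫⁻ y in B, ∫⁻ x in P, h (y + t • (x - y)) ≤ 8 * (volume P + volume B) * ∫⁻ x, h x := by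
  rcases le_total (1/2) t with h2 | h2
  · calc _ ≤ ∫⁻ y in B, 8 * ∫⁻ x, h x := by
          gcongr with y
          exact (lintegral_mono' Measure.restrict_le_self le_rfl).trans (lint_half h y h2)
      _ ≤ _ := by
          rw [setLIntegral_const, mul_right_comm]; gcongr; exact le_add_self
  · have hs : 1/2 ≤ 1 - t := by linarith
    calc _ = ∫⁻ x in P, ∫⁻ y in B, h (y + t • (x - y)) := by
          apply lintegral_lintegral_swap
          apply Measurable.aemeasurable; fun_prop
      _ = ∫⁻ x in P, ∫⁻ y in B, h (x + (1-t) • (y - x)) := by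
          congr! 5 with x y; module
      _ ≤ ∫⁻ x in P, 8 * ∫⁻ x, h x := by
          gcongr with y
          exact (lintegral_mono' Measure.restrict_le_self le_rfl).trans (lint_half h y hs)
      _ ≤ _ := by
          rw [setLIntegral_const, mul_right_comm]; gcongr; exact le_self_add
lemma seg_ftc {V W : Type*} [NormedAddCommGroup V] [NormedSpace ℝ V] [NormedAddCommGroup W]
    [NormedSpace ℝ W] {Ω : Set E3} (hΩ : IsOpen Ω) {f : E3 → V}
    (hf : ContDiffOn ℝ 1 f Ω) (ℓ : V →L[ℝ] W) (hs : segment ℝ y x ⊆ Ω) :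
    ‖ℓ (f x) - ℓ (f y)‖ₑ ≤ ∫⁻ t in u01, ‖ℓ (Df f (y + t • (x - y)) (x - y))‖ₑ := by
  have hm : ∀ t ∈ u01, y + t • (x - y) ∈ Ω := fun t ht => hs (by
    rw [segment_eq_image']; exact ⟨t, ht, rfl⟩)
  have hc : ContDiffOn ℝ 1 (fun t : ℝ => ℓ (f (y + t • (x - y)))) (Icc 0 1) :=
    ℓ.contDiff.comp_contDiffOn (hf.comp (by fun_prop) hm)
  have := enorm_sub_le_lintegral_deriv_of_contDiffOn_Icc hc zero_le_one
  simp only [one_smul, add_sub_cancel, zero_smul, add_zero] at this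
  refine this.trans (setLIntegral_mono' measurableSet_Icc fun t ht => le_of_eq ?_)
  congr 1
  have h1 : HasDerivAt (fun t : ℝ => y + t • (x - y)) (x - y) t := by
    simpa using ((hasDerivAt_id t).smul_const (x - y)).const_add y
  have h2 := ((hf.differentiableOn one_ne_zero).differentiableAt (hΩ.mem_nhds (hm t ht))).hasFDerivAt
  exact (ℓ.hasFDerivAt.comp_hasDerivAt t (h2.comp_hasDerivAt t h1)).deriv
lemma meas_fd {V : Type*} [NormedAddCommGroup V] [NormedSpace ℝ V] [CompleteSpace V] (f : E3 → V)
    {S : Set E3} (hS : MeasurableSet S) : Measurable (S.indicator fun x => ‖Df f x‖ₑ) :=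
  (measurable_fderiv ℝ f).enorm.indicator hS
lemma cs2 {α : Type*} [MeasurableSpace α] (m : Measure α) (f g : α → ℝ≥0∞) (hf : AEMeasurable f m)
    (hg : AEMeasurable g m) {a b : ℝ} (ha : 0 ≤ a) (hb : 0 ≤ b)
    (h1 : ∫⁻ x, f x ^ 2 ∂m ≤ eO (a^2))
    (h2 : ∫⁻ x, g x ^ 2 ∂m ≤ eO (b^2)) :
    ∫⁻ x, f x * g x ∂m ≤ eO (a * b) := by
  have h := ENNReal.lintegral_mul_le_Lp_mul_Lq m (p := 2) (q := 2) (by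
    rw [Real.holderConjugate_iff]; norm_num) hf hg
  simp only [Pi.mul_apply, ENNReal.rpow_two] at h
  refine h.trans ?_
  have e : ∀ c : ℝ, 0 ≤ c → (eO (c^2)) ^ ((1:ℝ)/2) = eO c := by
    intro c hc
    rw [ENNReal.ofReal_rpow_of_nonneg (by positivity) (by norm_num), ← Real.sqrt_eq_rpow,
      Real.sqrt_sq hc]
  calc _ ≤ (eO (a^2)) ^ ((1:ℝ)/2) * (eO (b^2)) ^ ((1:ℝ)/2) := by
        gcongr
    _ = _ := by rw [e a ha, e b hb, ENNReal.ofReal_mul ha]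
lemma scal_avg {K : Set E3} (hK : MeasurableSet K) {v₁ : ℝ} (hv₁ : 0 ≤ v₁)
    (hv : volume K ≤ eO (v₁^2)) (h : E3 → ℝ≥0∞) (hm : Measurable h) {M : ℝ}
    (hM0 : 0 ≤ M) (hM : ∫⁻ x, h x ^ 2 ≤ eO (M^2)) (x : E3) {t : ℝ} (ht : 0 < t) :
    ∫⁻ κ in K, h (x + t • (κ - x)) ≤ eO (v₁ * M * t ^ (-(3/2) : ℝ)) := by
  have e2 : (t ^ (-(3/2) : ℝ))^2 = (t^3)⁻¹ := by
    rw [← Real.rpow_natCast, ← Real.rpow_mul ht.le, ← Real.rpow_natCast t 3, ← Real.rpow_neg ht.le]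
    norm_num
  have := cs2 (volume.restrict K) (fun _ => 1) (fun κ => h (x + t • (κ - x))) (by fun_prop)
    (by fun_prop) hv₁ (b := M * t ^ (-(3/2) : ℝ)) (by positivity) (by simpa using hv) (by
      refine (lintegral_mono' Measure.restrict_le_self le_rfl).trans ?_
      have : ∀ y, x + t • (y - x) = (x - t • x) + t • y := fun y => by rw [smul_sub]; abel
      simp_rw [this]
      rw [lint_affine (fun y => h y ^ 2) _ ht, mul_pow, e2, mul_comm, 
        ENNReal.ofReal_mul (by positivity)]
      gcongr)
  simpa [mul_assoc] using this
lemma lint_rpow {c r a b : ℝ} (hc : 0 ≤ c) (ha : 0 ≤ a) (hab : a ≤ b)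
    (h : -1 < r ∨ r ≠ -1 ∧ 0 < a) :
    ∫⁻ s in Icc a b, eO (c * s ^ r) =
      eO (c * ((b ^ (r+1) - a ^ (r+1)) / (r+1))) := by
  have h0 : -1 < r ∨ r ≠ -1 ∧ (0:ℝ) ∉ uIcc a b := by
    rcases h with h | h
    · exact Or.inl h
    · refine Or.inr ⟨h.1, ?_⟩
      rw [uIcc_of_le hab]; intro h'; exact absurd h'.1 (not_le.2 h.2)
  have hi : IntervalIntegrable (fun s : ℝ => s ^ r) volume a b := by
    rcases h0 with h | h
    · exact intervalIntegral.intervalIntegrable_rpow' h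
    · exact intervalIntegral.intervalIntegrable_rpow (Or.inr h.2)
  rw [← restrict_Ioc_eq_restrict_Icc, ← ofReal_integral_eq_lintegral_ofReal,
    ← intervalIntegral.integral_of_le hab, intervalIntegral.integral_const_mul, integral_rpow h0]
  · exact ((intervalIntegrable_iff_integrableOn_Ioc_of_le hab).1 hi).const_mul c
  · refine (ae_restrict_mem measurableSet_Ioc).mono fun s hs => ?_
    have : 0 ≤ s := ha.trans hs.1.le
    simp only [Pi.zero_apply]; positivity
section
variable {V : Type*} [NormedAddCommGroup V] [NormedSpace ℝ V] [CompleteSpace V]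
lemma ray_ftc {K : Set E3} (hK : IsOpen K) (hc : Convex ℝ K) {d : ℝ}
    (hd : ∀ x ∈ K, ∀ y ∈ K, ‖x - y‖ ≤ d) {f : E3 → V} (hf : ContDiffOn ℝ 1 f K) {x κ : E3}
    (hx : x ∈ K) (hκ : κ ∈ K) {s s' : ℝ} (hs : 0 ≤ s) (hss : s ≤ s') (hs' : s' ≤ 1) :
    ‖f (x + s' • (κ - x)) - f (x + s • (κ - x))‖ₑ ≤
      ∫⁻ t in Icc s s', eO d * K.indicator (fun x => ‖Df f x‖ₑ)
        (x + t • (κ - x)) := by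
  have hm : ∀ t ∈ Icc s s', x + t • (κ - x) ∈ K := fun t ht =>
    hc.add_smul_sub_mem hx hκ ⟨hs.trans ht.1, ht.2.trans hs'⟩
  have hcd : ContDiffOn ℝ 1 (fun t : ℝ => f (x + t • (κ - x))) (Icc s s') :=
    hf.comp (by fun_prop) hm
  refine (enorm_sub_le_lintegral_deriv_of_contDiffOn_Icc hcd hss).trans
    (setLIntegral_mono' measurableSet_Icc fun t ht => ?_)
  have h1 : HasDerivAt (fun t : ℝ => x + t • (κ - x)) (κ - x) t := by
    simpa using ((hasDerivAt_id t).smul_const (κ - x)).const_add x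
  have h2 := ((hf.differentiableOn one_ne_zero).differentiableAt (hK.mem_nhds (hm t ht))).hasFDerivAt
  rw [show deriv (fun t : ℝ => f (x + t • (κ - x))) t = _ from (h2.comp_hasDerivAt t h1).deriv, indicator_of_mem (hm t ht), mul_comm]
  refine (ContinuousLinearMap.le_opENorm (Df f _) (κ - x)).trans ?_
  gcongr
  rw [← ofReal_norm]; exact ENNReal.ofReal_le_ofReal (hd _ hκ _ hx)
lemma ray_int {K : Set E3} (hK : IsOpen K) (hc : Convex ℝ K) {d : ℝ}
    (hd : ∀ x ∈ K, ∀ y ∈ K, ‖x - y‖ ≤ d) {f : E3 → V} (hf : ContDiffOn ℝ 1 f K) {x : E3}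
    (hx : x ∈ K) {s s' : ℝ} (hs : 0 ≤ s) (hss : s ≤ s') (hs' : s' ≤ 1) :
    ∫⁻ κ in K, ‖f (x + s' • (κ - x)) - f (x + s • (κ - x))‖ₑ ≤
      eO d * ∫⁻ t in Icc s s', ∫⁻ κ in K, K.indicator (fun x => ‖Df f x‖ₑ)
        (x + t • (κ - x)) := by
  have hm := meas_fd f hK.measurableSet
  refine (setLIntegral_mono' hK.measurableSet fun κ hκ =>
    ray_ftc hK hc hd hf hx hκ hs hss hs').trans (le_of_eq ?_)
  rw [lintegral_lintegral_swap (Measurable.aemeasurable (by fun_prop)),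
    ← lintegral_const_mul _ (Measurable.lintegral_prod_right (by fun_prop))]
  exact lintegral_congr fun t => lintegral_const_mul _ (by fun_prop)
lemma embA {K : Set E3} (hK : IsOpen K) (hc : Convex ℝ K) {d v₁ M : ℝ} (hd0 : 0 ≤ d)
    (hd : ∀ x ∈ K, ∀ y ∈ K, ‖x - y‖ ≤ d) (hv0 : 0 ≤ v₁) (hv : volume K ≤ eO (v₁^2))
    (hM0 : 0 ≤ M) {f : E3 → V} (hf : ContDiffOn ℝ 2 f K)
    (h1 : ∫⁻ x in K, ‖Df f x‖ₑ^2 ≤ eO (M^2))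
    (h2 : ∫⁻ x in K, ‖Df (Df f) x‖ₑ^2 ≤ eO (M^2)) {x : E3} (hx : x ∈ K)
    {s : ℝ} (hs : 0 < s) (hs1 : s ≤ 1) :
    ∫⁻ κ in K, K.indicator (fun x => ‖Df f x‖ₑ) (x + s • (κ - x)) ≤
      eO ((1 + 2 * d) * v₁ * M * s ^ (-(1/2) : ℝ)) := by
  have hfd : ContDiffOn ℝ 1 (Df f) K := hf.fderiv_of_isOpen hK (by norm_num)
  have hmem : ∀ κ ∈ K, x + s • (κ - x) ∈ K := fun κ hκ =>
    hc.add_smul_sub_mem hx hκ ⟨hs.le, hs1⟩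
  have a0 : ∫⁻ κ in K, ‖Df f κ‖ₑ ≤ eO (v₁ * M) := by
    have := cs2 (volume.restrict K) (fun _ => 1) (fun κ => ‖Df f κ‖ₑ) (by fun_prop)
      (measurable_fderiv ℝ f).enorm.aemeasurable hv0 hM0 (by simpa using hv) h1
    simpa using this
  have a1 := ray_int hK hc hd hfd hx hs.le hs1 le_rfl
  simp only [one_smul, add_sub_cancel] at a1
  have hm2 := meas_fd (Df f) hK.measurableSet
  have a2 : ∀ t ∈ Icc s 1, ∫⁻ κ in K, K.indicator (fun x => ‖Df (Df f) x‖ₑ)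
        (x + t • (κ - x)) ≤ eO (v₁ * M * t ^ (-(3/2) : ℝ)) := fun t ht => by
    refine scal_avg hK.measurableSet hv0 hv _ hm2 hM0 ?_ x (hs.trans_le ht.1)
    refine le_trans (le_of_eq ?_) h2
    rw [← lintegral_indicator hK.measurableSet]
    refine lintegral_congr fun y => ?_
    by_cases hy : y ∈ K <;> simp [hy]
  have a3 := (a1.trans (mul_le_mul_right (setLIntegral_mono' measurableSet_Icc a2) _))
  rw [lint_rpow (by positivity) hs.le hs1 (Or.inr ⟨by norm_num, hs⟩),
    ← ENNReal.ofReal_mul hd0] at a3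
  have b1 : 1 ≤ s ^ (-(1/2) : ℝ) := Real.one_le_rpow_of_pos_of_le_one_of_nonpos hs hs1 (by norm_num)
  calc _ ≤ ∫⁻ κ in K, (‖Df f κ‖ₑ + ‖Df f κ - Df f (x + s • (κ - x))‖ₑ) := by
        refine setLIntegral_mono' hK.measurableSet fun κ hκ => ?_
        rw [indicator_of_mem (hmem κ hκ), enorm_sub_rev]
        simpa [sub_add_cancel, add_comm] using 
          enorm_add_le (Df f (x + s • (κ - x)) - Df f κ) (Df f κ)
    _ = _ + _ := lintegral_add_left (measurable_fderiv ℝ f).enorm _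
    _ ≤ _ := add_le_add a0 a3
    _ = _ := by
        rw [← ENNReal.ofReal_add (by positivity)]
        have : (0:ℝ) ≤ ((1:ℝ) ^ (-(3 / 2) + 1 : ℝ) - s ^ (-(3 / 2) + 1 : ℝ)) / (-(3 / 2) + 1) := by
          rw [Real.one_rpow, show (-(3/2) + 1 : ℝ) = -(1/2) by norm_num]
          rw [div_nonneg_iff]; right; constructor <;> linarith
        positivity
    _ ≤ _ := by
        apply ENNReal.ofReal_le_ofReal
        rw [Real.one_rpow, show (-(3/2) + 1 : ℝ) = -(1/2) by norm_num]
        have : 0 ≤ v₁ * M := by positivity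
        have : 0 ≤ d * (v₁ * M) := by positivity
        nlinarith
lemma embB {K : Set E3} (hK : IsOpen K) (hc : Convex ℝ K) {d v₁ M : ℝ} (hd0 : 0 ≤ d)
    (hd : ∀ x ∈ K, ∀ y ∈ K, ‖x - y‖ ≤ d) (hv0 : 0 ≤ v₁) (hv : volume K ≤ eO (v₁^2))
    (hM0 : 0 ≤ M) {f : E3 → V} (hf : ContDiffOn ℝ 2 f K)
    (h1 : ∫⁻ x in K, ‖Df f x‖ₑ^2 ≤ eO (M^2))
    (h2 : ∫⁻ x in K, ‖Df (Df f) x‖ₑ^2 ≤ eO (M^2)) {x : E3} (hx : x ∈ K)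
    {s : ℝ} (hs : 0 ≤ s) (hs1 : s ≤ 1) :
    ∫⁻ κ in K, ‖f (x + s • (κ - x)) - f x‖ₑ ≤
      eO (2 * d * (1 + 2 * d) * v₁ * M * s ^ (1/2 : ℝ)) := by
  have a1 := ray_int hK hc hd (hf.of_le one_le_two) hx le_rfl hs hs1
  simp only [zero_smul, add_zero] at a1
  have e : ∫⁻ t in Icc 0 s, ∫⁻ κ in K, K.indicator (fun x => ‖Df f x‖ₑ) (x + t • (κ - x)) ≤
      ∫⁻ t in Icc 0 s, eO ((1 + 2 * d) * v₁ * M * t ^ (-(1/2) : ℝ)) := by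
    rw [← restrict_Ioc_eq_restrict_Icc]
    exact setLIntegral_mono' measurableSet_Ioc fun t ht =>
      embA hK hc hd0 hd hv0 hv hM0 hf h1 h2 hx ht.1 (ht.2.trans hs1)
  rw [lint_rpow (by positivity) le_rfl hs (Or.inl (by norm_num))] at e
  refine a1.trans ((mul_le_mul_right e _).trans (le_of_eq ?_))
  rw [← ENNReal.ofReal_mul hd0]
  congr 1
  rw [show (-(1/2) + 1 : ℝ) = 1/2 by norm_num, Real.zero_rpow (by norm_num)]
  ring
lemma embM {K : Set E3} (hK : IsOpen K) (hc : Convex ℝ K) {d v₁ M : ℝ} (hd0 : 0 ≤ d)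
    (hd : ∀ x ∈ K, ∀ y ∈ K, ‖x - y‖ ≤ d) (hv0 : 0 ≤ v₁) (hv : volume K ≤ eO (v₁^2))
    (hM0 : 0 ≤ M) {f : E3 → V} (hf : ContDiffOn ℝ 2 f K)
    (h1 : ∫⁻ x in K, ‖Df f x‖ₑ^2 ≤ eO (M^2))
    (h2 : ∫⁻ x in K, ‖Df (Df f) x‖ₑ^2 ≤ eO (M^2)) {x y : E3} (hx : x ∈ K)
    (hy : y ∈ K) {s : ℝ} (hs : 0 < s) (hs1 : s ≤ 1) :
    ∫⁻ κ in K, ‖f (x + s • (κ - x)) - f (y + s • (κ - y))‖ₑ ≤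
      eO (‖x - y‖ * ((1 + 2 * d) * v₁ * M * s ^ (-(1/2) : ℝ))) := by
  have hm := meas_fd f hK.measurableSet
  calc _ ≤ ∫⁻ κ in K, ∫⁻ t in u01, eO ‖x - y‖ *
          K.indicator (fun x => ‖Df f x‖ₑ) ((y + t • (x - y)) + s • (κ - (y + t • (x - y)))) := by
        refine setLIntegral_mono' hK.measurableSet fun κ hκ => ?_
        have m1 := hc.add_smul_sub_mem hx hκ ⟨hs.le, hs1⟩
        have m2 := hc.add_smul_sub_mem hy hκ ⟨hs.le, hs1⟩
        refine (seg_ftc hK (hf.of_le one_le_two) (ContinuousLinearMap.id ℝ V)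
          (hc.segment_subset m2 m1)).trans (setLIntegral_mono' measurableSet_Icc fun t ht => ?_)
        have m3 := hc.add_smul_sub_mem m2 m1 ht
        have e : (y + t • (x - y)) + s • (κ - (y + t • (x - y))) =
          y + s • (κ - y) + t • (x + s • (κ - x) - (y + s • (κ - y))) := by module
        rw [e, indicator_of_mem m3, mul_comm]
        refine (ContinuousLinearMap.le_opENorm (Df f _) _).trans ?_
        gcongr
        rw [← ofReal_norm]
        apply ENNReal.ofReal_le_ofReal
        have : x + s • (κ - x) - (y + s • (κ - y)) = (1 - s) • (x - y) := by module
        rw [this, norm_smul, Real.norm_eq_abs, abs_of_nonneg (by linarith)]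
        nlinarith [norm_nonneg (x - y)]
    _ = ∫⁻ t in u01, eO ‖x - y‖ * ∫⁻ κ in K,
          K.indicator (fun x => ‖Df f x‖ₑ) ((y + t • (x - y)) + s • (κ - (y + t • (x - y)))) := by
        rw [lintegral_lintegral_swap (Measurable.aemeasurable (by fun_prop))]
        exact lintegral_congr fun t => lintegral_const_mul _ (by fun_prop)
    _ ≤ ∫⁻ t in u01, eO ‖x - y‖ *
          eO ((1 + 2 * d) * v₁ * M * s ^ (-(1/2) : ℝ)) := by
        refine setLIntegral_mono' measurableSet_Icc fun t ht => ?_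
        gcongr
        exact embA hK hc hd0 hd hv0 hv hM0 hf h1 h2 (hc.add_smul_sub_mem hy hx ht) hs hs1
    _ = _ := by rw [setLIntegral_const, ENNReal.ofReal_mul (norm_nonneg _)]; simp
lemma emb_avg {K : Set E3} {v₀ : ℝ} (hv₀ : 0 < v₀)
    (hv' : eO v₀ ≤ volume K) {a : V} {b : ℝ} (hb : 0 ≤ b)
    (h : ∫⁻ _ in K, ‖a‖ₑ ≤ eO b) : ‖a‖ ≤ b / v₀ := by
  rw [setLIntegral_const] at h
  have : eO (‖a‖ * v₀) ≤ eO b := by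
    rw [ENNReal.ofReal_mul (norm_nonneg _), ofReal_norm]
    exact (mul_le_mul_right hv' _).trans h
  rw [ENNReal.ofReal_le_ofReal_iff hb] at this
  rwa [le_div_iff₀ hv₀]
lemma emb_hol {K : Set E3} (hK : IsOpen K) (hc : Convex ℝ K) {d v₀ v₁ M : ℝ} (hd0 : 0 < d)
    (hd : ∀ x ∈ K, ∀ y ∈ K, ‖x - y‖ ≤ d) (hv0 : 0 ≤ v₁) (hv : volume K ≤ eO (v₁^2))
    (hv₀ : 0 < v₀) (hv' : eO v₀ ≤ volume K)
    (hM0 : 0 ≤ M) {f : E3 → V} (hf : ContDiffOn ℝ 2 f K)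
    (h1 : ∫⁻ x in K, ‖Df f x‖ₑ^2 ≤ eO (M^2))
    (h2 : ∫⁻ x in K, ‖Df (Df f) x‖ₑ^2 ≤ eO (M^2)) {x y : E3} (hx : x ∈ K)
    (hy : y ∈ K) :
    ‖f x - f y‖ ≤ 5 * √d * (1 + 2 * d) * v₁ / v₀ * M * √‖x - y‖ := by
  rcases eq_or_ne x y with rfl | hxy
  · simp
  have hn : 0 < ‖x - y‖ := norm_sub_pos_iff.2 hxy
  set s := ‖x - y‖ / d with hs
  have hs0 : 0 < s := by positivity
  have hs1 : s ≤ 1 := by rw [hs, div_le_one hd0]; exact hd x hx y hy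
  have A := embB hK hc hd0.le hd hv0 hv hM0 hf h1 h2 hx hs0.le hs1
  have B := embB hK hc hd0.le hd hv0 hv hM0 hf h1 h2 hy hs0.le hs1
  have C := embM hK hc hd0.le hd hv0 hv hM0 hf h1 h2 hx hy hs0 hs1
  have hcts : ∀ z ∈ K, ContinuousOn (fun κ => f (z + s • (κ - z))) K := fun z hz =>
    hf.continuousOn.comp (by fun_prop) fun κ hκ => hc.add_smul_sub_mem hz hκ ⟨hs0.le, hs1⟩
  have m1 : AEMeasurable (fun κ => ‖f (x + s • (κ - x)) - f x‖ₑ) (volume.restrict K) :=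
    (((hcts x hx).sub continuousOn_const).aestronglyMeasurable hK.measurableSet).enorm
  have m2 : AEMeasurable (fun κ => ‖f (x + s • (κ - x)) - f (y + s • (κ - y))‖ₑ)
      (volume.restrict K) :=
    (((hcts x hx).sub (hcts y hy)).aestronglyMeasurable hK.measurableSet).enorm
  have T : ∫⁻ _ in K, ‖f x - f y‖ₑ ≤ eO (2 * d * (1 + 2 * d) * v₁ * M * s ^ (1/2 : ℝ) +
      (‖x - y‖ * ((1 + 2 * d) * v₁ * M * s ^ (-(1/2) : ℝ)) +
        2 * d * (1 + 2 * d) * v₁ * M * s ^ (1/2 : ℝ))) := by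
    rw [ENNReal.ofReal_add (by positivity) (by positivity),
      ENNReal.ofReal_add (by positivity) (by positivity)]
    refine le_trans ?_ (add_le_add A (add_le_add C B))
    rw [← lintegral_add_left' m2, ← lintegral_add_left' m1]
    refine lintegral_mono fun κ => ?_
    have : f x - f y = -(f (x + s • (κ - x)) - f x) + ((f (x + s • (κ - x)) - f (y + s • (κ - y)))
      + (f (y + s • (κ - y)) - f y)) := by abel
    rw [this]
    refine (enorm_add_le _ _).trans ?_
    rw [enorm_neg]
    gcongr
    exact enorm_add_le _ _
  refine (emb_avg hv₀ hv' (by positivity) T).trans (le_of_eq ?_)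
  have r1 : s ^ (1/2 : ℝ) = √‖x - y‖ / √d := by
    rw [← Real.sqrt_eq_rpow, hs, Real.sqrt_div (norm_nonneg _)]
  rw [Real.rpow_neg hs0.le, r1]
  have p1 : 0 < √‖x-y‖ := Real.sqrt_pos.2 hn
  have p2 : 0 < √d := Real.sqrt_pos.2 hd0
  have q1 : ‖x - y‖ = √‖x-y‖ ^ 2 := (Real.sq_sqrt hn.le).symm
  have q2 : d = √d ^ 2 := (Real.sq_sqrt hd0.le).symm
  generalize √‖x-y‖ = a at *
  generalize √d = e at *
  rw [q1, q2]
  field_simp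
  ring
lemma emb_sup {K : Set E3} (hK : IsOpen K) (hc : Convex ℝ K) {d v₀ v₁ M : ℝ} (hd0 : 0 < d)
    (hd : ∀ x ∈ K, ∀ y ∈ K, ‖x - y‖ ≤ d) (hv0 : 0 ≤ v₁) (hv : volume K ≤ eO (v₁^2))
    (hv₀ : 0 < v₀) (hv' : eO v₀ ≤ volume K)
    (hM0 : 0 ≤ M) {f : E3 → V} (hf : ContDiffOn ℝ 2 f K)
    (h0 : ∫⁻ x in K, ‖f x‖ₑ^2 ≤ eO (M^2))
    (h1 : ∫⁻ x in K, ‖Df f x‖ₑ^2 ≤ eO (M^2))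
    (h2 : ∫⁻ x in K, ‖Df (Df f) x‖ₑ^2 ≤ eO (M^2)) {x : E3} (hx : x ∈ K) :
    ‖f x‖ ≤ (1 + 2 * d * (1 + 2 * d)) * v₁ / v₀ * M := by
  have B := embB hK hc hd0.le hd hv0 hv hM0 hf h1 h2 hx zero_le_one le_rfl
  have mf : AEMeasurable (fun κ => ‖f κ‖ₑ) (volume.restrict K) :=
    (hf.continuousOn.aestronglyMeasurable hK.measurableSet).enorm
  have a0 : ∫⁻ κ in K, ‖f κ‖ₑ ≤ eO (v₁ * M) := by
    have := cs2 (volume.restrict K) (fun _ => 1) (fun κ => ‖f κ‖ₑ) (by fun_prop)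
      mf hv0 hM0 (by simpa using hv) h0
    simpa using this
  simp only [one_smul, add_sub_cancel, Real.one_rpow] at B
  have T : ∫⁻ _ in K, ‖f x‖ₑ ≤ eO (v₁ * M + 2 * d * (1 + 2 * d) * v₁ * M * 1) := by
    rw [ENNReal.ofReal_add (by positivity) (by positivity)]
    refine le_trans ?_ (add_le_add a0 B)
    rw [← lintegral_add_left' mf]
    refine lintegral_mono fun κ => ?_
    rw [enorm_sub_rev]
    simpa using enorm_add_le (f κ) (f x - f κ)
  refine (emb_avg hv₀ hv' (by positivity) T).trans (le_of_eq ?_)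
  field_simp
end
abbrev M3 := L3
def sym (A : M3) : M3 := (1/2 : ℝ) • (A + ContinuousLinearMap.adjoint A)
lemma sym_inner (A : M3) (x : E3) : ⟪A x, x⟫_ℝ = ⟪sym A x, x⟫_ℝ := by
  simp only [sym, _root_.smul_apply, _root_.add_apply, inner_smul_left,
    inner_add_left, ContinuousLinearMap.adjoint_inner_left]
  rw [real_inner_comm (A x) x]; simp; ring
lemma sym_cont : Continuous sym := by
  unfold sym
  fun_prop
lemma sym_meas (u : E3 → E3) : Measurable fun x => ‖sym (Df u x)‖ₑ :=
  (sym_cont.measurable.comp (measurable_fderiv ℝ u)).enorm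
def N2 {V : Type*} [NormedAddCommGroup V] (f : E3 → V) (S : Set E3) : ℝ≥0∞ := ∫⁻ x in S, ‖f x‖ₑ^2
lemma csE {α : Type*} [MeasurableSpace α] (m : Measure α) (f g : α → ℝ≥0∞) (hf : AEMeasurable f m)
    (hg : AEMeasurable g m) : (∫⁻ x, f x * g x ∂m)^2 ≤ (∫⁻ x, f x ^ 2 ∂m) * ∫⁻ x, g x ^ 2 ∂m := by
  have h := ENNReal.lintegral_mul_le_Lp_mul_Lq m (p := 2) (q := 2) (by
    rw [Real.holderConjugate_iff]; norm_num) hf hg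
  simp only [Pi.mul_apply, ENNReal.rpow_two] at h
  have h2 : (∫⁻ x, f x * g x ∂m)^2 ≤ _ ^ 2 := pow_le_pow_left₀ zero_le h 2
  refine h2.trans (le_of_eq ?_)
  rw [mul_pow, ← ENNReal.rpow_two, ← ENNReal.rpow_two, ← ENNReal.rpow_mul, ← ENNReal.rpow_mul]
  norm_num
lemma add_sqE (a b : ℝ≥0∞) : (a + b)^2 ≤ 2 * (a^2 + b^2) := by
  induction a using ENNReal.recTopCoe with
  | top => simp
  | coe a =>
    induction b using ENNReal.recTopCoe with
    | top => simp
    | coe b => exact_mod_cast (add_sq_le : (a + b)^2 ≤ _)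
lemma dir_low {s : ℝ} (hs : 0 < s) (a ξ z : E3) :
    eO ((s/4)^2) * volume (ball o3 (s/4)) * ‖a‖ₑ^2 ≤
      ∫⁻ y in ball z s, ‖⟪a, ξ - y⟫_ℝ‖ₑ^2 := by
  rcases eq_or_ne a 0 with rfl | ha
  · simp
  have hn : 0 < ‖a‖ := norm_pos_iff.2 ha
  obtain ⟨σ, hσ, hσ2⟩ : ∃ σ : ℝ, |σ| = 1 ∧ σ * ⟪a, ξ - z⟫_ℝ ≤ 0 := by
    rcases le_total ⟪a, ξ - z⟫_ℝ 0 with h | h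
    · exact ⟨1, by simp, by simpa⟩
    · exact ⟨-1, by simp, by simpa⟩
  have hσσ : σ * σ = 1 := by have := sq_abs σ; rw [hσ] at this; nlinarith
  set c := z + (σ * (s/2) / ‖a‖) • a
  have hc : ‖c - z‖ = s/2 := by
    simp only [c, add_sub_cancel_left, norm_smul, Real.norm_eq_abs, abs_div, abs_mul, hσ,
      abs_of_pos hn, abs_of_pos (half_pos hs)]
    field_simp
  have sub : ball c (s/4) ⊆ ball z s := by
    apply ball_subset_ball'
    rw [dist_eq_norm, hc]; linarith
  have key : ∀ y ∈ ball c (s/4), s/4 * ‖a‖ ≤ ‖⟪a, ξ - y⟫_ℝ‖ := by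
    intro y hy
    have h1 : |⟪a, y - c⟫_ℝ| ≤ ‖a‖ * (s/4) := (abs_real_inner_le_norm _ _).trans (by
      gcongr; rw [← dist_eq_norm]; exact (mem_ball.1 hy).le)
    have h2 : ⟪a, ξ - y⟫_ℝ = ⟪a, ξ - z⟫_ℝ - σ * (s/2) * ‖a‖ - ⟪a, y - c⟫_ℝ := by
      have : ξ - y = (ξ - z) - (σ * (s/2) / ‖a‖) • a - (y - c) := by simp only [c]; abel
      rw [this, inner_sub_right, inner_sub_right, inner_smul_right, real_inner_self_eq_norm_sq]
      field_simp
    have h3 : σ * ⟪a, ξ - y⟫_ℝ ≤ - (s/4 * ‖a‖) := by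
      have : -(σ * ⟪a, y - c⟫_ℝ) ≤ |⟪a, y - c⟫_ℝ| := by
        refine (neg_le_abs _).trans ?_
        rw [abs_mul, hσ, one_mul]
      have e : σ * ⟪a, ξ - y⟫_ℝ = σ * ⟪a, ξ - z⟫_ℝ - (σ*σ) * (s/2) * ‖a‖ - σ * ⟪a, y - c⟫_ℝ := by
        rw [h2]; ring
      rw [e, hσσ]; linarith
    calc s/4 * ‖a‖ ≤ |σ * ⟪a, ξ - y⟫_ℝ| := by
          rw [le_abs]; right; linarith
      _ = _ := by rw [abs_mul, hσ, one_mul, Real.norm_eq_abs]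
  calc _ = ∫⁻ y in ball c (s/4), eO ((s/4)^2) * ‖a‖ₑ^2 := by
        rw [setLIntegral_const, Measure.addHaar_ball_center volume c]; ring
    _ ≤ ∫⁻ y in ball c (s/4), ‖⟪a, ξ - y⟫_ℝ‖ₑ^2 := by
        refine setLIntegral_mono' measurableSet_ball fun y hy => ?_
        rw [ENNReal.ofReal_pow (by positivity), ← mul_pow]
        gcongr
        rw [← ofReal_norm, ← ofReal_norm, ← ENNReal.ofReal_mul (by positivity)]
        exact ENNReal.ofReal_le_ofReal (key y hy)
    _ ≤ _ := lintegral_mono_set sub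
lemma strain_seg {Ω : Set E3} (hΩ : IsOpen Ω) (hu : ContDiffOn ℝ 1 u Ω)
    (hs : segment ℝ y x ⊆ Ω) :
    ‖⟪u x, x - y⟫_ℝ‖ₑ^2 ≤ 2 * (‖x - y‖ₑ^2 * ‖u y‖ₑ^2 + ‖x - y‖ₑ^4 *
      ∫⁻ t in u01, Ω.indicator (fun x => ‖sym (Df u x)‖ₑ^2) (y + t • (x - y))) := by
  have h1 := seg_ftc hΩ hu (innerSL ℝ (x - y)) hs
  have hm : ∀ t ∈ u01, y + t • (x - y) ∈ Ω := fun t ht => hs (by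
    rw [segment_eq_image']; exact ⟨t, ht, rfl⟩)
  have h2 : ‖(innerSL ℝ (x - y)) (u x) - (innerSL ℝ (x - y)) (u y)‖ₑ ≤ ‖x - y‖ₑ^2 *
      ∫⁻ t in u01, Ω.indicator (fun x => ‖sym (Df u x)‖ₑ) (y + t • (x - y)) := by
    have hmm := (sym_meas u).indicator hΩ.measurableSet
    rw [← lintegral_const_mul _ (by fun_prop)]
    refine h1.trans (setLIntegral_mono' measurableSet_Icc fun t ht => ?_)
    rw [indicator_of_mem (hm t ht), innerSL_apply_apply, real_inner_comm, sym_inner]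
    calc _ ≤ ‖sym (Df u (y + t • (x - y))) (x - y)‖ₑ * ‖x - y‖ₑ := by
          simp only [← ofReal_norm]
          rw [← ENNReal.ofReal_mul (norm_nonneg _)]
          exact ENNReal.ofReal_le_ofReal (norm_inner_le_norm _ _)
      _ ≤ (‖sym (Df u (y + t • (x - y)))‖ₑ * ‖x - y‖ₑ) * ‖x - y‖ₑ := by
          gcongr; exact ContinuousLinearMap.le_opENorm _ _
      _ = _ := by ring
  have h3 : (∫⁻ t in u01, Ω.indicator (fun x => ‖sym (Df u x)‖ₑ) (y + t • (x - y)))^2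
      ≤ ∫⁻ t in u01, Ω.indicator (fun x => ‖sym (Df u x)‖ₑ^2) (y + t • (x - y)) := by
    have hmm := (sym_meas u).indicator hΩ.measurableSet
    have := csE (volume.restrict (u01)) (fun _ => 1) (fun t =>
      Ω.indicator (fun x => ‖sym (Df u x)‖ₑ) (y + t • (x - y))) (by fun_prop) (by fun_prop)
    simp only [one_mul] at this
    refine this.trans (le_of_eq ?_)
    simp only [one_pow, lintegral_const, MeasurableSet.univ, Measure.restrict_apply, univ_inter,
      Real.volume_Icc, sub_zero, ENNReal.ofReal_one, mul_one, one_mul]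
    refine setLIntegral_congr_fun measurableSet_Icc fun t ht => ?_
    simp [hm t ht]
  have h4 : ‖⟪u x, x - y⟫_ℝ‖ₑ ≤ ‖x - y‖ₑ * ‖u y‖ₑ + ‖x - y‖ₑ^2 *
      ∫⁻ t in u01, Ω.indicator (fun x => ‖sym (Df u x)‖ₑ) (y + t • (x - y)) := by
    have e : ⟪u x, x - y⟫_ℝ = (innerSL ℝ (x - y)) (u y) +
        ((innerSL ℝ (x - y)) (u x) - (innerSL ℝ (x - y)) (u y)) := by
      simp only [innerSL_apply_apply]; rw [real_inner_comm]; ring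
    rw [e]
    refine (enorm_add_le _ _).trans (add_le_add ?_ h2)
    simp only [← ofReal_norm]
    rw [← ENNReal.ofReal_mul (norm_nonneg _)]
    rw [innerSL_apply_apply]
    exact ENNReal.ofReal_le_ofReal (norm_inner_le_norm _ _)
  calc _ ≤ _ := pow_le_pow_left₀ zero_le h4 2
    _ ≤ _ := add_sqE _ _
    _ ≤ _ := by
      rw [mul_pow, mul_pow, ← pow_mul]
      gcongr
lemma qlem (s d : ℝ) (hs : 0 < s) : ∃ K : ℝ≥0, ∀ (Ω : Set E3) (u : E3 → E3) (P : Set E3) (z : E3),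
    IsOpen Ω → ContDiffOn ℝ 1 u Ω → MeasurableSet P →
    (∀ ξ ∈ P, ∀ y ∈ ball z s, segment ℝ y ξ ⊆ Ω ∧ ‖ξ - y‖ ≤ d) →
    N2 u P ≤ K * (N2 u (ball z s) + N2 (fun x => sym (Df u x)) Ω) := by
  set c := eO ((s/4)^2) * volume (ball o3 (s/4)) with hc
  have c0 : c ≠ 0 := by
    simp only [hc, ne_eq, mul_eq_zero, not_or, ENNReal.ofReal_eq_zero, not_le]
    exact ⟨by positivity, (measure_ball_pos _ _ (by positivity)).ne'⟩
  have ct : c ≠ ⊤ := ENNReal.mul_ne_top ENNReal.ofReal_ne_top measure_ball_lt_top.ne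
  set D := eO d
  set K := c⁻¹ * (2 * (D^2 * volume (closedBall o3 d) + D^4 *
    (8 * (volume (closedBall o3 d) + volume (ball o3 s))))) with hK
  have Kt : K ≠ ⊤ := by
    have h1 : volume (closedBall o3 d) ≠ ⊤ := measure_closedBall_lt_top.ne
    have h2 : volume (ball o3 s) ≠ ⊤ := measure_ball_lt_top.ne
    have h3 : D ≠ ⊤ := ENNReal.ofReal_ne_top
    have h4 : c⁻¹ ≠ ⊤ := ENNReal.inv_ne_top.2 c0
    finiteness
  refine ⟨K.toNNReal, fun Ω u P z hΩ hu hP hseg => ?_⟩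
  rw [ENNReal.coe_toNNReal Kt]
  have hPv : volume P ≤ volume (closedBall o3 d) := by
    rw [← Measure.addHaar_closedBall_center volume z]
    exact measure_mono fun ξ hξ => mem_closedBall_iff_norm.2 (hseg ξ hξ z (mem_ball_self hs)).2
  set g := Ω.indicator (fun x => ‖sym (Df u x)‖ₑ^2) with hg
  have hgm : Measurable g := ((sym_meas u).pow_const 2).indicator hΩ.measurableSet
  have ue : ContinuousOn u Ω := hu.continuousOn
  have zΩ : P.Nonempty → ball z s ⊆ Ω := fun ⟨ξ, hξ⟩ y hy =>
    (hseg ξ hξ y hy).1 (left_mem_segment ℝ _ _)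
  rcases P.eq_empty_or_nonempty with rfl | hne
  · simp [N2]
  have main : c * N2 u P ≤ ∫⁻ ξ in P, ∫⁻ y in ball z s, 2 * (D^2 * ‖u y‖ₑ^2 + D^4 *
      ∫⁻ t in u01, g (y + t • (ξ - y))) := by
    rw [N2, ← lintegral_const_mul' _ _ ct]
    refine setLIntegral_mono' hP fun ξ hξ => (dir_low hs (u ξ) ξ z).trans ?_
    refine setLIntegral_mono' measurableSet_ball fun y hy => ?_
    obtain ⟨h1, h2⟩ := hseg ξ hξ y hy
    have h3 : ‖ξ - y‖ₑ ≤ D := by rw [← ofReal_norm]; exact ENNReal.ofReal_le_ofReal h2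
    refine (strain_seg hΩ hu h1).trans ?_
    gcongr
  have muy : AEMeasurable (fun y => ‖u y‖ₑ^2) (volume.restrict (ball z s)) :=
    ((ue.mono (zΩ hne)).aestronglyMeasurable measurableSet_ball).enorm.pow_const 2
  have e1 : ∀ ξ, ∫⁻ y in ball z s, 2 * (D^2 * ‖u y‖ₑ^2 + D^4 *
      ∫⁻ t in u01, g (y + t • (ξ - y))) = 2 * (D^2 * N2 u (ball z s) + D^4 *
      ∫⁻ y in ball z s, ∫⁻ t in u01, g (y + t • (ξ - y))) := by
    intro ξ
    have m2 : Measurable fun y => ∫⁻ t in u01, g (y + t • (ξ - y)) :=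
      Measurable.lintegral_prod_right (by fun_prop)
    rw [lintegral_const_mul' _ _ (by simp), lintegral_add_left' (muy.const_mul _),
      lintegral_const_mul'' _ muy, lintegral_const_mul _ m2, N2]
  have m3 : Measurable fun ξ : E3 => ∫⁻ y in ball z s, ∫⁻ t in u01, g (y + t • (ξ - y)) := by
    apply Measurable.lintegral_prod_right' (f := fun p : E3 × E3 =>
      ∫⁻ t in u01, g (p.2 + t • (p.1 - p.2)))
    exact Measurable.lintegral_prod_right (by fun_prop)
  have e2 : ∫⁻ ξ in P, ∫⁻ y in ball z s, ∫⁻ t in u01, g (y + t • (ξ - y)) ≤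
      8 * (volume P + volume (ball o3 s)) * ∫⁻ x, g x := by
    calc _ = ∫⁻ t in u01, ∫⁻ y in ball z s, ∫⁻ ξ in P, g (y + t • (ξ - y)) := by
          rw [lintegral_lintegral_swap]
          swap
          · exact (Measurable.lintegral_prod_right' (f := fun p : (E3 × E3) × ℝ =>
              g (p.1.2 + p.2 • (p.1.1 - p.1.2))) (by fun_prop)).aemeasurable
          have : ∀ y, ∫⁻ ξ in P, ∫⁻ t in u01, g (y + t • (ξ - y)) =
              ∫⁻ t in u01, ∫⁻ ξ in P, g (y + t • (ξ - y)) := fun y =>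
            lintegral_lintegral_swap (Measurable.aemeasurable (by fun_prop))
          simp_rw [this]
          rw [lintegral_lintegral_swap]
          exact (Measurable.lintegral_prod_right' (f := fun p : (E3 × ℝ) × E3 =>
              g (p.1.1 + p.1.2 • (p.2 - p.1.1))) (by fun_prop)).aemeasurable
      _ ≤ ∫⁻ t in u01, 8 * (volume P + volume (ball o3 s)) * ∫⁻ x, g x := by
          gcongr with t
          rw [← Measure.addHaar_ball_center volume z]
          exact lint_seg g hgm P _
      _ = _ := by rw [setLIntegral_const]; simp
  have e3 : ∫⁻ x, g x = N2 (fun x => sym (Df u x)) Ω := by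
    rw [hg, lintegral_indicator hΩ.measurableSet, N2]
  simp_rw [e1] at main
  rw [lintegral_const_mul' _ _ (by simp), lintegral_add_left measurable_const,
    lintegral_const_mul _ m3, setLIntegral_const] at main
  rw [hK, mul_assoc, ← ENNReal.mul_le_iff_le_inv c0 ct]
  refine main.trans ?_
  rw [mul_assoc 2 (_ + _) (_ + _)]
  gcongr 2 * ?_
  rw [e3] at e2
  set a := N2 u (ball z s)
  set e := N2 (fun x => sym (Df u x)) Ω
  set W := volume (closedBall o3 d)
  calc _ ≤ D^2 * a * W + D^4 * (8 * (W + volume (ball o3 s)) * e) := by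
        gcongr
        exact e2.trans (by gcongr)
    _ = D^2 * W * a + D^4 * (8 * (W + volume (ball o3 s))) * e := by ring
    _ ≤ D^2 * W * (a + e) + D^4 * (8 * (W + volume (ball o3 s))) * (a + e) := by
        gcongr
        · exact le_self_add
        · exact le_add_self
    _ = _ := by ring
lemma strain_ray {Ω : Set E3} (hΩ : IsOpen Ω) (hu : ContDiffOn ℝ 1 u Ω) {ξ ω : E3}
    {r : ℝ} (hr : 0 ≤ r) (hs : ∀ s ∈ Icc 0 r, ξ + s • ω ∈ Ω) :
    ‖⟪u ξ, ω⟫_ℝ‖ₑ ≤ ‖ω‖ₑ * ‖u (ξ + r • ω)‖ₑ + ‖ω‖ₑ^2 *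
      ∫⁻ t in Icc (0:ℝ) r, Ω.indicator (fun x => ‖sym (Df u x)‖ₑ) (ξ + t • ω) := by
  have hcd : ContDiffOn ℝ 1 (fun t : ℝ => innerSL ℝ ω (u (ξ + t • ω))) (Icc 0 r) :=
    (innerSL ℝ ω).contDiff.comp_contDiffOn (hu.comp (by fun_prop) hs)
  have h2 : ‖⟪ω, u (ξ + r • ω)⟫_ℝ - ⟪ω, u ξ⟫_ℝ‖ₑ ≤ ‖ω‖ₑ^2 *
      ∫⁻ t in Icc (0:ℝ) r, Ω.indicator (fun x => ‖sym (Df u x)‖ₑ) (ξ + t • ω) := by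
    have hmm := (sym_meas u).indicator hΩ.measurableSet
    rw [← lintegral_const_mul _ (by fun_prop)]
    have := enorm_sub_le_lintegral_deriv_of_contDiffOn_Icc hcd hr
    simp only [zero_smul, add_zero, innerSL_apply_apply] at this
    refine this.trans (setLIntegral_mono' measurableSet_Icc fun t ht => ?_)
    have h1 : HasDerivAt (fun t : ℝ => ξ + t • ω) ω t := by
      simpa using ((hasDerivAt_id t).smul_const ω).const_add ξ
    have h2 := ((hu.differentiableOn one_ne_zero).differentiableAt
      (hΩ.mem_nhds (hs t ht))).hasFDerivAt
    have h3 : deriv (fun t : ℝ => ⟪ω, u (ξ + t • ω)⟫_ℝ) t = ⟪Df u (ξ + t • ω) ω, ω⟫_ℝ := by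
      rw [real_inner_comm]
      exact ((innerSL ℝ ω).hasFDerivAt.comp_hasDerivAt t (h2.comp_hasDerivAt t h1)).deriv
    rw [indicator_of_mem (hs t ht), h3, sym_inner]
    calc _ ≤ ‖sym (Df u (ξ + t • ω)) ω‖ₑ * ‖ω‖ₑ := by
          simp only [← ofReal_norm]
          rw [← ENNReal.ofReal_mul (norm_nonneg _)]
          exact ENNReal.ofReal_le_ofReal (norm_inner_le_norm _ _)
      _ ≤ (‖sym (Df u (ξ + t • ω))‖ₑ * ‖ω‖ₑ) * ‖ω‖ₑ := by
          gcongr; exact ContinuousLinearMap.le_opENorm _ _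
      _ = _ := by ring
  have e : ⟪u ξ, ω⟫_ℝ = ⟪ω, u (ξ + r • ω)⟫_ℝ - (⟪ω, u (ξ + r • ω)⟫_ℝ - ⟪ω, u ξ⟫_ℝ) := by
    rw [real_inner_comm]; ring
  rw [e]
  refine (enorm_sub_le).trans (add_le_add ?_ h2)
  simp only [← ofReal_norm]
  rw [← ENNReal.ofReal_mul (norm_nonneg _)]
  exact ENNReal.ofReal_le_ofReal (norm_inner_le_norm _ _)
lemma lint_w {r : ℝ} (hr : 0 ≤ r) :
    ∫⁻ s in Icc 0 r, eO ((1 + s) ^ (-(3/2) : ℝ)) ≤ 2 := by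
  have h : ∫⁻ s in Icc 0 r, eO ((1 + s) ^ (-(3/2) : ℝ)) =
      ∫⁻ s in Icc 1 (1 + r), eO (1 * s ^ (-(3/2) : ℝ)) := by
    rw [← lintegral_indicator measurableSet_Icc, ← lintegral_indicator measurableSet_Icc,
      ← lintegral_add_left_eq_self (fun s => (Icc 1 (1 + r)).indicator _ s) (1:ℝ)]
    refine lintegral_congr fun s => ?_
    by_cases hs : s ∈ Icc 0 r
    · have : 1 + s ∈ Icc 1 (1 + r) := ⟨by linarith [hs.1], by linarith [hs.2]⟩
      simp [hs, this]
    · have : 1 + s ∉ Icc 1 (1 + r) := fun h => hs ⟨by linarith [h.1], by linarith [h.2]⟩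
      rw [indicator_of_notMem hs, indicator_of_notMem this]
  rw [h, lint_rpow zero_le_one zero_le_one (by linarith) (Or.inr ⟨by norm_num, one_pos⟩)]
  have : 0 ≤ (1 + r) ^ (-(3/2) + 1 : ℝ) := by positivity
  rw [show (2:ℝ≥0∞) = eO 2 by norm_num]
  apply ENNReal.ofReal_le_ofReal
  rw [Real.one_rpow, show (-(3/2) + 1 : ℝ) = -(1/2) by norm_num] at *
  linarith
lemma cone_avg (h : E3 → ℝ≥0∞) (hm : Measurable h) (P S : Set E3) {s : ℝ} (hs : 0 ≤ s) :
    ∫⁻ ξ in P, ∫⁻ ω in S, h (ξ + s • ω) ≤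
      8 * (volume P + volume S) * eO (((1 + s)^3)⁻¹) * ∫⁻ x, h x := by
  rcases le_total s 1 with h1 | h1
  · rw [lintegral_lintegral_swap (Measurable.aemeasurable (by fun_prop))]
    calc _ ≤ ∫⁻ ω in S, ∫⁻ x, h x := by
          refine lintegral_mono fun ω => ?_
          refine (lintegral_mono' Measure.restrict_le_self le_rfl).trans (le_of_eq ?_)
          exact lintegral_add_right_eq_self h _
      _ = volume S * 1 * ∫⁻ x, h x := by rw [setLIntegral_const]; ring
      _ ≤ (volume P + volume S) * (8 * eO (((1 + s)^3)⁻¹)) * ∫⁻ x, h x := by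
          gcongr
          · exact le_add_self
          · rw [show (8:ℝ≥0∞) = eO 8 by norm_num, ← ENNReal.ofReal_mul (by norm_num),
              ← ENNReal.ofReal_one]
            apply ENNReal.ofReal_le_ofReal
            have : (1+s)^3 ≤ 2^3 := by gcongr; linarith
            rw [← div_eq_mul_inv, le_div_iff₀ (by positivity)]; linarith
      _ = _ := by ring
  · have s0 : 0 < s := by linarith
    calc _ ≤ ∫⁻ ξ in P, eO (s^3)⁻¹ * ∫⁻ x, h x := by
          gcongr with ξ
          refine (lintegral_mono' Measure.restrict_le_self le_rfl).trans (le_of_eq ?_)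
          exact lint_affine h ξ s0
      _ = volume P * eO (s^3)⁻¹ * ∫⁻ x, h x := by rw [setLIntegral_const]; ring
      _ ≤ (volume P + volume S) * (8 * eO (((1 + s)^3)⁻¹)) * ∫⁻ x, h x := by
          gcongr
          · exact le_self_add
          · rw [show (8:ℝ≥0∞) = eO 8 by norm_num, ← ENNReal.ofReal_mul (by norm_num)]
            apply ENNReal.ofReal_le_ofReal
            have : (1+s)^3 ≤ (2*s)^3 := by gcongr; linarith
            rw [← div_eq_mul_inv, inv_eq_one_div, div_le_div_iff₀ (by positivity) (by positivity)]
            nlinarith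
      _ = _ := by ring
lemma cone_sq {Ω : Set E3} (hΩ : IsOpen Ω) (hu : ContDiffOn ℝ 1 u Ω) {ξ ω : E3}
    (hω : ‖ω‖ ≤ 2) {r : ℝ} (hr : 0 ≤ r) (hs : ∀ s ∈ Icc 0 r, ξ + s • ω ∈ Ω) :
    ‖⟪u ξ, ω⟫_ℝ‖ₑ^2 ≤ 8 * ‖u (ξ + r • ω)‖ₑ^2 + 64 *
      ∫⁻ t in Icc (0:ℝ) r, eO ((1 + t)^(3/2 : ℝ)) *
        Ω.indicator (fun x => ‖sym (Df u x)‖ₑ^2) (ξ + t • ω) := by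
  have hw : ‖ω‖ₑ ≤ 2 := by
    rw [← ofReal_norm]
    exact (ENNReal.ofReal_le_ofReal hω).trans (by norm_num)
  have hmm := (sym_meas u).indicator hΩ.measurableSet
  have h3 : (∫⁻ t in Icc (0:ℝ) r, Ω.indicator (fun x => ‖sym (Df u x)‖ₑ) (ξ + t • ω))^2 ≤
      2 * ∫⁻ t in Icc (0:ℝ) r, eO ((1 + t)^(3/2 : ℝ)) *
        Ω.indicator (fun x => ‖sym (Df u x)‖ₑ^2) (ξ + t • ω) := by
    have := csE (volume.restrict (Icc (0:ℝ) r)) (fun t => eO ((1 + t) ^ (-(3/4) : ℝ)))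
      (fun t => eO ((1 + t) ^ (3/4 : ℝ)) * Ω.indicator (fun x => ‖sym (Df u x)‖ₑ)
        (ξ + t • ω)) (by fun_prop) (by fun_prop)
    have e1 : ∫⁻ t in Icc (0:ℝ) r, Ω.indicator (fun x => ‖sym (Df u x)‖ₑ) (ξ + t • ω) =
        ∫⁻ t in Icc (0:ℝ) r, eO ((1 + t) ^ (-(3/4) : ℝ)) *
        (eO ((1 + t) ^ (3/4 : ℝ)) * Ω.indicator (fun x => ‖sym (Df u x)‖ₑ)
        (ξ + t • ω)) := by
      refine setLIntegral_congr_fun measurableSet_Icc fun t ht => ?_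
      have : 0 < 1 + t := by linarith [ht.1]
      rw [← mul_assoc, ← ENNReal.ofReal_mul (by positivity), ← Real.rpow_add this]
      norm_num
    rw [e1]
    refine this.trans ?_
    gcongr ?_ * ?_
    · refine le_trans (le_of_eq ?_) (lint_w hr)
      refine setLIntegral_congr_fun measurableSet_Icc fun t ht => ?_
      have : 0 < 1 + t := by linarith [ht.1]
      rw [← ENNReal.ofReal_pow (by positivity), ← Real.rpow_natCast, ← Real.rpow_mul this.le]
      norm_num
    · refine le_of_eq (setLIntegral_congr_fun measurableSet_Icc fun t ht => ?_)
      have : 0 < 1 + t := by linarith [ht.1]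
      simp only [indicator_of_mem (hs t ht)]
      rw [mul_pow, ← ENNReal.ofReal_pow (by positivity), ← Real.rpow_natCast, ← Real.rpow_mul this.le]
      norm_num
  calc _ ≤ _ := pow_le_pow_left₀ zero_le (strain_ray hΩ hu hr hs) 2
    _ ≤ _ := add_sqE _ _
    _ ≤ 2 * ((2 * ‖u (ξ + r • ω)‖ₑ)^2 + (2 ^ 2 * ∫⁻ t in Icc (0:ℝ) r,
        Ω.indicator (fun x => ‖sym (Df u x)‖ₑ) (ξ + t • ω))^2) := by gcongr
    _ = 8 * ‖u (ξ + r • ω)‖ₑ^2 + 32 * (∫⁻ t in Icc (0:ℝ) r,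
        Ω.indicator (fun x => ‖sym (Df u x)‖ₑ) (ξ + t • ω))^2 := by ring
    _ ≤ 8 * ‖u (ξ + r • ω)‖ₑ^2 + 32 * (2 * _) := by gcongr
    _ = _ := by ring
lemma meas_ind {V : Type*} [NormedAddCommGroup V] {Ω : Set E3} (hΩ : IsOpen Ω) {u : E3 → V}
    (hu : ContinuousOn u Ω) : Measurable (Ω.indicator fun x => ‖u x‖ₑ^2) := by
  classical
  rw [← piecewise_eq_indicator]
  refine ContinuousOn.measurable_piecewise ?_ continuousOn_const hΩ.measurableSet
  exact (ENNReal.continuous_pow 2).comp_continuousOn hu.enorm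
lemma cone : ∃ K : ℝ≥0, ∀ (Ω : Set E3) (u : E3 → E3) (x w : E3),
    IsOpen Ω → ContDiffOn ℝ 1 u Ω → ‖w‖ ≤ 1 →
    (∀ ξ ∈ ball x 1, ∀ ω ∈ ball w (1/2), ∀ s : ℝ, 0 ≤ s → ξ + s • ω ∈ Ω) →
    (∫⁻ y in Ω, eO ((1 + ‖y‖^2)⁻¹) * ‖u y‖ₑ^2 ≠ ⊤) →
    N2 u (ball x 1) ≤ K * N2 (fun x => sym (Df u x)) Ω := by
  set c := eO ((1/2/4)^2) * volume (ball o3 (1/2/4)) with hc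
  have c0 : c ≠ 0 := by
    simp only [hc, ne_eq, mul_eq_zero, not_or, ENNReal.ofReal_eq_zero, not_le]
    exact ⟨by positivity, (measure_ball_pos _ _ (by positivity)).ne'⟩
  have ct : c ≠ ⊤ := ENNReal.mul_ne_top ENNReal.ofReal_ne_top measure_ball_lt_top.ne
  set v := 8 * (volume (ball o3 1) + volume (ball o3 (1/2))) with hv
  have h1 : volume (ball o3 1) ≠ ⊤ := measure_ball_lt_top.ne
  have h2 : volume (ball o3 (1/2)) ≠ ⊤ := measure_ball_lt_top.ne
  have vt : v ≠ ⊤ := by finiteness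
  set K := c⁻¹ * (64 * v * 2) with hK
  have h4 : c⁻¹ ≠ ⊤ := ENNReal.inv_ne_top.2 c0
  have Kt : K ≠ ⊤ := by finiteness
  refine ⟨K.toNNReal, fun Ω u x w hΩ hu hw hcone hJ => ?_⟩
  rw [ENNReal.coe_toNNReal Kt, hK, mul_assoc, ← ENNReal.mul_le_iff_le_inv c0 ct]
  set P := ball x 1
  set S := ball w (1/2)
  have hvv : v = 8 * (volume P + volume S) := by
    simp only [hv, P, S]
    rw [Measure.addHaar_ball_center volume x, Measure.addHaar_ball_center volume w]
  set g := Ω.indicator (fun x => ‖sym (Df u x)‖ₑ^2) with hg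
  have hgm : Measurable g := ((sym_meas u).pow_const 2).indicator hΩ.measurableSet
  have hGm := meas_ind hΩ hu.continuousOn
  set G := Ω.indicator (fun x => ‖u x‖ₑ^2) with hG
  set J := ∫⁻ y in Ω, eO ((1 + ‖y‖^2)⁻¹) * ‖u y‖ₑ^2 with hJd
  have e3 : ∫⁻ x, g x = N2 (fun x => sym (Df u x)) Ω := by
    rw [hg, lintegral_indicator hΩ.measurableSet, N2]
  set A := 1 + (‖x‖ + 3)^2 with hA
  have bound : ∀ r : ℝ, 0 ≤ r → c * N2 u P ≤
      8 * v * J * eO (A * (1 + r)⁻¹) + 64 * v * 2 * ∫⁻ x, g x := by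
    intro r hr
    set h := (closedBall o3 (‖x‖ + 1 + 2 * r)).indicator G with hh
    have hhm : Measurable h := hGm.indicator measurableSet_closedBall
    have s1 : c * N2 u P ≤ ∫⁻ ξ in P, ∫⁻ ω in S, (8 * h (ξ + r • ω) + 64 *
        ∫⁻ t in Icc (0:ℝ) r, eO ((1 + t)^(3/2 : ℝ)) * g (ξ + t • ω)) := by
      rw [N2, ← lintegral_const_mul' _ _ ct]
      refine setLIntegral_mono' measurableSet_ball fun ξ hξ => ?_
      refine (dir_low (by norm_num) (u ξ) 0 w).trans ?_
      refine setLIntegral_mono' measurableSet_ball fun ω hω => ?_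
      have hω2 : ‖ω‖ ≤ 2 := by
        have := mem_ball_iff_norm.1 hω
        have := norm_add_le (ω - w) w
        rw [sub_add_cancel] at this; linarith
      rw [zero_sub, inner_neg_right, enorm_neg]
      refine (cone_sq hΩ hu hω2 hr fun s hs => hcone ξ hξ ω hω s hs.1).trans ?_
      have : ξ + r • ω ∈ closedBall o3 (‖x‖ + 1 + 2 * r) := by
        rw [mem_closedBall_zero_iff]
        have h1 := mem_ball_iff_norm.1 hξ
        have h2 := norm_add_le (ξ - x) x
        rw [sub_add_cancel] at h2
        refine (norm_add_le _ _).trans ?_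
        rw [norm_smul, Real.norm_eq_abs, abs_of_nonneg hr]
        nlinarith
      rw [hh, indicator_of_mem this, hG, indicator_of_mem (hcone ξ hξ ω hω r hr)]
    have m1 : ∀ ξ : E3, Measurable fun ω : E3 =>
        ∫⁻ t in Icc (0:ℝ) r, eO ((1 + t)^(3/2 : ℝ)) * g (ξ + t • ω) := fun ξ =>
      Measurable.lintegral_prod_right (by fun_prop)
    have m2 : Measurable fun ξ : E3 => ∫⁻ ω in S, h (ξ + r • ω) :=
      Measurable.lintegral_prod_right (by fun_prop)
    have s2 : ∫⁻ ξ in P, ∫⁻ ω in S, (8 * h (ξ + r • ω) + 64 *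
        ∫⁻ t in Icc (0:ℝ) r, eO ((1 + t)^(3/2 : ℝ)) * g (ξ + t • ω)) =
        8 * (∫⁻ ξ in P, ∫⁻ ω in S, h (ξ + r • ω)) + 64 * ∫⁻ ξ in P, ∫⁻ ω in S,
        ∫⁻ t in Icc (0:ℝ) r, eO ((1 + t)^(3/2 : ℝ)) * g (ξ + t • ω) := by
      rw [← lintegral_const_mul _ m2, ← lintegral_const_mul' _ _ (by simp),
        ← lintegral_add_left (m2.const_mul _)]
      refine lintegral_congr fun ξ => ?_
      rw [lintegral_add_left (by fun_prop), lintegral_const_mul _ (by fun_prop),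
        lintegral_const_mul _ (m1 ξ)]
    have s3 : ∫⁻ ξ in P, ∫⁻ ω in S, ∫⁻ t in Icc (0:ℝ) r, eO ((1 + t)^(3/2 : ℝ)) *
        g (ξ + t • ω) ≤ v * 2 * ∫⁻ x, g x := by
      calc _ = ∫⁻ t in Icc (0:ℝ) r, eO ((1 + t)^(3/2 : ℝ)) *
            ∫⁻ ξ in P, ∫⁻ ω in S, g (ξ + t • ω) := by
            have : ∀ ξ, ∫⁻ ω in S, ∫⁻ t in Icc (0:ℝ) r, eO ((1 + t)^(3/2 : ℝ)) *
                g (ξ + t • ω) = ∫⁻ t in Icc (0:ℝ) r, eO ((1 + t)^(3/2 : ℝ)) *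
                ∫⁻ ω in S, g (ξ + t • ω) := fun ξ => by
              rw [lintegral_lintegral_swap (Measurable.aemeasurable (by fun_prop))]
              exact lintegral_congr fun t => lintegral_const_mul _ (by fun_prop)
            simp_rw [this]
            have m3 : Measurable fun p : E3 × ℝ => ∫⁻ ω in S, g (p.1 + p.2 • ω) :=
              Measurable.lintegral_prod_right' (f := fun q : (E3 × ℝ) × E3 =>
                g (q.1.1 + q.1.2 • q.2)) (by fun_prop)
            rw [lintegral_lintegral_swap]
            · exact lintegral_congr fun t => lintegral_const_mul' _ _ ENNReal.ofReal_ne_top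
            · refine Measurable.aemeasurable (Measurable.mul (by fun_prop) m3)
        _ ≤ ∫⁻ t in Icc (0:ℝ) r, (v * ∫⁻ x, g x) * eO ((1 + t)^(-(3/2) : ℝ)) := by
            refine setLIntegral_mono' measurableSet_Icc fun t ht => ?_
            have t0 : 0 < 1 + t := by linarith [ht.1]
            refine (mul_le_mul_right (cone_avg g hgm P S ht.1) _).trans (le_of_eq ?_)
            rw [← hvv]
            have : eO ((1 + t)^(-(3/2) : ℝ)) = eO ((1 + t)^(3/2 : ℝ)) *
              eO (((1 + t)^3)⁻¹) := by
              rw [← ENNReal.ofReal_mul (by positivity), ← Real.rpow_natCast, ← Real.rpow_neg t0.le,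
                ← Real.rpow_add t0]
              norm_num
            rw [this]; ring
        _ ≤ _ := by
            rw [lintegral_const_mul _ (by fun_prop), mul_right_comm]
            gcongr
            exact lint_w hr
    have s4 : ∫⁻ x, h x ≤ eO (A * (1 + r)^2) * J := by
      rw [hJd, ← lintegral_const_mul' _ _ ENNReal.ofReal_ne_top,
        ← lintegral_indicator hΩ.measurableSet]
      refine lintegral_mono fun y => ?_
      by_cases hy : y ∈ Ω
      · by_cases hy2 : y ∈ closedBall o3 (‖x‖ + 1 + 2 * r)
        · rw [hh, indicator_of_mem hy2, hG, indicator_of_mem hy, indicator_of_mem hy, ← mul_assoc,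
            ← ENNReal.ofReal_mul (by positivity)]
          refine le_mul_of_one_le_left' ?_
          rw [ENNReal.one_le_ofReal, ← div_eq_mul_inv, le_div_iff₀ (by positivity), one_mul]
          rw [mem_closedBall_zero_iff] at hy2
          have : ‖y‖ ≤ (‖x‖ + 3) * (1 + r) := by nlinarith [norm_nonneg x]
          have : ‖y‖^2 ≤ ((‖x‖ + 3) * (1 + r))^2 := by gcongr
          rw [hA]; nlinarith
        · rw [hh, indicator_of_notMem hy2]; exact zero_le
      · have : h y = 0 := by
          rw [hh]
          by_cases hy2 : y ∈ closedBall o3 (‖x‖ + 1 + 2 * r)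
          · rw [indicator_of_mem hy2, hG, indicator_of_notMem hy]
          · rw [indicator_of_notMem hy2]
        rw [this]; exact zero_le
    rw [s2] at s1
    refine s1.trans (add_le_add ?_ ?_)
    · calc _ ≤ 8 * (v * eO (((1 + r)^3)⁻¹) * (eO (A * (1 + r)^2) * J)) := by
            gcongr
            rw [hvv]
            exact (cone_avg h hhm P S hr).trans (by gcongr)
        _ = 8 * v * J * (eO (((1 + r)^3)⁻¹) * eO (A * (1 + r)^2)) := by ring
        _ = _ := by
            rw [← ENNReal.ofReal_mul (by positivity)]
            congr 2
            field_simp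
    · calc _ ≤ 64 * (v * 2 * ∫⁻ x, g x) := by gcongr
        _ = _ := by ring
  have lim : Tendsto (fun n : ℕ => 8 * v * J * eO (A * (1 + (n:ℝ))⁻¹) +
      64 * v * 2 * ∫⁻ x, g x) atTop (𝓝 (8 * v * J * eO (A * 0) +
      64 * v * 2 * ∫⁻ x, g x)) := by
    refine Tendsto.add_const _ (ENNReal.Tendsto.const_mul (ENNReal.tendsto_ofReal
      (Tendsto.const_mul _ ?_)) (Or.inr (by finiteness)))
    exact tendsto_inv_atTop_zero.comp (tendsto_atTop_add_const_left _ _ tendsto_natCast_atTop_atTop)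
  have := ge_of_tendsto' lim fun n => bound n n.cast_nonneg
  simpa [e3] using this
abbrev ee (i : Fin 3) : E3 := EuclideanSpace.single i 1
lemma dq_adj {f g : E3 → ℝ} {Lf Lg : ℝ≥0} (hf : LipschitzWith Lf f) (hg : LipschitzWith Lg g)
    (cf : HasCompactSupport f) (a b : E3) :
    ∫ x, (f (x + a) - f x) * (g (x + b) - g x) = ∫ x, (f (x - b) - f x) * (g (x - a) - g x) := by
  have hI : ∀ a b : E3, Integrable (fun x => f (x + a) * g (x + b)) := by
    intro a b
    refine Continuous.integrable_of_hasCompactSupport ?_ ?_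
    · have := hf.continuous; have := hg.continuous; fun_prop
    · exact (cf.comp_homeomorph (Homeomorph.addRight a)).mul_right
  have hT : ∀ a b : E3, ∫ x, f (x + a) * g (x + b) = ∫ x, f (x + (a - b)) * g x := by
    intro a b
    rw [← integral_add_right_eq_self (fun x => f (x + (a - b)) * g x) b]
    simp
  have e1 : ∀ a b : E3, ∫ x, (f (x + a) - f x) * (g (x + b) - g x) =
      (∫ x, f (x + (a - b)) * g x) - (∫ x, f (x + a) * g x) - (∫ x, f (x + (-b)) * g x) +
        ∫ x, f x * g x := by
    intro a b
    have h1 := hI a b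
    have h2 := hI a 0
    have h3 := hI 0 b
    have h4 := hI 0 0
    have t3 := hT 0 b
    simp only [add_zero, zero_sub] at *
    rw [← hT a b, ← t3, ← integral_sub h1 h2, ← integral_sub (by exact h1.sub h2) h3,
      ← integral_add (by exact (h1.sub h2).sub h3) h4]
    congr 1; ext x; ring
  have := e1 (-b) (-a)
  simp only [neg_neg, ← sub_eq_add_neg, sub_neg_eq_add] at this
  rw [this, e1, show -b + a = a - b by abel]
  simp only [← sub_eq_add_neg]
  ring
lemma dq_lim {f : E3 → ℝ} (h : DifferentiableAt ℝ f x) (a : E3) {t : ℕ → ℝ}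
    (ht : Tendsto t atTop (𝓝[≠] 0)) :
    Tendsto (fun n => (t n)⁻¹ * (f (x + t n • a) - f x)) atTop (𝓝 (Df f x a)) :=
  (h.hasFDerivAt.hasLineDerivAt a).tendsto_slope_zero.comp ht
lemma dq_lim_int {f g : E3 → ℝ} {Lf Lg : ℝ≥0} (hf : LipschitzWith Lf f) (hg : LipschitzWith Lg g)
    (cf : HasCompactSupport f) (df : ∀ᵐ x, DifferentiableAt ℝ f x)
    (dg : ∀ᵐ x, DifferentiableAt ℝ g x) (a b : E3) {t : ℕ → ℝ}
    (ht : Tendsto t atTop (𝓝[≠] 0)) (ht1 : ∀ n, |t n| ≤ 1) :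
    Tendsto (fun n => (t n)⁻¹ ^ 2 * ∫ x, (f (x + t n • a) - f x) * (g (x + t n • b) - g x)) atTop
      (𝓝 (∫ x, Df f x a * Df g x b)) := by
  obtain ⟨R, hR⟩ := cf.isCompact.isBounded.subset_closedBall o3
  have h0 : ∀ x : E3, R < ‖x‖ → f x = 0 := by
    intro x hx
    by_contra h
    have := hR (subset_tsupport f h)
    simp at this; linarith
  simp only [← integral_const_mul]
  refine tendsto_integral_of_dominated_convergence
    ((closedBall o3 (R + ‖a‖)).indicator fun _ => (Lf * ‖a‖) * (Lg * ‖b‖)) ?_ ?_ ?_ ?_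
  · intro n
    have := hf.continuous; have := hg.continuous
    exact Continuous.aestronglyMeasurable (by fun_prop)
  · exact (integrable_indicator_iff measurableSet_closedBall).2
      (integrableOn_const (measure_closedBall_lt_top.ne))
  · intro n
    refine ae_of_all _ fun x => ?_
    by_cases hx : x ∈ closedBall o3 (R + ‖a‖)
    · rw [indicator_of_mem hx]
      have h1 := hf.dist_le_mul (x + t n • a) x
      have h2 := hg.dist_le_mul (x + t n • b) x
      simp only [dist_eq_norm, add_sub_cancel_left, norm_smul] at h1 h2
      rw [norm_mul, norm_mul, norm_pow, norm_inv]
      by_cases h0 : t n = 0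
      · simp [h0]; positivity
      have tp : 0 < ‖t n‖ := by simpa using h0
      calc _ ≤ ‖t n‖⁻¹ ^2 * ((Lf * (‖t n‖ * ‖a‖)) * (Lg * (‖t n‖ * ‖b‖))) := by gcongr
        _ = _ := by field_simp
    · rw [indicator_of_notMem hx]
      simp only [mem_closedBall, dist_zero_right, not_le] at hx
      have e1 : f x = 0 := h0 x (by linarith [norm_nonneg a])
      have e2 : f (x + t n • a) = 0 := by
        apply h0
        have : ‖x‖ ≤ ‖x + t n • a‖ + ‖t n • a‖ := by
          simpa using norm_sub_le (x + t n • a) (t n • a)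
        have h3 : ‖t n • a‖ ≤ ‖a‖ := by
          rw [norm_smul]; exact mul_le_of_le_one_left (norm_nonneg _) (ht1 n)
        linarith
      simp [e1, e2]
  · filter_upwards [df, dg] with x h1 h2
    refine ((dq_lim h1 a ht).mul (dq_lim h2 b ht)).congr fun n => ?_
    ring
lemma swap_int {f g : E3 → ℝ} {Lf Lg : ℝ≥0} (hf : LipschitzWith Lf f) (hg : LipschitzWith Lg g)
    (cf : HasCompactSupport f) (df : ∀ᵐ x, DifferentiableAt ℝ f x)
    (dg : ∀ᵐ x, DifferentiableAt ℝ g x) (a b : E3) :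
    ∫ x, Df f x a * Df g x b = ∫ x, Df f x b * Df g x a := by
  have key : Tendsto (fun n : ℕ => 1 / ((n:ℝ) + 1)) atTop (𝓝[≠] 0) :=
    tendsto_nhdsWithin_iff.2 ⟨tendsto_one_div_add_atTop_nhds_zero_nat,
      Eventually.of_forall fun n => by simp; positivity⟩
  have key' : Tendsto (fun n : ℕ => -(1 / ((n:ℝ) + 1))) atTop (𝓝[≠] 0) :=
    tendsto_nhdsWithin_iff.2 ⟨by simpa using (tendsto_one_div_add_atTop_nhds_zero_nat (𝕜 := ℝ)).neg,
      Eventually.of_forall fun n => by simp; positivity⟩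
  have hb : ∀ n : ℕ, |1 / ((n:ℝ) + 1)| ≤ 1 := by
    intro n
    rw [abs_of_pos (by positivity), div_le_one (by positivity)]
    have : (0:ℝ) ≤ n := by positivity
    linarith
  have h1 := dq_lim_int hf hg cf df dg a b key hb
  have h2 := dq_lim_int hf hg cf df dg b a key' (fun n => by rw [abs_neg]; exact hb n)
  refine tendsto_nhds_unique h1 (h2.congr fun n => ?_)
  rw [dq_adj hf hg cf]
  simp only [neg_smul, sub_neg_eq_add]
  congr 1
  ring
def hs (A : M3) : ℝ := ∑ j, ‖A (ee j)‖^2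
lemma hs_coord (A : M3) : hs A = ∑ j, ∑ i, (A (ee j) i)^2 := by
  simp [hs, EuclideanSpace.norm_sq_eq]
lemma op_le_hs (A : M3) : ‖A‖^2 ≤ hs A := by
  have h0 : 0 ≤ hs A := Finset.sum_nonneg fun _ _ => by positivity
  refine (Real.le_sqrt (norm_nonneg _) h0).1 ?_
  refine A.opNorm_le_bound (Real.sqrt_nonneg _) fun x => ?_
  have e : x = ∑ j, x j • ee j := by
    ext i; fin_cases i <;> simp [Fin.sum_univ_three, ee]
  have h1 : ‖A x‖ ≤ ∑ j, ‖x j‖ * ‖A (ee j)‖ := by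
    conv_lhs => rw [e, map_sum]
    refine (norm_sum_le _ _).trans (Finset.sum_le_sum fun j _ => ?_)
    rw [map_smul, norm_smul]
  refine h1.trans ?_
  refine (Real.sum_mul_le_sqrt_mul_sqrt _ _ _).trans ?_
  rw [EuclideanSpace.norm_eq, mul_comm]
  rfl
lemma hs_le_op (A : M3) : hs A ≤ 3 * ‖A‖^2 := by
  have : ∀ j, ‖A (ee j)‖ ≤ ‖A‖ := fun j => by simpa [ee] using A.le_opNorm (ee j)
  simp only [hs, Fin.sum_univ_three]
  have := fun j => pow_le_pow_left₀ (norm_nonneg _) (this j) 2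
  linarith [this 0, this 1, this 2]
lemma adj_coord (A : M3) (i j : Fin 3) :
    (ContinuousLinearMap.adjoint A (ee j)) i = A (ee i) j := by
  have := ContinuousLinearMap.adjoint_inner_right A (ee i) (ee j)
  simpa [ee, EuclideanSpace.inner_single_left, EuclideanSpace.inner_single_right] using this
lemma sym_coord (A : M3) (i j : Fin 3) :
    (sym A (ee j)) i = (1/2) * (A (ee j) i + A (ee i) j) := by
  simp [sym, adj_coord]; ring
lemma hs_sym (A : M3) : 2 * hs (sym A) = hs A + ∑ j, ∑ i, A (ee j) i * A (ee i) j := by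
  simp only [hs_coord, sym_coord, Fin.sum_univ_three]; ring
lemma korn_whole {V : E3 → E3} {L : ℝ≥0} (hV : LipschitzWith L V) (cV : HasCompactSupport V)
    (dV : ∀ᵐ x, DifferentiableAt ℝ V x) :
    N2 (Df V) univ ≤ 6 * N2 (fun x => sym (Df V x)) univ := by
  have hc : ∀ i, LipschitzWith L (fun x => V x i) := fun i => by
    refine LipschitzWith.of_dist_le_mul fun x y => ?_
    refine le_trans ?_ (hV.dist_le_mul x y)
    rw [dist_eq_norm, dist_eq_norm]
    simpa using PiLp.norm_apply_le (V x - V y) i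
  have cc : ∀ i, HasCompactSupport (fun x => V x i) := fun i =>
    cV.comp_left (g := fun v : E3 => v i) (by simp)
  have dc : ∀ i, ∀ᵐ x, DifferentiableAt ℝ (fun x => V x i) x := fun i => by
    filter_upwards [dV] with x hx
    exact (EuclideanSpace.proj (𝕜 := ℝ) i).differentiableAt.comp x hx
  have fd : ∀ i a, ∀ᵐ x, Df (fun x => V x i) x a = Df V x a i := fun i a => by
    filter_upwards [dV] with x hx
    have := ((EuclideanSpace.proj (𝕜 := ℝ) i).hasFDerivAt (x := V x)).comp x hx.hasFDerivAt
    have h2 : Df (fun x => V x i) x = (EuclideanSpace.proj (𝕜 := ℝ) i).comp (Df V x) :=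
      this.fderiv
    rw [h2]; simp
  have sw : ∀ i j, ∫ x, Df V x (ee j) i * Df V x (ee i) j =
      ∫ x, Df V x (ee i) i * Df V x (ee j) j := fun i j => by
    have := swap_int (hc i) (hc j) (cc i) (dc i) (dc j) (ee j) (ee i)
    refine Eq.trans (integral_congr_ae ?_) (this.trans (integral_congr_ae ?_))
    · filter_upwards [fd i (ee j), fd j (ee i)] with x h1 h2; rw [h1, h2]
    · filter_upwards [fd i (ee i), fd j (ee j)] with x h1 h2; rw [h1, h2]
  have mD : Measurable (Df V) := measurable_fderiv ℝ V
  have mE : ∀ i j, Measurable fun x => Df V x (ee j) i := fun i j => by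
    have : Measurable fun x => Df V x (ee j) := measurable_fderiv_apply_const ℝ V _
    fun_prop
  have bD : ∀ x i j, |Df V x (ee j) i| ≤ L := fun x i j => by
    refine (PiLp.norm_apply_le (Df V x (ee j)) i).trans ?_
    refine ((Df V x).le_opNorm _).trans ?_
    simpa [ee] using norm_fderiv_le_of_lipschitz ℝ hV
  have iD : ∀ i j k l, Integrable fun x => Df V x (ee j) i * Df V x (ee l) k := by
    intro i j k l
    refine Integrable.mono' (g := (tsupport V).indicator fun _ => (L:ℝ) * L) ?_
      ((mE i j).mul (mE k l)).aestronglyMeasurable (ae_of_all _ fun x => ?_)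
    · exact (integrable_indicator_iff (isClosed_tsupport V).measurableSet).2
        (integrableOn_const cV.isCompact.measure_lt_top.ne)
    · by_cases hx : x ∈ tsupport V
      · rw [indicator_of_mem hx, norm_mul]
        exact mul_le_mul (bD x i j) (bD x k l) (norm_nonneg _) L.2
      · have : Df V x = 0 :=
          image_eq_zero_of_notMem_tsupport fun h => hx (tsupport_fderiv_subset ℝ h)
        rw [indicator_of_notMem hx, this]; simp
  have iH : Integrable fun x => hs (Df V x) := by
    simp only [hs_coord]
    refine integrable_finsetSum _ fun j _ => integrable_finsetSum _ fun i _ => ?_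
    simpa only [pow_two] using iD i j i j
  have iC : Integrable fun x => ∑ j, ∑ i, Df V x (ee j) i * Df V x (ee i) j :=
    integrable_finsetSum _ fun j _ => integrable_finsetSum _ fun i _ => iD i j j i
  have pos : 0 ≤ ∫ x, ∑ j, ∑ i, Df V x (ee j) i * Df V x (ee i) j := by
    have : ∫ x, ∑ j, ∑ i, Df V x (ee j) i * Df V x (ee i) j =
        ∫ x, (∑ i, Df V x (ee i) i)^2 := by
      have e : ∀ x, (∑ i, Df V x (ee i) i)^2 =
          ∑ j, ∑ i, Df V x (ee i) i * Df V x (ee j) j := fun x => by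
        simp only [Fin.sum_univ_three]; ring
      simp only [e]
      rw [integral_finsetSum _ fun j _ => integrable_finsetSum _ fun i _ => iD i j j i,
        integral_finsetSum _ fun j _ => integrable_finsetSum _ fun i _ => iD i i j j]
      refine Finset.sum_congr rfl fun j _ => ?_
      rw [integral_finsetSum _ fun i _ => iD i j j i, integral_finsetSum _ fun i _ => iD i i j j]
      exact Finset.sum_congr rfl fun i _ => sw i j
    rw [this]; exact integral_nonneg fun x => sq_nonneg _
  have iS : Integrable fun x => hs (sym (Df V x)) := by
    have : (fun x => hs (sym (Df V x))) = fun x => (1/2) * (hs (Df V x) +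
        ∑ j, ∑ i, Df V x (ee j) i * Df V x (ee i) j) := by
      ext x; rw [← hs_sym]; ring
    rw [this]; exact (iH.add iC).const_mul _
  have main : ∫ x, hs (Df V x) ≤ 2 * ∫ x, hs (sym (Df V x)) := by
    rw [← integral_const_mul]
    simp only [hs_sym]
    rw [integral_add iH iC]; linarith
  have hs0 : ∀ A, 0 ≤ hs A := fun A => Finset.sum_nonneg fun _ _ => by positivity
  simp only [N2, Measure.restrict_univ]
  calc ∫⁻ x, ‖Df V x‖ₑ^2 ≤ ∫⁻ x, eO (hs (Df V x)) := by
        refine lintegral_mono fun x => ?_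
        rw [← ofReal_norm, ← ENNReal.ofReal_pow (norm_nonneg _)]
        exact ENNReal.ofReal_le_ofReal (op_le_hs _)
    _ = eO (∫ x, hs (Df V x)) :=
        (ofReal_integral_eq_lintegral_ofReal iH (ae_of_all _ fun x => hs0 _)).symm
    _ ≤ eO (2 * ∫ x, hs (sym (Df V x))) := ENNReal.ofReal_le_ofReal main
    _ = 2 * ∫⁻ x, eO (hs (sym (Df V x))) := by
        rw [ENNReal.ofReal_mul zero_le_two,
          ofReal_integral_eq_lintegral_ofReal iS (ae_of_all _ fun x => hs0 _)]
        simp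
    _ ≤ 2 * ∫⁻ x, 3 * ‖sym (Df V x)‖ₑ^2 := by
        gcongr with x
        rw [← ofReal_norm, ← ENNReal.ofReal_pow (norm_nonneg _),
          show (3:ℝ≥0∞) = eO 3 by simp, ← ENNReal.ofReal_mul (by norm_num)]
        exact ENNReal.ofReal_le_ofReal (hs_le_op _)
    _ = _ := by
        rw [lintegral_const_mul' _ _ (by simp), ← mul_assoc]; norm_num
def Hs (s : ℝ) : Set E3 := {y | y 2 < s}
lemma Hs_open (s : ℝ) : IsOpen (Hs s) :=
  isOpen_lt (by fun_prop) continuous_const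
lemma Hs_convex (s : ℝ) : Convex ℝ (Hs s) :=
  convex_halfSpace_lt (f := fun y : E3 => y 2) ⟨fun _ _ => by simp, fun _ _ => by simp⟩ s
lemma plane_null : ∀ᵐ y : E3, y 2 ≠ 0 := by
  have h := Measure.addHaar_submodule (volume : Measure E3)
    (LinearMap.ker (EuclideanSpace.proj (𝕜 := ℝ) (2 : Fin 3)).toLinearMap) (by
      intro h
      have : ee 2 ∈ LinearMap.ker (EuclideanSpace.proj (𝕜 := ℝ) (2 : Fin 3)).toLinearMap := by
        rw [h]; trivial
      simp [ee] at this)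
  rw [ae_iff]
  refine measure_mono_null (fun y hy => ?_) h
  simpa using hy
def mfold (f : ℝ → ℝ) (y : E3) : E3 := y + (f (y 2) - y 2) • ee 2
lemma mfold_coord (f : ℝ → ℝ) (y : E3) : mfold f y 0 = y 0 ∧ mfold f y 1 = y 1 ∧
    mfold f y 2 = f (y 2) := by
  refine ⟨?_, ?_, ?_⟩ <;> simp [mfold, ee]
lemma mfold_lip {f : ℝ → ℝ} (hf : LipschitzWith 2 f) : LipschitzWith 4 (mfold f) := by
  have h2 : LipschitzWith 1 (fun y : E3 => y 2) := LipschitzWith.of_dist_le_mul fun x y => by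
    rw [dist_eq_norm, dist_eq_norm]
    simpa using PiLp.norm_apply_le (x - y) 2
  refine LipschitzWith.of_dist_le_mul fun x y => ?_
  have h3 := (hf.comp h2).dist_le_mul x y
  have h4 := h2.dist_le_mul x y
  simp only [dist_eq_norm, Function.comp] at *
  have e : mfold f x - mfold f y = (x - y) + ((f (x 2) - f (y 2)) - (x 2 - y 2)) • ee 2 := by
    simp only [mfold]; module
  rw [e]
  refine (norm_add_le _ _).trans ?_
  rw [norm_smul, show ‖ee 2‖ = 1 by simp [ee], mul_one]
  have := norm_sub_le (f (x 2) - f (y 2)) (x 2 - y 2)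
  push_cast at *
  linarith
def sg (k : ℝ) : M3 := ContinuousLinearMap.id ℝ E3 -
  (1 + k) • (EuclideanSpace.proj (𝕜 := ℝ) (2 : Fin 3)).smulRight (ee 2)
lemma sg_coord (k : ℝ) (y : E3) : sg k y 0 = y 0 ∧ sg k y 1 = y 1 ∧ sg k y 2 = -k * y 2 := by
  refine ⟨?_, ?_, ?_⟩ <;> simp [sg, ee]; ring
lemma sg_norm {k : ℝ} (hk : 1 ≤ k) : ‖sg k‖ ≤ k := by
  refine ContinuousLinearMap.opNorm_le_bound _ (by linarith) fun y => ?_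
  rw [← sq_le_sq₀ (norm_nonneg _) (by positivity), mul_pow, EuclideanSpace.norm_sq_eq,
    EuclideanSpace.norm_sq_eq]
  obtain ⟨h0, h1, h2⟩ := sg_coord k y
  simp only [Fin.sum_univ_three, h0, h1, h2, Real.norm_eq_abs, sq_abs]
  have : 1 ≤ k^2 := by nlinarith
  nlinarith [sq_nonneg (y 0), sq_nonneg (y 1)]
lemma sg_adj (k : ℝ) : ContinuousLinearMap.adjoint (sg k) = sg k := by
  symm
  rw [ContinuousLinearMap.eq_adjoint_iff]
  intro x y
  obtain ⟨h0, h1, h2⟩ := sg_coord k x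
  obtain ⟨g0, g1, g2⟩ := sg_coord k y
  simp only [EuclideanSpace.inner_eq_star_dotProduct, dotProduct, Fin.sum_univ_three, h0, h1, h2,
    g0, g1, g2, Pi.star_apply, star_trivial]
  ring
lemma sym_conj (k : ℝ) (A : M3) : sym ((sg k).comp (A.comp (sg k))) =
    (sg k).comp ((sym A).comp (sg k)) := by
  simp only [sym, ContinuousLinearMap.adjoint_comp, sg_adj]
  ext x : 1
  simp [ContinuousLinearMap.comp_apply]
lemma sg_lint {k : ℝ} (hk : 1 ≤ k) (f : E3 → ℝ≥0∞) (hf : Measurable f) :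
    ∫⁻ y in {y : E3 | 0 < y 2}, f (sg k y) ≤ ∫⁻ y in Hs 0, f y := by
  have hm : MeasurableSet {y : E3 | 0 < y 2} :=
    (isOpen_lt continuous_const (by fun_prop)).measurableSet
  have hdet : LinearMap.det (sg k : E3 →ₗ[ℝ] E3) = -k := by
    rw [← LinearMap.det_toMatrix (EuclideanSpace.basisFun (Fin 3) ℝ).toBasis, Matrix.det_fin_three]
    simp [LinearMap.toMatrix_apply, sg, ee]
  have e : {y : E3 | 0 < y 2} = (sg k) ⁻¹' (Hs 0) := by
    ext y
    simp only [mem_ofPred_eq, mem_preimage, Hs, (sg_coord k y).2.2]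
    constructor
    · intro h; nlinarith
    · intro h; by_contra h'; nlinarith
  have hmap := Measure.map_linearMap_addHaar_eq_smul_addHaar (volume : Measure E3)
    (f := (sg k : E3 →ₗ[ℝ] E3)) (by rw [hdet]; linarith)
  rw [e, ← setLIntegral_map (Hs_open 0).measurableSet hf (sg k).continuous.measurable]
  have h2 : Measure.map (sg k) (volume : Measure E3) ≤ volume := by
    have : Measure.map (sg k) (volume : Measure E3) = eO |(-k)⁻¹| • volume := by
      rw [← hdet]; exact hmap
    rw [this]
    intro s
    simp only [Measure.smul_apply, smul_eq_mul]
    refine mul_le_of_le_one_left (by positivity) ?_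
    rw [ENNReal.ofReal_le_one, abs_inv, abs_neg, abs_of_pos (by linarith)]
    exact inv_le_one_of_one_le₀ hk
  exact lintegral_mono' (Measure.restrict_mono le_rfl h2) le_rfl
lemma korn_pre {t R : ℝ} (ht : 0 < t) {g : E3 → E3} (hg : ContDiffOn ℝ 1 g (Hs t))
    (h0 : ∀ y ∈ Hs t, R ≤ ‖y‖ → g y = 0) :
    N2 (Df g) (Hs 0) ≤ 882 * N2 (fun x => sym (Df g x)) (Hs 0) := by
  have hsub : {y : E3 | y 2 ≤ 0} ⊆ Hs t := fun y hy => lt_of_le_of_lt hy ht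
  have hcv : Convex ℝ {y : E3 | y 2 ≤ 0} :=
    convex_halfSpace_le (f := fun y : E3 => y 2) ⟨fun _ _ => by simp, fun _ _ => by simp⟩ 0
  have hcl : IsClosed {y : E3 | y 2 ≤ 0} := isClosed_le (by fun_prop) continuous_const
  have hd : ∀ y ∈ Hs t, DifferentiableAt ℝ g y := fun y hy =>
    (hg.differentiableOn one_ne_zero).differentiableAt ((Hs_open t).mem_nhds hy)
  obtain ⟨Λ, hΛ⟩ : ∃ Λ : ℝ≥0, LipschitzOnWith Λ g {y : E3 | y 2 ≤ 0} := by
    have hc : ContinuousOn (Df g) (Hs t) := hg.continuousOn_fderiv_of_isOpen (Hs_open t) le_rfl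
    have hK : IsCompact ({y : E3 | y 2 ≤ 0} ∩ closedBall 0 R) :=
      (isCompact_closedBall _ _).inter_left hcl
    obtain ⟨c, hc⟩ := hK.exists_bound_of_continuousOn (hc.mono (inter_subset_left.trans hsub))
    refine ⟨c.toNNReal, hcv.lipschitzOnWith_of_nnnorm_fderiv_le (𝕜 := ℝ)
      (fun y hy => hd y (hsub hy)) fun y hy => ?_⟩
    rw [← NNReal.coe_le_coe, coe_nnnorm]
    by_cases hyR : ‖y‖ ≤ R
    · exact (hc y ⟨hy, by simpa using hyR⟩).trans (Real.le_coe_toNNReal c)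
    · have : g =ᶠ[𝓝 y] fun _ => 0 := by
        have h1 : ∀ᶠ z : E3 in 𝓝 y, R < ‖z‖ :=
          (isOpen_lt continuous_const continuous_norm).mem_nhds (not_le.1 hyR)
        filter_upwards [h1, (Hs_open t).mem_nhds (hsub hy)] with z hz hz2 using h0 z hz2 hz.le
      rw [this.fderiv_eq]; simp
  set V : E3 → E3 := fun y => g (mfold (fun s => min s 0) y) +
    (3:ℝ) • sg 1 (g (mfold (fun s => min (-s) 0) y)) +
    (-2:ℝ) • sg 2 (g (mfold (fun s => min (-2 * s) 0) y)) - g (mfold (fun _ => 0) y) with hVd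
  have VL : ∃ L, LipschitzWith L V := by
    have hm : ∀ f : ℝ → ℝ, LipschitzWith 2 f → (∀ s, f s ≤ 0) →
        LipschitzWith (Λ * 4) fun y => g (mfold f y) := by
      intro f hf hf0
      rw [← lipschitzOnWith_univ]
      refine hΛ.comp ((mfold_lip hf).lipschitzOnWith (s := univ)) fun y _ => ?_
      have := (mfold_coord f y).2.2
      simp only [mem_ofPred_eq, this]; exact hf0 _
    have hlin : ∀ c : ℝ, |c| ≤ 2 → LipschitzWith 2 fun s : ℝ => min (c * s) 0 := by
      intro c hc
      refine LipschitzWith.min_const (LipschitzWith.of_dist_le_mul fun x y => ?_) 0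
      rw [Real.dist_eq, Real.dist_eq, ← mul_sub, abs_mul]
      exact mul_le_mul_of_nonneg_right hc (abs_nonneg _)
    have a0 := hm (fun s => min s 0) (by simpa using hlin 1 (by norm_num)) (fun s => min_le_right _ _)
    have a1 := hm (fun s => min (-s) 0) (by simpa using hlin (-1) (by norm_num))
      (fun s => min_le_right _ _)
    have a2 := hm (fun s => min (-2*s) 0) (hlin (-2) (by norm_num)) (fun s => min_le_right _ _)
    have a3 := hm (fun s => 0) ((LipschitzWith.const _).weaken (by simp)) (fun s => le_rfl)
    exact ⟨_, ((a0.add (((3:ℝ) • sg 1).lipschitz.comp a1)).add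
      (((-2:ℝ) • sg 2).lipschitz.comp a2)).sub a3⟩
  obtain ⟨L, VL⟩ := VL
  have sgi : ∀ y : E3, (3:ℝ) • sg 1 y + (-2:ℝ) • sg 2 y = y := fun y => by
    obtain ⟨a0, a1, a2⟩ := sg_coord 1 y
    obtain ⟨b0, b1, b2⟩ := sg_coord 2 y
    ext i; fin_cases i
    · simp [a0, b0]; ring
    · simp [a1, b1]; ring
    · simp [a2, b2]; ring
  have ext3 : ∀ a b : E3, a 0 = b 0 → a 1 = b 1 → a 2 = b 2 → a = b := fun a b h0 h1 h2 => by
    ext i; fin_cases i <;> assumption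
  have Vneg : ∀ y : E3, y 2 ≤ 0 → V y = g y := by
    intro y hy
    have m0 : mfold (fun s => min s 0) y = y := by simp [mfold, hy]
    have m1 : mfold (fun s => min (-s) 0) y = mfold (fun _ => 0) y := by
      simp [mfold, hy]
    have m2 : mfold (fun s => min (-2*s) 0) y = mfold (fun _ => 0) y := by
      simp only [mfold]; rw [min_eq_right (by linarith)]
    simp only [hVd, m0, m1, m2]
    have := sgi (g (mfold (fun _ => 0) y))
    rw [add_assoc, this]; simp
  have Vpos : ∀ y : E3, 0 ≤ y 2 → V y = (3:ℝ) • sg 1 (g (sg 1 y)) + (-2:ℝ) • sg 2 (g (sg 2 y)) := by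
    intro y hy
    have m0 : mfold (fun s => min s 0) y = mfold (fun _ => 0) y := by simp [mfold, hy]
    have m1 : mfold (fun s => min (-s) 0) y = sg 1 y := by
      obtain ⟨a0, a1, a2⟩ := sg_coord 1 y
      obtain ⟨b0, b1, b2⟩ := mfold_coord (fun s => min (-s) 0) y
      apply ext3 <;> simp [*]
    have m2 : mfold (fun s => min (-2*s) 0) y = sg 2 y := by
      obtain ⟨a0, a1, a2⟩ := sg_coord 2 y
      obtain ⟨b0, b1, b2⟩ := mfold_coord (fun s => min (-2*s) 0) y
      exact ext3 _ _ (b0.trans a0.symm) (b1.trans a1.symm)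
        (b2.trans ((min_eq_left (by linarith)).trans a2.symm))
    simp only [hVd, m0, m1, m2]; abel
  have sgH : ∀ k : ℝ, 1 ≤ k → ∀ y : E3, 0 ≤ y 2 → sg k y ∈ Hs t := fun k hk y hy => by
    show sg k y 2 < t
    rw [(sg_coord k y).2.2]; nlinarith
  have sgN : ∀ k : ℝ, 1 ≤ k → ∀ y : E3, ‖y‖ ≤ ‖sg k y‖ := fun k hk y => by
    rw [← sq_le_sq₀ (norm_nonneg _) (by positivity), EuclideanSpace.norm_sq_eq,
      EuclideanSpace.norm_sq_eq]
    obtain ⟨h0, h1, h2⟩ := sg_coord k y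
    simp only [Fin.sum_univ_three, h0, h1, h2, Real.norm_eq_abs, sq_abs]
    nlinarith [sq_nonneg (y 2), mul_nonneg (sq_nonneg (y 2)) (sub_nonneg.2 (one_le_pow₀ hk (n := 2)))]
  have cV : HasCompactSupport V := by
    refine HasCompactSupport.intro (isCompact_closedBall 0 R) fun y hy => ?_
    have hy : R < ‖y‖ := by simpa using hy
    rcases le_total (y 2) 0 with h | h
    · rw [Vneg y h]; exact h0 y (hsub h) hy.le
    · rw [Vpos y h, h0 _ (sgH 1 le_rfl y h) (hy.le.trans (sgN 1 le_rfl y)),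
        h0 _ (sgH 2 one_le_two y h) (hy.le.trans (sgN 2 one_le_two y))]
      simp
  have dneg : ∀ y : E3, y 2 < 0 → V =ᶠ[𝓝 y] g := fun y hy => by
    filter_upwards [(Hs_open 0).mem_nhds hy] with z hz using Vneg z (le_of_lt hz)
  have hop : IsOpen {y : E3 | 0 < y 2} := isOpen_lt continuous_const (by fun_prop)
  have dpos : ∀ y : E3, 0 < y 2 → HasFDerivAt V
      ((3:ℝ) • (sg 1).comp ((Df g (sg 1 y)).comp (sg 1)) +
       (-2:ℝ) • (sg 2).comp ((Df g (sg 2 y)).comp (sg 2))) y := fun y hy => by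
    have e : V =ᶠ[𝓝 y] fun y => (3:ℝ) • sg 1 (g (sg 1 y)) + (-2:ℝ) • sg 2 (g (sg 2 y)) := by
      filter_upwards [hop.mem_nhds hy] with z hz using Vpos z (le_of_lt hz)
    refine HasFDerivAt.congr_of_eventuallyEq ?_ e
    have hk : ∀ k : ℝ, 1 ≤ k → HasFDerivAt (fun y => sg k (g (sg k y)))
        ((sg k).comp ((Df g (sg k y)).comp (sg k))) y := fun k hk =>
      (sg k).hasFDerivAt.comp y
        ((hd _ (sgH k hk y hy.le)).hasFDerivAt.comp y (sg k).hasFDerivAt)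
    exact ((hk 1 le_rfl).fun_const_smul (3:ℝ)).fun_add ((hk 2 one_le_two).fun_const_smul (-2:ℝ))
  have dV : ∀ᵐ y, DifferentiableAt ℝ V y := by
    filter_upwards [plane_null] with y hy
    rcases lt_or_gt_of_ne hy with h | h
    · exact (dneg y h).differentiableAt_iff.2 (hd y (hsub (le_of_lt h)))
    · exact (dpos y h).differentiableAt
  have K := korn_whole VL cV dV
  set I := N2 (fun x => sym (Df g x)) (Hs 0) with hI
  have mS : Measurable fun x => ‖sym (Df g x)‖ₑ^2 := by
    exact (sym_meas g).enorm.pow_const 2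
  have split : N2 (fun x => sym (Df V x)) univ ≤ 147 * I := by
    have e : (univ : Set E3) =ᵐ[volume] (Hs 0 ∪ {y : E3 | 0 < y 2} : Set E3) := by
      refine Filter.eventuallyEq_set.2 ?_
      filter_upwards [plane_null] with y hy
      simp only [mem_univ, true_iff]
      exact lt_or_gt_of_ne hy
    simp only [N2]
    rw [setLIntegral_congr e]
    refine (lintegral_union_le _ _ _).trans ?_
    have i1 : ∫⁻ x in Hs 0, ‖sym (Df V x)‖ₑ^2 = I := by
      refine setLIntegral_congr_fun (Hs_open 0).measurableSet fun y hy => ?_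
      simp only [(dneg y hy).fderiv_eq]
    have i2 : ∫⁻ x in {y : E3 | 0 < y 2}, ‖sym (Df V x)‖ₑ^2 ≤
        ∫⁻ y in {y : E3 | 0 < y 2}, (18 * ‖sym (Df g (sg 1 y))‖ₑ^2 +
          128 * ‖sym (Df g (sg 2 y))‖ₑ^2) := by
      refine setLIntegral_mono' hop.measurableSet fun y hy => ?_
      have e : sym (Df V y) = (3:ℝ) • (sg 1).comp ((sym (Df g (sg 1 y))).comp (sg 1)) +
          (-2:ℝ) • (sg 2).comp ((sym (Df g (sg 2 y))).comp (sg 2)) := by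
        rw [(dpos y hy).fderiv, ← sym_conj, ← sym_conj]
        simp only [sym, map_add, map_smulₛₗ, conj_trivial]; module
      have hk : ∀ k : ℝ, 1 ≤ k → ∀ S : M3, ‖(sg k).comp (S.comp (sg k))‖ ≤ k^2 * ‖S‖ := by
        intro k hk S
        have h := sg_norm hk
        calc _ ≤ ‖sg k‖ * (‖S‖ * ‖sg k‖) := (ContinuousLinearMap.opNorm_comp_le _ _).trans
              (by gcongr; exact ContinuousLinearMap.opNorm_comp_le _ _)
          _ ≤ k * (‖S‖ * k) := by gcongr
          _ = _ := by ring
      have : ‖sym (Df V y)‖^2 ≤ 18 * ‖sym (Df g (sg 1 y))‖^2 +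
          128 * ‖sym (Df g (sg 2 y))‖^2 := by
        have h1 := hk 1 le_rfl (sym (Df g (sg 1 y)))
        have h2 := hk 2 one_le_two (sym (Df g (sg 2 y)))
        have h3 : ‖sym (Df V y)‖ ≤ 3 * ‖sym (Df g (sg 1 y))‖ +
            8 * ‖sym (Df g (sg 2 y))‖ := by
          rw [e]
          refine (norm_add_le _ _).trans ?_
          rw [norm_smul, norm_smul]
          norm_num at h1 h2 ⊢
          linarith
        have := pow_le_pow_left₀ (norm_nonneg _) h3 2
        nlinarith [sq_nonneg (3 * ‖sym (Df g (sg 1 y))‖ - 8 * ‖sym (Df g (sg 2 y))‖)]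
      simp only [← ofReal_norm, ← ENNReal.ofReal_pow (norm_nonneg _)]
      rw [show (18:ℝ≥0∞) = eO 18 by simp, show (128:ℝ≥0∞) = eO 128 by simp,
        ← ENNReal.ofReal_mul (by norm_num), ← ENNReal.ofReal_mul (by norm_num),
        ← ENNReal.ofReal_add (by positivity) (by positivity)]
      exact ENNReal.ofReal_le_ofReal this
    rw [i1]
    refine (add_le_add le_rfl i2).trans ?_
    have mk : ∀ k, Measurable fun y => ‖sym (Df g (sg k y))‖ₑ^2 := fun k =>
      mS.comp (sg k).continuous.measurable
    rw [lintegral_add_left ((mk 1).const_mul _), lintegral_const_mul _ (mk 1),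
      lintegral_const_mul _ (mk 2)]
    calc _ ≤ I + (18 * I + 128 * I) := by
          gcongr
          · exact sg_lint le_rfl _ mS
          · exact sg_lint one_le_two _ mS
      _ = _ := by ring
  calc N2 (Df g) (Hs 0) = N2 (Df V) (Hs 0) := by
        refine setLIntegral_congr_fun (Hs_open 0).measurableSet fun y hy => ?_
        simp only [(dneg y hy).fderiv_eq]
    _ ≤ N2 (Df V) univ := lintegral_mono_set (subset_univ _)
    _ ≤ 6 * (147 * I) := K.trans (by gcongr)
    _ = _ := by rw [← mul_assoc]; norm_num
lemma N2_shift {F : Type*} [NormedAddCommGroup F] (f : E3 → F) (a : E3) (S : Set E3)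
    (hS : MeasurableSet S) :
    N2 (fun y => f (y + a)) S = N2 f ((fun y => y - a) ⁻¹' S) := by
  have hm : MeasurableSet ((fun y : E3 => y - a) ⁻¹' S) := (measurable_id.sub_const a) hS
  simp only [N2]
  rw [← lintegral_indicator hS, ← lintegral_indicator hm,
    ← lintegral_add_right_eq_self (((fun y => y - a) ⁻¹' S).indicator _) a]
  refine lintegral_congr fun y => ?_
  by_cases hy : y ∈ S
  · rw [indicator_of_mem hy, indicator_of_mem (by simpa using hy)]
  · rw [indicator_of_notMem hy, indicator_of_notMem (by simpa using hy)]
theorem korn {s R : ℝ} {W : E3 → E3} (hW : ContDiffOn ℝ 1 W (Hs s))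
    (h0 : ∀ y ∈ Hs s, R ≤ ‖y‖ → W y = 0) :
    N2 (Df W) (Hs s) ≤ 882 * N2 (fun x => sym (Df W x)) (Hs s) := by
  have main : ∀ t > 0, N2 (Df W) (Hs (s - t)) ≤
      882 * N2 (fun x => sym (Df W x)) (Hs s) := by
    intro t ht
    set a : E3 := (s - t) • ee 2 with ha
    have a2 : a 2 = s - t := by simp [ha, ee]
    have mem : ∀ y ∈ Hs t, y + a ∈ Hs s := fun y hy => by
      simp only [Hs, mem_ofPred_eq] at *
      simp only [PiLp.add_apply, a2]; linarith
    have h := korn_pre (R := R + ‖a‖) ht (g := fun y => W (y + a))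
      (hW.comp (by fun_prop) mem) fun y hy hR => h0 _ (mem y hy) (by
        have : ‖y‖ ≤ ‖y + a‖ + ‖a‖ := by simpa using norm_sub_le (y + a) a
        linarith)
    rw [show Df (fun y => W (y + a)) = fun y => Df W (y + a) from
      funext fun y => fderiv_comp_add_right a] at h
    rw [N2_shift (Df W) a _ (Hs_open 0).measurableSet,
      N2_shift (fun x => sym (Df W x)) a _ (Hs_open 0).measurableSet] at h
    have e : (fun y => y - a) ⁻¹' Hs 0 = Hs (s - t) := by
      ext y; simp [Hs, a2]
    rw [e] at h
    refine h.trans ?_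
    gcongr
    exact lintegral_mono_set fun y hy => lt_trans (show y 2 < s - t from hy) (show s - t < s by linarith)
  have hu : Hs s = ⋃ n : ℕ, Hs (s - 1 / ((n:ℝ) + 1)) := by
    ext y
    simp only [Hs, mem_ofPred_eq, mem_iUnion]
    constructor
    · intro h
      obtain ⟨n, hn⟩ := exists_nat_one_div_lt (sub_pos.2 h)
      exact ⟨n, by linarith⟩
    · rintro ⟨n, hn⟩
      have : 0 < 1 / ((n:ℝ) + 1) := by positivity
      linarith
  have hmono : Monotone fun n : ℕ => Hs (s - 1 / ((n:ℝ) + 1)) := by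
    intro m n hmn y hy
    simp only [Hs, mem_ofPred_eq] at *
    have := one_div_le_one_div_of_le (by positivity) (add_le_add (Nat.cast_le (α := ℝ).2 hmn) le_rfl (c := (1:ℝ)))
    linarith
  rw [show N2 (Df W) (Hs s) = ⨆ n : ℕ, N2 (Df W) (Hs (s - 1 / ((n:ℝ) + 1))) by
    conv_lhs => rw [hu]
    exact setLIntegral_iUnion_of_directed _ (directed_of_isDirected_le hmono)]
  exact iSup_le fun n => main _ (by positivity)
open scoped ContDiff
def trc (A : M3) : ℝ := ∑ i, A (ee i) i
abbrev BB := M3 →L[ℝ] M3 →L[ℝ] ℝ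
def bil (lam mu : ℝ) : BB :=
  LinearMap.toContinuousBilinearMap (LinearMap.mk₂ ℝ
    (fun A B : M3 => lam * trc A * trc B + mu * ∑ j, ∑ i, (A (ee j) i * B (ee j) i + A (ee j) i * B (ee i) j))
    (by intros; simp [trc, Fin.sum_univ_three]; ring)
    (by intros; simp [trc, Fin.sum_univ_three]; ring)
    (by intros; simp [trc, Fin.sum_univ_three]; ring)
    (by intros; simp [trc, Fin.sum_univ_three]; ring))
lemma bil_apply (lam mu : ℝ) (A B : M3) : bil lam mu A B = lam * trc A * trc B +
    mu * ∑ j, ∑ i, (A (ee j) i * B (ee j) i + A (ee j) i * B (ee i) j) := rfl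
lemma bil_coer (A : M3) :
    min (2 * mu) (3 * lam + 2 * mu) * ‖sym A‖^2 ≤ bil lam mu A A ∨ min (2 * mu) (3 * lam + 2 * mu) < 0 := by
  by_cases hc : 0 ≤ min (2 * mu) (3 * lam + 2 * mu)
  swap
  · exact Or.inr (not_le.1 hc)
  left
  have h1 : bil lam mu A A = lam * trc (sym A)^2 + 2 * mu * hs (sym A) := by
    rw [bil_apply, hs_coord]
    simp only [trc, sym_coord, Fin.sum_univ_three]; ring
  have h2 : trc (sym A)^2 ≤ 3 * hs (sym A) := by
    rw [hs_coord]
    simp only [trc, Fin.sum_univ_three]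
    nlinarith [sq_nonneg (sym A (ee 0) 0 - sym A (ee 1) 1), sq_nonneg (sym A (ee 0) 0 - sym A (ee 2) 2),
      sq_nonneg (sym A (ee 1) 1 - sym A (ee 2) 2), sq_nonneg (sym A (ee 0) 1), sq_nonneg (sym A (ee 0) 2),
      sq_nonneg (sym A (ee 1) 0), sq_nonneg (sym A (ee 1) 2), sq_nonneg (sym A (ee 2) 0),
      sq_nonneg (sym A (ee 2) 1)]
  have h3 := op_le_hs (sym A)
  rw [h1]
  calc _ ≤ min (2 * mu) (3 * lam + 2 * mu) * hs (sym A) := by gcongr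
    _ ≤ _ := by
      have ha := min_le_left (2 * mu) (3 * lam + 2 * mu)
      have hb := min_le_right (2 * mu) (3 * lam + 2 * mu)
      have h0 : 0 ≤ hs (sym A) := (sq_nonneg _).trans h3
      rcases le_total 0 lam with hl | hl
      · nlinarith [sq_nonneg (trc (sym A)), mul_nonneg hl (sq_nonneg (trc (sym A)))]
      · nlinarith
lemma trans_cont {V : Type*} [NormedAddCommGroup V] {γ : E3 → V} (hγ : MemLp γ 2 volume) :
    Tendsto (fun a : E3 => N2 (fun y => γ (a + y) - γ y) univ) (𝓝 0) (𝓝 0) := by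
  have : Fact ((2:ℝ≥0∞) ≠ ⊤) := ⟨by simp⟩
  have hc : Continuous fun a : E3 => (DomAddAct.mk a) +ᵥ (hγ.toLp γ) :=
    (DomAddAct.continuous_mk).vadd continuous_const
  have h0 : Tendsto (fun a : E3 => ‖(DomAddAct.mk a +ᵥ hγ.toLp γ) - hγ.toLp γ‖ₑ) (𝓝 0) (𝓝 0) := by
    have : Continuous fun a : E3 => ‖(DomAddAct.mk a +ᵥ hγ.toLp γ) - hγ.toLp γ‖ₑ := by fun_prop
    have := this.tendsto 0
    simpa using this
  have h1 := (ENNReal.continuous_pow 2).tendsto _ |>.comp h0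
  simp only [zero_pow two_ne_zero] at h1
  refine h1.congr fun a => ?_
  have e : (DomAddAct.mk a +ᵥ hγ.toLp γ) - hγ.toLp γ = MemLp.toLp (fun y => γ (a + y) - γ y)
      ((hγ.comp_measurePreserving (measurePreserving_add_left volume a)).sub hγ) := by
    rw [DomAddAct.mk_vadd_toLp, ← MemLp.toLp_sub]; rfl
  simp only [Function.comp, e, Lp.enorm_toLp]
  rw [eLpNorm_eq_lintegral_rpow_enorm_toReal two_ne_zero (by simp)]
  simp only [N2, Measure.restrict_univ, ENNReal.toReal_ofNat, ENNReal.rpow_two]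
  rw [← ENNReal.rpow_natCast, ← ENNReal.rpow_mul]; norm_num
def Wk (s r : ℝ) (G : E3 → M3 →L[ℝ] ℝ) : Prop :=
  ∀ v : E3 → E3, ContDiff ℝ 1 v → HasCompactSupport v → tsupport v ⊆ ball 0 r →
    ∫ y in Hs s, G y (Df v y) = 0
lemma fderiv_zero_of_out {s ρ : ℝ} {v : E3 → E3} (h0 : ∀ y ∈ Hs s, ρ < ‖y‖ → v y = 0)
    {y : E3} (hy : y ∈ Hs s) (hr : ρ < ‖y‖) : Df v y = 0 := by
  have : v =ᶠ[𝓝 y] fun _ => 0 := by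
    have h1 : ∀ᶠ z : E3 in 𝓝 y, ρ < ‖z‖ :=
      (isOpen_lt continuous_const continuous_norm).mem_nhds hr
    filter_upwards [h1, (Hs_open s).mem_nhds hy] with z hz hz2 using h0 z hz2 hz
  rw [this.fderiv_eq]; simp
lemma lint_ind {V : Type*} [NormedAddCommGroup V] (f : E3 → V) {S : Set E3} (hS : MeasurableSet S) :
    ∫⁻ y, ‖S.indicator f y‖ₑ^2 = N2 f S := by
  have : (fun y => ‖S.indicator f y‖ₑ^2) = S.indicator fun y => ‖f y‖ₑ^2 := by
    ext y; by_cases h : y ∈ S <;> simp [h]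
  rw [this, lintegral_indicator hS]; rfl
lemma memLp_of {V : Type*} [NormedAddCommGroup V] {f : E3 → V} {m : Measure E3}
    (h : AEStronglyMeasurable f m) (n : ∫⁻ y, ‖f y‖ₑ^2 ∂m ≠ ⊤) : MemLp f 2 m := by
  refine ⟨h, ?_⟩
  rw [eLpNorm_eq_lintegral_rpow_enorm_toReal two_ne_zero (by simp)]
  simp only [ENNReal.toReal_ofNat, ENNReal.rpow_two]
  exact ENNReal.rpow_lt_top_of_nonneg (by norm_num) n
lemma pair_int {W : Type*} [NormedAddCommGroup W] [NormedSpace ℝ W] {Γ : E3 → W →L[ℝ] ℝ} {f : E3 → W}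
    {m : Measure E3}
    (hΓ : AEStronglyMeasurable Γ m) (nΓ : ∫⁻ y, ‖Γ y‖ₑ^2 ∂m ≠ ⊤) (hf : AEStronglyMeasurable f m)
    (nf : ∫⁻ y, ‖f y‖ₑ^2 ∂m ≠ ⊤) : Integrable (fun y => Γ y (f y)) m := by
  have := (memLp_of hΓ nΓ).norm.integrable_mul (memLp_of hf nf).norm
  refine this.mono' ?_ (ae_of_all _ fun y => (Γ y).le_opNorm (f y))
  exact ((ContinuousLinearMap.apply ℝ ℝ).flip).aestronglyMeasurable_comp₂ hΓ hf
lemma pair_cs {W : Type*} [NormedAddCommGroup W] [NormedSpace ℝ W] {Γ : E3 → W →L[ℝ] ℝ} {f : E3 → W}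
    {m : Measure E3} (hΓ : AEStronglyMeasurable Γ m) (hf : AEStronglyMeasurable f m) :
    ‖∫ y, Γ y (f y) ∂m‖ₑ^2 ≤ (∫⁻ y, ‖Γ y‖ₑ^2 ∂m) * ∫⁻ y, ‖f y‖ₑ^2 ∂m := by
  have h5 : ‖∫ y, Γ y (f y) ∂m‖ₑ ≤ ∫⁻ y, ‖Γ y‖ₑ * ‖f y‖ₑ ∂m := by
    refine (enorm_integral_le_lintegral_enorm _).trans (lintegral_mono fun y => ?_)
    exact ContinuousLinearMap.le_opENorm _ _
  exact (pow_le_pow_left₀ zero_le h5 2).trans (csE m _ _ hΓ.enorm hf.enorm)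
lemma ext_test {s r ρ : ℝ} (hρ : ρ < r) {G : E3 → M3 →L[ℝ] ℝ} (hG : Wk s r G)
    (mG : ContinuousOn G (Hs s ∩ ball 0 r)) (nG : N2 G (Hs s ∩ ball 0 r) ≠ ⊤) {v : E3 → E3}
    (hv : ContDiffOn ℝ 1 v (Hs s)) (h0 : ∀ y ∈ Hs s, ρ < ‖y‖ → v y = 0)
    (nv : N2 (Df v) (Hs s) ≠ ⊤) :
    ∫ y in Hs s, G y (Df v y) = 0 := by
  set D := Hs s ∩ ball o3 r with hD
  have oD : IsOpen D := (Hs_open s).inter isOpen_ball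
  have mH := (Hs_open s).measurableSet
  set γ : E3 → M3 := (Hs s).indicator (Df v) with hγd
  have mγ : Measurable γ := (measurable_fderiv ℝ v).indicator mH
  have γ0 : ∀ y, ρ < ‖y‖ → γ y = 0 := fun y hy => by
    by_cases h : y ∈ Hs s
    · rw [hγd, indicator_of_mem h, fderiv_zero_of_out h0 h hy]
    · rw [hγd, indicator_of_notMem h]
  have Mγ : MemLp γ 2 volume := by
    refine memLp_of mγ.aestronglyMeasurable ?_
    rw [hγd, lint_ind _ mH]; exact nv
  set Γ : E3 → M3 →L[ℝ] ℝ := D.indicator G with hΓd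
  have mΓ : AEStronglyMeasurable Γ volume :=
    (aestronglyMeasurable_indicator_iff oD.measurableSet).2
      (mG.aestronglyMeasurable oD.measurableSet)
  have nΓ : ∫⁻ y, ‖Γ y‖ₑ^2 ≠ ⊤ := by
    exact (lint_ind G oD.measurableSet).trans_ne nG
  have iΓ : ∀ f : E3 → M3, MemLp f 2 volume → Integrable fun y => Γ y (f y) := by
    intro f hf
    refine pair_int mΓ nΓ hf.1 ?_
    have := hf.eLpNorm_lt_top
    rw [eLpNorm_eq_lintegral_rpow_enorm_toReal two_ne_zero (by simp)] at this
    simp only [ENNReal.toReal_ofNat, ENNReal.rpow_two] at this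
    intro h; rw [h] at this; simp at this
  have key : ∀ t, 0 < t → t < r - ρ → ∫ y, Γ y (γ (-(t • ee 2) + y)) = 0 := by
    intro t ht htr
    have te : ‖t • ee 2‖ = t := by rw [norm_smul]; simp [ee, abs_of_pos ht]
    have t2 : ∀ y : E3, (-(t • ee 2) + y) 2 = y 2 - t := fun y => by simp [ee]; ring
    set τ : E3 → ℝ := fun y => Real.smoothTransition ((s + 2 * t / 3 - y 2) / (t / 3)) with hτ
    set vt : E3 → E3 := fun y => τ y • v (-(t • ee 2) + y) with hvt
    have τc : ContDiff ℝ 1 τ := Real.smoothTransition.contDiff.comp (by fun_prop)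
    have τ1 : ∀ y : E3, y 2 ≤ s + t / 3 → τ y = 1 := fun y hy =>
      Real.smoothTransition.one_of_one_le (by rw [le_div_iff₀ (by positivity)]; linarith)
    have τ0 : ∀ y : E3, s + 2 * t / 3 ≤ y 2 → τ y = 0 := fun y hy =>
      Real.smoothTransition.zero_of_nonpos (div_nonpos_of_nonpos_of_nonneg (by linarith) (by positivity))
    have c2 : Continuous fun y : E3 => y 2 := by fun_prop
    have hc : ContDiff ℝ 1 vt := by
      rw [contDiff_iff_contDiffAt]
      intro y
      by_cases hy : y 2 < s + t
      · have hm : -(t • ee 2) + y ∈ Hs s := by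
          show (-(t • ee 2) + y) 2 < s
          rw [t2]; linarith
        refine τc.contDiffAt.smul ?_
        exact (hv.contDiffAt ((Hs_open s).mem_nhds hm)).comp y (by fun_prop)
      · have : vt =ᶠ[𝓝 y] fun _ => 0 := by
          filter_upwards [(isOpen_lt continuous_const c2).mem_nhds
            (show s + 2 * t / 3 < y 2 by linarith)] with z hz
          simp only [hvt, τ0 z (le_of_lt hz), zero_smul]
        exact contDiffAt_const.congr_of_eventuallyEq this
    have hs : Function.support vt ⊆ closedBall 0 (ρ + t) := by
      intro y hy
      by_contra hn
      apply hy
      by_cases h : y 2 < s + 2 * t / 3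
      · have hm : -(t • ee 2) + y ∈ Hs s := by
          show (-(t • ee 2) + y) 2 < s
          rw [t2]; linarith
        simp only [mem_closedBall, dist_zero_right, not_le] at hn
        have : ‖y‖ ≤ ‖-(t • ee 2) + y‖ + ‖t • ee 2‖ := by
          simpa using norm_add_le (-(t • ee 2) + y) (t • ee 2)
        simp only [hvt]
        rw [h0 _ hm (by linarith), smul_zero]
      · simp only [hvt, τ0 y (not_lt.1 h), zero_smul]
    have hts : tsupport vt ⊆ closedBall 0 (ρ + t) := closure_minimal hs isClosed_closedBall
    have := hG vt hc ((isCompact_closedBall 0 (ρ + t)).of_isClosed_subset (isClosed_tsupport _) hts)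
      (hts.trans (closedBall_subset_ball (by linarith)))
    rw [← this, ← integral_indicator mH]
    congr 1; ext y
    by_cases hy : y ∈ Hs s
    · rw [indicator_of_mem hy]
      have hy' : y 2 < s := hy
      have hm : -(t • ee 2) + y ∈ Hs s := by
        show (-(t • ee 2) + y) 2 < s
        rw [t2]; linarith
      have hd : Df vt y = Df v (-(t • ee 2) + y) := by
        have : vt =ᶠ[𝓝 y] fun z => v (-(t • ee 2) + z) := by
          filter_upwards [(Hs_open s).mem_nhds hy] with z hz
          have hz' : z 2 < s := hz
          simp only [hvt, τ1 z (by linarith), one_smul]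
        rw [this.fderiv_eq, fderiv_comp_add_left]
      by_cases hyr : y ∈ ball o3 r
      · rw [hd, hΓd, indicator_of_mem (show y ∈ D from ⟨hy, hyr⟩), hγd, indicator_of_mem hm]
      · have hn : ρ < ‖-(t • ee 2) + y‖ := by
          simp only [mem_ball, dist_zero_right, not_lt] at hyr
          have : ‖y‖ ≤ ‖-(t • ee 2) + y‖ + ‖t • ee 2‖ := by
            simpa using norm_add_le (-(t • ee 2) + y) (t • ee 2)
          linarith
        rw [hd, γ0 _ hn, fderiv_zero_of_out h0 hm hn]; simp
    · rw [indicator_of_notMem hy, hΓd, indicator_of_notMem (fun h => hy h.1)]; simp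
  have fin : ∫ y, Γ y (γ y) = 0 := by
    have hl : Tendsto (fun n : ℕ => -((1 / ((n:ℝ) + 1)) • ee 2)) atTop (𝓝 0) := by
      have := (tendsto_one_div_add_atTop_nhds_zero_nat (𝕜 := ℝ)).smul_const (ee 2)
      simpa using this.neg
    have h1 := (trans_cont Mγ).comp hl
    have h2 : Tendsto (fun n : ℕ => (∫⁻ y, ‖Γ y‖ₑ^2) *
        N2 (fun y => γ (-((1 / ((n:ℝ) + 1)) • ee 2) + y) - γ y) univ) atTop (𝓝 0) := by
      have := ENNReal.Tendsto.const_mul h1 (Or.inr nΓ)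
      simpa using this
    have h3 : ‖∫ y, Γ y (γ y)‖ₑ^2 ≤ 0 := by
      refine ge_of_tendsto h2 ?_
      have hev : ∀ᶠ n : ℕ in atTop, 1 / ((n:ℝ) + 1) < r - ρ :=
        (tendsto_one_div_add_atTop_nhds_zero_nat (𝕜 := ℝ)).eventually_lt_const (by linarith)
      filter_upwards [hev] with n hn
      have hk := key _ (by positivity) hn
      set a := -((1 / ((n:ℝ) + 1)) • ee 2)
      have Ma : MemLp (fun y => γ (a + y)) 2 volume :=
        Mγ.comp_measurePreserving (measurePreserving_add_left volume a)
      have e : ∫ y, Γ y (γ y) = -∫ y, Γ y (γ (a + y) - γ y) := by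
        simp only [map_sub]
        rw [integral_sub (iΓ _ Ma) (iΓ _ Mγ), hk]; simp
      rw [e, enorm_neg]
      have := pair_cs mΓ (Ma.1.sub Mγ.1)
      simpa [N2] using this
    simpa using h3
  rw [← fin, ← integral_indicator mH]
  congr 1; ext y
  by_cases hy : y ∈ Hs s
  · rw [indicator_of_mem hy]
    by_cases hyr : y ∈ ball o3 r
    · rw [hΓd, indicator_of_mem (show y ∈ D from ⟨hy, hyr⟩), hγd, indicator_of_mem hy]
    · have hn : ρ < ‖y‖ := by
        simp only [mem_ball, dist_zero_right, not_lt] at hyr; linarith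
      rw [γ0 _ hn, fderiv_zero_of_out h0 hy hn]; simp
  · rw [indicator_of_notMem hy, hΓd, indicator_of_notMem (fun h => hy h.1)]; simp
set_option maxSynthPendingDepth 3
section
local instance (priority := 10000) : NormedAddCommGroup M3 := ContinuousLinearMap.toNormedAddCommGroup
local instance (priority := 10000) : NormedSpace ℝ M3 := ContinuousLinearMap.toNormedSpace
local instance (priority := 10000) : NormedAddCommGroup (M3 →L[ℝ] ℝ) := ContinuousLinearMap.toNormedAddCommGroup
local instance (priority := 10000) : NormedSpace ℝ (M3 →L[ℝ] ℝ) := ContinuousLinearMap.toNormedSpace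
local instance (priority := 10000) : NormedAddCommGroup BB := ContinuousLinearMap.toNormedAddCommGroup
local instance (priority := 10000) : NormedSpace ℝ BB := ContinuousLinearMap.toNormedSpace
lemma N2_le {V V' : Type*} [NormedAddCommGroup V] [NormedAddCommGroup V'] {f : E3 → V} {g : E3 → V'}
    {S : Set E3} (hS : MeasurableSet S) {c : ℝ} (h : ∀ y ∈ S, ‖f y‖ ≤ c * ‖g y‖) :
    N2 f S ≤ eO (c^2) * N2 g S := by
  unfold N2
  rw [← lintegral_const_mul' _ _ ENNReal.ofReal_ne_top]
  refine setLIntegral_mono' hS fun y hy => ?_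
  have h1 := h y hy
  rw [← ofReal_norm, ← ofReal_norm, ← ENNReal.ofReal_pow (norm_nonneg _), ← ENNReal.ofReal_pow (norm_nonneg _),
    ← ENNReal.ofReal_mul (sq_nonneg _), ← mul_pow]
  exact ENNReal.ofReal_le_ofReal (pow_le_pow_left₀ (norm_nonneg _) h1 2)
lemma N2_mono {V : Type*} [NormedAddCommGroup V] {f : E3 → V} {S T : Set E3} (h : S ⊆ T) :
    N2 f S ≤ N2 f T := lintegral_mono_set h
lemma N2_two {V V₁ V₂ : Type*} [NormedAddCommGroup V] [NormedAddCommGroup V₁] [NormedAddCommGroup V₂]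
    {f : E3 → V} {g : E3 → V₁} {h : E3 → V₂}
    {S : Set E3} (hS : MeasurableSet S) (mg : AEStronglyMeasurable g (volume.restrict S)) {a b : ℝ}
    (hh : ∀ y ∈ S, ‖f y‖ ≤ a * ‖g y‖ + b * ‖h y‖) :
    N2 f S ≤ eO (2 * a^2) * N2 g S + eO (2 * b^2) * N2 h S := by
  unfold N2
  rw [← lintegral_const_mul' _ _ ENNReal.ofReal_ne_top, ← lintegral_const_mul' _ _ ENNReal.ofReal_ne_top,
    ← lintegral_add_left' ((mg.enorm.pow_const 2).const_mul _)]
  refine setLIntegral_mono' hS fun y hy => ?_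
  have h1 := hh y hy
  simp only [← ofReal_norm]
  rw [← ENNReal.ofReal_pow (norm_nonneg _), ← ENNReal.ofReal_pow (norm_nonneg _),
    ← ENNReal.ofReal_pow (norm_nonneg _),
    ← ENNReal.ofReal_mul (by positivity), ← ENNReal.ofReal_mul (by positivity),
    ← ENNReal.ofReal_add (by positivity) (by positivity)]
  refine ENNReal.ofReal_le_ofReal ((pow_le_pow_left₀ (norm_nonneg _) h1 2).trans ?_)
  nlinarith [sq_nonneg (a * ‖g y‖ - b * ‖h y‖)]
lemma int_sq {V : Type*} [NormedAddCommGroup V] {f : E3 → V} {m : Measure E3}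
    (h : AEStronglyMeasurable f m) (n : ∫⁻ y, ‖f y‖ₑ^2 ∂m ≠ ⊤) :
    Integrable (fun y => ‖f y‖^2) m ∧ ∫⁻ y, ‖f y‖ₑ^2 ∂m = eO (∫ y, ‖f y‖^2 ∂m) := by
  have h1 := (memLp_of h n).integrable_norm_pow two_ne_zero
  refine ⟨h1, ?_⟩
  rw [ofReal_integral_eq_lintegral_ofReal h1 (ae_of_all _ fun y => by positivity)]
  refine lintegral_congr fun y => ?_
  rw [← ofReal_norm, ← ENNReal.ofReal_pow (norm_nonneg _)]
lemma young_pt {M c₀ ε η sX X P F b1 : ℝ} (hη : 0 < η) (hb : c₀ * sX^2 - ε * X^2 - 2 * M * X * P - M * P^2 - F * X - F * P ≤ b1) :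
    c₀ * sX^2 ≤ b1 + (ε + 2 * η) * X^2 + (M^2 / η + |M| + 1) * P^2 + (1 / η + 1) * F^2 := by
  have h1 : 2 * M * X * P ≤ η * X^2 + M^2 / η * P^2 := by
    have : 0 ≤ (η * X - M * P)^2 / η := by positivity
    have e : (η * X - M * P)^2 / η = η * X^2 - 2 * M * X * P + M^2 / η * P^2 := by field_simp; ring
    linarith
  have h2 : F * X ≤ η * X^2 + 1 / η * F^2 := by
    have : 0 ≤ (η * X - F)^2 / η := by positivity
    have e : (η * X - F)^2 / η = η * X^2 - 2 * (F * X) + 1 / η * F^2 := by field_simp; ring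
    have h0 : 0 ≤ η * X^2 + 1 / η * F^2 := by positivity
    linarith
  linarith [sq_nonneg (F - P), sq_nonneg (F+P), mul_le_mul_of_nonneg_right (le_abs_self M) (sq_nonneg P)]
lemma form_low {lam mu ε : ℝ} (hmu : 0 < mu) (hlam : 0 < 3 * lam + 2 * mu) {B : BB} {F : M3 →L[ℝ] ℝ}
    {X P : M3} {t : ℝ} (ht : |t| ≤ 1)
    (hB : ‖B - bil lam mu‖ ≤ ε) :
    min (2 * mu) (3 * lam + 2 * mu) * ‖sym X‖^2 - ε * ‖X‖^2 - 2 * (‖bil lam mu‖ + ε) * ‖X‖ * ‖P‖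
      - (‖bil lam mu‖ + ε) * ‖P‖^2 - ‖F‖ * ‖X‖ - ‖F‖ * ‖P‖ ≤ B (X - P) (X + P) - t * F (X + P) := by
  have hc := (bil_coer (lam := lam) (mu := mu) X).resolve_right (not_lt.2 (le_min (by linarith) hlam.le))
  have hN : ‖B‖ ≤ ‖bil lam mu‖ + ε := by
    have := norm_add_le (bil lam mu) (B - bil lam mu)
    rw [add_sub_cancel] at this; linarith
  have e : B (X - P) (X + P) - t * F (X + P) = bil lam mu X X + (B - bil lam mu) X X + B X P - B P X - B P P
     - t * F X - t * F P := by
    simp only [map_sub, map_add, _root_.sub_apply]; ring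
  have b : ∀ (T : BB) (Y Z : M3), |T Y Z| ≤ ‖T‖ * ‖Y‖ * ‖Z‖ := fun T Y Z => T.le_opNorm₂ Y Z
  have b1 : |(B - bil lam mu) X X| ≤ ε * ‖X‖ * ‖X‖ := (b _ X X).trans (by gcongr)
  have b2 : |B X P| ≤ (‖bil lam mu‖ + ε) * ‖X‖ * ‖P‖ := (b _ X P).trans (by gcongr)
  have b3 : |B P X| ≤ (‖bil lam mu‖ + ε) * ‖P‖ * ‖X‖ := (b _ P X).trans (by gcongr)
  have b4 : |B P P| ≤ (‖bil lam mu‖ + ε) * ‖P‖ * ‖P‖ := (b _ P P).trans (by gcongr)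
  have b5 : ∀ Z, |t * F Z| ≤ ‖F‖ * ‖Z‖ := fun Z => by
    rw [abs_mul]
    calc _ ≤ 1 * (‖F‖ * ‖Z‖) := by gcongr; exact F.le_opNorm Z
      _ = _ := one_mul _
  have b6 := b5 X
  have b7 := b5 P
  rw [e]
  rw [abs_le] at b1 b2 b3 b4 b6 b7
  linarith [b1.1, b2.1, b3.2, b4.2, b6.2, b7.2]
lemma bump_ex {ρ r : ℝ} (hρ : 0 < ρ) (h : ρ < r) : ∃ (χ : E3 → ℝ) (K : ℝ), 0 ≤ K ∧ ContDiff ℝ ∞ χ ∧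
    (∀ y, ‖y‖ ≤ ρ → χ y = 1) ∧ (∀ y, (ρ + r) / 2 ≤ ‖y‖ → χ y = 0) ∧ (∀ y, 0 ≤ χ y ∧ χ y ≤ 1) ∧
    ∀ y, ‖Df χ y‖ ≤ K := by
  let f : ContDiffBump o3 := ⟨ρ, (ρ + r) / 2, hρ, by linarith⟩
  have hf : ContDiff ℝ ∞ (f : E3 → ℝ) := f.contDiff
  obtain ⟨K, hK⟩ := (hf.continuous_fderiv (by simp)).bounded_above_of_compact_support
    (f.hasCompactSupport.fderiv ℝ)
  refine ⟨f, K, (norm_nonneg _).trans (hK 0), hf, fun y hy => f.one_of_mem_closedBall (by simpa using hy),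
    fun y hy => f.zero_of_le_dist (by simpa using hy), fun y => ⟨f.nonneg, f.le_one⟩, hK⟩
def cc0 (lam mu : ℝ) : ℝ := min (2 * mu) (3 * lam + 2 * mu)
def eps0 (lam mu : ℝ) : ℝ := cc0 lam mu / 882 / 8
set_option maxHeartbeats 1000000 in
lemma cacc (hmu : 0 < mu) (hlam : 0 < 3 * lam + 2 * mu) {ρ r : ℝ} (hρ : 0 < ρ) (hr : ρ < r) :
    ∃ K : ℝ≥0, ∀ (s : ℝ) (B : E3 → BB) (F : E3 → M3 →L[ℝ] ℝ) (w : E3 → E3),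
    ContDiffOn ℝ 1 w (Hs s ∩ ball 0 r) → ContinuousOn B (Hs s ∩ ball 0 r) →
    (∀ y ∈ Hs s ∩ ball 0 r, ‖B y - bil lam mu‖ ≤ eps0 lam mu) → ContinuousOn F (Hs s ∩ ball 0 r) →
    N2 w (Hs s ∩ ball 0 r) ≠ ⊤ → N2 (Df w) (Hs s ∩ ball 0 r) ≠ ⊤ → N2 F (Hs s ∩ ball 0 r) ≠ ⊤ →
    Wk s r (fun y => B y (Df w y) - F y) →
    N2 (Df w) (Hs s ∩ ball 0 ρ) ≤ K * (N2 w (Hs s ∩ ball 0 r) + N2 F (Hs s ∩ ball 0 r)) := by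
  obtain ⟨χ, K, hK, χs, χ1, χ0, χb, χd⟩ := bump_ex hρ hr
  have hc0 : 0 < cc0 lam mu := lt_min (by linarith) hlam
  set c₀ := cc0 lam mu with hc0d
  set κ := c₀ / 882 with hκ
  have κ0 : 0 < κ := by positivity
  set ε := eps0 lam mu with hε
  have εκ : ε = κ / 8 := rfl
  set M := ‖bil lam mu‖ + ε with hM
  have M0 : 0 ≤ M := add_nonneg (norm_nonneg (bil lam mu)) (by rw [εκ]; positivity)
  set C1 := (M^2 / (κ/8) + |M| + 1) * K^2 with hC1
  set C2 := 1 / (κ/8) + 1 with hC2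
  have C1n : 0 ≤ C1 := by positivity
  have C2n : 0 ≤ C2 := by positivity
  refine ⟨Real.toNNReal (2 / κ * (C1 + C2)), ?_⟩
  intro s B F w hw cB hB cF nw ndw nF hWk
  set D := Hs s ∩ ball o3 r with hD
  have oD : IsOpen D := (Hs_open s).inter isOpen_ball
  have mD := oD.measurableSet
  set W : E3 → E3 := fun y => χ y • w y with hW
  set P : E3 → M3 := fun y => (Df χ y).smulRight (w y) with hP
  have χdf : ∀ y, HasFDerivAt χ (Df χ y) y := fun y =>
    (χs.differentiable (by simp) y).hasFDerivAt
  have wdf : ∀ y ∈ D, HasFDerivAt w (Df w y) y := fun y hy =>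
    ((hw.differentiableOn one_ne_zero).differentiableAt (oD.mem_nhds hy)).hasFDerivAt
  have W0 : ∀ y, (ρ + r) / 2 ≤ ‖y‖ → W y = 0 := fun y hy => by simp [hW, χ0 y hy]
  have WC : ContDiffOn ℝ 1 W (Hs s) := by
    intro y hy
    refine ContDiffAt.contDiffWithinAt ?_
    by_cases h : ‖y‖ < r
    · exact (χs.contDiffAt.of_le (by simp)).smul
        (hw.contDiffAt (oD.mem_nhds ⟨hy, by simpa using h⟩))
    · have : W =ᶠ[𝓝 y] fun _ => 0 := by
        filter_upwards [(isOpen_lt continuous_const continuous_norm).mem_nhds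
          (show (ρ + r) / 2 < ‖y‖ by linarith)] with z hz using W0 z (le_of_lt hz)
      exact contDiffAt_const.congr_of_eventuallyEq this
  have WD : ∀ y ∈ D, HasFDerivAt W (χ y • Df w y + P y) y := fun y hy =>
    (χdf y).smul (wdf y hy)
  have WDe : ∀ y ∈ D, Df W y = χ y • Df w y + P y := fun y hy => (WD y hy).fderiv
  set v : E3 → E3 := fun y => χ y • W y with hv
  have vC : ContDiffOn ℝ 1 v (Hs s) := ((χs.of_le (by simp)).contDiffOn).smul WC
  have v0 : ∀ y ∈ Hs s, (ρ + r) / 2 < ‖y‖ → v y = 0 := fun y _ hy => by simp [hv, W0 y hy.le]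
  have vDe : ∀ y ∈ D, Df v y = χ y • (Df W y + P y) := fun y hy => by
    have h1 : HasFDerivAt W (Df W y) y := WDe y hy ▸ WD y hy
    have := ((χdf y).smul h1).fderiv
    rw [show v = χ • W from rfl, this, smul_add]
    congr 1
    ext x
    simp [hP, hW, smul_smul, mul_comm]
  have mW : AEStronglyMeasurable (Df W) (volume.restrict D) := (measurable_fderiv ℝ W).aestronglyMeasurable
  have mw : AEStronglyMeasurable w (volume.restrict D) := hw.continuousOn.aestronglyMeasurable mD
  have mdw : AEStronglyMeasurable (Df w) (volume.restrict D) := (measurable_fderiv ℝ w).aestronglyMeasurable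
  have cdw : ContinuousOn (Df w) D := hw.continuousOn_fderiv_of_isOpen oD le_rfl
  have cP : ContinuousOn P D := by
    have : Continuous (Df χ) := χs.continuous_fderiv (by simp)
    exact ((ContinuousLinearMap.smulRightL ℝ E3 E3).continuous₂.comp_continuousOn (this.continuousOn.prodMk hw.continuousOn))
  have Pw : ∀ y ∈ D, ‖P y‖ ≤ K * ‖w y‖ := fun y _ => by
    rw [hP, ContinuousLinearMap.norm_smulRight_apply]; gcongr; exact χd y
  have nP : N2 P D ≠ ⊤ := ne_top_of_le_ne_top (by finiteness) (N2_le mD Pw)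
  have χa : ∀ y, |χ y| ≤ 1 := fun y => by rw [abs_of_nonneg (χb y).1]; exact (χb y).2
  have nW : N2 (Df W) D ≠ ⊤ := by
    refine ne_top_of_le_ne_top ?_ (N2_two (a := 1) (b := 1) (g := Df w) (h := P) mD mdw fun y hy => ?_)
    · finiteness
    · rw [WDe y hy]
      refine (norm_add_le _ _).trans ?_
      rw [norm_smul, one_mul]
      gcongr
      · calc _ ≤ 1 * ‖Df w y‖ := by gcongr; exact χa y
          _ = _ := one_mul _
      · simp
  have zW : ∀ y ∈ Hs s, y ∉ D → Df W y = 0 ∧ Df v y = 0 := by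
    intro y hy hn
    have h : r ≤ ‖y‖ := by
      by_contra h; exact hn ⟨hy, by simpa using h⟩
    exact ⟨fderiv_zero_of_out (ρ := (ρ + r)/2) (fun z _ hz => W0 z hz.le) hy (by linarith),
      fderiv_zero_of_out v0 hy (by linarith)⟩
  have ext0 : ∀ {V : Type} [NormedAddCommGroup V] (f : E3 → V), (∀ y ∈ Hs s, y ∉ D → f y = 0) →
      N2 f (Hs s) = N2 f D := by
    intro V _ f hf
    unfold N2
    rw [← lintegral_indicator (Hs_open s).measurableSet, ← lintegral_indicator mD]
    congr 1; ext y
    by_cases h1 : y ∈ D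
    · rw [indicator_of_mem h1, indicator_of_mem h1.1]
    · rw [indicator_of_notMem h1]
      by_cases h2 : y ∈ Hs s
      · rw [indicator_of_mem h2, hf y h2 h1]; simp
      · rw [indicator_of_notMem h2]
  set G : E3 → M3 →L[ℝ] ℝ := fun y => B y (Df w y) - F y with hG
  have cG : ContinuousOn G D := (cB.clm_apply cdw).sub cF
  have Bn : ∀ y ∈ D, ‖B y‖ ≤ M := fun y hy => by
    have := norm_add_le (bil lam mu) (B y - bil lam mu)
    rw [add_sub_cancel] at this; linarith [hB y hy]
  have nG : N2 G D ≠ ⊤ := by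
    refine ne_top_of_le_ne_top ?_ (N2_two (a := M) (b := 1) (g := Df w) (h := F) mD mdw fun y hy => ?_)
    · finiteness
    · refine (norm_sub_le _ _).trans ?_
      rw [one_mul]
      gcongr
      exact ((B y).le_opNorm _).trans (by gcongr; exact Bn y hy)
  have nv : N2 (Df v) D ≠ ⊤ := by
    refine ne_top_of_le_ne_top ?_ (N2_two (a := 1) (b := 1) (g := Df W) (h := P) mD mW fun y hy => ?_)
    · finiteness
    · rw [vDe y hy, norm_smul, one_mul, one_mul]
      calc _ ≤ 1 * (‖Df W y‖ + ‖P y‖) := by gcongr; exacts [χa y, norm_add_le _ _]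
        _ = _ := one_mul _
  have I0 := ext_test (ρ := (ρ + r)/2) (by linarith) hWk cG nG vC v0
    (by rw [ext0 _ fun y h1 h2 => (zW y h1 h2).2]; exact nv)
  have I1 : ∫ y in D, G y (Df v y) = 0 := by
    rw [← I0]
    symm
    refine setIntegral_eq_of_subset_of_forall_sdiff_eq_zero (Hs_open s).measurableSet inter_subset_left ?_
    intro y hy
    rw [(zW y hy.1 hy.2).2]; simp
  have J1 : IntegrableOn (fun y => G y (Df v y)) D :=
    pair_int (cG.aestronglyMeasurable mD) nG (measurable_fderiv ℝ v).aestronglyMeasurable nv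
  have msym : Measurable fun y => sym (Df W y) := sym_cont.measurable.comp (measurable_fderiv ℝ W)
  have symle : ∀ A : M3, ‖sym A‖ ≤ ‖A‖ := by
    intro A
    unfold sym
    rw [norm_smul]
    have := norm_add_le A (ContinuousLinearMap.adjoint A)
    have e : ‖ContinuousLinearMap.adjoint A‖ = ‖A‖ := LinearIsometryEquiv.norm_map _ _
    rw [e] at this
    norm_num
    linarith
  have nS : N2 (fun y => sym (Df W y)) D ≠ ⊤ :=
    ne_top_of_le_ne_top (by finiteness)
      (N2_le (c := 1) (g := Df W) mD fun y _ => by rw [one_mul]; exact symle _)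
  obtain ⟨iS, eS⟩ := int_sq msym.aestronglyMeasurable nS
  obtain ⟨iX, eX⟩ := int_sq mW nW
  obtain ⟨iw, ew⟩ := int_sq mw nw
  obtain ⟨iF, eF⟩ := int_sq (cF.aestronglyMeasurable mD) nF
  have main : c₀ * ∫ y in D, ‖sym (Df W y)‖^2 ≤ κ / 8 * 3 * (∫ y in D, ‖Df W y‖^2) +
      C1 * (∫ y in D, ‖w y‖^2) + C2 * ∫ y in D, ‖F y‖^2 := by
    have hle : ∫ y in D, c₀ * ‖sym (Df W y)‖^2 ≤ ∫ y in D, (G y (Df v y) +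
        κ / 8 * 3 * ‖Df W y‖^2 + C1 * ‖w y‖^2 + C2 * ‖F y‖^2) := by
      refine setIntegral_mono_on (iS.const_mul _)
        (((J1.add (iX.const_mul _)).add (iw.const_mul _)).add (iF.const_mul _)) mD fun y hy => ?_
      have h1 := form_low hmu hlam (F := F y) (X := Df W y) (P := P y) (χa y) (hB y hy)
      have h2 := young_pt (η := κ/8) (by positivity) h1
      have e1 : B y (Df W y - P y) (Df W y + P y) - χ y * F y (Df W y + P y) =
          G y (Df v y) := by
        rw [vDe y hy]
        have : Df W y - P y = χ y • Df w y := by rw [WDe y hy]; abel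
        rw [this]
        simp only [hG, map_smul, _root_.sub_apply, _root_.smul_apply, smul_eq_mul]; ring
      rw [e1] at h2
      have h3 : ‖P y‖^2 ≤ K^2 * ‖w y‖^2 := by
        rw [← mul_pow]; exact pow_le_pow_left₀ (norm_nonneg _) (Pw y hy) 2
      have h4 : (M^2 / (κ/8) + |M| + 1) * ‖P y‖^2 ≤ C1 * ‖w y‖^2 := by
        rw [hC1, mul_assoc]; gcongr
      have h5 : (eps0 lam mu + 2 * (κ/8)) = κ / 8 * 3 := by
        rw [← hε, εκ]; ring
      rw [h5] at h2
      calc _ ≤ _ := h2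
        _ ≤ _ := by gcongr
    rw [integral_const_mul, integral_add (by exact (J1.add (iX.const_mul _)).add (iw.const_mul _)) (iF.const_mul _),
      integral_add (by exact J1.add (iX.const_mul _)) (iw.const_mul _), integral_add J1 (iX.const_mul _), I1,
      integral_const_mul, integral_const_mul, integral_const_mul, zero_add] at hle
    exact hle
  have hk := korn (R := (ρ + r)/2) WC fun y _ hy => W0 y hy
  rw [ext0 _ fun y h1 h2 => (zW y h1 h2).1, ext0 (fun x => sym (Df W x)) fun y h1 h2 => by
    simp [(zW y h1 h2).1, sym]] at hk
  have iSn : 0 ≤ ∫ y in D, ‖sym (Df W y)‖^2 := integral_nonneg fun _ => by positivity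
  have iXn : 0 ≤ ∫ y in D, ‖Df W y‖^2 := integral_nonneg fun _ => by positivity
  have iwn : 0 ≤ ∫ y in D, ‖w y‖^2 := integral_nonneg fun _ => by positivity
  have iFn : 0 ≤ ∫ y in D, ‖F y‖^2 := integral_nonneg fun _ => by positivity
  have hk2 : ∫ y in D, ‖Df W y‖^2 ≤ 882 * ∫ y in D, ‖sym (Df W y)‖^2 := by
    unfold N2 at hk
    rw [eX, eS, show (882:ℝ≥0∞) = eO 882 by simp, ← ENNReal.ofReal_mul (by norm_num)] at hk
    exact (ENNReal.ofReal_le_ofReal_iff (by positivity)).1 hk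
  have fin : ∫ y in D, ‖Df W y‖^2 ≤ 2 / κ * (C1 + C2) * ((∫ y in D, ‖w y‖^2) + ∫ y in D, ‖F y‖^2) := by
    have h1 : c₀ = κ * 882 := by rw [hκ]; ring
    rw [h1] at main
    have h2 : κ / 2 * ∫ y in D, ‖Df W y‖^2 ≤ (C1 + C2) * ((∫ y in D, ‖w y‖^2) + ∫ y in D, ‖F y‖^2) := by
      linarith [mul_nonneg C1n iFn, mul_nonneg C2n iwn, mul_le_mul_of_nonneg_left hk2 κ0.le,
        mul_nonneg κ0.le iXn]
    calc _ = 2 / κ * (κ / 2 * ∫ y in D, ‖Df W y‖^2) := by field_simp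
      _ ≤ 2 / κ * ((C1 + C2) * ((∫ y in D, ‖w y‖^2) + ∫ y in D, ‖F y‖^2)) := by gcongr
      _ = _ := by ring
  have sub : Hs s ∩ ball 0 ρ ⊆ D := inter_subset_inter_right _ (ball_subset_ball hr.le)
  calc N2 (Df w) (Hs s ∩ ball 0 ρ) = N2 (Df W) (Hs s ∩ ball 0 ρ) := by
        refine setLIntegral_congr_fun ((Hs_open s).inter isOpen_ball).measurableSet fun y hy => ?_
        have : W =ᶠ[𝓝 y] w := by
          filter_upwards [isOpen_ball.mem_nhds hy.2] with z hz
          rw [hW]; simp only []; rw [χ1 z (by simpa using (mem_ball.1 hz).le), one_smul]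
        simp only [this.fderiv_eq]
    _ ≤ N2 (Df W) D := N2_mono sub
    _ ≤ _ := by
      unfold N2
      rw [eX, ew, eF, ← ENNReal.ofReal_add iwn iFn]
      change _ ≤ eO (2 / κ * (C1 + C2)) * _
      rw [← ENNReal.ofReal_mul (by positivity)]
      exact ENNReal.ofReal_le_ofReal fin
abbrev DD (s r : ℝ) : Set E3 := Hs s ∩ ball o3 r
lemma DD_open (s r : ℝ) : IsOpen (DD s r) := (Hs_open s).inter isOpen_ball
lemma DD_sub {s ρ r : ℝ} (h : ρ ≤ r) : DD s ρ ⊆ DD s r := inter_subset_inter_right _ (ball_subset_ball h)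
section gen
variable {V : Type*} [NormedAddCommGroup V] [NormedSpace ℝ V]
def dd (k : Fin 3) (f : E3 → V) : E3 → V := fun y => Df f y (ee k)
lemma dd_C {k : Fin 3} {f : E3 → V} (hD : IsOpen D) {m n : ℕ∞ω} (hf : ContDiffOn ℝ n f D)
    (h : m + 1 ≤ n) : ContDiffOn ℝ m (dd k f) D :=
  (hf.fderiv_of_isOpen hD h).clm_apply contDiffOn_const
lemma fd_dd {k : Fin 3} {f : E3 → V} (hD : IsOpen D) (hf : ContDiffOn ℝ 2 f D)
    (hy : y ∈ D) : Df (dd k f) y = dd k (Df f) y := by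
  have h1 : DifferentiableAt ℝ (Df f) y :=
    ((hf.fderiv_of_isOpen hD (m := 1) (by norm_num)).differentiableOn one_ne_zero).differentiableAt (hD.mem_nhds hy)
  have h2 : IsSymmSndFDerivAt ℝ f y := (hf.contDiffAt (hD.mem_nhds hy)).isSymmSndFDerivAt (by simp)
  ext z
  have : HasFDerivAt (dd k f) ((Df (Df f) y).flip (ee k)) y := by
    have := h1.hasFDerivAt.clm_apply (hasFDerivAt_const (ee k) y)
    refine this.congr_fderiv ?_
    ext z; simp
  rw [this.fderiv]
  exact h2 z (ee k)
lemma nrm_basis (L : E3 →L[ℝ] V) : ‖L‖ ≤ ∑ k, ‖L (ee k)‖ := by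
  refine L.opNorm_le_bound (Finset.sum_nonneg fun _ _ => norm_nonneg _) fun x => ?_
  have hx : x = ∑ k, x k • ee k := by
    ext i; fin_cases i <;> simp [Fin.sum_univ_three, ee]
  conv_lhs => rw [hx, map_sum]
  refine (norm_sum_le _ _).trans ?_
  rw [Finset.sum_mul]
  refine Finset.sum_le_sum fun k _ => ?_
  rw [map_smul, norm_smul, mul_comm]
  gcongr
  exact PiLp.norm_apply_le x k
lemma dd_le (k : Fin 3) (f : E3 → V) (y : E3) : ‖dd k f y‖ ≤ ‖Df f y‖ := by
  have := (Df f y).le_opNorm (ee k)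
  rw [show ‖ee k‖ = 1 by simp [ee], mul_one] at this
  exact this
lemma ee_add (ha : a ≠ 2) (y : E3) (t : ℝ) : (y + t • ee a) 2 = y 2 := by
  simp [ee, Ne.symm ha]
lemma ee_n (a : Fin 3) {t : ℝ} (ht : 0 ≤ t) : ‖t • ee a‖ = t := by
  rw [norm_smul]; simp [ee, abs_of_nonneg ht]
lemma DD_shift {s ρ r t : ℝ} (ha : a ≠ 2) (h : ρ + t ≤ r) (hy : y ∈ DD s ρ) {σ : ℝ}
    (h0 : 0 ≤ σ) (h1 : σ ≤ t) : y + σ • ee a ∈ DD s r := by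
  refine ⟨?_, ?_⟩
  · show (y + σ • ee a) 2 < s
    rw [ee_add ha]; exact hy.1
  · have h2 := hy.2
    simp only [mem_ball, dist_zero_right] at h2 ⊢
    have := norm_add_le y (σ • ee a)
    rw [ee_n a h0] at this
    linarith
def dq (a : Fin 3) (t : ℝ) (f : E3 → V) : E3 → V := fun y => t⁻¹ • (f (y + t • ee a) - f y)
lemma dq_pt {s ρ r t : ℝ} (ha : a ≠ 2) (ht : 0 < t) (h : ρ + t ≤ r) {f : E3 → V}
    (hf : ContDiffOn ℝ 1 f (DD s r)) (hy : y ∈ DD s ρ) (ℓ : E3 →L[ℝ] V) :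
    ‖dq a t f y - ℓ (ee a)‖ₑ ≤ ∫⁻ σ in u01, ‖dd a f (y + (σ * t) • ee a) - ℓ (ee a)‖ₑ := by
  set F : E3 → V := fun z => f z - ℓ z with hF
  have mem : ∀ σ ∈ u01, y + (σ * t) • ee a ∈ DD s r := fun σ hσ =>
    DD_shift ha h hy (by have := hσ.1; positivity) (by nlinarith [hσ.2])
  have hseg : segment ℝ y (y + t • ee a) ⊆ DD s r := by
    rw [segment_eq_image']
    rintro _ ⟨σ, hσ, rfl⟩
    have := mem σ hσ
    simpa [smul_smul] using this
  have hFC : ContDiffOn ℝ 1 F (DD s r) := hf.sub ℓ.contDiff.contDiffOn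
  have h1 := seg_ftc (DD_open s r) hFC (ContinuousLinearMap.id ℝ V) hseg
  simp only [ContinuousLinearMap.coe_id', id_eq, add_sub_cancel_left] at h1
  have e : dq a t f y - ℓ (ee a) = t⁻¹ • (F (y + t • ee a) - F y) := by
    simp only [dq, hF, map_add, map_smul]
    rw [show f (y + t • ee a) - (ℓ y + t • ℓ (ee a)) - (f y - ℓ y) =
      (f (y + t • ee a) - f y) - t • ℓ (ee a) by abel, smul_sub t⁻¹ (f _ - _), smul_smul, inv_mul_cancel₀ ht.ne', one_smul]
  rw [e, enorm_smul]
  calc _ ≤ ‖t⁻¹‖ₑ * _ := mul_le_mul_right h1 _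
    _ = _ := by
      rw [← lintegral_const_mul' _ _ (by simp)]
      refine setLIntegral_congr_fun measurableSet_Icc fun σ hσ => ?_
      have hm := mem σ hσ
      have hd : Df F (y + (σ * t) • ee a) = Df f (y + (σ * t) • ee a) - ℓ := by
        have h3 := ((hf.differentiableOn one_ne_zero).differentiableAt ((DD_open s r).mem_nhds hm)).hasFDerivAt
        exact (h3.sub ℓ.hasFDerivAt).fderiv
      rw [← enorm_smul, smul_smul, hd, _root_.sub_apply, map_smul, map_smul, ← smul_sub, smul_smul,
        inv_mul_cancel₀ ht.ne', one_smul]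
      rfl
lemma dq_sq {s ρ r t : ℝ} (ha : a ≠ 2) (ht : 0 < t) (h : ρ + t ≤ r) {f : E3 → V}
    (hf : ContDiffOn ℝ 1 f (DD s r)) (hy : y ∈ DD s ρ) (ℓ : E3 →L[ℝ] V) :
    ‖dq a t f y - ℓ (ee a)‖ₑ^2 ≤ ∫⁻ σ in u01, ‖dd a f (y + (σ * t) • ee a) - ℓ (ee a)‖ₑ^2 := by
  have h1 := dq_pt ha ht h hf hy ℓ
  have hc : ContinuousOn (fun σ : ℝ => dd a f (y + (σ * t) • ee a) - ℓ (ee a)) (Icc 0 1) := by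
    refine ContinuousOn.sub ?_ continuousOn_const
    refine (dd_C (m := 0) (DD_open s r) hf (by simp)).continuousOn.comp (by fun_prop) fun σ hσ => ?_
    exact DD_shift ha h hy (by have := hσ.1; positivity) (by nlinarith [hσ.2])
  have := csE (volume.restrict (u01)) (fun _ => 1)
    (fun σ => ‖dd a f (y + (σ * t) • ee a) - ℓ (ee a)‖ₑ) aemeasurable_const
    (hc.aestronglyMeasurable measurableSet_Icc).enorm
  simp at this
  exact (pow_le_pow_left₀ zero_le h1 2).trans this
end gen
lemma dd_sm [FiniteDimensional ℝ V] (a : Fin 3)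
    (f : E3 → V) : StronglyMeasurable (dd a f) := by
  let _ : MeasurableSpace V := borel V
  have : BorelSpace V := ⟨rfl⟩
  have : ProperSpace V := FiniteDimensional.proper_real V
  exact (measurable_fderiv_apply_const ℝ f (ee a)).stronglyMeasurable
lemma dq_L2 [FiniteDimensional ℝ V] {s ρ r t : ℝ}
    (ha : a ≠ 2) (ht : 0 < t) (h : ρ + t ≤ r)
    (hf : ContDiffOn ℝ 1 f (DD s r)) : N2 (dq a t f) (DD s ρ) ≤ N2 (dd a f) (DD s r) := by
  set H : E3 → ℝ≥0∞ := (DD s r).indicator fun y => ‖dd a f y‖ₑ^2 with hH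
  have mdd : Measurable fun y => ‖dd a f y‖ₑ := (dd_sm a f).enorm
  have mH : Measurable H := by
    refine Measurable.indicator ?_ (DD_open s r).measurableSet
    exact mdd.pow_const 2
  calc N2 (dq a t f) (DD s ρ) ≤ ∫⁻ y in DD s ρ, ∫⁻ σ in u01, H (y + (σ * t) • ee a) := by
        refine setLIntegral_mono' (DD_open s ρ).measurableSet fun y hy => ?_
        have := dq_sq ha ht h hf hy 0
        simp only [_root_.zero_apply, sub_zero] at this
        refine this.trans (le_of_eq ?_)
        refine setLIntegral_congr_fun measurableSet_Icc fun σ hσ => ?_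
        simp only [hH]
        rw [indicator_of_mem (DD_shift ha h hy (by have := hσ.1; positivity) (by nlinarith [hσ.2]))]
    _ ≤ ∫⁻ y, ∫⁻ σ in u01, H (y + (σ * t) • ee a) := setLIntegral_le_lintegral _ _
    _ = ∫⁻ σ in u01, ∫⁻ y, H (y + (σ * t) • ee a) := by
        rw [lintegral_lintegral_swap]
        exact (mH.comp (by fun_prop)).aemeasurable
    _ = ∫⁻ σ in u01, N2 (dd a f) (DD s r) := by
        refine lintegral_congr fun σ => ?_
        rw [lintegral_add_right_eq_self H, hH, lintegral_indicator (DD_open s r).measurableSet]; rfl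
    _ = _ := by simp
lemma dqt_lim [FiniteDimensional ℝ V] {s ρ r : ℝ}
    (ha : a ≠ 2) (h : ρ < r)
    (hf : ContDiffOn ℝ 1 f (DD s r)) (n : N2 (dd a f) (DD s r) ≠ ⊤) :
    Tendsto (fun t => N2 (fun y => dq a t f y - dd a f y) (DD s ρ)) (𝓝[>] 0) (𝓝 0) := by
  have oD := DD_open s r
  set γ : E3 → V := (DD s r).indicator (dd a f) with hγ
  have mγ : StronglyMeasurable γ := by
    exact (dd_sm a f).indicator oD.measurableSet
  have Lγ : MemLp γ 2 volume := memLp_of mγ.aestronglyMeasurable (by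
    rw [hγ, lint_ind _ oD.measurableSet]; exact n)
  have T := trans_cont Lγ
  rw [ENNReal.tendsto_nhds_zero] at T ⊢
  intro ε hε
  obtain ⟨δ, hδ, hT⟩ := Metric.eventually_nhds_iff.1 (T ε hε)
  filter_upwards [Ioo_mem_nhdsGT (show 0 < min δ (r - ρ) from lt_min hδ (by linarith))] with t ht
  have ht0 := ht.1
  have ht1 : t < δ := ht.2.trans_le (min_le_left _ _)
  have ht2 : ρ + t ≤ r := by linarith [ht.2.trans_le (min_le_right _ _)]
  calc N2 (fun y => dq a t f y - dd a f y) (DD s ρ)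
      ≤ ∫⁻ y in DD s ρ, ∫⁻ σ in u01, ‖γ ((σ * t) • ee a + y) - γ y‖ₑ^2 := by
        refine setLIntegral_mono' (DD_open s ρ).measurableSet fun y hy => ?_
        refine (dq_sq ha ht0 ht2 hf hy (Df f y)).trans (le_of_eq ?_)
        refine setLIntegral_congr_fun measurableSet_Icc fun σ hσ => ?_
        rw [add_comm]
        simp only [hγ]
        rw [indicator_of_mem (DD_sub h.le hy), add_comm, 
          indicator_of_mem (DD_shift ha ht2 hy (by have := hσ.1; positivity) (by nlinarith [hσ.2]))]
        rfl
    _ ≤ ∫⁻ y, ∫⁻ σ in u01, ‖γ ((σ * t) • ee a + y) - γ y‖ₑ^2 := setLIntegral_le_lintegral _ _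
    _ = ∫⁻ σ in u01, ∫⁻ y, ‖γ ((σ * t) • ee a + y) - γ y‖ₑ^2 := by
        rw [lintegral_lintegral_swap]
        refine AEMeasurable.pow_const (StronglyMeasurable.aestronglyMeasurable ?_).enorm 2
        refine StronglyMeasurable.sub (mγ.comp_measurable (by fun_prop)) (mγ.comp_measurable (by fun_prop))
    _ ≤ ∫⁻ σ in u01, ε := by
        refine setLIntegral_mono' measurableSet_Icc fun σ hσ => ?_
        have hb : dist ((σ * t) • ee a) 0 < δ := by
          rw [dist_zero_right, ee_n a (by have := hσ.1; positivity)]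
          nlinarith [hσ.2]
        have := hT hb
        simpa [N2] using this
    _ = ε := by simp
lemma N2_bdd {V : Type*} [NormedAddCommGroup V] {f : E3 → V} {S : Set E3} (hS : MeasurableSet S) {M : ℝ}
    (h : ∀ y ∈ S, ‖f y‖ ≤ M) : N2 f S ≤ eO (M^2) * volume S := by
  have := N2_le (f := f) (g := fun _ => (1:ℝ)) hS (c := M) (by simpa using h)
  simpa [N2] using this
lemma vol_DD (s r : ℝ) : volume (DD s r) ≠ ⊤ :=
  ne_top_of_le_ne_top measure_ball_lt_top.ne (measure_mono inter_subset_right)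
lemma test_b {v : E3 → E3} (hv : ContDiff ℝ 1 v) (cv : HasCompactSupport v) :
    ∃ M, ∀ y, ‖Df v y‖ ≤ M :=
  (hv.continuous_fderiv one_ne_zero).bounded_above_of_compact_support (cv.fderiv ℝ)
lemma test_out {r : ℝ} {v : E3 → E3} (sv : tsupport v ⊆ ball 0 r) (hy : y ∉ ball o3 r) :
    Df v y = 0 :=
  image_eq_zero_of_notMem_tsupport fun h => hy (sv (tsupport_fderiv_subset ℝ h))
lemma Wk_res {s r : ℝ} (G : E3 → M3 →L[ℝ] ℝ) {v : E3 → E3} (sv : tsupport v ⊆ ball 0 r) :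
    ∫ y in Hs s, G y (Df v y) = ∫ y in DD s r, G y (Df v y) := by
  refine setIntegral_eq_of_subset_of_forall_sdiff_eq_zero (Hs_open s).measurableSet inter_subset_left ?_
  intro y hy
  rw [test_out sv fun h => hy.2 ⟨hy.1, h⟩]; simp
lemma Wk_int {s r : ℝ} {G : E3 → M3 →L[ℝ] ℝ} (cG : ContinuousOn G (DD s r)) (nG : N2 G (DD s r) ≠ ⊤)
    {v : E3 → E3} (hv : ContDiff ℝ 1 v) (cv : HasCompactSupport v) :
    IntegrableOn (fun y => G y (Df v y)) (DD s r) := by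
  obtain ⟨M, hM⟩ := test_b hv cv
  refine pair_int (cG.aestronglyMeasurable (DD_open s r).measurableSet) nG
    (measurable_fderiv ℝ v).aestronglyMeasurable ?_
  exact ne_top_of_le_ne_top (ENNReal.mul_ne_top ENNReal.ofReal_ne_top (vol_DD s r))
    (N2_bdd (DD_open s r).measurableSet fun y _ => hM y)
lemma Wk_mono {s ρ r : ℝ} {G : E3 → M3 →L[ℝ] ℝ} (h : ρ ≤ r) (hG : Wk s r G) : Wk s ρ G :=
  fun v h1 h2 h3 => hG v h1 h2 (h3.trans (ball_subset_ball h))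
lemma Wk_congr {s r : ℝ} {G G' : E3 → M3 →L[ℝ] ℝ} (h : ∀ y ∈ DD s r, G y = G' y) (hG : Wk s r G) :
    Wk s r G' := fun v h1 h2 h3 => by
  rw [← hG v h1 h2 h3, Wk_res G h3, Wk_res G' h3]
  refine setIntegral_congr_fun (DD_open s r).measurableSet fun y hy => ?_
  simp only [h y hy]
lemma Wk_dq {s ρ r t : ℝ} (ha : a ≠ 2) (ht : 0 < t) (h : ρ + t ≤ r) {G : E3 → M3 →L[ℝ] ℝ}
    (hG : Wk s r G) (cG : ContinuousOn G (DD s r)) (nG : N2 G (DD s r) ≠ ⊤) : Wk s ρ (dq a t G) := by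
  intro v hv cv sv
  have sv' : tsupport v ⊆ ball 0 r := sv.trans (ball_subset_ball (by linarith))
  set v' : E3 → E3 := fun z => v (z - t • ee a) with hv'
  have e : v' = v ∘ (Homeomorph.subRight (t • ee a)) := rfl
  have Cv' : ContDiff ℝ 1 v' := hv.comp (contDiff_id.sub contDiff_const)
  have cv' : HasCompactSupport v' := cv.comp_homeomorph (Homeomorph.subRight (t • ee a))
  have ts : tsupport v' ⊆ ball 0 r := by
    rw [e, tsupport_comp_eq_preimage v (Homeomorph.subRight (t • ee a))]
    intro z hz
    have h1 := sv hz
    simp only [Homeomorph.coe_subRight, mem_ball, dist_zero_right] at h1 ⊢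
    have := norm_add_le (z - t • ee a) (t • ee a)
    rw [sub_add_cancel, ee_n a ht.le] at this
    linarith
  have fd : ∀ z, Df v' z = Df v (z - t • ee a) := fun z => fderiv_comp_sub _
  have mH := (Hs_open s).measurableSet
  have i1 : IntegrableOn (fun y => G y (Df v y)) (Hs s) := by
    refine (Wk_int cG nG hv cv).of_forall_sdiff_eq_zero mH fun y hy => ?_
    rw [test_out sv' fun h => hy.2 ⟨hy.1, h⟩]; simp
  have i2 : IntegrableOn (fun y => G y (Df v' y)) (Hs s) := by
    refine (Wk_int cG nG Cv' cv').of_forall_sdiff_eq_zero mH fun y hy => ?_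
    rw [test_out ts fun h => hy.2 ⟨hy.1, h⟩]; simp
  have es : (fun y => (Hs s).indicator (fun y => G y (Df v' y)) (y + t • ee a)) =
      (Hs s).indicator fun y => G (y + t • ee a) (Df v y) := by
    ext y
    have : y + t • ee a ∈ Hs s ↔ y ∈ Hs s := by
      show (y + t • ee a) 2 < s ↔ y 2 < s
      rw [ee_add ha]
    by_cases hy : y ∈ Hs s
    · rw [indicator_of_mem (this.2 hy), indicator_of_mem hy, fd, add_sub_cancel_right]
    · rw [indicator_of_notMem (mt this.1 hy), indicator_of_notMem hy]
  have i3 : IntegrableOn (fun y => G (y + t • ee a) (Df v y)) (Hs s) := by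
    rw [← integrable_indicator_iff mH, ← es]
    exact ((integrable_indicator_iff mH).2 i2).comp_add_right _
  have e3 : ∫ y in Hs s, G (y + t • ee a) (Df v y) = 0 := by
    rw [← integral_indicator mH, ← es, integral_add_right_eq_self
      ((Hs s).indicator fun y => G y (Df v' y)), integral_indicator mH]
    exact hG v' Cv' cv' ts
  have : ∀ y, dq a t G y (Df v y) = t⁻¹ * (G (y + t • ee a) (Df v y) - G y (Df v y)) :=
    fun y => by simp [dq]
  simp only [this]
  rw [integral_const_mul, integral_sub i3 i1, e3, hG v hv cv sv']; simp
lemma Wk_dd {s ρ r : ℝ} (ha : a ≠ 2) (h : ρ < r) {G : E3 → M3 →L[ℝ] ℝ}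
    (hG : Wk s r G) (cG : ContDiffOn ℝ 1 G (DD s r)) (nG : N2 G (DD s r) ≠ ⊤)
    (ng : N2 (dd a G) (DD s r) ≠ ⊤) : Wk s ρ (dd a G) := by
  intro v hv cv sv
  have oD := DD_open s ρ
  have hsub : DD s ρ ⊆ DD s r := DD_sub h.le
  have cg : ContinuousOn (dd a G) (DD s ρ) :=
    (dd_C (m := 0) (DD_open s r) cG (by simp)).continuousOn.mono hsub
  have i1 := Wk_int cg (ne_top_of_le_ne_top ng (N2_mono hsub)) hv cv
  obtain ⟨M, hM⟩ := test_b hv cv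
  have nv : N2 (Df v) (DD s ρ) ≠ ⊤ :=
    ne_top_of_le_ne_top (ENNReal.mul_ne_top ENNReal.ofReal_ne_top (vol_DD s ρ))
      (N2_bdd oD.measurableSet fun y _ => hM y)
  have L := ENNReal.Tendsto.mul_const (dqt_lim ha h cG ng) (Or.inr nv)
  rw [zero_mul] at L
  have : ‖∫ y in Hs s, dd a G y (Df v y)‖ₑ^2 ≤ 0 := by
    refine ge_of_tendsto L ?_
    filter_upwards [Ioo_mem_nhdsGT (show 0 < r - ρ by linarith)] with t ht
    have hW := Wk_dq (ρ := ρ) ha ht.1 (by linarith [ht.2]) hG cG.continuousOn nG v hv cv sv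
    have cq : ContinuousOn (dq a t G) (DD s ρ) := by
      show ContinuousOn (fun y => t⁻¹ • (G (y + t • ee a) - G y)) _
      refine ContinuousOn.const_smul (ContinuousOn.sub ?_ (cG.continuousOn.mono hsub)) t⁻¹
      exact cG.continuousOn.comp (by fun_prop) fun y hy => DD_shift ha (by linarith [ht.2]) hy ht.1.le le_rfl
    have nq : N2 (dq a t G) (DD s ρ) ≠ ⊤ :=
      ne_top_of_le_ne_top ng (dq_L2 ha ht.1 (by linarith [ht.2]) cG)
    have i2 := Wk_int cq nq hv cv
    rw [Wk_res _ sv] at hW ⊢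
    have e : ∫ y in DD s ρ, dd a G y (Df v y) = -∫ y in DD s ρ, (dq a t G y - dd a G y) (Df v y) := by
      simp only [_root_.sub_apply]
      rw [integral_sub i2 i1, hW]; simp
    rw [e, enorm_neg]
    exact pair_cs ((cq.sub cg).aestronglyMeasurable oD.measurableSet)
      (measurable_fderiv ℝ v).aestronglyMeasurable
  simpa using this
def Gd (lam mu : ℝ) (s r : ℝ) (K : ℝ≥0) (B : E3 → BB) : Prop :=
  ContDiffOn ℝ 2 B (DD s r) ∧ (∀ y ∈ DD s r, ‖B y - bil lam mu‖ ≤ eps0 lam mu) ∧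
  (∀ y ∈ DD s r, ‖Df B y‖ ≤ K) ∧ ∀ j k, ∀ y ∈ DD s r, ‖dd j (dd k B) y‖ ≤ K
lemma Gd.mono {lam mu s ρ r : ℝ} {K : ℝ≥0} {B : E3 → BB} (h : ρ ≤ r) (hB : Gd lam mu s r K B) :
    Gd lam mu s ρ K B :=
  ⟨hB.1.mono (DD_sub h), fun y hy => hB.2.1 y (DD_sub h hy), fun y hy => hB.2.2.1 y (DD_sub h hy),
    fun j k y hy => hB.2.2.2 j k y (DD_sub h hy)⟩
lemma Gd.bd {lam mu s r : ℝ} {K : ℝ≥0} {B : E3 → BB} (hB : Gd lam mu s r K B) (hy : y ∈ DD s r) :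
    ‖B y‖ ≤ ‖bil lam mu‖ + eps0 lam mu := by
  have := norm_add_le (bil lam mu) (B y - bil lam mu)
  rw [add_sub_cancel] at this
  linarith [hB.2.1 y hy]
lemma dq_fd {s ρ r t : ℝ} (ha : a ≠ 2) (ht : 0 < t) (h : ρ + t ≤ r) {V : Type*}
    [NormedAddCommGroup V] [NormedSpace ℝ V] {f : E3 → V} (hf : ContDiffOn ℝ 1 f (DD s r)) :
    ContDiffOn ℝ 1 (dq a t f) (DD s ρ) ∧ ∀ y ∈ DD s ρ, Df (dq a t f) y = dq a t (Df f) y := by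
  have mem : ∀ y ∈ DD s ρ, y + t • ee a ∈ DD s r := fun y hy => DD_shift ha h hy ht.le le_rfl
  have hs : DD s ρ ⊆ DD s r := DD_sub (by linarith)
  refine ⟨?_, fun y hy => ?_⟩
  · show ContDiffOn ℝ 1 (fun y => t⁻¹ • (f (y + t • ee a) - f y)) _
    exact ContDiffOn.const_smul t⁻¹ ((hf.comp (by fun_prop) mem).sub (hf.mono hs))
  · have d : ∀ z ∈ DD s r, DifferentiableAt ℝ f z := fun z hz =>
      (hf.differentiableOn one_ne_zero).differentiableAt ((DD_open s r).mem_nhds hz)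
    have h1 : HasFDerivAt (fun y => f (y + t • ee a)) (Df f (y + t • ee a)) y := by
      exact ((d _ (mem y hy)).hasFDerivAt.comp y ((hasFDerivAt_id y).add_const (t • ee a))).congr_fderiv (by ext; simp)
    exact ((h1.sub (d _ (hs hy)).hasFDerivAt).const_smul t⁻¹).fderiv
lemma DD_convex (s r : ℝ) : Convex ℝ (DD s r) := (Hs_convex s).inter (convex_ball _ _)
lemma lim_seq {g : ℝ} (hg : 0 < g) : Tendsto (fun n : ℕ => g / ((n:ℝ) + 1)) atTop (𝓝[>] 0) := by
  refine tendsto_nhdsWithin_iff.2 ⟨?_, Eventually.of_forall fun n => mem_Ioi.2 (by positivity)⟩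
  simpa [div_eq_mul_inv] using (tendsto_one_div_add_atTop_nhds_zero_nat (𝕜 := ℝ)).const_mul g
lemma dq_tt
    (h : DifferentiableAt ℝ f y) : Tendsto (fun t => dq a t f y) (𝓝[>] 0) (𝓝 (dd a f y)) :=
  (h.hasFDerivAt.hasLineDerivAt (ee a)).tendsto_slope_zero_right
set_option maxHeartbeats 1000000 in
lemma T1 (hmu : 0 < mu) (hlam : 0 < 3 * lam + 2 * mu) {ρ r : ℝ} (hρ : 0 < ρ) (hr : ρ < r) (K : ℝ≥0) :
    ∃ C : ℝ≥0, ∀ (s : ℝ) (a : Fin 3) (B : E3 → BB) (F : E3 → M3 →L[ℝ] ℝ) (w : E3 → E3), a ≠ 2 →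
    Gd lam mu s r K B → ContDiffOn ℝ 2 w (DD s r) → ContDiffOn ℝ 1 F (DD s r) →
    N2 (Df w) (DD s r) ≠ ⊤ → N2 F (DD s r) ≠ ⊤ → N2 (dd a F) (DD s r) ≠ ⊤ →
    Wk s r (fun y => B y (Df w y) - F y) →
    N2 (Df (dd a w)) (DD s ρ) ≤ C * (N2 (Df w) (DD s r) + N2 (dd a F) (DD s r)) := by
  set m := (ρ + r) / 2 with hm
  obtain ⟨Kc, hKc⟩ := cacc hmu hlam hρ (show ρ < m by linarith)
  refine ⟨Kc * (3 + 2 * K^2), fun s a B F w ha hB hw hF nw nF ndF hW => ?_⟩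
  have oD := DD_open s r
  have om := DD_open s m
  have hms : DD s m ⊆ DD s r := DD_sub (by linarith)
  have cDw : ContDiffOn ℝ 1 (Df w) (DD s r) := hw.fderiv_of_isOpen oD (by norm_num)
  have cB1 : ContDiffOn ℝ 1 B (DD s r) := hB.1.of_le (by norm_num)
  have mDw : AEStronglyMeasurable (Df w) (volume.restrict (DD s r)) :=
    cDw.continuousOn.aestronglyMeasurable oD.measurableSet
  have cG : ContinuousOn (fun y => B y (Df w y) - F y) (DD s r) :=
    (cB1.continuousOn.clm_apply cDw.continuousOn).sub hF.continuousOn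
  have nG : N2 (fun y => B y (Df w y) - F y) (DD s r) ≠ ⊤ := by
    refine ne_top_of_le_ne_top ?_ (N2_two (a := ‖bil lam mu‖ + eps0 lam mu) (b := 1) (g := Df w) (h := F)
      oD.measurableSet mDw fun y hy => ?_)
    · finiteness
    · refine (norm_sub_le _ _).trans ?_
      rw [one_mul]
      gcongr
      exact ((B y).le_opNorm _).trans (by gcongr; exact hB.bd hy)
  have key : ∀ t, 0 < t → m + t ≤ r → N2 (dq a t (Df w)) (DD s ρ) ≤
      (Kc * (3 + 2 * K^2) : ℝ≥0) * (N2 (Df w) (DD s r) + N2 (dd a F) (DD s r)) := by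
    intro t ht hmt
    have mem : ∀ y ∈ DD s m, y + t • ee a ∈ DD s r := fun y hy => DD_shift ha hmt hy ht.le le_rfl
    obtain ⟨c1, f1⟩ := dq_fd ha ht hmt (hw.of_le (by norm_num))
    set Ft : E3 → M3 →L[ℝ] ℝ := fun y => dq a t F y - dq a t B y (Df w (y + t • ee a)) with hFt
    have hWt : Wk s m (fun y => B y (Df (dq a t w) y) - Ft y) := by
      refine Wk_congr ?_ (Wk_dq ha ht hmt hW cG nG)
      intro y hy
      simp only [f1 y hy, hFt, dq, map_smul, map_sub, _root_.smul_apply, _root_.sub_apply]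
      module
    have qB : ∀ y ∈ DD s m, ‖dq a t B y‖ ≤ K := by
      intro y hy
      have := (DD_convex s r).norm_image_sub_le_of_norm_fderiv_le (𝕜 := ℝ)
        (fun z hz => (cB1.differentiableOn one_ne_zero).differentiableAt (oD.mem_nhds hz))
        hB.2.2.1 (hms hy) (mem y hy)
      rw [add_sub_cancel_left, ee_n a ht.le] at this
      rw [dq, norm_smul, Real.norm_of_nonneg (by positivity), inv_mul_le_iff₀ ht, mul_comm]
      exact this
    have cFt : ContinuousOn Ft (DD s m) := by
      refine (dq_fd ha ht hmt hF).1.continuousOn.sub ?_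
      refine (dq_fd ha ht hmt cB1).1.continuousOn.clm_apply ?_
      exact cDw.continuousOn.comp (by fun_prop) mem
    have n1 : N2 (dq a t w) (DD s m) ≤ N2 (Df w) (DD s r) :=
      (dq_L2 ha ht hmt (hw.of_le (by norm_num))).trans <| by
        simpa using N2_le (c := 1) oD.measurableSet fun y _ => by rw [one_mul]; exact dd_le a w y
    have n2 : N2 (Df (dq a t w)) (DD s m) ≠ ⊤ := by
      refine ne_top_of_le_ne_top ?_ (N2_two (f := Df (dq a t w)) (a := t⁻¹) (b := t⁻¹)
        (g := fun y => Df w (y + t • ee a)) (h := Df w) om.measurableSet ?_ fun y hy => ?_)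
      · have := N2_shift (Df w) (t • ee a) (DD s m) om.measurableSet
        rw [this]
        have h2 : N2 (Df w) ((· - t • ee a) ⁻¹' DD s m) ≤ N2 (Df w) (DD s r) :=
          N2_mono fun z hz => by simpa using mem _ hz
        have h3 := N2_mono (f := Df w) hms
        have h4 := ne_top_of_le_ne_top nw h2
        have h5 := ne_top_of_le_ne_top nw h3
        finiteness
      · exact (cDw.continuousOn.comp (by fun_prop) mem).aestronglyMeasurable om.measurableSet
      · rw [f1 y hy, dq, norm_smul, Real.norm_of_nonneg (by positivity), ← mul_add]
        gcongr; exact norm_sub_le _ _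
    have n3 : N2 Ft (DD s m) ≤ 2 * N2 (dd a F) (DD s r) + 2 * K^2 * N2 (Df w) (DD s r) := by
      have := N2_two (f := Ft) (a := 1) (b := K) (g := dq a t F) (h := fun y => Df w (y + t • ee a))
        om.measurableSet ((dq_fd ha ht hmt hF).1.continuousOn.aestronglyMeasurable om.measurableSet)
        fun y hy => by
          refine (norm_sub_le _ _).trans ?_
          rw [one_mul]
          gcongr
          exact ((dq a t B y).le_opNorm _).trans (by gcongr; exact qB y hy)
      refine this.trans ?_
      rw [N2_shift (Df w) (t • ee a) (DD s m) om.measurableSet]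
      have h2 : N2 (Df w) ((· - t • ee a) ⁻¹' DD s m) ≤ N2 (Df w) (DD s r) :=
          N2_mono fun z hz => by simpa using mem _ hz
      have h3 := dq_L2 ha ht hmt hF
      have e1 : eO (2 * 1^2) = 2 := by norm_num
      have e2 : eO (2 * (K:ℝ)^2) = 2 * (K:ℝ≥0∞)^2 := by
        rw [ENNReal.ofReal_mul (by norm_num), ENNReal.ofReal_pow K.coe_nonneg]; simp
      rw [e1, e2]
      gcongr
    have n3' : N2 Ft (DD s m) ≠ ⊤ := ne_top_of_le_ne_top (by finiteness) n3
    have := hKc s B Ft (dq a t w) c1 (cB1.continuousOn.mono hms) (fun y hy => hB.2.1 y (hms hy)) cFt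
      (ne_top_of_le_ne_top nw n1) n2 n3' hWt
    have e : N2 (dq a t (Df w)) (DD s ρ) = N2 (Df (dq a t w)) (DD s ρ) := by
      refine setLIntegral_congr_fun (DD_open s ρ).measurableSet fun y hy => ?_
      simp only [f1 y (DD_sub (by linarith) hy)]
    rw [e]
    refine this.trans ?_
    push_cast
    rw [mul_assoc]
    gcongr
    refine (add_le_add n1 n3).trans ?_
    calc _ ≤ (N2 (Df w) (DD s r) + (2 * N2 (dd a F) (DD s r) + 2 * K^2 * N2 (Df w) (DD s r)))
          + (2 * N2 (Df w) (DD s r) + (1 + 2 * K^2) * N2 (dd a F) (DD s r)) := le_self_add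
      _ = _ := by ring
  have hsr : DD s ρ ⊆ DD s r := DD_sub hr.le
  set tn : ℕ → ℝ := fun n => (r - m) / ((n:ℝ) + 1) with htn
  have tl : Tendsto tn atTop (𝓝[>] 0) := lim_seq (by linarith)
  have tp : ∀ n, 0 < tn n ∧ m + tn n ≤ r := fun n => by
    refine ⟨div_pos (by linarith) (by positivity), ?_⟩
    have : tn n ≤ r - m := div_le_self (by linarith) (by linarith [n.cast_nonneg (α := ℝ)])
    linarith
  have mem' : ∀ n, ∀ y ∈ DD s ρ, y + tn n • ee a ∈ DD s r := fun n y hy =>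
    DD_shift ha (by have := (tp n).2; linarith) hy (tp n).1.le le_rfl
  calc N2 (Df (dd a w)) (DD s ρ) = ∫⁻ y in DD s ρ, liminf (fun n => ‖dq a (tn n) (Df w) y‖ₑ^2) atTop := by
        refine setLIntegral_congr_fun (DD_open s ρ).measurableSet fun y hy => ?_
        have := (dq_tt (a := a) ((cDw.differentiableOn one_ne_zero).differentiableAt (oD.mem_nhds (hsr hy)))).comp tl
        have h2 : Tendsto (fun n => ‖dq a (tn n) (Df w) y‖ₑ^2) atTop (𝓝 (‖dd a (Df w) y‖ₑ^2)) :=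
          (ENNReal.continuous_pow 2).continuousAt.tendsto.comp ((continuous_enorm.tendsto _).comp this)
        simp only [fd_dd oD hw (hsr hy)]
        exact h2.liminf_eq.symm
    _ ≤ liminf (fun n => ∫⁻ y in DD s ρ, ‖dq a (tn n) (Df w) y‖ₑ^2) atTop := by
        refine lintegral_liminf_le' fun n => ?_
        have : ContinuousOn (dq a (tn n) (Df w)) (DD s ρ) := by
          show ContinuousOn (fun y => (tn n)⁻¹ • (Df w (y + tn n • ee a) - Df w y)) _
          refine ContinuousOn.const_smul (ContinuousOn.sub ?_ (cDw.continuousOn.mono hsr)) (tn n)⁻¹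
          exact cDw.continuousOn.comp (by fun_prop) (mem' n)
        exact (this.aestronglyMeasurable (DD_open s ρ).measurableSet).enorm.pow_const 2
    _ ≤ _ := by
        refine liminf_le_of_frequently_le' (Frequently.of_forall fun n => key _ (tp n).1 (tp n).2)
lemma dif (hD : IsOpen D)
    (hf : ContDiffOn ℝ 1 f D) (hy : y ∈ D) : DifferentiableAt ℝ f y :=
  (hf.differentiableOn one_ne_zero).differentiableAt (hD.mem_nhds hy)
lemma dd_app {V W : Type*} [NormedAddCommGroup V] [NormedSpace ℝ V] [NormedAddCommGroup W] [NormedSpace ℝ W]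
    {B : E3 → V →L[ℝ] W} {f : E3 → V} (hB : DifferentiableAt ℝ B y)
    (hf : DifferentiableAt ℝ f y) : dd a (fun y => B y (f y)) y = dd a B y (f y) + B y (dd a f y) := by
  unfold dd
  rw [(hB.hasFDerivAt.clm_apply hf.hasFDerivAt).fderiv]
  simp [add_comm]
def lo (a : Fin 3) (B : E3 → BB) (w : E3 → E3) : E3 → M3 →L[ℝ] ℝ := fun y => -dd a B y (Df w y)
lemma dd_G (hD : IsOpen D) {B : E3 → BB} {w : E3 → E3} (hB : ContDiffOn ℝ 1 B D)
    (hw : ContDiffOn ℝ 2 w D) (a : Fin 3) (hy : y ∈ D) :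
    dd a (fun y => B y (Df w y)) y = B y (Df (dd a w) y) - lo a B w y := by
  rw [dd_app (dif hD hB hy) (dif hD (hw.fderiv_of_isOpen hD (by norm_num)) hy), fd_dd hD hw hy, lo]
  abel
lemma T2 {ρ r s : ℝ} (hr : ρ < r) {K : ℝ≥0} (ha : a ≠ 2)
    {B : E3 → BB} {w : E3 → E3} (hB : Gd lam mu s r K B) (hw : ContDiffOn ℝ 2 w (DD s r))
    (nw : N2 (Df w) (DD s r) ≠ ⊤) (na : N2 (Df (dd a w)) (DD s r) ≠ ⊤)
    (hW : Wk s r (fun y => B y (Df w y))) :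
    Wk s ρ (fun y => B y (Df (dd a w) y) - lo a B w y) := by
  have oD := DD_open s r
  have cDw : ContDiffOn ℝ 1 (Df w) (DD s r) := hw.fderiv_of_isOpen oD (by norm_num)
  have cB1 : ContDiffOn ℝ 1 B (DD s r) := hB.1.of_le (by norm_num)
  have e := fun y hy => dd_G oD cB1 hw a (y := y) hy
  refine Wk_congr (fun y hy => e y (DD_sub hr.le hy)) (Wk_dd ha hr hW (cB1.clm_apply cDw) ?_ ?_)
  · refine ne_top_of_le_ne_top ?_ (N2_le (c := ‖bil lam mu‖ + eps0 lam mu) (g := Df w) oD.measurableSet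
      fun y hy => ((B y).le_opNorm _).trans (by gcongr; exact hB.bd hy))
    finiteness
  · refine ne_top_of_le_ne_top ?_ (N2_two (a := ‖bil lam mu‖ + eps0 lam mu) (b := K) (g := Df (dd a w))
      (h := Df w) oD.measurableSet
      (((dd_C oD hw (m := 1) (by norm_num)).fderiv_of_isOpen oD (m := 0) (by simp)).continuousOn.aestronglyMeasurable
        oD.measurableSet) fun y hy => ?_)
    · finiteness
    · rw [e y hy]
      refine (norm_sub_le _ _).trans (add_le_add ?_ ?_)
      · exact ((B y).le_opNorm _).trans (by gcongr; exact hB.bd hy)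
      · rw [lo, norm_neg]
        exact ((dd a B y).le_opNorm _).trans (by gcongr; exact (dd_le a B y).trans (hB.2.2.1 y hy))
lemma ts_sub {V W : Type*} [Zero V] [Zero W] {f : E3 → V} {g : E3 → W} (h : ∀ y, g y = 0 → f y = 0) :
    tsupport f ⊆ tsupport g := closure_mono fun y hy h' => hy (h y h')
lemma cont_mul (hD : IsOpen D) {f g : E3 → ℝ} (hf : ContinuousOn f D) (hg : Continuous g)
    (cg : HasCompactSupport g) (sg : tsupport g ⊆ D) : Integrable (fun y => f y * g y) := by
  have h1 : tsupport (fun y => f y * g y) ⊆ D := (ts_sub fun y h => by simp [h]).trans sg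
  exact ((hf.mul hg.continuousOn).continuous_of_tsupport_subset hD h1).integrable_of_hasCompactSupport cg.mul_left
lemma ibp (hD : IsOpen D) {f g : E3 → ℝ} (hf : ContDiffOn ℝ 1 f D) (hg : ContDiff ℝ 1 g)
    (cg : HasCompactSupport g) (sg : tsupport g ⊆ D) (i : Fin 3) :
    ∫ y, f y * dd i g y = -∫ y, dd i f y * g y := by
  have h1 : Continuous (dd i g) := (hg.continuous_fderiv one_ne_zero).clm_apply continuous_const
  have h2 : HasCompactSupport (dd i g) := cg.fderiv_apply ℝ (ee i)
  have h3 : tsupport (dd i g) ⊆ D := ((ts_sub (g := Df g) fun y h => by simp [dd, h]).trans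
    (tsupport_fderiv_subset ℝ)).trans sg
  exact integral_mul_fderiv_eq_neg_fderiv_mul_of_integrable
    (cont_mul hD (dd_C (m := 0) hD hf (by simp)).continuousOn hg.continuous cg sg)
    (cont_mul hD hf.continuousOn h1 h2 h3) (cont_mul hD hf.continuousOn hg.continuous cg sg)
    (fun y hy => dif hD hf (sg hy)) fun y _ => hg.differentiable one_ne_zero y
def ro (i : Fin 3) (ξ : E3) : M3 := (EuclideanSpace.proj i : E3 →L[ℝ] ℝ).smulRight ξ
lemma ro_app (i : Fin 3) (ξ y : E3) : ro i ξ y = y i • ξ := by simp [ro]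
lemma ro_norm (i : Fin 3) (ξ : E3) : ‖ro i ξ‖ ≤ ‖ξ‖ := by
  refine ContinuousLinearMap.opNorm_le_bound _ (norm_nonneg _) fun y => ?_
  rw [ro_app, norm_smul, mul_comm]
  gcongr
  exact PiLp.norm_apply_le y i
lemma sum_ee (y : E3) : ∑ i, y i • ee i = y := by
  ext j; fin_cases j <;> simp [Fin.sum_univ_three]
lemma ro_sum (A : M3) : ∑ i, ro i (A (ee i)) = A := by
  ext1 y
  simp only [_root_.sum_apply, ro_app]
  conv_rhs => rw [← sum_ee y]
  simp
def Sf (D : Set E3) (G : E3 → M3 →L[ℝ] ℝ) : Prop := ∀ y ∈ D, ∀ ξ, ∑ i, dd i G y (ro i ξ) = 0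
lemma dd_cst (hD : IsOpen D) {V W : Type*} [NormedAddCommGroup V] [NormedSpace ℝ V] [NormedAddCommGroup W]
    [NormedSpace ℝ W] {G : E3 → V →L[ℝ] W}
    (hG : ContDiffOn ℝ 1 G D) (X : V) (i : Fin 3) (hy : y ∈ D) :
    dd i (fun y => G y X) y = dd i G y X := by
  rw [dd_app (dif hD hG hy) (differentiableAt_const X)]; simp [dd]
lemma strong {s r : ℝ} {G : E3 → M3 →L[ℝ] ℝ} (hG : Wk s r G) (cG : ContDiffOn ℝ 1 G (DD s r)) :
    Sf (DD s r) G := by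
  have oD := DD_open s r
  intro y hy ξ
  have cd : ∀ i, ContinuousOn (fun y => dd i G y (ro i ξ)) (DD s r) := fun i =>
    (dd_C (m := 0) oD cG (by simp)).continuousOn.clm_apply continuousOn_const
  have ch : ContinuousOn (fun y => ∑ i, dd i G y (ro i ξ)) (DD s r) := continuousOn_finsetSum _ fun i _ => cd i
  have h := oD.ae_eq_zero_of_integral_contDiff_smul_eq_zero
    (ch.locallyIntegrableOn oD.measurableSet (μ := volume)) ?_
  · exact Measure.eqOn_open_of_ae_eq (μ := volume) (ae_restrict_iff' oD.measurableSet |>.2 h) oD ch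
      (continuousOn_const (c := (0:ℝ))) hy
  intro g hg cg sg
  have hg1 : ContDiff ℝ 1 g := hg.of_le (by norm_num)
  have fv : ∀ y, Df (fun y => g y • ξ) y = ∑ i, dd i g y • ro i ξ := fun y => by
    rw [((hg1.differentiable one_ne_zero y).hasFDerivAt.smul_const ξ).fderiv, ← ro_sum ((Df g y).smulRight ξ)]
    refine Finset.sum_congr rfl fun i _ => ?_
    ext1 z
    simp [ro_app, dd, smul_smul, mul_comm]
  have ts : tsupport (fun y => g y • ξ) ⊆ DD s r := (ts_sub fun y h => by simp [h]).trans sg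
  have h0 := hG (fun y => g y • ξ) (hg1.smul contDiff_const) cg.smul_right (ts.trans inter_subset_right)
  have i1 : ∀ i, Integrable (fun y => G y (ro i ξ) * dd i g y) := fun i => by
    refine cont_mul oD (cG.continuousOn.clm_apply continuousOn_const)
      ((hg1.continuous_fderiv one_ne_zero).clm_apply continuous_const) (cg.fderiv_apply ℝ (ee i)) ?_
    exact ((ts_sub (g := Df g) fun y h => by simp [dd, h]).trans (tsupport_fderiv_subset ℝ)).trans sg
  have e1 : ∫ y in Hs s, G y (Df (fun y => g y • ξ) y) = ∑ i, ∫ y, G y (ro i ξ) * dd i g y := by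
    rw [setIntegral_eq_integral_of_forall_compl_eq_zero, ← integral_finsetSum _ fun i _ => i1 i]
    · refine integral_congr_ae (ae_of_all _ fun y => ?_)
      simp only [fv, map_sum, map_smul, smul_eq_mul]
      exact Finset.sum_congr rfl fun i _ => mul_comm _ _
    · intro y hy
      rw [image_eq_zero_of_notMem_tsupport fun h => hy (ts (tsupport_fderiv_subset ℝ h)).1]; simp
  have i2 : ∀ i, Integrable (fun y => dd i G y (ro i ξ) * g y) := fun i =>
    cont_mul oD (cd i) hg.continuous cg sg
  have e2 : ∀ i, ∫ y, G y (ro i ξ) * dd i g y = -∫ y, dd i G y (ro i ξ) * g y := fun i => by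
    rw [ibp oD (f := fun y => G y (ro i ξ)) (cG.clm_apply contDiffOn_const) hg1 cg sg i]
    congr 1
    refine integral_congr_ae (ae_of_all _ fun y => ?_)
    by_cases hy : y ∈ DD s r
    · simp only [dd_cst oD cG (ro i ξ) i hy]
    · simp [image_eq_zero_of_notMem_tsupport fun h => hy (sg h)]
  rw [e1, Finset.sum_congr rfl fun i _ => e2 i, Finset.sum_neg_distrib, ← integral_finsetSum _ fun i _ => i2 i] at h0
  rw [← neg_eq_zero, ← h0]
  congr 1
  refine integral_congr_ae (ae_of_all _ fun y => ?_)
  simp only [smul_eq_mul, Finset.mul_sum, mul_comm]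
lemma Sf_dd (hD : IsOpen D) {G : E3 → M3 →L[ℝ] ℝ} (cG : ContDiffOn ℝ 2 G D) (h : Sf D G) (k : Fin 3) :
    Sf D (dd k G) := by
  intro y hy ξ
  have c1 : ∀ i, ContDiffOn ℝ 1 (dd i G) D := fun i => dd_C hD cG (by norm_num)
  have e : ∀ i, dd i (dd k G) y = dd k (dd i G) y := fun i => by
    rw [show dd i (dd k G) y = Df (dd k G) y (ee i) from rfl, fd_dd hD cG hy]
    have h1 := dd_cst hD (cG.fderiv_of_isOpen hD (m := 1) (by norm_num)) (ee i) k hy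
    exact h1.symm
  simp only [e]
  have h2 : Df (fun y => ∑ i, dd i G y (ro i ξ)) y = 0 := by
    rw [Filter.EventuallyEq.fderiv_eq (f := fun _ => (0:ℝ)) (Filter.eventually_of_mem (hD.mem_nhds hy) fun z hz => h z hz ξ)]
    simp
  have h3 : ∀ i, HasFDerivAt (fun y => dd i G y (ro i ξ)) (Df (fun y => dd i G y (ro i ξ)) y) y := fun i =>
    (dif hD ((c1 i).clm_apply contDiffOn_const) hy).hasFDerivAt
  rw [(HasFDerivAt.fun_sum fun i _ => h3 i).fderiv] at h2
  have h4 := congrArg (fun L => L (ee k)) h2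
  simp only [_root_.sum_apply, _root_.zero_apply] at h4
  rw [← h4]
  exact Finset.sum_congr rfl fun i _ => (dd_cst hD (c1 i) (ro i ξ) k hy).symm
lemma dd_comm (hD : IsOpen D)
    (hf : ContDiffOn ℝ 2 f D) (hy : y ∈ D) (i k : Fin 3) : dd i (dd k f) y = dd k (dd i f) y := by
  rw [show dd i (dd k f) y = Df (dd k f) y (ee i) from rfl, fd_dd hD hf hy]
  exact (dd_cst hD (hf.fderiv_of_isOpen hD (m := 1) (by norm_num)) (ee i) k hy).symm
lemma ro_low (hmu : 0 < mu) (hlam : 0 < 3 * lam + 2 * mu) {B : BB}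
    (hB : ‖B - bil lam mu‖ ≤ eps0 lam mu) (ξ : E3) : cc0 lam mu / 8 * ‖ξ‖^2 ≤ B (ro 2 ξ) (ro 2 ξ) := by
  have hc0 : 0 < cc0 lam mu := lt_min (by linarith) hlam
  have hc := (bil_coer (lam := lam) (mu := mu) (ro 2 ξ)).resolve_right (not_lt.2 hc0.le)
  have h1 := hs_sym (ro 2 ξ)
  have h2 := hs_le_op (sym (ro 2 ξ))
  have h3 : hs (ro 2 ξ) = ‖ξ‖^2 := by simp [hs, Fin.sum_univ_three, ro_app]
  have h4 : ∑ j, ∑ i, ro 2 ξ (ee j) i * ro 2 ξ (ee i) j = (ξ 2)^2 := by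
    simp [Fin.sum_univ_three, ro_app]; ring
  have h5 : |(B - bil lam mu) (ro 2 ξ) (ro 2 ξ)| ≤ eps0 lam mu * ‖ξ‖ * ‖ξ‖ :=
    ((B - bil lam mu).le_opNorm₂ _ _).trans (by
      have := ro_norm 2 ξ
      have h0 : 0 ≤ eps0 lam mu := by unfold eps0; positivity
      gcongr)
  have e : (B - bil lam mu) (ro 2 ξ) (ro 2 ξ) = B (ro 2 ξ) (ro 2 ξ) - bil lam mu (ro 2 ξ) (ro 2 ξ) := rfl
  rw [e] at h5
  have h6 := (abs_le.1 h5).1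
  have h7 : ‖ξ‖^2 / 6 ≤ ‖sym (ro 2 ξ)‖^2 := by rw [h3, h4] at h1; nlinarith [sq_nonneg (ξ 2)]
  have h8 : cc0 lam mu * (‖ξ‖^2 / 6) ≤ cc0 lam mu * ‖sym (ro 2 ξ)‖^2 := by gcongr
  have h9 : eps0 lam mu = cc0 lam mu / 882 / 8 := rfl
  have h10 : 0 ≤ cc0 lam mu * ‖ξ‖^2 := by positivity
  rw [h9] at h6
  unfold cc0 at *
  linarith
set_option maxHeartbeats 1000000 in
lemma Pt (hmu : 0 < mu) (hlam : 0 < 3 * lam + 2 * mu) (K : ℝ≥0) : ∃ C : ℝ, 1 ≤ C ∧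
    ∀ (s r : ℝ) (B : E3 → BB) (F : E3 → M3 →L[ℝ] ℝ) (f : E3 → E3), Gd lam mu s r K B →
    ContDiffOn ℝ 2 f (DD s r) → ContDiffOn ℝ 1 F (DD s r) →
    Sf (DD s r) (fun y => B y (Df f y) - F y) → ∀ y ∈ DD s r,
    ‖Df (dd 2 f) y‖ ≤ C * (‖Df f y‖ + ‖Df (dd 0 f) y‖ + ‖Df (dd 1 f) y‖ + ∑ i, ‖dd i F y‖) := by
  have hc0 : 0 < cc0 lam mu := lt_min (by linarith) hlam
  set M := ‖bil lam mu‖ + eps0 lam mu with hM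
  have hM0 : 0 ≤ M := by
    have : 0 ≤ eps0 lam mu := by unfold eps0; positivity
    positivity
  set c := 8 / cc0 lam mu with hc
  have hcp : 0 < c := by positivity
  refine ⟨1 + c * (2 * M + 3 * K + 1), ?_, fun s r B F f hB hf hF hS y hy => ?_⟩
  · have : 0 ≤ c * (2 * M + 3 * K + 1) := by positivity
    linarith
  have oD := DD_open s r
  have cB1 : ContDiffOn ℝ 1 B (DD s r) := hB.1.of_le (by norm_num)
  have cDf : ContDiffOn ℝ 1 (Df f) (DD s r) := hf.fderiv_of_isOpen oD (by norm_num)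
  set ξ := dd 2 (dd 2 f) y with hξ
  have h0 := hS y hy ξ
  have e1 : ∀ i, dd i (fun y => B y (Df f y) - F y) y =
      B y (Df (dd i f) y) - lo i B f y - dd i F y := fun i => by
    rw [← dd_G oD cB1 hf i hy]
    unfold dd
    rw [fderiv_fun_sub (dif oD (cB1.clm_apply cDf) hy) (dif oD hF hy)]; rfl
  simp only [e1, _root_.sub_apply, Fin.sum_univ_three] at h0
  have e2 : Df (dd 2 f) y = ro 0 (dd 2 (dd 0 f) y) + ro 1 (dd 2 (dd 1 f) y) + ro 2 ξ := by
    conv_lhs => rw [← ro_sum (Df (dd 2 f) y)]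
    rw [Fin.sum_univ_three, ← dd_comm oD hf hy 0 2, ← dd_comm oD hf hy 1 2]; rfl
  set X := ‖ξ‖ with hX
  have hX0 : 0 ≤ X := norm_nonneg _
  have n0 := dd_le 2 (dd 0 f) y
  have n1 := dd_le 2 (dd 1 f) y
  set a := ‖Df (dd 0 f) y‖
  set b := ‖Df (dd 1 f) y‖
  set g := ‖Df f y‖
  have ha : 0 ≤ a := norm_nonneg _
  have hb : 0 ≤ b := norm_nonneg _
  have hg : 0 ≤ g := norm_nonneg _
  have bB : ∀ (Y : M3) (i : Fin 3) (u : ℝ), ‖Y‖ ≤ u → |B y Y (ro i ξ)| ≤ M * u * X := fun Y i u hu =>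
    ((B y).le_opNorm₂ _ _).trans (by
      have := hB.bd hy
      have := ro_norm i ξ
      have := (norm_nonneg Y).trans hu
      gcongr)
  have bL : ∀ i, |lo i B f y (ro i ξ)| ≤ K * g * X := fun i => by
    have : lo i B f y (ro i ξ) = - dd i B y (Df f y) (ro i ξ) := rfl
    rw [this, abs_neg]
    refine ((dd i B y).le_opNorm₂ _ _).trans ?_
    have := (dd_le i B y).trans (hB.2.2.1 y hy)
    have := ro_norm i ξ
    gcongr
  have bF : ∀ i, |dd i F y (ro i ξ)| ≤ ‖dd i F y‖ * X := fun i =>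
    ((dd i F y).le_opNorm _).trans (by gcongr; exact ro_norm i ξ)
  have low := ro_low hmu hlam (hB.2.1 y hy) ξ
  have p0 := bB (ro 0 (dd 2 (dd 0 f) y)) 2 a ((ro_norm _ _).trans n0)
  have p1 := bB (ro 1 (dd 2 (dd 1 f) y)) 2 b ((ro_norm _ _).trans n1)
  have p2 := bB (Df (dd 0 f) y) 0 a le_rfl
  have p3 := bB (Df (dd 1 f) y) 1 b le_rfl
  rw [e2] at h0
  simp only [map_add, _root_.add_apply] at h0
  have main : cc0 lam mu / 8 * X^2 ≤ (2 * M * (a + b) + 3 * K * g + ∑ i, ‖dd i F y‖) * X := by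
    rw [Fin.sum_univ_three]
    have q0 := bL 0
    have q1 := bL 1
    have q2 := bL 2
    have r0 := bF 0
    have r1 := bF 1
    have r2 := bF 2
    rw [abs_le] at p0 p1 p2 p3 q0 q1 q2 r0 r1 r2
    linarith [p0.1, p0.2, p1.1, p1.2, p2.1, p2.2, p3.1, p3.2, q0.1, q0.2, q1.1, q1.2, q2.1, q2.2, r0.1, r0.2, r1.1,
      r1.2, r2.1, r2.2]
  set S := ∑ i, ‖dd i F y‖
  have hS0 : 0 ≤ S := Finset.sum_nonneg fun i _ => norm_nonneg _
  have hXb : X ≤ c * (2 * M * (a + b) + 3 * K * g + S) := by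
    rcases hX0.eq_or_lt with h | h
    · rw [← h]; positivity
    · have : cc0 lam mu / 8 * X ≤ 2 * M * (a + b) + 3 * K * g + S := by
        refine le_of_mul_le_mul_right ?_ h
        linarith
      calc X = c * (cc0 lam mu / 8 * X) := by rw [hc]; field_simp
        _ ≤ _ := by gcongr
  have n2 : ‖Df (dd 2 f) y‖ ≤ a + b + X := by
    rw [e2]
    exact (norm_add₃_le).trans (add_le_add (add_le_add ((ro_norm _ _).trans n0) ((ro_norm _ _).trans n1)) (ro_norm _ _))
  clear_value S X a b g
  have t1 : 0 ≤ c * M := by positivity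
  have t2 : 0 ≤ c * (K:ℝ) := by positivity
  have u : ∀ p q : ℝ, 0 ≤ p → 0 ≤ q → 0 ≤ p * q := fun p q => mul_nonneg
  linarith [u _ _ t1 ha, u _ _ t1 hb, u _ _ t1 hg, u _ _ t1 hS0, u _ _ t2 ha, u _ _ t2 hb, u _ _ t2 hg, u _ _ t2 hS0,
    u _ _ hcp.le ha, u _ _ hcp.le hb, u _ _ hcp.le hg, u _ _ hcp.le hS0]
lemma N2_sum {ι : Type*} (I : Finset ι) {V : Type*} [NormedAddCommGroup V] {f : E3 → V}
    {g : ι → E3 → ℝ} {S : Set E3} (hS : MeasurableSet S)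
    (mg : ∀ i ∈ I, AEStronglyMeasurable (g i) (volume.restrict S)) {c : ℝ}
    (hh : ∀ y ∈ S, ‖f y‖ ≤ c * ∑ i ∈ I, ‖g i y‖) :
    N2 f S ≤ eO (c^2 * I.card) * ∑ i ∈ I, N2 (g i) S := by
  unfold N2
  rw [← lintegral_finsetSum' _ fun i hi => ((mg i hi).enorm.pow_const 2), ← lintegral_const_mul' _ _ ENNReal.ofReal_ne_top]
  refine setLIntegral_mono' hS fun y hy => ?_
  have h1 := hh y hy
  have : ∑ i ∈ I, ‖g i y‖ₑ^2 = eO (∑ i ∈ I, ‖g i y‖^2) := by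
    rw [ENNReal.ofReal_sum_of_nonneg fun i _ => by positivity]
    exact Finset.sum_congr rfl fun i _ => by rw [← ofReal_norm, ← ENNReal.ofReal_pow (norm_nonneg _)]
  rw [this, ← ofReal_norm, ← ENNReal.ofReal_pow (norm_nonneg _), ← ENNReal.ofReal_mul (by positivity)]
  refine ENNReal.ofReal_le_ofReal ((pow_le_pow_left₀ (norm_nonneg _) h1 2).trans ?_)
  rw [mul_pow, mul_assoc]
  gcongr
  exact sq_sum_le_card_mul_sum_sq
lemma lo_C (hD : IsOpen D) {B : E3 → BB} {w : E3 → E3} (hB : ContDiffOn ℝ 2 B D)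
    (hw : ContDiffOn ℝ 2 w D) (k : Fin 3) : ContDiffOn ℝ 1 (lo k B w) D :=
  ((dd_C hD hB (m := 1) (by norm_num)).clm_apply (hw.fderiv_of_isOpen hD (m := 1) (by norm_num))).neg
lemma sm_fd (hD : IsOpen D)
    (hf : ContDiffOn ℝ 1 f D) : ContinuousOn (Df f) D :=
  (hf.fderiv_of_isOpen hD (m := 0) (by simp)).continuousOn
lemma lo_N {lam mu s r : ℝ} {K : ℝ≥0} {B : E3 → BB} {w : E3 → E3} (hB : Gd lam mu s r K B)
    (hw : ContDiffOn ℝ 2 w (DD s r)) (k : Fin 3) {A : ℝ≥0∞} (h1 : N2 (Df w) (DD s r) ≤ A) :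
    N2 (lo k B w) (DD s r) ≤ (4 * K^2) * A ∧ ∀ i, N2 (Df (dd i w)) (DD s r) ≤ A →
    N2 (dd i (lo k B w)) (DD s r) ≤ (4 * K^2) * A := by
  have oD := DD_open s r
  have cDw : ContDiffOn ℝ 1 (Df w) (DD s r) := hw.fderiv_of_isOpen oD (by norm_num)
  have cB : ContDiffOn ℝ 1 (dd k B) (DD s r) := dd_C oD hB.1 (by norm_num)
  have e2 : eO (2 * (K:ℝ)^2) = 2 * (K:ℝ≥0∞)^2 := by
    rw [ENNReal.ofReal_mul (by norm_num), ENNReal.ofReal_pow K.coe_nonneg]; simp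
  have bK : ∀ y ∈ DD s r, ‖dd k B y‖ ≤ K := fun y hy => (dd_le k B y).trans (hB.2.2.1 y hy)
  constructor
  · have := N2_two (f := lo k B w) (a := K) (b := K) (h := Df w) oD.measurableSet
      (cDw.continuousOn.aestronglyMeasurable oD.measurableSet) fun y hy => by
        rw [lo, norm_neg]
        have := ((dd k B y).le_opNorm (Df w y)).trans (mul_le_mul_of_nonneg_right (bK y hy) (norm_nonneg _))
        have h0 : 0 ≤ (K:ℝ) * ‖Df w y‖ := by positivity
        linarith
    rw [e2] at this
    calc _ ≤ _ := this
      _ ≤ 2 * K^2 * A + 2 * K^2 * A := by gcongr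
      _ = _ := by ring
  · intro i hi
    have := N2_two (f := dd i (lo k B w)) (a := K) (b := K) (h := Df (dd i w)) oD.measurableSet
      (cDw.continuousOn.aestronglyMeasurable oD.measurableSet) fun y hy => by
        have e : dd i (lo k B w) y = -(dd i (dd k B) y (Df w y) + dd k B y (Df (dd i w) y)) := by
          rw [fd_dd oD hw hy, ← dd_app (dif oD cB hy) (dif oD cDw hy)]
          show Df (fun y => -dd k B y (Df w y)) y (ee i) = _
          rw [fderiv_fun_neg]; rfl
        rw [e, norm_neg]
        refine (norm_add_le _ _).trans (add_le_add ?_ ?_)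
        · exact ((dd i (dd k B) y).le_opNorm _).trans (by gcongr; exact hB.2.2.2 i k y hy)
        · exact ((dd k B y).le_opNorm _).trans (by gcongr; exact bK y hy)
    rw [e2] at this
    calc _ ≤ _ := this
      _ ≤ 2 * K^2 * A + 2 * K^2 * A := by gcongr
      _ = _ := by ring
lemma Sf_congr (hD : IsOpen D) {G G' : E3 → M3 →L[ℝ] ℝ} (h : ∀ y ∈ D, G y = G' y) (hG : Sf D G) :
    Sf D G' := by
  intro y hy ξ
  rw [← hG y hy ξ]
  refine Finset.sum_congr rfl fun i _ => ?_
  rw [dd, dd, Filter.EventuallyEq.fderiv_eq (Filter.eventually_of_mem (hD.mem_nhds hy) fun z hz => (h z hz).symm)]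
lemma dd_zero (i : Fin 3) (y : E3) :
    dd i (fun _ => (0:V)) y = 0 := by simp [dd]
set_option maxHeartbeats 1000000 in
lemma Tg (hmu : 0 < mu) (hlam : 0 < 3 * lam + 2 * mu) {ρ r : ℝ} (hρ : 0 < ρ) (hr : ρ < r) (K : ℝ≥0) :
    ∃ C : ℝ≥0, ∀ (s : ℝ) (B : E3 → BB) (w : E3 → E3), Gd lam mu s r K B → ContDiffOn ℝ 3 w (DD s r) →
    N2 w (DD s r) ≠ ⊤ → N2 (Df w) (DD s r) ≠ ⊤ → Wk s r (fun y => B y (Df w y)) →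
    N2 (Df w) (DD s ρ) ≤ C * N2 w (DD s r) ∧ ∀ a, a ≠ 2 → N2 (Df (dd a w)) (DD s ρ) ≤ C * N2 w (DD s r) ∧
    ∀ b, b ≠ 2 → N2 (Df (dd b (dd a w))) (DD s ρ) ≤ C * N2 w (DD s r) := by
  set d := (r - ρ) / 4 with hd
  have d0 : 0 < d := by rw [hd]; linarith
  obtain ⟨c0, h0⟩ := cacc hmu hlam (show 0 < ρ + 3 * d by linarith) (show ρ + 3 * d < r by rw [hd]; linarith)
  obtain ⟨c1, h1⟩ := T1 hmu hlam (show 0 < ρ + 2 * d by linarith) (show ρ + 2 * d < ρ + 3 * d by linarith) K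
  obtain ⟨c2, h2⟩ := T1 hmu hlam hρ (show ρ < ρ + d by linarith) K
  set a0 : ℝ≥0 := c0 + c1 * c0 with ha0
  refine ⟨a0 + c2 * (a0 + 4 * K^2 * a0), fun s B w hB hw nw nD hW => ?_⟩
  set E := N2 w (DD s r) with hE
  have hw2 : ContDiffOn ℝ 2 w (DD s r) := hw.of_le (by norm_num)
  have m3 : DD s (ρ + 3 * d) ⊆ DD s r := DD_sub (by rw [hd]; linarith)
  have m2 : DD s (ρ + 2 * d) ⊆ DD s (ρ + 3 * d) := DD_sub (by linarith)
  have m1 : DD s (ρ + d) ⊆ DD s (ρ + 2 * d) := DD_sub (by linarith)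
  have m0 : DD s ρ ⊆ DD s (ρ + d) := DD_sub (by linarith)
  have z0 : ∀ (S : Set E3), N2 (fun _ : E3 => (0 : M3 →L[ℝ] ℝ)) S = 0 := fun S => by simp [N2]
  have W0 : Wk s r (fun y => B y (Df w y) - (fun _ => 0 : E3 → M3 →L[ℝ] ℝ) y) := by simpa using hW
  have e0 : N2 (Df w) (DD s (ρ + 3 * d)) ≤ c0 * E := by
    have := h0 s B (fun _ => 0) w (hw.of_le (by norm_num)) hB.1.continuousOn hB.2.1 continuousOn_const nw nD
      (by rw [z0]; simp) W0
    rwa [z0, add_zero] at this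
  have B3 := hB.mono (show ρ + 3 * d ≤ r by rw [hd]; linarith)
  have zd : ∀ (a : Fin 3) (S : Set E3), N2 (dd a (fun _ : E3 => (0 : M3 →L[ℝ] ℝ))) S = 0 := fun a S => by
    simp [N2, dd_zero]
  have e1 : ∀ a, a ≠ 2 → N2 (Df (dd a w)) (DD s (ρ + 2 * d)) ≤ c1 * (c0 * E) := fun a ha => by
    have := h1 s a B (fun _ => 0) w ha B3 (hw2.mono m3) contDiffOn_const
      (ne_top_of_le_ne_top nD (N2_mono m3)) (by rw [z0]; simp) (by rw [zd]; simp)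
      (Wk_mono (by rw [hd]; linarith) W0)
    rw [zd, add_zero] at this
    exact this.trans (by gcongr)
  have f0 : N2 (Df w) (DD s (ρ + 2 * d)) ≤ a0 * E := ((N2_mono m2).trans e0).trans (by
    rw [ha0]; gcongr; exact le_self_add)
  have f1 : ∀ a, a ≠ 2 → N2 (Df (dd a w)) (DD s (ρ + 2 * d)) ≤ a0 * E := fun a ha => (e1 a ha).trans (by
    rw [ha0, ← mul_assoc]; push_cast; gcongr; exact le_add_self)
  have fin0 : a0 * E ≠ ⊤ := ENNReal.mul_ne_top ENNReal.coe_ne_top nw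
  have le0 : a0 * E ≤ (a0 + c2 * (a0 + 4 * K^2 * a0) : ℝ≥0) * E := by
    push_cast; gcongr; exact le_self_add
  refine ⟨((N2_mono (m0.trans m1)).trans f0).trans le0, fun a ha =>
    ⟨((N2_mono (m0.trans m1)).trans (f1 a ha)).trans le0, fun b hb => ?_⟩⟩
  have Wa : Wk s (ρ + d) (fun y => B y (Df (dd a w) y) - lo a B w y) :=
    T2 (show ρ + d < ρ + 2 * d by linarith) ha (hB.mono (by rw [hd]; linarith)) (hw2.mono (m2.trans m3))
      (ne_top_of_le_ne_top fin0 f0) (ne_top_of_le_ne_top fin0 (f1 a ha)) (Wk_mono (by rw [hd]; linarith) hW)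
  have B1 : Gd lam mu s (ρ + d) K B := hB.mono (by rw [hd]; linarith)
  have hw1 := hw2.mono (m1.trans (m2.trans m3))
  obtain ⟨l0, l1⟩ := lo_N B1 hw1 a ((N2_mono m1).trans f0)
  have l1 := l1 b ((N2_mono m1).trans (f1 b hb))
  have := h2 s b B (lo a B w) (dd a w) hb B1 (dd_C (DD_open s _) (hw.mono (m1.trans (m2.trans m3))) (by norm_num))
    (lo_C (DD_open s _) B1.1 hw1 a) (ne_top_of_le_ne_top fin0 ((N2_mono m1).trans (f1 a ha)))
    (ne_top_of_le_ne_top (by finiteness) l0) (ne_top_of_le_ne_top (by finiteness) l1) Wa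
  calc _ ≤ _ := this
    _ ≤ c2 * (a0 * E + 4 * K^2 * (a0 * E)) := by gcongr; exact (N2_mono m1).trans (f1 a ha)
    _ ≤ a0 * E + c2 * (a0 * E + 4 * K^2 * (a0 * E)) := le_add_self
    _ = _ := by push_cast; ring
lemma PN (hmu : 0 < mu) (hlam : 0 < 3 * lam + 2 * mu) (K : ℝ≥0) : ∃ C : ℝ≥0, 1 ≤ C ∧
    ∀ (s r : ℝ) (B : E3 → BB) (F : E3 → M3 →L[ℝ] ℝ) (f : E3 → E3) (A : ℝ≥0∞), Gd lam mu s r K B →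
    ContDiffOn ℝ 2 f (DD s r) → ContDiffOn ℝ 1 F (DD s r) →
    Sf (DD s r) (fun y => B y (Df f y) - F y) → N2 (Df f) (DD s r) ≤ A →
    N2 (Df (dd 0 f)) (DD s r) ≤ A → N2 (Df (dd 1 f)) (DD s r) ≤ A → (∀ i, N2 (dd i F) (DD s r) ≤ A) →
    N2 (Df (dd 2 f)) (DD s r) ≤ C * A := by
  obtain ⟨c, hc, h⟩ := Pt hmu hlam K
  refine ⟨Real.toNNReal (c^2 * 6 * 6), ?_, fun s r B F f A hB hf hF hS h0 h1 h2 h3 => ?_⟩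
  · rw [Real.one_le_toNNReal]; nlinarith
  have oD := DD_open s r
  set g : Fin 6 → E3 → ℝ := ![fun y => ‖Df f y‖, fun y => ‖Df (dd 0 f) y‖, fun y => ‖Df (dd 1 f) y‖,
    fun y => ‖dd 0 F y‖, fun y => ‖dd 1 F y‖, fun y => ‖dd 2 F y‖] with hg
  have cf : ∀ k, ContinuousOn (Df (dd k f)) (DD s r) := fun k => sm_fd oD (dd_C oD hf (by norm_num))
  have cF : ∀ k, ContinuousOn (dd k F) (DD s r) := fun k => (dd_C (m := 0) oD hF (by simp)).continuousOn
  have c1 : ContinuousOn (Df f) (DD s r) := sm_fd oD (hf.of_le (by norm_num))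
  have cg : ∀ i, ContinuousOn (g i) (DD s r) := fun i => by
    fin_cases i
    exacts [c1.norm, (cf 0).norm, (cf 1).norm, (cF 0).norm, (cF 1).norm, (cF 2).norm]
  have ng : ∀ i, N2 (g i) (DD s r) ≤ A := fun i => by
    fin_cases i <;> simp only [N2, hg] <;> simp [enorm_norm]
    exacts [h0, h1, h2, h3 0, h3 1, h3 2]
  have := N2_sum Finset.univ (f := Df (dd 2 f)) (g := g) oD.measurableSet
    (fun i _ => (cg i).aestronglyMeasurable oD.measurableSet) (c := c) fun y hy => by
      refine (h s r B F f hB hf hF hS y hy).trans (le_of_eq ?_)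
      congr 1; simp [hg, Fin.sum_univ_six, Fin.sum_univ_three]; try ring
  calc _ ≤ _ := this
    _ ≤ eO (c^2 * (Finset.univ : Finset (Fin 6)).card) * ∑ i : Fin 6, A := by
        gcongr with i; exact ng i
    _ = _ := by
        rw [Finset.sum_const, Finset.card_univ, Fintype.card_fin, nsmul_eq_mul, ← mul_assoc]
        congr 1
        rw [← ENNReal.ofReal, ENNReal.ofReal_mul (p := c^2 * 6) (by positivity)]; norm_num
set_option maxHeartbeats 1000000 in
lemma R2 (hmu : 0 < mu) (hlam : 0 < 3 * lam + 2 * mu) {ρ r : ℝ} (hρ : 0 < ρ) (hr : ρ < r) (K : ℝ≥0) :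
    ∃ C : ℝ≥0, ∀ (s : ℝ) (B : E3 → BB) (w : E3 → E3), Gd lam mu s r K B → ContDiffOn ℝ 3 w (DD s r) →
    N2 w (DD s r) ≠ ⊤ → N2 (Df w) (DD s r) ≠ ⊤ → Wk s r (fun y => B y (Df w y)) →
    N2 (Df w) (DD s ρ) ≤ C * N2 w (DD s r) ∧ ∀ a, N2 (Df (dd a w)) (DD s ρ) ≤ C * N2 w (DD s r) ∧
    ∀ b, N2 (Df (dd b (dd a w))) (DD s ρ) ≤ C * N2 w (DD s r) := by
  obtain ⟨c, h⟩ := Tg hmu hlam hρ hr K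
  obtain ⟨q, hq, hP⟩ := PN hmu hlam K
  refine ⟨q * (q * ((1 + 4 * K^2) * (q * c))), fun s B w hB hw nw nD hW => ?_⟩
  obtain ⟨h0, h1⟩ := h s B w hB hw nw nD hW
  have hq' : (1:ℝ≥0∞) ≤ q := by exact_mod_cast hq
  have le_q : ∀ x : ℝ≥0∞, x ≤ q * x := fun x => by
    calc x = 1 * x := (one_mul _).symm
      _ ≤ _ := by gcongr
  have m : DD s ρ ⊆ DD s r := DD_sub hr.le
  have oD := DD_open s ρ
  have hB' := hB.mono hr.le
  have hw3 := hw.mono m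
  have hw2 : ContDiffOn ℝ 2 w (DD s ρ) := hw3.of_le (by norm_num)
  have cd : ∀ k, ContDiffOn ℝ 2 (dd k w) (DD s ρ) := fun k => dd_C oD hw3 (by norm_num)
  set A1 : ℝ≥0∞ := c * N2 w (DD s r) with hA1
  have cG : ContDiffOn ℝ 2 (fun y => B y (Df w y)) (DD s ρ) :=
    hB'.1.clm_apply (hw3.fderiv_of_isOpen oD (by norm_num))
  have SG : Sf (DD s ρ) (fun y => B y (Df w y)) := strong (Wk_mono hr.le hW) (cG.of_le (by norm_num))
  have e2 : N2 (Df (dd 2 w)) (DD s ρ) ≤ q * A1 :=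
    hP s ρ B (fun _ => 0) w A1 hB' hw2 contDiffOn_const (Sf_congr oD (fun y _ => by simp) SG) h0
      (h1 0 (by decide)).1 (h1 1 (by decide)).1 fun i => by simp [N2, dd_zero]
  set A2 := q * A1 with hA2
  have f0 : N2 (Df w) (DD s ρ) ≤ A2 := h0.trans (le_q _)
  have f1 : ∀ k, N2 (Df (dd k w)) (DD s ρ) ≤ A2 := fun k => by
    rcases eq_or_ne k 2 with rfl | hk
    · exact e2
    · exact (h1 k hk).1.trans (le_q _)
  have Sk : ∀ k, Sf (DD s ρ) (fun y => B y (Df (dd k w) y) - lo k B w y) := fun k =>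
    Sf_congr oD (fun y hy => dd_G oD (hB'.1.of_le (by norm_num)) hw2 k hy) (Sf_dd oD cG SG k)
  set A3 : ℝ≥0∞ := (1 + 4 * K^2) * A2 with hA3
  have l23 : A2 ≤ A3 := by
    rw [hA3, add_mul, one_mul]; exact le_self_add
  have lN : ∀ k i, N2 (dd i (lo k B w)) (DD s ρ) ≤ A3 := fun k i =>
    ((lo_N hB' hw2 k f0).2 i (f1 i)).trans (by rw [hA3]; gcongr; exact le_add_self)
  have l13 : A1 ≤ A3 := (le_q _).trans l23
  have g1 : ∀ a, a ≠ 2 → N2 (Df (dd 2 (dd a w))) (DD s ρ) ≤ q * A3 := fun a ha =>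
    hP s ρ B (lo a B w) (dd a w) A3 hB' (cd a) (lo_C oD hB'.1 hw2 a) (Sk a) ((f1 a).trans l23)
      (((h1 a ha).2 0 (by decide)).trans l13) (((h1 a ha).2 1 (by decide)).trans l13) (lN a)
  set A4 := q * A3 with hA4
  have l34 : A3 ≤ A4 := le_q _
  have sw : ∀ a, N2 (Df (dd a (dd 2 w))) (DD s ρ) = N2 (Df (dd 2 (dd a w))) (DD s ρ) := fun a => by
    refine setLIntegral_congr_fun oD.measurableSet fun y hy => ?_
    have : Df (dd a (dd 2 w)) y = Df (dd 2 (dd a w)) y :=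
      Filter.EventuallyEq.fderiv_eq (eventually_of_mem (oD.mem_nhds hy) fun z hz => dd_comm oD hw2 hz a 2)
    simp only [this]
  have g2 : N2 (Df (dd 2 (dd 2 w))) (DD s ρ) ≤ q * A4 :=
    hP s ρ B (lo 2 B w) (dd 2 w) A4 hB' (cd 2) (lo_C oD hB'.1 hw2 2) (Sk 2) ((f1 2).trans (l23.trans l34))
      ((sw 0).le.trans (g1 0 (by decide))) ((sw 1).le.trans (g1 1 (by decide))) fun i => (lN 2 i).trans l34
  have eC : ((q * (q * ((1 + 4 * K^2) * (q * c))) : ℝ≥0) : ℝ≥0∞) * N2 w (DD s r) = q * A4 := by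
    rw [hA4, hA3, hA2, hA1]; push_cast; ring
  rw [eC]
  have l45 := le_q A4
  refine ⟨f0.trans (l23.trans (l34.trans l45)), fun a => ⟨(f1 a).trans (l23.trans (l34.trans l45)), fun b => ?_⟩⟩
  rcases eq_or_ne a 2 with rfl | ha
  · rcases eq_or_ne b 2 with rfl | hb
    · exact g2
    · exact (sw b).le.trans ((g1 b hb).trans l45)
  · rcases eq_or_ne b 2 with rfl | hb
    · exact (g1 a ha).trans l45
    · exact ((h1 a ha).2 b hb).trans (l13.trans (l34.trans l45))
lemma fd2 (hD : IsOpen D) {f : E3 → E3} (hf : ContDiffOn ℝ 2 f D) {A : ℝ≥0∞}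
    (h : ∀ j, N2 (Df (dd j f)) D ≤ A) : N2 (Df (Df f)) D ≤ 9 * A := by
  have := N2_sum Finset.univ (f := Df (Df f)) (g := fun j y => ‖Df (dd j f) y‖) hD.measurableSet
    (fun i _ => ((sm_fd hD (dd_C hD hf (by norm_num))).norm.aestronglyMeasurable hD.measurableSet)) (c := 1) fun y hy => by
      rw [one_mul]
      refine (nrm_basis _).trans (Finset.sum_le_sum fun j _ => le_of_eq ?_)
      rw [norm_norm, fd_dd hD hf hy]; rfl
  refine this.trans ?_
  calc _ ≤ eO (1^2 * (Finset.univ : Finset (Fin 3)).card) * ∑ j : Fin 3, A := by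
        gcongr with j; simpa [N2] using h j
    _ = _ := by
        simp [← mul_assoc]; norm_num
lemma vol_low {s ρ : ℝ} (hs : 0 ≤ s) (hρ : 0 < ρ) : ball ((-(ρ/2)) • ee 2) (ρ/2) ⊆ DD s ρ := by
  intro y hy
  rw [mem_ball, dist_eq_norm] at hy
  have h1 := PiLp.norm_apply_le (y - (-(ρ/2)) • ee 2) 2
  refine ⟨show y 2 < s from ?_, mem_ball_zero_iff.2 ?_⟩
  · have h2 := (le_abs_self _).trans_lt (h1.trans_lt hy)
    simp at h2
    linarith
  · have h3 : ‖(-(ρ/2)) • ee 2‖ = ρ/2 := by rw [norm_smul]; simp [abs_of_pos hρ]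
    have : y = (y - (-(ρ/2)) • ee 2) + (-(ρ/2)) • ee 2 := by abel
    rw [this]
    refine (norm_add_le _ _).trans_lt ?_
    linarith
set_option maxHeartbeats 1000000 in
lemma RR (hmu : 0 < mu) (hlam : 0 < 3 * lam + 2 * mu) {ρ r : ℝ} (hρ : 0 < ρ) (hr : ρ < r) (K : ℝ≥0) :
    ∃ C : ℝ, 0 ≤ C ∧ ∀ (s : ℝ) (B : E3 → BB) (w : E3 → E3) (M : ℝ), 0 ≤ s → 0 ≤ M → Gd lam mu s r K B →
    ContDiffOn ℝ 3 w (DD s r) → N2 (Df w) (DD s r) ≠ ⊤ → N2 w (DD s r) ≤ eO (M^2) →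
    Wk s r (fun y => B y (Df w y)) →
    ∀ x ∈ DD s ρ, ‖w x‖ ≤ C * M ∧ ‖Df w x‖ ≤ C * M ∧
      ∀ y ∈ DD s ρ, ‖Df w x - Df w y‖ ≤ C * M * √‖x - y‖ := by
  obtain ⟨c, h⟩ := R2 hmu hlam hρ hr K
  set v₀ := (volume (ball o3 (ρ/2))).toReal with hv0
  set v₁ := √(volume (ball o3 ρ)).toReal with hv1
  have v00 : 0 < v₀ := ENNReal.toReal_pos (measure_ball_pos _ _ (by linarith)).ne' measure_ball_lt_top.ne
  set d := 2 * ρ with hd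
  have d0 : 0 < d := by rw [hd]; linarith
  set m := 1 + 3 * √c with hm
  set C1 := (1 + 2 * d * (1 + 2 * d)) * v₁ / v₀ with hC1
  set C2 := 5 * √d * (1 + 2 * d) * v₁ / v₀ with hC2
  have C10 : 0 ≤ C1 := by positivity
  have C20 : 0 ≤ C2 := by positivity
  have m0 : 0 ≤ m := by positivity
  refine ⟨3 * (C1 + C2) * m, by positivity, fun s B w M hs hM hB hw nD hN hW => ?_⟩
  obtain ⟨h0, h1⟩ := h s B w hB hw (ne_top_of_le_ne_top ENNReal.ofReal_ne_top hN) nD hW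
  have oD := DD_open s ρ
  have mm : DD s ρ ⊆ DD s r := DD_sub hr.le
  have hw3 := hw.mono mm
  have e9 : 9 * ((c:ℝ≥0∞) * N2 w (DD s r)) ≤ eO ((m*M)^2) := by
    calc _ ≤ 9 * ((c:ℝ≥0∞) * eO (M^2)) := by gcongr
      _ = eO (9 * (c * M^2)) := by
        rw [ENNReal.ofReal_mul (by norm_num), ENNReal.ofReal_mul (by positivity)]; simp
      _ ≤ _ := by
        apply ENNReal.ofReal_le_ofReal
        rw [mul_pow, ← mul_assoc]
        gcongr
        have := Real.sq_sqrt c.coe_nonneg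
        have h3 := Real.sqrt_nonneg (c:ℝ)
        rw [hm]; nlinarith
  have e1 : (c:ℝ≥0∞) * N2 w (DD s r) ≤ eO ((m*M)^2) := by
    refine le_trans ?_ e9
    calc (c:ℝ≥0∞) * N2 w (DD s r) = 1 * (c * N2 w (DD s r)) := (one_mul _).symm
      _ ≤ _ := by gcongr; norm_num
  have ew : N2 w (DD s ρ) ≤ eO ((m*M)^2) := by
    refine (N2_mono mm).trans (hN.trans (ENNReal.ofReal_le_ofReal ?_))
    have : M ≤ m * M := by
      have : 0 ≤ √(c:ℝ) * M := by positivity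
      rw [hm]; linarith
    gcongr
  have cd : ∀ k, ContDiffOn ℝ 2 (dd k w) (DD s ρ) := fun k => dd_C oD hw3 (by norm_num)
  have hw2 : ContDiffOn ℝ 2 w (DD s ρ) := hw3.of_le (by norm_num)
  have diam : ∀ x ∈ DD s ρ, ∀ y ∈ DD s ρ, ‖x - y‖ ≤ d := fun x hx y hy => by
    have a := mem_ball_zero_iff.1 hx.2
    have b := mem_ball_zero_iff.1 hy.2
    have := norm_sub_le x y
    rw [hd]; linarith
  have hv : volume (DD s ρ) ≤ eO (v₁^2) := by
    rw [hv1, Real.sq_sqrt ENNReal.toReal_nonneg, ENNReal.ofReal_toReal measure_ball_lt_top.ne]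
    exact measure_mono inter_subset_right
  have hv' : eO v₀ ≤ volume (DD s ρ) := by
    rw [hv0, ENNReal.ofReal_toReal measure_ball_lt_top.ne]
    refine le_trans (le_of_eq ?_) (measure_mono (vol_low hs hρ))
    rw [Measure.addHaar_ball_center volume (-(ρ / 2) • ee 2)]
  have mM : 0 ≤ m * M := by positivity
  have hol := fun {k : Fin 3} {x y : E3} (hx : x ∈ DD s ρ) (hy : y ∈ DD s ρ) => show _ ≤ C2 * (m * M) * _ from
    emb_hol oD (DD_convex s ρ) d0 diam (Real.sqrt_nonneg _) hv v00 hv' mM (cd k) ((h1 k).1.trans e1)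
      ((fd2 oD (cd k) fun j => (h1 k).2 j).trans e9) hx hy
  have sup0 := fun {x : E3} (hx : x ∈ DD s ρ) => show _ ≤ C1 * (m * M) from
    emb_sup oD (DD_convex s ρ) d0 diam (Real.sqrt_nonneg _) hv v00 hv' mM hw2 ew (h0.trans e1)
      ((fd2 oD hw2 fun j => (h1 j).1).trans e9) hx
  have sup1 := fun {k : Fin 3} {x : E3} (hx : x ∈ DD s ρ) => show _ ≤ C1 * (m * M) from
    emb_sup oD (DD_convex s ρ) d0 diam (Real.sqrt_nonneg _) hv v00 hv' mM (cd k)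
      (le_trans (show N2 (dd k w) (DD s ρ) ≤ _ by simpa using N2_le (c := 1) oD.measurableSet fun y _ => by simpa using dd_le k w y) (h0.trans e1))
      ((h1 k).1.trans e1)
      ((fd2 oD (cd k) fun j => (h1 k).2 j).trans e9) hx
  have q1 : 0 ≤ C1 * (m * M) := by positivity
  have q2 : 0 ≤ C2 * (m * M) := by positivity
  intro x hx
  refine ⟨(sup0 hx).trans ?_, (nrm_basis _).trans ((Finset.sum_le_sum fun k _ => sup1 (k := k) hx).trans ?_), fun y hy =>
    (nrm_basis _).trans ((Finset.sum_le_sum fun k _ => hol (k := k) hx hy).trans ?_)⟩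
  · linarith
  · rw [Finset.sum_const, Finset.card_univ, Fintype.card_fin, nsmul_eq_mul]; push_cast; linarith
  · rw [Finset.sum_const, Finset.card_univ, Fintype.card_fin, nsmul_eq_mul]; push_cast
    rw [← mul_assoc]
    exact mul_le_mul_of_nonneg_right (by linarith) (Real.sqrt_nonneg _)
lemma leI (n : ℕ) : (n : ℕ∞ω) ≤ (∞ : ℕ∞ω) := by exact_mod_cast le_top
lemma DD_ball (r : ℝ) : DD r r = ball 0 r := by
  refine inter_eq_right.2 fun y hy => show y 2 < r from ?_
  exact ((le_abs_self _).trans (PiLp.norm_apply_le y 2)).trans_lt (mem_ball_zero_iff.1 hy)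
lemma Sf_Wk {r : ℝ} {G : E3 → M3 →L[ℝ] ℝ} (cG : ContDiffOn ℝ 1 G (ball 0 r)) (h : Sf (ball 0 r) G) : Wk r r G := by
  intro v hv cv sv
  have oD : IsOpen (ball o3 r) := isOpen_ball
  set vj : Fin 3 → E3 → ℝ := fun j y => v y j with hvj
  have hj : ∀ j, ContDiff ℝ 1 (vj j) := fun j => contDiff_euclidean.1 hv j
  have cj : ∀ j, HasCompactSupport (vj j) := fun j => cv.comp_left (g := fun x : E3 => x j) (by simp)
  have sj : ∀ j, tsupport (vj j) ⊆ ball 0 r := fun j => (ts_sub fun y h => by simp [hvj, h]).trans sv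
  have dj : ∀ i j y, dd i (vj j) y = Df v y (ee i) j := fun i j y => by
    have := ((EuclideanSpace.proj j : E3 →L[ℝ] ℝ).hasFDerivAt.comp y (hv.differentiable one_ne_zero y).hasFDerivAt).fderiv
    exact congrArg (fun L : E3 →L[ℝ] ℝ => L (ee i)) this
  have e1 : ∀ y, G y (Df v y) = ∑ j, ∑ i, G y (ro i (ee j)) * dd i (vj j) y := fun y => by
    rw [Finset.sum_comm, ← ro_sum (Df v y), map_sum]
    refine Finset.sum_congr rfl fun i _ => ?_
    have : ro i (Df v y (ee i)) = ∑ j, dd i (vj j) y • ro i (ee j) := by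
      conv_lhs => rw [← sum_ee (Df v y (ee i))]
      ext1 z
      simp only [ro_app, _root_.sum_apply, _root_.smul_apply, Finset.smul_sum, dj, smul_smul, mul_comm]
    rw [this, map_sum]
    exact Finset.sum_congr rfl fun j _ => by rw [map_smul, smul_eq_mul, mul_comm]
  have i1 : ∀ i j, Integrable (fun y => G y (ro i (ee j)) * dd i (vj j) y) := fun i j =>
    cont_mul oD (cG.continuousOn.clm_apply continuousOn_const)
      (((hj j).continuous_fderiv one_ne_zero).clm_apply continuous_const) ((cj j).fderiv_apply ℝ (ee i))
      (((ts_sub (g := Df (vj j)) fun y h => by simp [dd, h]).trans (tsupport_fderiv_subset ℝ)).trans (sj j))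
  rw [setIntegral_eq_integral_of_forall_compl_eq_zero fun y hy => by
    rw [image_eq_zero_of_notMem_tsupport fun h => hy (((DD_ball r).symm.subset
      (sv (tsupport_fderiv_subset ℝ h))).1)]; simp]
  simp only [e1]
  rw [integral_finsetSum _ fun j _ => integrable_finsetSum _ fun i _ => i1 i j]
  refine Finset.sum_eq_zero fun j _ => ?_
  have i2 : ∀ i, Integrable (fun y => dd i G y (ro i (ee j)) * vj j y) := fun i =>
    cont_mul oD ((dd_C (m := 0) oD cG (by simp)).continuousOn.clm_apply continuousOn_const) (hj j).continuous (cj j) (sj j)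
  have e2 : ∀ i, ∫ y, G y (ro i (ee j)) * dd i (vj j) y = -∫ y, dd i G y (ro i (ee j)) * vj j y := fun i => by
    rw [ibp oD (f := fun y => G y (ro i (ee j))) (cG.clm_apply contDiffOn_const) (hj j) (cj j) (sj j) i]
    congr 1
    refine integral_congr_ae (ae_of_all _ fun y => ?_)
    by_cases hy : y ∈ ball o3 r
    · simp only [dd_cst oD cG (ro i (ee j)) i hy]
    · simp [image_eq_zero_of_notMem_tsupport fun h => hy (sj j h)]
  rw [integral_finsetSum _ fun i _ => i1 i j, Finset.sum_congr rfl fun i _ => e2 i, Finset.sum_neg_distrib,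
    ← integral_finsetSum _ fun i _ => i2 i, neg_eq_zero]
  refine integral_eq_zero_of_ae (ae_of_all _ fun y => ?_)
  by_cases hy : y ∈ ball o3 r
  · simp only [← Finset.sum_mul, h y hy (ee j)]; simp
  · simp [image_eq_zero_of_notMem_tsupport fun h => hy (sj j h)]
lemma Gd_const (hmu : 0 < mu) (hlam : 0 < 3 * lam + 2 * mu) (s r : ℝ) :
    Gd lam mu s r 0 (fun _ => bil lam mu) := by
  refine ⟨contDiffOn_const, fun y _ => ?_, fun y _ => by rw [fderiv_const_apply]; exact (norm_zero (E := E3 →L[ℝ] BB)).le, fun j k y _ => ?_⟩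
  · simp only [sub_self, norm_zero, eps0, cc0]
    have := lt_min (show 0 < 2 * mu by linarith) hlam
    positivity
  · rw [show dd k (fun _ : E3 => bil lam mu) = fun _ => 0 from funext fun z => by simp [dd], dd_zero]; simp
lemma lim_step (hmu : 0 < mu) (hlam : 0 < 3 * lam + 2 * mu) {ρ r : ℝ} (hρ : 0 < ρ) (hr : ρ < r)
    {f : ℕ → E3 → E3} {F : E3 → E3} (hf : ∀ n, ContDiffOn ℝ ∞ (f n) (ball 0 r))
    (hS : ∀ n, Sf (ball 0 r) (fun y => bil lam mu (Df (f n) y)))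
    (hu : TendstoUniformlyOn f F atTop (ball 0 r)) :
    ∃ g : E3 → M3, (∀ x ∈ ball o3 ρ, HasFDerivAt F (g x) x) ∧
      TendstoUniformlyOn (fun n => Df (f n)) g atTop (ball 0 ρ) := by
  set ρ₂ := (ρ + r) / 2 with hρ₂
  have l1 : ρ < ρ₂ := by rw [hρ₂]; linarith
  have l2 : ρ₂ < r := by rw [hρ₂]; linarith
  obtain ⟨C, C0, hC⟩ := RR hmu hlam hρ l1 0
  have o := isOpen_ball (x := o3) (ε := r)
  have b2 : ball o3 ρ₂ ⊆ ball 0 r := ball_subset_ball l2.le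
  set V := √(volume (ball o3 ρ₂)).toReal with hV
  have bDD : ball o3 ρ ⊆ DD ρ₂ ρ := fun y hy =>
    ⟨((DD_ball ρ₂).symm.subset (ball_subset_ball l1.le hy)).1, hy⟩
  have key : ∀ ε, 0 < ε → ∀ m n, (∀ x ∈ ball o3 r, ‖f m x - f n x‖ ≤ ε) →
      ∀ x ∈ ball o3 ρ, ‖Df (f m) x - Df (f n) x‖ ≤ C * (ε * V) := by
    intro ε hε m n h x hx
    have df : ∀ n, ∀ y ∈ ball o3 r, DifferentiableAt ℝ (f n) y := fun n y hy =>
      dif o ((hf n).of_le (leI 1)) hy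
    have fs : ∀ y ∈ ball o3 r, Df (fun y => f m y - f n y) y = Df (f m) y - Df (f n) y :=
      fun y hy => fderiv_fun_sub (df m y hy) (df n y hy)
    have cw : ContDiffOn ℝ ∞ (fun y => f m y - f n y) (ball 0 r) := (hf m).sub (hf n)
    have cG : ∀ n, ContDiffOn ℝ 1 (fun y => bil lam mu (Df (f n) y)) (ball 0 r) := fun n =>
      (bil lam mu).contDiff.comp_contDiffOn ((hf n).fderiv_of_isOpen o (leI 2))
    have W : Wk ρ₂ ρ₂ (fun y => bil lam mu (Df (fun y => f m y - f n y) y)) := by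
      refine Sf_Wk (((bil lam mu).contDiff.comp_contDiffOn (cw.fderiv_of_isOpen o (leI 2))).mono b2) ?_
      intro y hy ξ
      have hy' := b2 hy
      have e : ∀ i, dd i (fun y => bil lam mu (Df (fun y => f m y - f n y) y)) y
          = dd i (fun y => bil lam mu (Df (f m) y)) y - dd i (fun y => bil lam mu (Df (f n) y)) y := fun i => by
        simp only [dd]
        rw [← _root_.sub_apply, ← fderiv_fun_sub (dif o (cG m) hy') (dif o (cG n) hy')]
        congr 1
        exact EventuallyEq.fderiv_eq (eventually_of_mem (o.mem_nhds hy') fun z hz => by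
          simp only [fs z hz, map_sub])
      simp only [e, _root_.sub_apply, Finset.sum_sub_distrib, hS m y hy' ξ, hS n y hy' ξ, sub_self]
    have nb : N2 (fun y => f m y - f n y) (DD ρ₂ ρ₂) ≤ eO ((ε * V)^2) := by
      refine (N2_bdd (DD_open _ _).measurableSet (M := ε) fun y hy => h y (b2 hy.2)).trans ?_
      rw [DD_ball, mul_pow, ENNReal.ofReal_mul (by positivity), hV, Real.sq_sqrt ENNReal.toReal_nonneg,
        ENNReal.ofReal_toReal measure_ball_lt_top.ne]
    have nD : N2 (Df (fun y => f m y - f n y)) (DD ρ₂ ρ₂) ≠ ⊤ := by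
      obtain ⟨M, hM⟩ := (isCompact_closedBall o3 ρ₂).exists_bound_of_continuousOn
        ((sm_fd o (cw.of_le (leI 1))).mono (closedBall_subset_ball l2))
      exact ne_top_of_le_ne_top (ENNReal.mul_ne_top ENNReal.ofReal_ne_top (vol_DD _ _))
        (N2_bdd (DD_open _ _).measurableSet fun y hy => hM y (ball_subset_closedBall hy.2))
    have := (hC ρ₂ _ _ (ε * V) (hρ.trans l1).le (by positivity) (Gd_const hmu hlam _ _)
      ((cw.of_le (leI 3)).mono (inter_subset_right.trans b2)) nD nb W x (bDD hx)).2.1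
    rwa [fs x (ball_subset_ball hr.le hx)] at this
  have UC : UniformCauchySeqOn (fun n => Df (f n)) atTop (ball 0 ρ) := by
    rw [Metric.uniformCauchySeqOn_iff]
    intro ε hε
    obtain ⟨N, hN⟩ := Metric.uniformCauchySeqOn_iff.1 hu.uniformCauchySeqOn (ε / (C * V + 1)) (by positivity)
    refine ⟨N, fun m hm n hn x hx => ?_⟩
    rw [dist_eq_norm]
    refine (key _ (by positivity : 0 < ε / (C * V + 1)) m n (fun y hy => ?_) x hx).trans_lt ?_
    · rw [← dist_eq_norm]; exact (hN m hm n hn y hy).le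
    · have : C * (ε / (C * V + 1) * V) = ε * (C * V / (C * V + 1)) := by ring
      rw [this]
      have : C * V / (C * V + 1) < 1 := by
        rw [div_lt_one (by positivity)]; linarith
      nlinarith
  have hg : ∀ x, ∃ g, x ∈ ball o3 ρ → Tendsto (fun n => Df (f n) x) atTop (𝓝 g) := fun x => by
    by_cases hx : x ∈ ball o3 ρ
    · obtain ⟨g, hg⟩ := cauchySeq_tendsto_of_complete (UC.cauchySeq hx)
      exact ⟨g, fun _ => hg⟩
    · exact ⟨0, fun h => absurd h hx⟩
  choose g hg using hg
  have T := UC.tendstoUniformlyOn_of_tendsto hg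
  refine ⟨g, fun x hx => ?_, T⟩
  exact hasFDerivAt_of_tendstoUniformlyOn isOpen_ball T (fun n y hy =>
    (dif o ((hf n).of_le (leI 1)) (ball_subset_ball hr.le hy)).hasFDerivAt)
    (fun y hy => hu.tendsto_at (ball_subset_ball hr.le hy)) hx
lemma lim_C (hmu : 0 < mu) (hlam : 0 < 3 * lam + 2 * mu) (k : ℕ) : ∀ {ρ r : ℝ}, 0 < ρ → ρ < r →
    ∀ {f : ℕ → E3 → E3} {F : E3 → E3}, (∀ n, ContDiffOn ℝ ∞ (f n) (ball 0 r)) →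
    (∀ n, Sf (ball 0 r) (fun y => bil lam mu (Df (f n) y))) →
    TendstoUniformlyOn f F atTop (ball 0 r) → ContDiffOn ℝ k F (ball 0 ρ) := by
  induction k with
  | zero =>
    intro ρ r _ hr f F hf _ hu
    simp only [Nat.cast_zero, contDiffOn_zero]
    exact (hu.continuousOn (Eventually.frequently (Eventually.of_forall fun n => (hf n).continuousOn))).mono
      (ball_subset_ball hr.le)
  | succ k ih =>
    intro ρ r hρ hr f F hf hS hu
    set ρ₂ := (ρ + r) / 2 with hρ₂
    have l1 : ρ < ρ₂ := by rw [hρ₂]; linarith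
    have l2 : ρ₂ < r := by rw [hρ₂]; linarith
    obtain ⟨g, hg, T⟩ := lim_step hmu hlam (hρ.trans l1) l2 hf hS hu
    have o := isOpen_ball (x := o3) (ε := r)
    have b1 : ball o3 ρ ⊆ ball 0 ρ₂ := ball_subset_ball l1.le
    have b2 : ball o3 ρ₂ ⊆ ball 0 r := ball_subset_ball l2.le
    have hk : ∀ i, ContDiffOn ℝ k (fun y => g y (ee i)) (ball 0 ρ) := fun i => by
      refine ih hρ l1 (f := fun n => dd i (f n)) (fun n => (dd_C o (hf n) (by norm_num)).mono b2) (fun n y hy ξ => ?_) ?_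
      · have cG : ContDiffOn ℝ 2 (fun y => bil lam mu (Df (f n) y)) (ball 0 r) :=
          (bil lam mu).contDiff.comp_contDiffOn ((hf n).fderiv_of_isOpen o (leI 3))
        refine Sf_congr o (fun z hz => ?_) (Sf_dd o cG (hS n) i) y (b2 hy) ξ
        rw [dd_G (B := fun _ => bil lam mu) o contDiffOn_const ((hf n).of_le (leI 2)) i hz, lo]
        simp [dd]
      · rw [Metric.tendstoUniformlyOn_iff] at T ⊢
        intro ε hε
        filter_upwards [T ε hε] with n hn x hx
        refine lt_of_le_of_lt ?_ (hn x hx)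
        rw [dist_eq_norm, dist_eq_norm, dd, ← _root_.sub_apply]
        simpa using (g x - Df (f n) x).le_opNorm (ee i)
    push_cast
    rw [contDiffOn_succ_iff_fderiv_of_isOpen isOpen_ball]
    refine ⟨fun y hy => (hg y (b1 hy)).differentiableAt.differentiableWithinAt, fun h => by simp at h, ?_⟩
    refine ContDiffOn.congr (f := g) (contDiffOn_clm_apply.2 fun z => ?_) fun y hy => (hg y (b1 hy)).fderiv
    rw [← sum_ee z]
    simp only [map_sum, map_smul]
    exact ContDiffOn.sum fun i _ => (contDiffOn_const (c := z i)).fun_smul (hk i)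
open scoped Convolution
def mo {V : Type*} [NormedAddCommGroup V] [NormedSpace ℝ V] (φ : ContDiffBump o3) (g : E3 → V) : E3 → V :=
  φ.normed volume ⋆[ContinuousLinearMap.lsmul ℝ ℝ, volume] g
section
variable {V W : Type*} [NormedAddCommGroup V] [NormedSpace ℝ V] [CompleteSpace V] [NormedAddCommGroup W] [NormedSpace ℝ W]
  [CompleteSpace W]
lemma mo_C (φ : ContDiffBump o3) {g : E3 → V} (hg : Continuous g) : ContDiff ℝ ∞ (mo φ g) :=
  φ.hasCompactSupport_normed.contDiff_convolution_left _ φ.contDiff_normed hg.locallyIntegrable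
lemma mo_int (φ : ContDiffBump o3) {g : E3 → V} (hg : Continuous g) (x : E3) :
    Integrable (fun t => φ.normed volume t • g (x - t)) :=
  φ.hasCompactSupport_normed.convolutionExists_left (ContinuousLinearMap.lsmul ℝ ℝ) φ.continuous_normed hg.locallyIntegrable x
lemma mo_fd (φ : ContDiffBump o3) {g : E3 → V} (hg : ContDiff ℝ 1 g) (cg : HasCompactSupport g) (x : E3) :
    Df (mo φ g) x = mo φ (Df g) x :=
  (cg.hasFDerivAt_convolution_right (ContinuousLinearMap.lsmul ℝ ℝ) φ.continuous_normed.locallyIntegrable hg x).fderiv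
lemma mo_clm (φ : ContDiffBump o3) {g : E3 → V} (hg : Continuous g) (L : V →L[ℝ] W) (x : E3) :
    L (mo φ g x) = mo φ (fun y => L (g y)) x := by
  refine (L.integral_comp_comm (mo_int φ hg x)).symm.trans (integral_congr_ae (ae_of_all _ fun t => ?_))
  simp
lemma mo_near (φ : ContDiffBump o3) {g : E3 → V} (hg : Continuous g) {ε : ℝ}
    (h : ∀ y ∈ ball x φ.rOut, dist (g y) (g x) ≤ ε) : dist (mo φ g x) (g x) ≤ ε :=
  φ.dist_normed_convolution_le hg.aestronglyMeasurable h
def bt (δ : ℝ) (hδ : 0 < δ) (n : ℕ) : ContDiffBump o3 :=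
  ⟨δ / (n + 2) / 2, δ / (n + 2), by positivity, half_lt_self (by positivity)⟩
lemma bt_lt (δ : ℝ) (hδ : 0 < δ) (n : ℕ) : (bt δ hδ n).rOut < δ := by
  show δ / ((n:ℝ) + 2) < δ
  rw [div_lt_iff₀ (by positivity)]
  have : (0:ℝ) ≤ n := n.cast_nonneg
  nlinarith
lemma bt_tt (δ : ℝ) (hδ : 0 < δ) : Tendsto (fun n => (bt δ hδ n).rOut) atTop (𝓝 0) :=
  (tendsto_const_nhds (x := δ)).div_atTop (tendsto_natCast_atTop_atTop.atTop_add tendsto_const_nhds)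
lemma mo_unif (δ : ℝ) (hδ : 0 < δ) {g : E3 → V} (hg : Continuous g) (cg : HasCompactSupport g) :
    TendstoUniformly (fun n => mo (bt δ hδ n) g) g atTop := by
  rw [Metric.tendstoUniformly_iff]
  intro ε hε
  obtain ⟨η, η0, hη⟩ := Metric.uniformContinuous_iff.1 (cg.uniformContinuous_of_continuous hg) (ε/2) (by linarith)
  filter_upwards [(bt_tt δ hδ).eventually (gt_mem_nhds η0)] with n hn x
  rw [dist_comm]
  refine (mo_near _ hg (ε := ε/2) fun y hy => (hη ?_).le).trans_lt (by linarith)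
  exact (mem_ball.1 hy).trans hn
lemma mo_supp (φ : ContDiffBump o3) {g : E3 → V} {R : ℝ} (hR : ∀ x, R < ‖x‖ → g x = 0) {x : E3}
    (hx : R + φ.rOut < ‖x‖) : mo φ g x = 0 := by
  refine integral_eq_zero_of_ae (ae_of_all _ fun t => ?_)
  by_cases ht : t ∈ ball o3 φ.rOut
  · have : g (x - t) = 0 := hR _ (by
      have := norm_sub_norm_le x t
      rw [mem_ball_zero_iff] at ht
      linarith)
    simp [this]
  · rw [← φ.support_normed_eq (μ := volume)] at ht
    simp [Function.notMem_support.1 ht]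
end
lemma mo_dd (φ : ContDiffBump o3) {k : E3 → ℝ} (hk : Continuous k) (i : Fin 3) (x : E3) :
    Integrable (fun t => dd i (φ.normed volume) (x - t) * k t) ∧
    dd i (mo φ k) x = ∫ t, dd i (φ.normed volume) (x - t) * k t := by
  have hφ : ContDiff ℝ 1 (φ.normed volume) := φ.contDiff_normed
  have cφ := φ.hasCompactSupport_normed (μ := volume)
  constructor
  · have h1 : Continuous fun t => dd i (φ.normed volume) (x - t) :=
      ((hφ.continuous_fderiv one_ne_zero).comp (continuous_const.sub continuous_id)).clm_apply continuous_const
    refine (h1.mul hk).integrable_of_hasCompactSupport (HasCompactSupport.mul_right ?_)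
    exact (cφ.fderiv_apply ℝ (ee i)).comp_homeomorph (Homeomorph.subLeft x)
  · have h := (cφ.hasFDerivAt_convolution_left (ContinuousLinearMap.lsmul ℝ ℝ) hφ (hk.locallyIntegrable (μ := volume)) x).fderiv
    have h2 := ((cφ.fderiv ℝ).convolutionExists_left ((ContinuousLinearMap.lsmul ℝ ℝ).precompL E3)
      (hφ.continuous_fderiv one_ne_zero) (hk.locallyIntegrable (μ := volume)) x)
    rw [dd, mo, h, convolution_def, ContinuousLinearMap.integral_apply h2]
    rw [← integral_sub_left_eq_self _ volume x]
    refine integral_congr_ae (ae_of_all _ fun t => ?_)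
    simp [dd]
lemma mo_Sf {lam mu r : ℝ} (hr : 0 < r) {U : E3 → E3} (hU : ContDiff ℝ 1 U) (cU : HasCompactSupport U)
    (hw : ∀ v : E3 → E3, ContDiff ℝ ∞ v → HasCompactSupport v → tsupport v ⊆ ball 0 (2 * r) →
      ∫ y, bil lam mu (Df U y) (Df v y) = 0) {φ : ContDiffBump o3} (hφ : φ.rOut < r) :
    Sf (ball 0 r) (fun y => bil lam mu (Df (mo φ U) y)) := by
  intro x hx ξ
  have cD := hU.continuous_fderiv one_ne_zero
  have cG : ContDiff ℝ 1 (fun y => bil lam mu (Df (mo φ U) y)) :=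
    (bil lam mu).contDiff.comp ((mo_C φ hU.continuous).fderiv_right (leI 2))
  have ck : ∀ i, Continuous fun y => bil lam mu (Df U y) (ro i ξ) := fun i =>
    ((bil lam mu).continuous.comp cD).clm_apply continuous_const
  have e : ∀ i, dd i (fun y => bil lam mu (Df (mo φ U) y)) x (ro i ξ)
      = ∫ t, dd i (φ.normed volume) (x - t) * bil lam mu (Df U t) (ro i ξ) := fun i => by
    rw [← dd_cst isOpen_univ cG.contDiffOn (ro i ξ) i (mem_univ x), ← (mo_dd φ (ck i) i x).2]
    congr 2
    ext y
    rw [mo_fd φ hU cU]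
    exact mo_clm φ cD ((bil lam mu).flip (ro i ξ)) y
  rw [Finset.sum_congr rfl fun i _ => e i, ← integral_finsetSum _ fun i _ => (mo_dd φ (ck i) i x).1]
  have hn : ContDiff ℝ ∞ (φ.normed volume : E3 → ℝ) := φ.contDiff_normed
  have hv : ContDiff ℝ ∞ fun t : E3 => φ.normed volume (x - t) • ξ :=
    (hn.comp (contDiff_const.sub contDiff_id)).smul contDiff_const
  have sv : Function.support (fun t : E3 => φ.normed volume (x - t) • ξ) ⊆ closedBall x φ.rOut := fun t ht => by
    have : x - t ∈ Function.support (φ.normed volume : E3 → ℝ) := fun h => ht (by simp [h])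
    rw [φ.support_normed_eq, mem_ball_zero_iff] at this
    rw [mem_closedBall, dist_comm, dist_eq_norm]; exact this.le
  have cv : HasCompactSupport fun t : E3 => φ.normed volume (x - t) • ξ :=
    HasCompactSupport.intro (isCompact_closedBall x φ.rOut) fun t ht => by_contra fun h => ht (sv h)
  have tv : tsupport (fun t : E3 => φ.normed volume (x - t) • ξ) ⊆ ball 0 (2 * r) := by
    refine (closure_minimal sv isClosed_closedBall).trans fun t ht => ?_
    rw [mem_closedBall] at ht
    rw [mem_ball] at hx ⊢
    linarith [dist_triangle t x 0]
  have := hw _ hv cv tv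
  rw [← neg_eq_zero, ← integral_neg, ← this]
  refine integral_congr_ae (ae_of_all _ fun t => ?_)
  have ev : Df (fun t : E3 => φ.normed volume (x - t) • ξ) t = -∑ i, dd i (φ.normed volume) (x - t) • ro i ξ := by
    have h1 := ((hn.differentiable (by simp) (x - t)).hasFDerivAt.comp t ((hasFDerivAt_id t).const_sub x)).smul_const ξ
    refine HasFDerivAt.fderiv (h1.congr_fderiv ?_)
    conv_lhs => rw [← ro_sum (ContinuousLinearMap.smulRight _ ξ)]
    rw [← Finset.sum_neg_distrib]
    refine Finset.sum_congr rfl fun i _ => ?_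
    ext1 z
    simp [ro_app, dd, smul_smul, mul_comm]
  simp only [ev, map_neg, map_sum, map_smul, smul_eq_mul]
lemma glob_C {n : ℕ∞ω}
    (h : ∀ y ∈ tsupport f, ContDiffAt ℝ n f y) : ContDiff ℝ n f := contDiff_iff_contDiffAt.2 fun y => by
  by_cases hy : y ∈ tsupport f
  · exact h y hy
  · exact contDiffAt_const.congr_of_eventuallyEq (notMem_tsupport_iff_eventuallyEq.1 hy)
lemma int_reg (hmu : 0 < mu) (hlam : 0 < 3 * lam + 2 * mu) {r : ℝ} (hr : 0 < r)
    (hu : ContDiffOn ℝ 1 u (ball 0 r))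
    (hw : ∀ v : E3 → E3, ContDiff ℝ ∞ v → HasCompactSupport v → tsupport v ⊆ ball 0 r →
      ∫ y, bil lam mu (Df u y) (Df v y) = 0) : ContDiffOn ℝ 3 u (ball 0 (r/8)) := by
  obtain ⟨χ, K, -, hχ, χ1, χ0, -, -⟩ := bump_ex (ρ := r/2) (r := r) (by linarith) (by linarith)
  have o : IsOpen (ball o3 r) := isOpen_ball
  have χ0' : ∀ y, y ∉ closedBall o3 ((r/2+r)/2) → χ y = 0 := fun y hy => χ0 y (by simp at hy; exact hy.le)
  set U : E3 → E3 := fun y => χ y • u y with hUd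
  have tU : tsupport U ⊆ closedBall 0 ((r/2+r)/2) := closure_minimal (fun y hy => by_contra fun h => hy (by
    simp [hUd, χ0' y h])) isClosed_closedBall
  have tU' : tsupport U ⊆ ball 0 r := tU.trans (closedBall_subset_ball (by linarith))
  have cU : HasCompactSupport U := (isCompact_closedBall _ _).of_isClosed_subset (isClosed_tsupport _) tU
  have hU : ContDiff ℝ 1 U := glob_C fun y hy =>
    ((hχ.of_le (leI 1)).contDiffOn.smul hu).contDiffAt (o.mem_nhds (tU' hy))
  have eU : ∀ y ∈ ball o3 (r/2), U y = u y := fun y hy => by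
    simp [hUd, χ1 y (mem_ball_zero_iff.1 hy).le]
  have r4 : 0 < r/4 := by linarith
  have := lim_C hmu hlam 3 (ρ := r/8) (r := r/4) (by linarith) (by linarith) (f := fun n => mo (bt (r/4) r4 n) U) (F := U)
    (fun n => (mo_C _ hU.continuous).contDiffOn) (fun n => mo_Sf r4 hU cU (fun v h1 h2 h3 => ?_) (bt_lt _ _ n))
    (mo_unif (r/4) r4 hU.continuous cU).tendstoUniformlyOn
  · exact this.congr fun y hy => (eU y (ball_subset_ball (by linarith) hy)).symm
  · rw [show 2 * (r/4) = r/2 by ring] at h3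
    rw [← hw v h1 h2 (h3.trans (ball_subset_ball (by linarith)))]
    refine integral_congr_ae (ae_of_all _ fun y => ?_)
    by_cases hy : y ∈ ball o3 (r/2)
    · simp only [EventuallyEq.fderiv_eq (eventually_of_mem (isOpen_ball.mem_nhds hy) eU)]
    · simp only [test_out h3 hy, map_zero]
abbrev Om (C : Set E3) : Set E3 := lowerHalf \ closure C
lemma Om_open (C : Set E3) : IsOpen (Om C) :=
  (show IsOpen (Hs 0) from Hs_open 0).sdiff isClosed_closure
def trL : M3 →L[ℝ] ℝ := ∑ i, (EuclideanSpace.proj i : E3 →L[ℝ] ℝ).comp (ContinuousLinearMap.apply ℝ E3 (ee i))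
lemma trL_app (A : M3) : trL A = trc A := by simp [trL, trc]
lemma conv_test {S : Set E3} {H : E3 → M3 →L[ℝ] ℝ} (hH : AEStronglyMeasurable H (volume.restrict S)) (nH : N2 H S ≠ ⊤)
    {v : E3 → E3} (hv : ContDiff ℝ 1 v) (cv : HasCompactSupport v) :
    Tendsto (fun n => ∫ y in S, H y (Df (mo (bt 1 one_pos n) v) y)) atTop (𝓝 (∫ y in S, H y (Df v y))) := by
  have cD := hv.continuous_fderiv one_ne_zero
  obtain ⟨M, hM⟩ := cD.bounded_above_of_compact_support (cv.fderiv ℝ)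
  obtain ⟨R, hR⟩ := (cv.fderiv ℝ).isCompact.isBounded.subset_closedBall o3
  have hR' : ∀ x, R < ‖x‖ → Df v x = 0 := fun x hx => image_eq_zero_of_notMem_tsupport fun h => by
    have := mem_closedBall_zero_iff.1 (hR h); linarith
  set ind : E3 → ℝ := (closedBall o3 (R+1)).indicator fun _ => 3 * M with hind
  have mi : Measurable ind := measurable_const.indicator measurableSet_closedBall
  have bnd : ∀ n x, ‖Df (mo (bt 1 one_pos n) v) x‖ ≤ ind x := fun n x => by
    rw [mo_fd _ hv cv, hind]
    by_cases hx : x ∈ closedBall o3 (R+1)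
    · rw [indicator_of_mem hx]
      have := mo_near (bt 1 one_pos n) cD (x := x) (ε := 2 * M) fun y _ => by
        rw [dist_eq_norm]; linarith [norm_sub_le (Df v y) (Df v x), hM x, hM y]
      rw [dist_eq_norm] at this
      linarith [norm_le_norm_add_norm_sub' (mo (bt 1 one_pos n) (Df v) x) (Df v x), hM x]
    · rw [indicator_of_notMem hx, mo_supp _ hR' (by
        have := bt_lt 1 one_pos n
        rw [mem_closedBall_zero_iff, not_le] at hx; linarith), norm_zero]
  have ni : ∫⁻ y in S, ‖ind y‖ₑ^2 ≠ ⊤ := by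
    refine ne_top_of_le_ne_top ?_ (lintegral_mono' Measure.restrict_le_self le_rfl)
    rw [hind, lint_ind _ measurableSet_closedBall]
    exact ne_top_of_le_ne_top (ENNReal.mul_ne_top ENNReal.ofReal_ne_top measure_closedBall_lt_top.ne)
      (N2_bdd measurableSet_closedBall (M := ‖3 * M‖) fun y _ => le_rfl)
  have ib := (memLp_of hH nH).norm.integrable_mul (memLp_of mi.aestronglyMeasurable ni)
  refine tendsto_integral_of_dominated_convergence _ (fun n => ?_) ib (fun n => ae_of_all _ fun x => ?_) (ae_of_all _ fun x => ?_)
  · exact isBoundedBilinearMap_apply.continuous.comp_aestronglyMeasurable (hH.prodMk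
      ((mo_C (bt 1 one_pos n) hv.continuous).continuous_fderiv (by simp)).aestronglyMeasurable)
  · exact ((H x).le_opNorm _).trans (mul_le_mul_of_nonneg_left (bnd n x) (norm_nonneg _))
  · simp only [mo_fd _ hv cv]
    exact ((H x).continuous.tendsto _).comp (ContDiffBump.convolution_tendsto_right_of_continuous (bt_tt 1 one_pos) cD x)
def Sol (lam mu p : ℝ) (C : Set E3) (u : E3 → E3) : Prop :=
  ContDiffOn ℝ 1 u (Om C) ∧ ∫⁻ y in Om C, eO ((1+‖y‖^2)⁻¹) * ‖u y‖ₑ^2 ≠ ⊤ ∧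
  N2 (Df u) (Om C) ≠ ⊤ ∧ ∀ v, ContDiff ℝ 1 v → HasCompactSupport v →
    ∫ y in Om C, bil lam mu (Df u y) (Df v y) = -p * ∫ y in C, trc (Df v y)
lemma frob_hs (u : E3 → E3) (x : E3) : frob2 (jac u x) = hs (Df u x) := by
  rw [hs_coord, Finset.sum_comm]; rfl
lemma weak1 {lam mu p : ℝ} (bC : Bornology.IsBounded C)
    (h : IsWeakSolution lam mu p C u) : Sol lam mu p C u := by
  obtain ⟨h1, h2, h3, h4⟩ := h
  have o := Om_open C
  have m := o.measurableSet
  have mD : AEStronglyMeasurable (Df u) (volume.restrict (Om C)) := (sm_fd o h1).aestronglyMeasurable m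
  have nD : N2 (Df u) (Om C) ≠ ⊤ := by
    refine ne_top_of_le_ne_top h3.lintegral_lt_top.ne (lintegral_mono fun y => ?_)
    rw [frob_hs, ← ofReal_norm, ← ENNReal.ofReal_pow (norm_nonneg _)]
    exact ENNReal.ofReal_le_ofReal (op_le_hs _)
  refine ⟨h1, ?_, nD, fun v hv cv => ?_⟩
  · refine ne_top_of_le_ne_top h2.lintegral_lt_top.ne (lintegral_mono fun y => ?_)
    rw [← ofReal_norm, ← ENNReal.ofReal_pow (norm_nonneg _), ← ENNReal.ofReal_mul (by positivity), div_eq_inv_mul]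
  · have t1 := conv_test (H := fun y => bil lam mu (Df u y)) ((bil lam mu).continuous.comp_aestronglyMeasurable mD)
      (ne_top_of_le_ne_top (ENNReal.mul_ne_top ENNReal.ofReal_ne_top nD)
        (N2_le m (c := ‖bil lam mu‖) fun y _ => (bil lam mu).le_opNorm _)) hv cv
    have t2 := conv_test (S := C) (H := fun _ => trL) aestronglyMeasurable_const (by
      simp only [N2, lintegral_const, Measure.restrict_apply_univ]
      exact ENNReal.mul_ne_top (by finiteness) bC.measure_lt_top.ne) hv cv
    simp only [trL_app] at t2
    refine tendsto_nhds_unique t1 ((t2.const_mul (-p)).congr fun n => ?_)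
    have := h4 (mo (bt 1 one_pos n) v) (mo_C _ hv.continuous)
      ((bt 1 one_pos n).hasCompactSupport_normed.convolution _ cv)
    refine Eq.trans ?_ (this.symm.trans ?_)
    · rfl
    · refine integral_congr_ae (ae_of_all _ fun y => ?_)
      simp only [bil_apply, divg, strain, jac, trc, Fin.sum_univ_three]
      ring
lemma Sol.C3 {lam mu p : ℝ} (hmu : 0 < mu) (hlam : 0 < 3 * lam + 2 * mu)
    (h : Sol lam mu p C u) : ContDiffOn ℝ 3 u (Om C) := by
  intro x hx
  obtain ⟨r, r0, hr⟩ := Metric.isOpen_iff.1 (Om_open C) x hx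
  have m1 : MapsTo (fun y => y + x) (ball 0 r) (Om C) := fun y hy => hr (by simpa using hy)
  have e1 : ∀ y, Df (fun y => u (y + x)) y = Df u (y + x) := fun y => fderiv_comp_add_right x
  have := int_reg hmu hlam r0 (u := fun y => u (y + x)) (h.1.comp (contDiff_id.add contDiff_const).contDiffOn m1)
    (fun v h1 h2 h3 => ?_)
  · have h5 : ContDiffAt ℝ 3 ((fun y => u (y + x)) ∘ fun z => z - x) x :=
      ContDiffAt.comp x (by rw [sub_self]; exact this.contDiffAt (ball_mem_nhds 0 (by linarith)))
        (contDiff_id.sub contDiff_const).contDiffAt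
    simpa [Function.comp_def] using h5.contDiffWithinAt
  · set V : E3 → E3 := fun z => v (z + -x) with hV
    have eV : ∀ z, Df V z = Df v (z + -x) := fun z => fderiv_comp_add_right (-x)
    have zV : ∀ z, z ∉ Om C → Df V z = 0 := fun z hz => by
      rw [eV]; exact test_out h3 fun h' => hz (by simpa using m1 h')
    have := h.2.2.2 V ((h1.of_le (leI 1)).comp (contDiff_id.add contDiff_const))
      (h2.comp_homeomorph (Homeomorph.addRight (-x)))
    rw [setIntegral_eq_zero_of_forall_eq_zero (t := C) fun z hz => by
      rw [zV z fun h' => h'.2 (subset_closure hz)]; simp [trc], mul_zero,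
      setIntegral_eq_integral_of_forall_compl_eq_zero fun z hz => by rw [zV z hz, map_zero]] at this
    rw [← this]
    refine Eq.trans ?_ (integral_add_right_eq_self (fun z => bil lam mu (Df u z) (Df V z)) x)
    simp only [e1, eV, add_neg_cancel_right]
structure Pch (O : Set E3) (ε K r : ℝ) (x : E3) (S : E3 ≃ₗᵢ[ℝ] E3) (g : E3 → ℝ) (s : ℝ) : Prop where
  s0 : 0 ≤ s
  gC : ContDiff ℝ 3 g
  g0 : g 0 = 0
  gi : ∀ y (t : ℝ), g (y + t • ee 2) = g y
  g1 : ∀ i, ∀ y ∈ ball o3 r, |dd i g y| ≤ ε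
  g2 : ∀ i j, ∀ y ∈ ball o3 r, |dd i (dd j g) y| ≤ K
  g3 : ∀ i j k, ∀ y ∈ ball o3 r, |dd i (dd j (dd k g)) y| ≤ K
  mem : ∀ y ∈ ball o3 r, (x + S y ∈ O ↔ y 2 < s + g y)
def Th (x : E3) (S : E3 ≃ₗᵢ[ℝ] E3) (g : E3 → ℝ) (y : E3) : E3 := x + S (y + g y • ee 2)
def Xi (x : E3) (S : E3 ≃ₗᵢ[ℝ] E3) (g : E3 → ℝ) (z : E3) : E3 := S.symm (z - x) - g (S.symm (z - x)) • ee 2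
def rk (l : E3 →L[ℝ] ℝ) : M3 := l.smulRight (ee 2)
def Lm (g : E3 → ℝ) (y : E3) : M3 := ContinuousLinearMap.id ℝ E3 - rk (Df g y)
def Jm (g : E3 → ℝ) (y : E3) : M3 := ContinuousLinearMap.id ℝ E3 + rk (Df g y)
abbrev Sc (S : E3 ≃ₗᵢ[ℝ] E3) : M3 := S.toContinuousLinearEquiv.toContinuousLinearMap
namespace Pch
variable {O : Set E3} {ε K r : ℝ} {x : E3} {S : E3 ≃ₗᵢ[ℝ] E3} {g : E3 → ℝ} {s : ℝ}
local notation "PP" => Pch O ε K r x S g s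
lemma gd2 (h : PP) (y : E3) : Df g y (ee 2) = 0 := by
  have h1 := (h.gC.differentiable (by simp) y).hasFDerivAt
  have h2 : HasDerivAt (fun t : ℝ => y + t • ee 2) (ee 2) 0 := by
    simpa using ((hasDerivAt_id (0:ℝ)).smul_const (ee 2)).const_add y
  have h3 : HasDerivAt (fun t : ℝ => g (y + t • ee 2)) (Df g y (ee 2)) 0 := by
    have : HasFDerivAt g (Df g y) (y + (0:ℝ) • ee 2) := by simpa using h1
    exact this.comp_hasDerivAt (0:ℝ) h2
  simp only [h.gi] at h3
  exact h3.unique (hasDerivAt_const _ _)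
lemma JL (h : PP) (y : E3) : (Jm g y).comp (Lm g y) = ContinuousLinearMap.id ℝ E3 := by
  ext1 z
  simp [Jm, Lm, rk, h.gd2 y]
lemma ThXi (h : PP) (z : E3) : Th x S g (Xi x S g z) = z := by
  have : g (Xi x S g z) = g (S.symm (z - x)) := by
    rw [Xi, sub_eq_add_neg, ← neg_smul, h.gi]
  rw [Th, this, Xi]; simp
lemma XiTh (h : PP) (y : E3) : Xi x S g (Th x S g y) = y := by
  simp [Xi, Th, ← map_smul, ← map_add, h.gi]
lemma Th_fd (h : PP) (y : E3) : HasFDerivAt (Th x S g) ((Sc S).comp (Jm g y)) y := by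
  have h1 := (h.gC.differentiable (by simp) y).hasFDerivAt
  have h2 := (Sc S).hasFDerivAt.comp y ((hasFDerivAt_id y).add (h1.smul_const (ee 2)))
  exact h2.const_add x
lemma Th_C (h : PP) : ContDiff ℝ 3 (Th x S g) :=
  contDiff_const.add ((Sc S).contDiff.comp (contDiff_id.add (h.gC.smul contDiff_const)))
lemma Xi_C (h : PP) : ContDiff ℝ 3 (Xi x S g) := by
  have : ContDiff ℝ 3 fun z => S.symm (z - x) := (Sc S.symm).contDiff.comp (contDiff_id.sub contDiff_const)
  exact this.sub ((h.gC.comp this).smul contDiff_const)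
lemma lip (h : PP) {y z : E3} (hy : y ∈ ball o3 r) (hz : z ∈ ball o3 r) :
    |g y - g z| ≤ 3 * ε * ‖y - z‖ := by
  refine (convex_ball o3 r).norm_image_sub_le_of_norm_fderiv_le (fun w _ => h.gC.differentiable (by simp) w)
    (fun w hw => (nrm_basis _).trans ?_) hz hy
  have := h.g1 0 w hw
  have := h.g1 1 w hw
  have := h.g1 2 w hw
  simp only [dd] at *
  simp only [Fin.sum_univ_three, Real.norm_eq_abs]; linarith
lemma gsm (h : PP) (he : ε ≤ 1/72) (hy : y ∈ ball o3 r) : |g y| ≤ ‖y‖ / 24 := by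
  have h0 : o3 ∈ ball o3 r := mem_ball_self (pos_of_mem_ball hy)
  have := h.lip hy h0
  rw [h.g0, sub_zero, sub_zero] at this
  nlinarith [norm_nonneg y]
lemma mp (h : PP) : MeasurePreserving (Th x S g) volume volume := by
  have mt : Measurable (Th x S g) := h.Th_C.continuous.measurable
  have mT : MeasurePreserving (fun y : E3 => y + g y • ee 2) volume volume := by
    have hc : ContDiff ℝ 3 fun y : E3 => y + g y • ee 2 := contDiff_id.add (h.gC.smul contDiff_const)
    refine ⟨hc.continuous.measurable, Measure.ext fun A hA => ?_⟩
    rw [Measure.map_apply hc.continuous.measurable hA]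
    set B := (fun y : E3 => y + g y • ee 2) ⁻¹' A with hB
    have inj : Function.Injective fun y : E3 => y + g y • ee 2 := fun y z hyz => by
      have e : g y = g z := by rw [← h.gi y (g y), ← h.gi z (g z)]; exact congrArg g hyz
      simp only [e, add_left_inj] at hyz; exact hyz
    have im : (fun y : E3 => y + g y • ee 2) '' B = A := image_preimage_eq _ fun z =>
      ⟨z + (-g z) • ee 2, by simp only [h.gi]; simp⟩
    have := lintegral_abs_det_fderiv_eq_addHaar_image volume (s := B) (hc.continuous.measurable hA)
      (f := fun y : E3 => y + g y • ee 2) (f' := Jm g) (fun y _ => ((hasFDerivAt_id y).add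
        ((h.gC.differentiable (by simp) y).hasFDerivAt.smul_const (ee 2))).hasFDerivWithinAt) inj.injOn
    rw [im] at this
    rw [← this]
    have dt : ∀ y, (Jm g y).det = 1 := fun y => by
      have := LinearMap.transvection.det ((Df g y : E3 →L[ℝ] ℝ) : E3 →ₗ[ℝ] ℝ) (ee 2)
      rw [ContinuousLinearMap.coe_coe, h.gd2 y, add_zero] at this
      rw [← this, ContinuousLinearMap.det]
      congr 1
    simp [dt]
  have := (measurePreserving_add_left volume x).comp (S.measurePreserving.comp mT)
  exact this
lemma emb (h : PP) : MeasurableEmbedding (Th x S g) :=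
  h.Th_C.continuous.measurableEmbedding (Function.LeftInverse.injective h.XiTh)
lemma Th_in (h : PP) (he : ε ≤ 1/72) (hy : y ∈ ball o3 (r/2)) :
    y + g y • ee 2 ∈ ball o3 r := by
  rw [mem_ball_zero_iff] at *
  have := h.gsm he (y := y) (by rw [mem_ball_zero_iff]; linarith [norm_nonneg y])
  refine (norm_add_le _ _).trans_lt ?_
  rw [norm_smul, (by simp : ‖ee 2‖ = 1), mul_one, Real.norm_eq_abs]
  linarith [norm_nonneg y]
lemma Th_mem (h : PP) (he : ε ≤ 1/72) (hy : y ∈ ball o3 (r/2)) :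
    Th x S g y ∈ O ↔ y 2 < s := by
  rw [Th, h.mem _ (h.Th_in he hy), h.gi]
  simp
lemma Th_ball (h : PP) (he : ε ≤ 1/72) (hy : y ∈ ball o3 (r/2)) :
    Th x S g y ∈ ball x r := by
  have := h.Th_in he hy
  rw [mem_ball_zero_iff] at this
  rw [Th, mem_ball, dist_eq_norm, add_sub_cancel_left, S.norm_map]; exact this
lemma Xi_ball (h : PP) (he : ε ≤ 1/72) {t : ℝ} (ht : t ≤ r) {z : E3} (hz : z ∈ ball x t) :
    ‖Xi x S g z‖ ≤ 2 * ‖z - x‖ := by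
  have e : ‖S.symm (z - x)‖ = ‖z - x‖ := S.symm.norm_map _
  have hz' : ‖z - x‖ < t := by rwa [mem_ball, dist_eq_norm] at hz
  have := h.gsm he (y := S.symm (z - x)) (by rw [mem_ball_zero_iff, e]; linarith)
  rw [Xi]
  refine (norm_sub_le _ _).trans ?_
  rw [norm_smul, (by simp : ‖ee 2‖ = 1), mul_one, Real.norm_eq_abs]
  rw [e] at *
  linarith [norm_nonneg (z-x)]
end Pch
set_option maxSynthPendingDepth 4
lemma trc_tr (A : M3) : trc A = LinearMap.trace ℝ E3 (A : E3 →ₗ[ℝ] E3) := by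
  rw [LinearMap.trace_eq_sum_inner _ (EuclideanSpace.basisFun (Fin 3) ℝ)]
  simp [trc, EuclideanSpace.inner_single_left]
def cj (S : E3 ≃ₗᵢ[ℝ] E3) (X : M3) : M3 := (Sc S).comp (X.comp (Sc S.symm))
lemma cj_app (S : E3 ≃ₗᵢ[ℝ] E3) (X : M3) (y : E3) : cj S X y = S (X (S.symm y)) := rfl
lemma trc_cj (S : E3 ≃ₗᵢ[ℝ] E3) (X : M3) : trc (cj S X) = trc X := by
  rw [trc_tr, trc_tr]
  exact LinearMap.trace_conj' (X : E3 →ₗ[ℝ] E3) S.toLinearEquiv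
lemma bil_tr (lam mu : ℝ) (A B : M3) : bil lam mu A B = lam * trc A * trc B +
    mu * (trc ((ContinuousLinearMap.adjoint A).comp B) + trc (B.comp A)) := by
  have e1 : ∀ A B : M3, trc (B.comp A) = ∑ j, ∑ i, A (ee j) i * B (ee i) j := fun A B => by
    unfold trc
    refine Finset.sum_congr rfl fun j _ => ?_
    have hx : A (ee j) = ∑ k, A (ee j) k • ee k := by
      ext i; fin_cases i <;> simp [Fin.sum_univ_three, ee]
    rw [ContinuousLinearMap.comp_apply]
    conv_lhs => rw [hx, map_sum]
    simp
  rw [bil_apply, e1, e1]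
  simp only [Fin.sum_univ_three, adj_coord]; ring
lemma cj_bil (lam mu : ℝ) (S : E3 ≃ₗᵢ[ℝ] E3) (A B : M3) : bil lam mu (cj S A) (cj S B) = bil lam mu A B := by
  have e1 : ContinuousLinearMap.adjoint (cj S A) = cj S (ContinuousLinearMap.adjoint A) := by
    refine ContinuousLinearMap.ext fun y => ext_inner_left ℝ fun z => ?_
    rw [ContinuousLinearMap.adjoint_inner_right, cj_app, cj_app]
    rw [← S.symm.inner_map_map, ← S.symm.inner_map_map z]
    simp [ContinuousLinearMap.adjoint_inner_right]
  have e2 : ∀ A B : M3, (cj S A).comp (cj S B) = cj S (A.comp B) := fun A B => by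
    ext1 y; simp [cj_app]
  rw [bil_tr, bil_tr, e1, e2, e2]; simp only [trc_cj]
lemma bil_id (lam mu c : ℝ) (B : M3) : bil lam mu (c • ContinuousLinearMap.id ℝ E3) B = c * (3 * lam + 2 * mu) * trc B := by
  rw [bil_apply]
  simp [trc, Fin.sum_univ_three]; ring
def Qd (lam mu : ℝ) : M3 →L[ℝ] M3 →L[ℝ] BB :=
  LinearMap.toContinuousBilinearMap (LinearMap.mk₂ ℝ
    (fun N N' : M3 => (bil lam mu).bilinearComp (ContinuousLinearMap.precomp E3 N) (ContinuousLinearMap.precomp E3 N'))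
    (by intros; ext X Y; simp [ContinuousLinearMap.comp_add])
    (by intros; ext X Y; simp [ContinuousLinearMap.comp_smul])
    (by intros; ext X Y; simp [ContinuousLinearMap.comp_add])
    (by intros; ext X Y; simp [ContinuousLinearMap.comp_smul]))
lemma Qd_app (lam mu : ℝ) (N N' X Y : M3) : Qd lam mu N N' X Y = bil lam mu (X.comp N) (Y.comp N') := rfl
def Bg (lam mu : ℝ) (g : E3 → ℝ) (y : E3) : BB := Qd lam mu (Lm g y) (Lm g y)
lemma rk_norm (l : E3 →L[ℝ] ℝ) : ‖rk l‖ = ‖l‖ := by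
  simp [rk, ContinuousLinearMap.norm_smulRight_apply]
section
variable {V : Type*} [NormedAddCommGroup V] [NormedSpace ℝ V]
lemma dd_Q (Q : M3 →L[ℝ] M3 →L[ℝ] V) {f h : E3 → M3} (k : Fin 3) (hf : ContDiff ℝ 1 f) (hh : ContDiff ℝ 1 h) :
    dd k (fun y => Q (f y) (h y)) = fun y => Q (dd k f y) (h y) + Q (f y) (dd k h y) := by
  funext y
  have df := hf.differentiable one_ne_zero y
  have dq : DifferentiableAt ℝ (fun y => Q (f y)) y := Q.differentiableAt.comp y df
  rw [dd_app dq (hh.differentiable one_ne_zero y)]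
  congr 2
  have : HasFDerivAt (fun y => Q (f y)) (Q.comp (Df f y)) y := Q.hasFDerivAt.comp y df.hasFDerivAt
  unfold dd
  rw [this.fderiv]; rfl
lemma dd_add {f h : E3 → V} (j : Fin 3) (hf : ContDiff ℝ 1 f)
    (hh : ContDiff ℝ 1 h) (y : E3) : dd j (fun y => f y + h y) y = dd j f y + dd j h y := by
  unfold dd
  rw [fderiv_fun_add (hf.differentiable one_ne_zero y) (hh.differentiable one_ne_zero y)]; rfl
lemma Q_le (Q : M3 →L[ℝ] M3 →L[ℝ] V) {N N' : M3} {a b : ℝ} (h : ‖N‖ ≤ a) (h' : ‖N'‖ ≤ b) : ‖Q N N'‖ ≤ ‖Q‖ * a * b :=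
  (Q.le_opNorm₂ N N').trans (by have := (norm_nonneg N).trans h; gcongr)
lemma Q_gen (Q : M3 →L[ℝ] M3 →L[ℝ] V) {L : E3 → M3} (LC : ContDiff ℝ 2 L) {ε K : ℝ} (hK : 0 ≤ K)
    (a : ‖L y - ContinuousLinearMap.id ℝ E3‖ ≤ 3 * ε) (he : ε ≤ 1/72) (b : ∀ k, ‖dd k L y‖ ≤ 3 * K)
    (c : ∀ j k, ‖dd j (dd k L) y‖ ≤ 3 * K) :
    ‖Q (L y) (L y) - Q (ContinuousLinearMap.id ℝ E3) (ContinuousLinearMap.id ℝ E3)‖ ≤ ‖Q‖ * (9 * ε) ∧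
    ‖Df (fun y => Q (L y) (L y)) y‖ ≤ ‖Q‖ * (3*K) * 2 * 6 + (‖Q‖ * (3*K) * 2 * 2 + ‖Q‖ * (3*K) * (3*K)*2) ∧
    ∀ j k, ‖dd j (dd k fun y => Q (L y) (L y)) y‖ ≤
      ‖Q‖ * (3*K) * 2 * 6 + (‖Q‖ * (3*K) * 2 * 2 + ‖Q‖ * (3*K) * (3*K)*2) := by
  set q := ‖Q‖ with hq
  have q0 : 0 ≤ q := by rw [hq]; positivity
  have LC1 := LC.of_le (m := 1) (by norm_num)
  have dC : ∀ k, ContDiff ℝ 1 (dd k L) := fun k => (LC.fderiv_right (m := 1) (by norm_num)).clm_apply contDiff_const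
  have dB : ∀ k, dd k (fun y => Q (L y) (L y)) = _ := fun k => dd_Q Q k LC1 LC1
  have L1 : ‖ContinuousLinearMap.id ℝ E3‖ ≤ 1 := ContinuousLinearMap.norm_id_le
  have L2 : ‖L y‖ ≤ 2 := by
    have := norm_add_le (L y - ContinuousLinearMap.id ℝ E3) (ContinuousLinearMap.id ℝ E3)
    rw [sub_add_cancel] at this
    linarith
  have qC : ∀ {f k : E3 → M3}, ContDiff ℝ 1 f → ContDiff ℝ 1 k → ContDiff ℝ 1 fun y => Q (f y) (k y) :=
    fun hf hk => (Q.contDiff.comp hf).clm_apply hk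
  have hk1 : ∀ k, ‖dd k (fun y => Q (L y) (L y)) y‖ ≤ q * (3*K) * 2 * 2 := fun k => by
    rw [dB]
    refine (norm_add_le _ _).trans ?_
    have := Q_le Q (b k) L2
    have := Q_le Q L2 (b k)
    linarith
  have n1 : 0 ≤ q * (3*K) := by positivity
  have n2 : 0 ≤ q * (3*K) * (3*K)*2 := by positivity
  refine ⟨?_, ?_, fun j k => ?_⟩
  · have e : Q (L y) (L y) - Q (ContinuousLinearMap.id ℝ E3) (ContinuousLinearMap.id ℝ E3) =
        Q (L y - ContinuousLinearMap.id ℝ E3) (L y) +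
        Q (ContinuousLinearMap.id ℝ E3) (L y - ContinuousLinearMap.id ℝ E3) := by simp
    rw [e]
    refine (norm_add_le _ _).trans ?_
    have := Q_le Q a L2
    have := Q_le Q L1 a
    linarith
  · refine (nrm_basis _).trans ?_
    have h0 := hk1 0
    have h1 := hk1 1
    have h2 := hk1 2
    unfold dd at h0 h1 h2
    simp only [Fin.sum_univ_three]
    linarith
  · rw [dB, dd_add j (qC (dC k) LC1) (qC LC1 (dC k)), dd_Q Q j (dC k) LC1, dd_Q Q j LC1 (dC k)]
    have h1 := Q_le Q (c j k) L2
    have h2 := Q_le Q L2 (c j k)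
    have h3 := Q_le Q (b j) (b k)
    have h4 := Q_le Q (b k) (b j)
    refine (norm_add_le _ _).trans ?_
    refine (add_le_add (norm_add_le _ _) (norm_add_le _ _)).trans ?_
    linarith
end
def rkL : (E3 →L[ℝ] ℝ) →L[ℝ] M3 := (ContinuousLinearMap.smulRightL ℝ E3 E3).flip (ee 2)
namespace Pch
variable {O : Set E3} {ε K r : ℝ} {x : E3} {S : E3 ≃ₗᵢ[ℝ] E3} {g : E3 → ℝ} {s : ℝ}
local notation "PP" => Pch O ε K r x S g s
lemma Lm_C (h : PP) : ContDiff ℝ 2 (Lm g) :=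
  contDiff_const.sub (rkL.contDiff.comp (h.gC.fderiv_right (m := 2) (by norm_num)))
lemma Lm_d (h : PP) (k : Fin 3) : dd k (Lm g) = fun y => -rkL (Df (dd k g) y) := by
  funext y
  have d := ((h.gC.fderiv_right (m := 2) (by norm_num)).differentiable (by simp)) y
  rw [fd_dd isOpen_univ (h.gC.of_le (by norm_num)).contDiffOn (mem_univ y)]
  unfold dd
  have : HasFDerivAt (Lm g) (-(rkL.comp (Df (Df g) y))) y :=
    (rkL.hasFDerivAt.comp y d.hasFDerivAt).const_sub _
  rw [this.fderiv]; rfl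
lemma Lm_b (h : PP) (hy : y ∈ ball o3 r) :
    ‖Lm g y - ContinuousLinearMap.id ℝ E3‖ ≤ 3 * ε ∧ (∀ k, ‖dd k (Lm g) y‖ ≤ 3 * K) ∧
    ∀ j k, ‖dd j (dd k (Lm g)) y‖ ≤ 3 * K := by
  refine ⟨?_, fun k => ?_, fun j k => ?_⟩
  · rw [Lm, sub_right_comm, sub_self, zero_sub, norm_neg, rk_norm]
    refine (nrm_basis _).trans ?_
    have a := h.g1 0 y hy
    have b := h.g1 1 y hy
    have c := h.g1 2 y hy
    simp only [dd] at a b c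
    simp only [Fin.sum_univ_three, Real.norm_eq_abs]; linarith
  · rw [h.Lm_d, norm_neg]
    refine (rk_norm _).le.trans ((nrm_basis _).trans ?_)
    have a := h.g2 0 k y hy
    have b := h.g2 1 k y hy
    have c := h.g2 2 k y hy
    unfold dd at a b c ⊢
    simp only [Fin.sum_univ_three, Real.norm_eq_abs]; linarith
  · have hc : ContDiff ℝ 2 (dd k g) := (h.gC.fderiv_right (m := 2) (by norm_num)).clm_apply contDiff_const
    have d := ((hc.fderiv_right (m := 1) (by norm_num)).differentiable (by simp)) y
    have e : dd j (dd k (Lm g)) y = - rkL (Df (dd j (dd k g)) y) := by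
      have : HasFDerivAt (fun y => -rkL (Df (dd k g) y)) (-(rkL.comp (Df (Df (dd k g)) y))) y :=
        (rkL.hasFDerivAt.comp y d.hasFDerivAt).fun_neg
      rw [h.Lm_d, fd_dd isOpen_univ hc.contDiffOn (mem_univ y), show dd j (fun y => -rkL (Df (dd k g) y)) y =
        Df (fun y => -rkL (Df (dd k g) y)) y (ee j) from rfl, this.fderiv]; rfl
    rw [e, norm_neg]
    refine (rk_norm _).le.trans ((nrm_basis _).trans ?_)
    have a := h.g3 0 j k y hy
    have b := h.g3 1 j k y hy
    have c := h.g3 2 j k y hy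
    unfold dd at a b c ⊢
    simp only [Fin.sum_univ_three, Real.norm_eq_abs]; linarith
end Pch
def eps1 (lam mu : ℝ) : ℝ := min (1/72) (eps0 lam mu / (9 * ‖Qd lam mu‖ + 1))
lemma eps0_pos (hmu : 0 < mu) (hlam : 0 < 3 * lam + 2 * mu) : 0 < eps0 lam mu := by
  have : 0 < cc0 lam mu := lt_min (by linarith) hlam
  unfold eps0; positivity
lemma eps1_pos (hmu : 0 < mu) (hlam : 0 < 3 * lam + 2 * mu) : 0 < eps1 lam mu :=
  lt_min (by norm_num) (div_pos (eps0_pos hmu hlam) (by positivity))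
lemma Bg_Gd (hmu : 0 < mu) (hlam : 0 < 3 * lam + 2 * mu) {K r : ℝ} (hK : 0 ≤ K) : ∃ K' : ℝ≥0,
    ∀ O x S g s, Pch O (eps1 lam mu) K r x S g s → Gd lam mu s r K' (Bg lam mu g) := by
  set q := ‖Qd lam mu‖ with hq
  have q0 : 0 ≤ q := by rw [hq]; positivity
  refine ⟨Real.toNNReal (q * (3*K) * 2 * 6 + (q * (3*K) * 2 * 2 + q * (3*K) * (3*K)*2)), fun O x S g s h => ?_⟩
  have e1 : eps1 lam mu ≤ 1/72 := min_le_left _ _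
  have e0 := eps1_pos hmu hlam
  have e2 : eps1 lam mu * (9 * q + 1) ≤ eps0 lam mu := by
    have := min_le_right (1/72) (eps0 lam mu / (9 * q + 1))
    rwa [le_div_iff₀ (by positivity)] at this
  have gen : ∀ y ∈ DD s r, _ := fun y hy => Q_gen (Qd lam mu) h.Lm_C hK (h.Lm_b hy.2).1 e1 (h.Lm_b hy.2).2.1 (h.Lm_b hy.2).2.2
  refine ⟨(((Qd lam mu).contDiff.comp h.Lm_C).clm_apply h.Lm_C).contDiffOn, fun y hy => ?_, fun y hy =>
    (gen y hy).2.1.trans (Real.le_coe_toNNReal _), fun j k y hy => ((gen y hy).2.2 j k).trans (Real.le_coe_toNNReal _)⟩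
  exact (gen y hy).1.trans (by linarith)
set_option maxSynthPendingDepth 3
def pb (x : E3) (S : E3 ≃ₗᵢ[ℝ] E3) (g : E3 → ℝ) (f : E3 → E3) (y : E3) : E3 := S.symm (f (Th x S g y))
lemma Om_ne_meas (C : Set E3) : MeasurableSet (Om C) := (Om_open C).measurableSet
namespace Pch
variable {O : Set E3} {ε K r : ℝ} {x : E3} {S : E3 ≃ₗᵢ[ℝ] E3} {g : E3 → ℝ} {s : ℝ}
local notation "PP" => Pch O ε K r x S g s
lemma pb_fd (h : PP) {f : E3 → E3} (hf : DifferentiableAt ℝ f (Th x S g y)) :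
    HasFDerivAt (pb x S g f) ((Sc S.symm).comp ((Df f (Th x S g y)).comp ((Sc S).comp (Jm g y)))) y :=
  (Sc S.symm).hasFDerivAt.comp y (hf.hasFDerivAt.comp y (h.Th_fd y))
lemma pb_L (h : PP) {f : E3 → E3} (hf : DifferentiableAt ℝ f (Th x S g y)) :
    (Df (pb x S g f) y).comp (Lm g y) = cj S.symm (Df f (Th x S g y)) := by
  rw [(h.pb_fd hf).fderiv]
  have := h.JL y
  ext1 z
  have := congrArg (fun A : M3 => A z) this
  simp only [ContinuousLinearMap.comp_apply, ContinuousLinearMap.id_apply] at this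
  simp only [ContinuousLinearMap.comp_apply, this]; rfl
lemma pb_B (h : PP) {f V : E3 → E3} (hf : DifferentiableAt ℝ f (Th x S g y))
    (hV : DifferentiableAt ℝ V (Th x S g y)) :
    Bg lam mu g y (Df (pb x S g f) y) (Df (pb x S g V) y) =
      bil lam mu (Df f (Th x S g y)) (Df V (Th x S g y)) := by
  rw [Bg, Qd_app, h.pb_L hf, h.pb_L hV, cj_bil]
lemma Jm_le (h : PP) (he : ε ≤ 1/72) (hy : y ∈ ball o3 r) : ‖Jm g y‖ ≤ 2 := by
  have h1 := (h.Lm_b hy).1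
  have h2 : Jm g y = ContinuousLinearMap.id ℝ E3 - (Lm g y - ContinuousLinearMap.id ℝ E3) := by
    simp [Jm, Lm]
  have h3 : ‖ContinuousLinearMap.id ℝ E3‖ ≤ 1 := ContinuousLinearMap.norm_id_le
  rw [h2]
  linarith [norm_sub_le (ContinuousLinearMap.id ℝ E3) (Lm g y - ContinuousLinearMap.id ℝ E3)]
lemma Sc_le (S : E3 ≃ₗᵢ[ℝ] E3) : ‖Sc S‖ ≤ 1 :=
  ContinuousLinearMap.opNorm_le_bound _ zero_le_one fun z => by rw [one_mul]; exact (S.norm_map z).le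
lemma pb_le (h : PP) (he : ε ≤ 1/72) {f : E3 → E3} (hy : y ∈ ball o3 r)
    (hf : DifferentiableAt ℝ f (Th x S g y)) : ‖Df (pb x S g f) y‖ ≤ 2 * ‖Df f (Th x S g y)‖ := by
  rw [(h.pb_fd hf).fderiv]
  have h1 := h.Jm_le he hy
  calc _ ≤ ‖Sc S.symm‖ * (‖Df f (Th x S g y)‖ * (‖Sc S‖ * ‖Jm g y‖)) := by
        refine (ContinuousLinearMap.opNorm_comp_le _ _).trans ?_
        gcongr
        refine (ContinuousLinearMap.opNorm_comp_le _ _).trans ?_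
        gcongr
        exact ContinuousLinearMap.opNorm_comp_le _ _
    _ ≤ 1 * (‖Df f (Th x S g y)‖ * (1 * 2)) := by
        gcongr
        · exact Sc_le _
        · exact Sc_le _
    _ = _ := by ring
lemma Th_DD (h : PP) (he : ε ≤ 1/72) (hy : y ∈ DD s (r/2)) :
    Th x S g y ∈ O ∩ ball x r :=
  ⟨(h.Th_mem he hy.2).2 hy.1, h.Th_ball he hy.2⟩
lemma pb_C (h : PP) (he : ε ≤ 1/72) {f : E3 → E3} {n : ℕ∞ω} (hn : n ≤ 3)
    (hf : ContDiffOn ℝ n f O) : ContDiffOn ℝ n (pb x S g f) (DD s (r/2)) :=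
  (Sc S.symm).contDiff.comp_contDiffOn (hf.comp (h.Th_C.of_le hn).contDiffOn fun _ hy => (h.Th_DD he hy).1)
lemma N_comp (h : PP) (he : ε ≤ 1/72) {V : Type*} [NormedAddCommGroup V] (F : E3 → V) :
    N2 (fun y => F (Th x S g y)) (DD s (r/2)) ≤ N2 F (O ∩ ball x r) := by
  unfold N2
  rw [h.mp.setLIntegral_comp_emb h.emb (fun z => ‖F z‖ₑ^2)]
  exact lintegral_mono_set (image_subset_iff.2 fun y hy => h.Th_DD he hy)
lemma pb_N (h : PP) (he : ε ≤ 1/72) (oO : IsOpen O) {f : E3 → E3}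
    (hf : ContDiffOn ℝ 1 f O) : N2 (Df (pb x S g f)) (DD s (r/2)) ≤ eO (2^2) * N2 (Df f) (O ∩ ball x r) := by
  refine (N2_le (g := fun y => Df f (Th x S g y)) (DD_open s _).measurableSet fun y hy => ?_).trans
    (mul_le_mul_right (h.N_comp he _) _)
  have hr : y ∈ ball o3 r := ball_subset_ball (by
    have : 0 < r/2 := pos_of_mem_ball hy.2
    linarith) hy.2
  exact h.pb_le he hr (dif oO hf (h.Th_DD he hy).1)
lemma tr_int (h : PP) (he : ε ≤ 1/72) (oO : IsOpen O) {F : E3 → ℝ}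
    (hF : ∀ z ∈ O, z ∉ Th x S g '' ball 0 (r/2) → F z = 0) : ∫ z in O, F z = ∫ y in DD s (r/2), F (Th x S g y) := by
  rw [← h.mp.setIntegral_image_emb h.emb]
  refine (setIntegral_eq_of_subset_of_forall_sdiff_eq_zero oO.measurableSet
    (image_subset_iff.2 fun y hy => (h.Th_DD he hy).1) fun z hz => hF z hz.1 ?_)
  rintro ⟨y, hy, rfl⟩
  exact hz.2 ⟨y, ⟨(h.Th_mem he hy).1 hz.1, hy⟩, rfl⟩
lemma Wk_pull (h : PP) (he : ε ≤ 1/72) (oO : IsOpen O) {f : E3 → E3}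
    (hf : ContDiffOn ℝ 1 f O) (hV : ∀ V : E3 → E3, ContDiff ℝ 1 V → HasCompactSupport V → tsupport V ⊆ ball x r →
      ∫ z in O, bil lam mu (Df f z) (Df V z) = 0) :
    Wk s (r/2) fun y => Bg lam mu g y (Df (pb x S g f) y) := by
  intro v v1 v2 v3
  set V : E3 → E3 := fun z => S (v (Xi x S g z)) with hVd
  have VC : ContDiff ℝ 1 V := (Sc S).contDiff.comp (v1.comp (h.Xi_C.of_le (by norm_num)))
  have pV : pb x S g V = v := funext fun y => by simp [pb, hVd, h.XiTh]
  have c1 : IsCompact (Th x S g '' tsupport v) := v2.isCompact.image h.Th_C.continuous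
  have z1 : ∀ z, z ∉ Th x S g '' tsupport v → V z = 0 := fun z hz => by
    have : v (Xi x S g z) = 0 := image_eq_zero_of_notMem_tsupport fun h' => hz ⟨_, h', h.ThXi z⟩
    simp [hVd, this]
  have ts : tsupport V ⊆ Th x S g '' tsupport v := closure_minimal (fun z hz => by
    by_contra h'; exact hz (z1 z h')) c1.isClosed
  have i1 := hV V VC (HasCompactSupport.intro c1 z1) (ts.trans (image_subset_iff.2 fun y hy => h.Th_ball he (v3 hy)))
  rw [h.tr_int he oO fun z hz hz' => by
    rw [image_eq_zero_of_notMem_tsupport fun h' => hz' (image_mono v3 (ts (tsupport_fderiv_subset ℝ h'))), map_zero]] at i1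
  rw [Wk_res _ v3, ← i1]
  refine setIntegral_congr_fun (DD_open s _).measurableSet fun y hy => ?_
  have := h.pb_B (lam := lam) (mu := mu) (dif oO hf (h.Th_DD he hy).1) (VC.differentiable one_ne_zero (Th x S g y))
  rw [pV] at this
  exact this
lemma ext_pull (h : PP) (he : ε ≤ 1/72) (oO : IsOpen O) {K' : ℝ≥0}
    (hB : Gd lam mu s r K' (Bg lam mu g)) {f : E3 → E3} (hr : 0 < r)
    (hf : ContDiffOn ℝ 1 f O) (nf : N2 (Df f) (O ∩ ball x r) ≠ ⊤)
    (hw : Wk s (r/2) fun y => Bg lam mu g y (Df (pb x S g f) y))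
    {V : E3 → E3} (hV : ContDiffOn ℝ 1 V O) (V0 : ∀ z ∈ O, r/6 ≤ ‖z - x‖ → V z = 0)
    (nV : N2 (Df V) O ≠ ⊤) : ∫ z in O, bil lam mu (Df f z) (Df V z) = 0 := by
  classical
  have hb : DD s (r/2) ⊆ DD s r := DD_sub (by linarith)
  set v : E3 → E3 := fun y => if ‖y‖ < r/2 then pb x S g V y else 0 with hv
  have far : ∀ y : E3, r/3 < ‖y‖ → r/6 ≤ ‖Th x S g y - x‖ := fun y hy => by
    by_contra h'
    rw [not_le] at h'
    have := h.Xi_ball he (t := r) le_rfl (z := Th x S g y) (by rw [mem_ball, dist_eq_norm]; linarith)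
    rw [h.XiTh] at this
    linarith
  have v0 : ∀ y ∈ Hs s, r/3 < ‖y‖ → v y = 0 := fun y hy hn => by
    by_cases hy2 : ‖y‖ < r/2
    · simp only [hv, if_pos hy2, pb]
      rw [V0 _ (h.Th_DD he ⟨hy, by simpa using hy2⟩).1 (far y hn), map_zero]
    · simp only [hv, if_neg hy2]
  have veq : ∀ y ∈ DD s (r/2), v =ᶠ[𝓝 y] pb x S g V := fun y hy => by
    filter_upwards [isOpen_ball.mem_nhds hy.2] with z hz
    simp only [hv, if_pos (mem_ball_zero_iff.1 hz)]
  have cV := h.pb_C he (by norm_num) hV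
  have vz : ∀ y ∈ Hs s, r/3 < ‖y‖ → v =ᶠ[𝓝 y] fun _ => 0 := fun y hy hn => by
    filter_upwards [(Hs_open s).mem_nhds hy, (isOpen_lt continuous_const continuous_norm).mem_nhds hn] with z h1 h2
    exact v0 z h1 h2
  have cv : ContDiffOn ℝ 1 v (Hs s) := fun y hy => by
    by_cases hy2 : ‖y‖ < r/2
    · have hy' : y ∈ DD s (r/2) := ⟨hy, by simpa using hy2⟩
      exact ((cV.contDiffAt ((DD_open s _).mem_nhds hy')).congr_of_eventuallyEq (veq y hy')).contDiffWithinAt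
    · exact (contDiffAt_const.congr_of_eventuallyEq (vz y hy (by linarith))).contDiffWithinAt
  have dz : ∀ y ∈ Hs s, y ∉ DD s (r/2) → Df v y = 0 := fun y hy hn => by
    rw [(vz y hy (by
      by_contra h'
      exact hn ⟨hy, by rw [mem_ball_zero_iff]; linarith⟩)).fderiv_eq]; simp
  have nv : N2 (Df v) (Hs s) ≠ ⊤ := by
    have e : N2 (Df v) (Hs s) = N2 (Df v) (DD s (r/2)) := by
      unfold N2
      rw [← lintegral_inter_add_sdiff _ (Hs s) (measurableSet_ball (x := o3) (ε := r/2)),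
        setLIntegral_eq_zero ((Hs_open s).measurableSet.diff measurableSet_ball) fun y hy => by
          rw [dz y hy.1 fun h' => hy.2 h'.2]; simp, add_zero]
    rw [e]
    have := h.pb_N he oO hV
    rw [show N2 (Df v) (DD s (r/2)) = N2 (Df (pb x S g V)) (DD s (r/2)) from
      setLIntegral_congr_fun (DD_open s _).measurableSet fun y hy => by rw [(veq y hy).fderiv_eq]]
    exact ne_top_of_le_ne_top (ENNReal.mul_ne_top (by finiteness)
      (ne_top_of_le_ne_top nV (N2_mono inter_subset_left))) this
  have cf := h.pb_C he (by norm_num) hf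
  have := ext_test (ρ := r/3) (by linarith) hw ((hB.1.continuousOn.mono hb).clm_apply (sm_fd (DD_open s _) cf))
    (by
      refine ne_top_of_le_ne_top ?_ (N2_le (g := Df (pb x S g f)) (DD_open s (r/2)).measurableSet fun y hy =>
        ((Bg lam mu g y).le_opNorm _).trans (mul_le_mul_of_nonneg_right (hB.bd (hb hy)) (norm_nonneg _)))
      exact ENNReal.mul_ne_top (by finiteness)
        (ne_top_of_le_ne_top (ENNReal.mul_ne_top (by finiteness) nf) (h.pb_N he oO hf))) cv v0 nv
  rw [h.tr_int he oO fun z hz hz' => by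
    have : V =ᶠ[𝓝 z] fun _ => 0 := by
      have hn : r/6 < ‖z - x‖ := by
        by_contra h'
        rw [not_lt] at h'
        have := h.Xi_ball he (t := r) le_rfl (z := z) (by rw [mem_ball, dist_eq_norm]; linarith)
        exact hz' ⟨Xi x S g z, by rw [mem_ball_zero_iff]; linarith, h.ThXi z⟩
      filter_upwards [oO.mem_nhds hz, (isOpen_lt continuous_const (continuous_id.sub continuous_const).norm).mem_nhds hn] with w h1 h2
      exact V0 w h1 (le_of_lt h2)
    rw [this.fderiv_eq]; simp, ← this]
  symm
  refine (setIntegral_eq_of_subset_of_forall_sdiff_eq_zero (Hs_open s).measurableSet (s := DD s (r/2)) inter_subset_left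
    fun y hy => by rw [dz y hy.1 hy.2, map_zero]).trans ?_
  refine setIntegral_congr_fun (DD_open s _).measurableSet fun y hy => ?_
  have hO := (h.Th_DD he hy).1
  simp only [(veq y hy).fderiv_eq]
  exact h.pb_B (dif oO hf hO) (dif oO hV hO)
end Pch
def p12 : E3 →L[ℝ] E2 := LinearMap.toContinuousLinearMap
  { toFun := proj12
    map_add' := fun x y => by ext i; fin_cases i <;> simp [proj12]
    map_smul' := fun c x => by ext i; fin_cases i <;> simp [proj12] }
lemma p12_app (x : E3) : p12 x = proj12 x := rfl
lemma p12_norm (x : E3) : ‖p12 x‖ ≤ ‖x‖ := by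
  rw [EuclideanSpace.norm_eq, EuclideanSpace.norm_eq]
  refine Real.sqrt_le_sqrt ?_
  simp [p12_app, proj12, Fin.sum_univ_three]
  positivity
lemma p12_ee (i : Fin 3) : ‖p12 (ee i)‖ ≤ 1 := (p12_norm _).trans (by simp)
lemma p12_two : p12 (ee 2) = 0 := by
  rw [p12_app]; ext i; fin_cases i <;> simp [proj12]
lemma chart {r₀ : ℝ} {φ : E3 ≃ᵢ E3} {ψ : E2 → ℝ} (cψ : Continuous ψ)
    (h : (φ '' C) ∩ ball 0 r₀ = {x ∈ ball o3 r₀ | ψ (proj12 x) < x 2}) {z : E3} (hz : ‖φ z‖ < r₀) :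
    (z ∈ C ↔ ψ (p12 (φ z)) < φ z 2) ∧ (z ∉ closure C ↔ φ z 2 < ψ (p12 (φ z))) := by
  have m : ∀ w : E3, ‖φ w‖ < r₀ → (w ∈ C ↔ ψ (p12 (φ w)) < φ w 2) := fun w hw => by
    have := Set.ext_iff.1 h (φ w)
    simp only [mem_inter_iff, φ.injective.mem_set_image, mem_ball_zero_iff, hw, and_true, mem_ofPred_eq, true_and] at this
    exact this
  have cφ := φ.continuous
  have c2 : Continuous fun w : E3 => φ w 2 := (EuclideanSpace.proj (𝕜 := ℝ) (2 : Fin 3)).continuous.comp cφ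
  refine ⟨m z hz, ⟨fun h1 => ?_, fun h1 h2 => ?_⟩⟩
  · by_contra h2
    rw [not_lt] at h2
    refine h1 (mem_closure_of_tendsto (b := 𝓝[>] (0:ℝ)) (f := fun t : ℝ => φ.symm (φ z + t • ee 2)) ?_ ?_)
    · have : Continuous fun t : ℝ => φ.symm (φ z + t • ee 2) := φ.symm.continuous.comp (by fun_prop)
      have := this.tendsto 0
      simp only [zero_smul, add_zero, φ.symm_apply_apply] at this
      exact this.mono_left nhdsWithin_le_nhds
    · have : Continuous fun t : ℝ => ‖φ z + t • ee 2‖ := by fun_prop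
      have := (isOpen_lt this continuous_const).mem_nhds (x := (0:ℝ)) (show ‖φ z + (0:ℝ) • ee 2‖ < r₀ by simpa using hz)
      filter_upwards [nhdsWithin_le_nhds this, self_mem_nhdsWithin] with t h3 h4
      rw [m _ (by rw [φ.apply_symm_apply]; exact h3), φ.apply_symm_apply, map_add, map_smul, p12_two, smul_zero, add_zero]
      have : (0:ℝ) < t := h4
      simp; linarith
  · obtain ⟨w, w1, w2⟩ := mem_closure_iff.1 h2 ({w | φ w 2 < ψ (p12 (φ w))} ∩ {w | ‖φ w‖ < r₀})
      ((isOpen_lt c2 (cψ.comp (p12.continuous.comp cφ))).inter (isOpen_lt cφ.norm continuous_const)) ⟨h1, hz⟩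
    have h3 : φ w 2 < ψ (p12 (φ w)) := w1.1
    linarith [(m w w1.2).1 w2]
lemma iso_aff (φ : E3 ≃ᵢ E3) : ∃ S : E3 ≃ₗᵢ[ℝ] E3, ∀ x y, φ (x + S y) = φ x + y := by
  refine ⟨φ.toRealAffineIsometryEquiv.linearIsometryEquiv.symm, fun x y => ?_⟩
  have := φ.toRealAffineIsometryEquiv.map_vadd x (φ.toRealAffineIsometryEquiv.linearIsometryEquiv.symm y)
  simp only [IsometryEquiv.coeFn_toRealAffineIsometryEquiv, LinearIsometryEquiv.apply_symm_apply, vadd_eq_add] at this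
  rw [add_comm x, this, add_comm]
lemma fr_null {r₀ E₀ : ℝ} (h0 : 0 < r₀) (oC : IsOpen C) (h : HasC3Boundary r₀ E₀ C) : volume (frontier C) = 0 := by
  refine measure_null_of_locally_null _ fun P hP => ?_
  obtain ⟨φ, ψ, f0, p0, pC, -, -, hc⟩ := h P hP
  obtain ⟨S, hS⟩ := iso_aff φ
  refine ⟨frontier C ∩ ball P r₀, inter_mem_nhdsWithin _ (ball_mem_nhds P h0), ?_⟩
  have hp : Pch univ 0 0 0 P S (fun y => ψ (p12 y)) 0 :=
    ⟨le_rfl, pC.comp p12.contDiff, by simp [p0], fun y t => by simp [p12_two], by simp, by simp, by simp, by simp⟩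
  rw [← hp.mp.measure_preimage_emb hp.emb]
  refine measure_mono_null (t := {y : E3 | ¬ y 2 ≠ 0}) (fun y hy => ?_) (ae_iff.1 plane_null)
  have e : φ (Th P S (fun y => ψ (p12 y)) y) = y + ψ (p12 y) • ee 2 := by rw [Th, hS, f0, zero_add]
  have n : ‖φ (Th P S (fun y => ψ (p12 y)) y)‖ < r₀ := by
    rw [← dist_zero_right, ← f0, φ.dist_eq]; exact hy.2
  obtain ⟨c1, c2⟩ := chart pC.continuous hc n
  have hf : Th P S (fun y => ψ (p12 y)) y ∈ frontier C := hy.1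
  rw [frontier, oC.interior_eq] at hf
  have d1 := mt c1.2 hf.2
  have d2 := mt c2.2 (not_not.2 hf.1)
  rw [e, map_add, map_smul, p12_two, smul_zero, add_zero] at d1 d2
  simp only [PiLp.add_apply, PiLp.smul_apply, PiLp.single_apply, smul_eq_mul, if_true, mul_one, not_lt] at d1 d2
  simp only [mem_ofPred_eq, not_not]
  linarith
lemma dd_p12 {F : E2 → V} (hF : ContDiff ℝ 1 F) (q : E2) (i : Fin 3) :
    dd i (fun y => F (p12 y + q)) = fun y => Df F (p12 y + q) (p12 (ee i)) := by
  funext y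
  have : HasFDerivAt (fun y => F (p12 y + q)) ((Df F (p12 y + q)).comp p12) y :=
    (hF.differentiable one_ne_zero (p12 y + q)).hasFDerivAt.comp y (p12.hasFDerivAt.add_const q)
  unfold dd
  rw [this.fderiv]; rfl
lemma app1 {V W : Type*} [NormedAddCommGroup V] [NormedSpace ℝ V] [NormedAddCommGroup W] [NormedSpace ℝ W] (A : V →L[ℝ] W) {v : V}
    (h : ‖v‖ ≤ 1) : ‖A v‖ ≤ ‖A‖ := (A.le_opNorm v).trans (by nlinarith [norm_nonneg A])
lemma patch {r₀ E₀ D₀ ε : ℝ} (hr₀ : 0 < r₀) (hE₀ : 0 < E₀) (hD₀ : 1 < D₀) (hε : 0 < ε) :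
    ∃ r : ℝ, 0 < r ∧ r ≤ 1/6 ∧ ∀ C : Set E3, IsC3Cavity r₀ E₀ D₀ C → ∀ x : E3, x 2 ≤ 0 → x ∉ C →
      ∃ S g s, Pch (Om C) ε E₀ r x S g s ∧ (Disjoint (ball x r) (closure C) ∨ ball x r ⊆ Hs (-(2/3))) := by
  refine ⟨min (1/6) (min (r₀/2) (ε/(2*E₀))), by positivity, min_le_left _ _, fun C hC x x0 xC => ?_⟩
  set r := min (1/6) (min (r₀/2) (ε/(2*E₀))) with hr
  have r1 : r ≤ 1/6 := min_le_left _ _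
  have r2 : r ≤ r₀/2 := (min_le_right _ _).trans (min_le_left _ _)
  have r3 : E₀ * (2*r) ≤ ε := by
    have : r ≤ ε/(2*E₀) := (min_le_right _ _).trans (min_le_right _ _)
    rw [le_div_iff₀ (by positivity)] at this; linarith
  have rp : 0 < r := by positivity
  obtain ⟨⟨oC, -, -, -, -, hC2, -⟩, hb⟩ := hC
  by_cases hd : Disjoint (ball x r) (closure C)
  · refine ⟨LinearIsometryEquiv.refl ℝ E3, fun _ => 0, -x 2, ⟨by linarith, contDiff_const, rfl, fun _ _ => rfl,
      fun i y _ => by simp [dd, hε.le], fun i j y _ => ?_, fun i j k y _ => ?_, fun y hy => ?_⟩, Or.inl hd⟩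
    · have : dd j (fun _ : E3 => (0:ℝ)) = fun _ => 0 := by funext y; simp [dd]
      simp [this, dd, hE₀.le]
    · have : ∀ k, dd k (fun _ : E3 => (0:ℝ)) = fun _ => 0 := fun k => by funext y; simp [dd]
      simp [this, dd, hE₀.le]
    · have h1 : x + y ∉ closure C := fun h' => Set.disjoint_left.1 hd (by simpa using hy) h'
      simp only [LinearIsometryEquiv.coe_refl, id, add_zero, Om, Set.mem_sdiff, h1, not_false_eq_true, and_true]
      show (x + y) 2 < 0 ↔ _
      simp only [PiLp.add_apply]
      constructor <;> intro h <;> linarith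
  obtain ⟨P, hP, Px⟩ : ∃ P ∈ frontier C, P ∈ ball x r := by
    by_contra hn
    push Not at hn
    obtain ⟨c, c1, c2⟩ := Set.not_disjoint_iff.1 hd
    obtain ⟨d, d1, d2⟩ := mem_closure_iff.1 c2 _ isOpen_ball c1
    have fe : frontier C = closure C \ C := by rw [frontier, oC.interior_eq]
    have := (convex_ball x r).isPreconnected.subset_or_subset oC isClosed_closure.isOpen_compl
      (Set.disjoint_left.2 fun z h1 h2 => h2 (subset_closure h1)) (fun z hz => by
        by_contra h'
        simp only [mem_union, mem_compl_iff, not_or, not_not] at h'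
        exact hn z (by rw [fe]; exact ⟨h'.2, h'.1⟩) hz)
    rcases this with h1 | h1
    · exact xC (h1 (mem_ball_self rp))
    · exact h1 d1 (subset_closure d2)
  obtain ⟨φ, ψ, f0, p0, pC, pd0, pb, hc⟩ := hb P hP
  obtain ⟨S, hS⟩ := iso_aff φ
  have nφ : ∀ z, ‖φ z‖ = dist z P := fun z => by rw [← dist_zero_right, ← f0, φ.dist_eq]
  set a := φ x with ha
  have na : ‖a‖ < r := by rw [ha, nφ, dist_comm]; exact Px
  have nq : ∀ y ∈ ball o3 r, ‖p12 y + p12 a‖ < 2 * r := fun y hy => by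
    have := p12_norm y
    have := p12_norm a
    have := mem_ball_zero_iff.1 hy
    linarith [norm_add_le (p12 y) (p12 a)]
  have nr : ∀ y ∈ ball o3 r, p12 y + p12 a ∈ ball (0:E2) r₀ := fun y hy => by
    rw [mem_ball_zero_iff]; linarith [nq y hy]
  have C1 := pC.fderiv_right (m := 2) (by norm_num)
  have C2 := C1.fderiv_right (m := 1) (by norm_num)
  have b2 : ∀ q ∈ ball (0:E2) r₀, ‖Df (Df ψ) q‖ ≤ E₀ := fun q hq => by
    rw [← norm_iteratedFDeriv_one, norm_iteratedFDeriv_fderiv]; exact pb q hq 2 (by norm_num)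
  have b3 : ∀ q ∈ ball (0:E2) r₀, ‖Df (Df (Df ψ)) q‖ ≤ E₀ := fun q hq => by
    rw [← norm_iteratedFDeriv_one, norm_iteratedFDeriv_fderiv, norm_iteratedFDeriv_fderiv]; exact pb q hq 3 le_rfl
  have b1 : ∀ q ∈ ball (0:E2) r₀, ‖Df ψ q‖ ≤ E₀ * ‖q‖ := fun q hq => by
    have := (convex_ball (0:E2) r₀).norm_image_sub_le_of_norm_fderiv_le (fun w _ => C1.differentiable (by simp) w) b2
      (mem_ball_self hr₀) hq
    simpa [pd0] using this
  set g : E3 → ℝ := fun y => ψ (p12 y + p12 a) - ψ (p12 a) with hg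
  have d1 : ∀ j, dd j g = fun y => Df ψ (p12 y + p12 a) (p12 (ee j)) := fun j => by
    rw [← dd_p12 (pC.of_le (by norm_num))]
    funext y; unfold dd; rw [hg, fderiv_sub_const]
  have d2 : ∀ i j, dd i (dd j g) = fun y => Df (Df ψ) (p12 y + p12 a) (p12 (ee i)) (p12 (ee j)) := fun i j => by
    rw [d1, dd_p12 (F := fun q => Df ψ q (p12 (ee j))) ((C1.clm_apply contDiff_const).of_le (by norm_num))]
    funext y
    have := ((C1.differentiable (by simp) (p12 y + p12 a)).hasFDerivAt.clm_apply (hasFDerivAt_const (p12 (ee j)) _)).fderiv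
    rw [this]; simp
  have d3 : ∀ k i j, dd k (dd i (dd j g)) = fun y => Df (Df (Df ψ)) (p12 y + p12 a) (p12 (ee k)) (p12 (ee i)) (p12 (ee j)) := fun k i j => by
    rw [d2, dd_p12 (F := fun q => Df (Df ψ) q (p12 (ee i)) (p12 (ee j))) ((C2.clm_apply contDiff_const).clm_apply contDiff_const)]
    funext y
    have := (((C2.differentiable (by simp) (p12 y + p12 a)).hasFDerivAt.clm_apply (hasFDerivAt_const (p12 (ee i)) _)).clm_apply
      (hasFDerivAt_const (p12 (ee j)) _)).fderiv
    rw [this]; simp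
  have P2 : P 2 ≤ -D₀ := by
    have cl : IsClosed {z : E3 | z 2 ≤ -D₀} := isClosed_le (EuclideanSpace.proj (𝕜 := ℝ) (2 : Fin 3)).continuous continuous_const
    exact closure_minimal hC2 cl (frontier_subset_closure hP)
  have zl : ball x r ⊆ Hs (-(2/3)) := fun z hz => by
    have h1 := PiLp.norm_apply_le (z - P) (2 : Fin 3)
    have h2 : ‖z - P‖ < 2 * r := by
      rw [← dist_eq_norm]
      have := dist_triangle_right z P x
      have := mem_ball.1 hz
      have := mem_ball.1 Px
      linarith
    have h3 := (le_abs_self _).trans h1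
    simp only [PiLp.sub_apply] at h3
    show z 2 < -(2/3)
    linarith
  refine ⟨S, g, ψ (p12 a) - a 2, ⟨?_, ?_, ?_, fun y t => ?_, fun i y hy => ?_, fun i j y hy => ?_, fun i j k y hy => ?_, fun y hy => ?_⟩, Or.inr zl⟩
  · have := mt (chart pC.continuous hc (z := x) (by rw [← ha]; linarith)).1.2 xC
    linarith
  · exact (pC.comp (p12.contDiff.add contDiff_const)).sub contDiff_const
  · simp [hg]
  · simp [hg, p12_two]
  · rw [d1, ← Real.norm_eq_abs]
    refine (app1 _ (p12_ee i)).trans ((b1 _ (nr y hy)).trans ?_)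
    have := nq y hy
    nlinarith
  · rw [d2, ← Real.norm_eq_abs]
    exact (app1 _ (p12_ee j)).trans ((app1 _ (p12_ee i)).trans (b2 _ (nr y hy)))
  · rw [d3, ← Real.norm_eq_abs]
    exact (app1 _ (p12_ee k)).trans ((app1 _ (p12_ee j)).trans ((app1 _ (p12_ee i)).trans (b3 _ (nr y hy))))
  · have hz : x + S y ∈ ball x r := by simpa using hy
    have h1 : x + S y ∈ lowerHalf := by
      have : (x + S y) 2 < -(2/3) := zl hz
      show (x + S y) 2 < 0
      linarith
    have hy' := mem_ball_zero_iff.1 hy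
    have h2 := (chart pC.continuous hc (z := x + S y) (by rw [hS, ← ha]; linarith [norm_add_le a y])).2
    rw [hS, ← ha, map_add, add_comm (p12 a)] at h2
    simp only [Om, Set.mem_sdiff, h1, true_and, h2, hg, PiLp.add_apply]
    constructor <;> intro h <;> linarith
lemma trc_dd {W : E3 → E3} (h : DifferentiableAt ℝ W y) :
    trc (Df W y) = ∑ i, dd i (fun y => W y i) y := by
  unfold trc dd
  refine Finset.sum_congr rfl fun i _ => ?_
  have : HasFDerivAt (fun y => W y i) ((EuclideanSpace.proj i : E3 →L[ℝ] ℝ).comp (Df W y)) y :=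
    (EuclideanSpace.proj i : E3 →L[ℝ] ℝ).hasFDerivAt.comp y h.hasFDerivAt
  rw [this.fderiv]; rfl
lemma div0 {W : E3 → E3} (hW : ContDiff ℝ 1 W) (cW : HasCompactSupport W) : ∫ y, trc (Df W y) = 0 := by
  have c1 : ∀ i, ContDiff ℝ 1 fun y => W y i := fun i => (EuclideanSpace.proj i : E3 →L[ℝ] ℝ).contDiff.comp hW
  have c2 : ∀ i, HasCompactSupport fun y => W y i := fun i => cW.comp_left (g := fun w : E3 => w i) rfl
  have e : (fun y => trc (Df W y)) = fun y => ∑ i, (1:ℝ) * dd i (fun y => W y i) y := by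
    ext y; simp [trc_dd (hW.differentiable one_ne_zero y)]
  rw [e, integral_finsetSum]
  · refine Finset.sum_eq_zero fun i _ => ?_
    rw [ibp isOpen_univ contDiffOn_const (c1 i) (c2 i) (subset_univ _) i]
    simp [dd]
  · intro i _
    exact cont_mul isOpen_univ continuousOn_const
      (((c1 i).continuous_fderiv one_ne_zero).clm_apply continuous_const) ((c2 i).fderiv_apply ℝ (ee i)) (subset_univ _)
lemma fd_off {W : E3 → E3} (h : y ∉ tsupport W) : Df W y = 0 := by
  by_contra h'
  exact h (tsupport_fderiv_subset ℝ (f := W) (subset_tsupport _ h'))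
lemma Sol.near {lam mu p : ℝ} (h : Sol lam mu p C u) (n : volume (frontier C) = 0) (oC : IsOpen C)
    (cC : closure C ⊆ lowerHalf) {W : E3 → E3} (hW : ContDiff ℝ 1 W) (cW : HasCompactSupport W) (sW : tsupport W ⊆ lowerHalf) :
    ∫ y in Om C, bil lam mu (Df u y) (Df W y) = p * ∫ y in Om C, trc (Df W y) := by
  have ct : Continuous fun y => trc (Df W y) := by
    simp only [← trL_app]; exact trL.continuous.comp (hW.continuous_fderiv one_ne_zero)
  have it : Integrable fun y => trc (Df W y) := ct.integrable_of_hasCompactSupport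
    ((cW.fderiv ℝ).comp_left (g := trc) (by simp [trc]))
  have e1 : ∫ y in lowerHalf, trc (Df W y) = 0 := by
    rw [setIntegral_eq_integral_of_forall_compl_eq_zero, div0 hW cW]
    intro y hy; rw [fd_off fun h' => hy (sW h')]; simp [trc]
  have e2 := setIntegral_sdiff (μ := volume) (f := fun y => trc (Df W y)) isClosed_closure.measurableSet it.integrableOn cC
  have e3 : ∫ y in closure C, trc (Df W y) = ∫ y in C, trc (Df W y) := by
    refine setIntegral_congr_set (ae_eq_set.2 ⟨?_, ?_⟩)
    · rw [← oC.frontier_eq]; exact n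
    · rw [sdiff_eq_empty.2 subset_closure]; simp
  rw [h.2.2.2 W hW cW]
  unfold Om
  linear_combination p * (e3 - e2 - e1)
structure Cu (D₀ : ℝ) (θ : E3 → ℝ) : Prop where
  C : ContDiff ℝ ∞ θ
  up : ∀ y : E3, -(1/3) ≤ y 2 → θ y = 0
  far : ∀ y : E3, 2*D₀+2 ≤ ‖y‖ → θ y = 0
  one : ∀ y : E3, y 2 < -(2/3) → ‖y‖ < 2*D₀+1 → θ y = 1
lemma Cu_ex {D₀ : ℝ} (h : 1 < D₀) : ∃ θ, Cu D₀ θ := by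
  obtain ⟨χ, K, -, h1, h2, h3, -, -⟩ := bump_ex (ρ := 2*D₀+1) (r := 2*D₀+2) (by linarith) (by linarith)
  refine ⟨fun y => χ y * Real.smoothTransition (-3 * y 2 - 1), ?_, ?_, ?_, ?_⟩
  · refine h1.mul (Real.smoothTransition.contDiff.comp ?_)
    exact (contDiff_const.mul (EuclideanSpace.proj (2:Fin 3) : E3 →L[ℝ] ℝ).contDiff).sub contDiff_const
  · intro y hy; rw [Real.smoothTransition.zero_of_nonpos (by linarith)]; simp
  · intro y hy; rw [h3 y (by linarith)]; simp
  · intro y hy hy'; rw [Real.smoothTransition.one_of_one_le (by linarith), h2 y hy'.le]; simp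
lemma Cu.cs {D₀ : ℝ} (h : Cu D₀ θ) : HasCompactSupport θ :=
  HasCompactSupport.of_support_subset_isCompact (isCompact_closedBall o3 (2*D₀+2)) fun y hy => by
    rw [mem_closedBall_zero_iff]; by_contra h'; exact hy (h.far y (not_le.1 h').le)
lemma Cu.N {D₀ : ℝ} (h : Cu D₀ θ) {V : Type*} [NormedAddCommGroup V] {F : E3 → V} (hF : Continuous F)
    (hF0 : ∀ y, y ∉ tsupport θ → F y = 0) (O : Set E3) : N2 F O ≠ ⊤ := by
  have cF : HasCompactSupport F := HasCompactSupport.intro h.cs hF0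
  obtain ⟨M, hM⟩ := cF.exists_bound_of_continuous hF
  have e : N2 F univ = N2 F (tsupport θ) := by
    unfold N2
    rw [← lintegral_indicator (isClosed_tsupport _).measurableSet, Measure.restrict_univ]
    congr 1; ext y
    by_cases hy : y ∈ tsupport θ
    · rw [indicator_of_mem hy]
    · rw [indicator_of_notMem hy, hF0 y hy]; simp
  refine ((N2_mono (subset_univ O)).trans_lt ?_).ne
  rw [e]
  refine (N2_bdd (isClosed_tsupport _).measurableSet fun y _ => hM y).trans_lt ?_
  exact ENNReal.mul_lt_top ENNReal.ofReal_lt_top h.cs.measure_lt_top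
lemma Cu.T {D₀ : ℝ} (h : Cu D₀ θ) (O : Set E3) : AEStronglyMeasurable (fun z => θ z • trL) (volume.restrict O) ∧
    N2 (fun z => θ z • trL) O ≠ ⊤ ∧ AEStronglyMeasurable (Df θ) (volume.restrict O) ∧ N2 (Df θ) O ≠ ⊤ := by
  have c1 : Continuous fun z => θ z • trL := h.C.continuous.smul continuous_const
  have c2 : Continuous (Df θ) := h.C.continuous_fderiv (by simp)
  exact ⟨c1.aestronglyMeasurable, h.N c1 (fun y hy => by rw [image_eq_zero_of_notMem_tsupport hy, zero_smul]) O,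
    c2.aestronglyMeasurable, h.N c2 (fun y hy => image_eq_zero_of_notMem_tsupport fun h' => hy (tsupport_fderiv_subset ℝ h')) O⟩
def Adm (O : Set E3) (V : E3 → E3) : Prop := ContDiffOn ℝ 1 V O ∧ N2 V O ≠ ⊤ ∧ N2 (Df V) O ≠ ⊤
def Lf (θ : E3 → ℝ) (O : Set E3) (V : E3 → E3) : ℝ :=
  (∫ z in O, (θ z • trL) (Df V z)) + ∫ z in O, Df θ z (V z)
lemma Adm.m {V : E3 → E3} (oO : IsOpen O) (h : ContDiffOn ℝ 1 V O) : AEStronglyMeasurable V (volume.restrict O) ∧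
    AEStronglyMeasurable (Df V) (volume.restrict O) :=
  ⟨h.continuousOn.aestronglyMeasurable oO.measurableSet, (sm_fd oO h).aestronglyMeasurable oO.measurableSet⟩
lemma Adm.i1 {D₀ : ℝ} (c : Cu D₀ θ) {V : E3 → E3} (oO : IsOpen O) (h : Adm O V) :
    IntegrableOn (fun z => (θ z • trL) (Df V z)) O :=
  pair_int (c.T O).1 (c.T O).2.1 (Adm.m oO h.1).2 h.2.2
lemma Adm.i2 {D₀ : ℝ} (c : Cu D₀ θ) {V : E3 → E3} (oO : IsOpen O) (h : Adm O V) :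
    IntegrableOn (fun z => Df θ z (V z)) O :=
  pair_int (c.T O).2.2.1 (c.T O).2.2.2 (Adm.m oO h.1).1 h.2.1
lemma Adm.i3 {u V : E3 → E3} (oO : IsOpen O) (hu : ContDiffOn ℝ 1 u O)
    (nu : N2 (Df u) O ≠ ⊤) (h : Adm O V) :
    IntegrableOn (fun z => bil lam mu (Df u z) (Df V z)) O := by
  refine pair_int ((bil lam mu).continuous.comp_aestronglyMeasurable (Adm.m oO hu).2) ?_ (Adm.m oO h.1).2 h.2.2
  exact ((N2_le oO.measurableSet (f := fun z => bil lam mu (Df u z)) (g := Df u) (c := ‖bil lam mu‖)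
    fun y _ => (bil lam mu).le_opNorm _).trans_lt (ENNReal.mul_lt_top ENNReal.ofReal_lt_top nu.lt_top)).ne
lemma Adm.test {V : E3 → E3} (hV : ContDiff ℝ 1 V) (cV : HasCompactSupport V) (O : Set E3) : Adm O V := by
  have key : ∀ {W : Type} [NormedAddCommGroup W] (F : E3 → W), Continuous F → HasCompactSupport F → N2 F O ≠ ⊤ := by
    intro W _ F hF cF
    refine ((N2_mono (subset_univ O)).trans_lt ?_).ne
    have := hF.memLp_of_hasCompactSupport (p := 2) (μ := (volume : Measure E3)) cF
    have h2 := lintegral_rpow_enorm_lt_top_of_eLpNorm_lt_top (two_ne_zero) (by simp) this.2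
    simpa [N2] using h2
  exact ⟨hV.contDiffOn, key V hV.continuous cV, key _ (hV.continuous_fderiv one_ne_zero) (cV.fderiv ℝ)⟩
lemma Lf_zero {D₀ : ℝ} (c : Cu D₀ θ) {V : E3 → E3} (hV : Adm (Om C) V) {r : ℝ} (hr : 0 < r)
    (d : Disjoint (ball x r) (closure C)) (V0 : ∀ z ∈ Om C, r/6 ≤ ‖z - x‖ → V z = 0) : Lf θ (Om C) V = 0 := by
  classical
  set W : E3 → E3 := fun z => if z ∈ Om C then θ z • V z else 0 with hW
  have A : IsClosed {z : E3 | ‖z - x‖ ≤ r/6 ∧ z 2 ≤ -(1/3)} :=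
    IsClosed.and (isClosed_le (f := fun z : E3 => ‖z - x‖) (by fun_prop) continuous_const)
      (isClosed_le (f := fun z : E3 => z 2) ((EuclideanSpace.proj (2:Fin 3) : E3 →L[ℝ] ℝ).continuous) continuous_const)
  have ts : tsupport W ⊆ {z : E3 | ‖z - x‖ ≤ r/6 ∧ z 2 ≤ -(1/3)} := by
    refine closure_minimal (fun z hz => ?_) A
    have hz' : z ∈ Om C := by by_contra h; exact hz (if_neg h)
    have hz2 : θ z • V z ≠ 0 := by rw [show θ z • V z = W z from (if_pos hz').symm]; exact hz
    constructor
    · by_contra h; exact hz2 (by rw [V0 z hz' (not_le.1 h).le, smul_zero])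
    · by_contra h; exact hz2 (by rw [c.up z (not_le.1 h).le, zero_smul])
  have tO : tsupport W ⊆ Om C := fun z hz => by
    have := ts hz
    refine ⟨lt_of_le_of_lt this.2 (by norm_num), fun h => disjoint_left.1 d ?_ h⟩
    rw [mem_ball, dist_eq_norm]; linarith [this.1]
  have cW : HasCompactSupport W := HasCompactSupport.of_support_subset_isCompact (isCompact_closedBall x (r/6))
    fun z hz => by rw [mem_closedBall, dist_eq_norm]; exact (ts (subset_tsupport _ hz)).1
  have ev : ∀ z ∈ Om C, W =ᶠ[𝓝 z] fun z => θ z • V z := fun z hz => by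
    filter_upwards [(Om_open C).mem_nhds hz] with y hy; exact if_pos hy
  have CW : ContDiff ℝ 1 W := glob_C fun z hz => by
    refine ContDiffAt.congr_of_eventuallyEq ?_ (ev z (tO hz))
    exact ((c.C.of_le (leI 1)).contDiffAt).fun_smul (hV.1.contDiffAt ((Om_open C).mem_nhds (tO hz)))
  have fW : ∀ z ∈ Om C, trc (Df W z) = (θ z • trL) (Df V z) + Df θ z (V z) := fun z hz => by
    rw [(ev z hz).fderiv_eq, ((c.C.differentiable (by simp) z).hasFDerivAt.fun_smul (dif (Om_open C) hV.1 hz).hasFDerivAt).fderiv,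
      ← trL_app, map_add, map_smul]
    congr 1
    rw [trL_app]
    conv_rhs => rw [← sum_ee (V z)]
    simp [trc, mul_comm]
  have := div0 CW cW
  rw [← setIntegral_eq_integral_of_forall_compl_eq_zero (s := Om C) fun y hy => by
    rw [fd_off fun h' => hy (tO h')]; simp [trc], setIntegral_congr_fun (Om_ne_meas C) fW,
    integral_add (hV.i1 c (Om_open C)) (hV.i2 c (Om_open C))] at this
  exact this
def uk (κ : ℝ) (u : E3 → E3) (z : E3) : E3 := u z - κ • z
lemma uk_C {κ : ℝ} {n : ℕ∞ω} (h : ContDiffOn ℝ n u O) : ContDiffOn ℝ n (uk κ u) O :=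
  h.sub (contDiff_const_smul κ).contDiffOn
lemma uk_fd {κ : ℝ} {z : E3} (h : DifferentiableAt ℝ u z) :
    Df (uk κ u) z = Df u z - κ • ContinuousLinearMap.id ℝ E3 := by
  have : HasFDerivAt (uk κ u) (Df u z - κ • ContinuousLinearMap.id ℝ E3) z :=
    h.hasFDerivAt.fun_sub ((hasFDerivAt_id z).fun_const_smul κ)
  exact this.fderiv
lemma uk_N {κ : ℝ} (oO : IsOpen O) (h : ContDiffOn ℝ 1 u O) (n : N2 (Df u) O ≠ ⊤) {T : Set E3}
    (hT : T ⊆ O) (mT : MeasurableSet T) (vT : volume T ≠ ⊤) : N2 (Df (uk κ u)) T ≠ ⊤ := by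
  have h1 := N2_two (f := Df (uk κ u)) (g := Df u) (h := fun _ => κ • ContinuousLinearMap.id ℝ E3) mT
    ((Adm.m oO h).2.mono_measure (Measure.restrict_mono_set _ hT)) (a := 1) (b := 1) fun y hy => by
      rw [uk_fd (dif oO h (hT hy)), one_mul, one_mul]; exact norm_sub_le _ _
  have h2 := N2_bdd (f := fun _ : E3 => κ • ContinuousLinearMap.id ℝ E3) mT fun y _ => le_rfl
  refine (h1.trans_lt (ENNReal.add_lt_top.2 ⟨ENNReal.mul_lt_top ENNReal.ofReal_lt_top ((N2_mono hT).trans_lt n.lt_top),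
    ENNReal.mul_lt_top ENNReal.ofReal_lt_top (h2.trans_lt (ENNReal.mul_lt_top ENNReal.ofReal_lt_top vT.lt_top))⟩)).ne
lemma split_k {lam mu κ D₀ : ℝ} (c : Cu D₀ θ) (oO : IsOpen O) {u V : E3 → E3}
    (hu : ContDiffOn ℝ 1 u O) (nu : N2 (Df u) O ≠ ⊤) (hV : Adm O V) {r : ℝ}
    (V0 : ∀ z ∈ O, z ∉ ball x r → Df V z = 0) (h1 : ∀ z ∈ ball x r, θ z = 1) :
    ∫ z in O, bil lam mu (Df (uk κ u) z) (Df V z) = (∫ z in O, bil lam mu (Df u z) (Df V z)) -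
      κ * (3*lam+2*mu) * ∫ z in O, (θ z • trL) (Df V z) := by
  rw [← integral_const_mul, ← integral_sub (Adm.i3 oO hu nu hV) ((hV.i1 c oO).const_mul _)]
  refine setIntegral_congr_fun oO.measurableSet fun z hz => ?_
  show bil lam mu (Df (uk κ u) z) (Df V z) = bil lam mu (Df u z) (Df V z) -
    κ * (3*lam+2*mu) * (θ z • trL) (Df V z)
  rw [uk_fd (dif oO hu hz), map_sub, _root_.sub_apply, bil_id]
  congr 1
  by_cases hb : z ∈ ball x r
  · rw [h1 z hb, one_smul, trL_app]
  · rw [V0 z hz hb]; simp [trc]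
structure Cx (lam mu p D₀ K r : ℝ) (K' : ℝ≥0) (C : Set E3) (u : E3 → E3) : Prop where
  mu0 : 0 < mu
  lam0 : 0 < 3*lam + 2*mu
  D1 : 1 < D₀
  oC : IsOpen C
  nC : volume (frontier C) = 0
  cC : closure C ⊆ lowerHalf
  CC : IsConnected (Om C)
  bC : C ⊆ ball 0 (2*D₀)
  r0 : 0 < r
  r6 : r ≤ 1/6
  p0 : 0 < p
  sol : Sol lam mu p C u
  pt : ∀ x : E3, x 2 ≤ 0 → x ∉ C → ∃ S g s, Pch (Om C) (eps1 lam mu) K r x S g s ∧ Gd lam mu s r K' (Bg lam mu g) ∧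
    (Disjoint (ball x r) (closure C) ∨ ball x r ⊆ Hs (-(2/3)))
lemma eps1_le (lam mu : ℝ) : eps1 lam mu ≤ 1/72 := min_le_left _ _
variable {lam mu p D₀ K r : ℝ} {K' : ℝ≥0} {C : Set E3} {u : E3 → E3}
lemma Cx.loc (h : Cx lam mu p D₀ K r K' C u) (c : Cu D₀ θ) (hx : x 2 ≤ 0) (hxC : x ∉ C) :
    ∃ S g s κ, Pch (Om C) (eps1 lam mu) K r x S g s ∧ Gd lam mu s r K' (Bg lam mu g) ∧
    Wk s (r/2) (fun y => Bg lam mu g y (Df (pb x S g (uk κ u)) y)) ∧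
    (κ = 0 ∧ Disjoint (ball x r) (closure C) ∨ κ * (3*lam+2*mu) = p ∧ ∀ z ∈ ball x r, θ z = 1) := by
  obtain ⟨S, g, s, hP, hG, hd⟩ := h.pt x hx hxC
  have oO := Om_open C
  by_cases d : Disjoint (ball x r) (closure C)
  · refine ⟨S, g, s, 0, hP, hG, ?_, Or.inl ⟨rfl, d⟩⟩
    have e : uk 0 u = u := by ext1 z; simp [uk]
    rw [e]
    refine hP.Wk_pull (eps1_le _ _) oO h.sol.1 fun V V1 V2 V3 => ?_
    rw [h.sol.2.2.2 V V1 V2, setIntegral_eq_zero_of_forall_eq_zero, mul_zero]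
    intro z hz
    rw [fd_off fun h' => disjoint_left.1 d (V3 h') (subset_closure hz)]; simp [trc]
  · have hb := hd.resolve_left d
    obtain ⟨w, w1, w2⟩ := not_disjoint_iff.1 d
    have w3 : ‖w‖ ≤ 2*D₀ := by
      have := closure_mono h.bC w2
      exact mem_closedBall_zero_iff.1 (closure_ball_subset_closedBall this)
    have h1 : ∀ z ∈ ball x r, θ z = 1 := fun z hz => c.one z (hb hz) (by
      rw [mem_ball, dist_eq_norm] at hz w1
      have := norm_add₃_le (a := z - x) (b := x - w) (c := w)
      rw [norm_sub_rev x w, show z - x + (x - w) + w = z by abel] at this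
      linarith [h.r6])
    refine ⟨S, g, s, p/(3*lam+2*mu), hP, hG, ?_, Or.inr ⟨div_mul_cancel₀ _ h.lam0.ne', h1⟩⟩
    refine hP.Wk_pull (eps1_le _ _) oO (uk_C h.sol.1) fun V V1 V2 V3 => ?_
    rw [split_k c oO h.sol.1 h.sol.2.2.1 (Adm.test V1 V2 _) (x := x) (r := r) (fun z _ hz => fd_off fun h' => hz (V3 h')) h1,
      h.sol.near h.nC h.oC h.cC V1 V2 fun z hz => lt_trans (show z 2 < _ from hb (V3 hz)) (by norm_num),
      div_mul_cancel₀ _ h.lam0.ne', sub_eq_zero]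
    congr 1
    refine setIntegral_congr_fun oO.measurableSet fun z _ => ?_
    show trc _ = (θ z • trL) _
    by_cases hz : z ∈ ball x r
    · rw [h1 z hz, one_smul, trL_app]
    · rw [fd_off fun h' => hz (V3 h')]; simp [trc]
lemma Cx.id1 (h : Cx lam mu p D₀ K r K' C u) (c : Cu D₀ θ) (hx : x 2 ≤ 0) (hxC : x ∉ C)
    {V : E3 → E3} (hV : Adm (Om C) V) (V0 : ∀ z ∈ Om C, r/6 ≤ ‖z - x‖ → V z = 0) :
    ∫ z in Om C, bil lam mu (Df u z) (Df V z) = p * Lf θ (Om C) V := by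
  obtain ⟨S, g, s, κ, hP, hG, hw, hd⟩ := h.loc c hx hxC
  have oO := Om_open C
  have hr := h.r0
  have := hP.ext_pull (eps1_le _ _) oO hG h.r0 (uk_C h.sol.1) (uk_N oO h.sol.1 h.sol.2.2.1 inter_subset_left
    (oO.measurableSet.inter measurableSet_ball) (measure_lt_top_mono inter_subset_right measure_ball_lt_top).ne) hw hV.1 V0 hV.2.2
  rcases hd with ⟨rfl, d⟩ | ⟨k, h1⟩
  · have e : uk 0 u = u := by ext1 z; simp [uk]
    rw [e] at this
    rw [this, Lf_zero c hV h.r0 d V0, mul_zero]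
  · have V1 : ∀ z ∈ Om C, z ∉ ball x r → Df V z = 0 := fun z hz hb => by
      have : V =ᶠ[𝓝 z] fun _ => 0 := by
        rw [mem_ball, dist_eq_norm, not_lt] at hb
        have o : IsOpen {y : E3 | r/6 < ‖y - x‖} := isOpen_lt continuous_const (by fun_prop)
        filter_upwards [oO.mem_nhds hz, o.mem_nhds (show r/6 < ‖z - x‖ by linarith)] with y hy hy'
        exact V0 y hy (le_of_lt hy')
      rw [this.fderiv_eq]; simp
    rw [split_k c oO h.sol.1 h.sol.2.2.1 hV V1 h1, sub_eq_zero, k] at this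
    rw [this, Lf]
    have z0 : ∫ z in Om C, Df θ z (V z) = 0 := setIntegral_eq_zero_of_forall_eq_zero fun z hz => by
      by_cases hb : z ∈ ball x r
      · have : θ =ᶠ[𝓝 z] fun _ => 1 := by
          filter_upwards [isOpen_ball.mem_nhds hb] with y hy using h1 y hy
        rw [this.fderiv_eq]; simp
      · rw [V0 z hz (by rw [mem_ball, dist_eq_norm, not_lt] at hb; linarith), map_zero]
    rw [z0, add_zero]
lemma Adm.mul {V : E3 → E3} (oO : IsOpen O) (h : Adm O V) {f : E3 → ℝ} (hf : ContDiff ℝ ∞ f) {M : ℝ}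
    (b1 : ∀ z, |f z| ≤ M) (b2 : ∀ z, ‖Df f z‖ ≤ M) : Adm O (fun z => f z • V z) := by
  refine ⟨((hf.of_le (leI 1)).contDiffOn).fun_smul h.1, ?_, ?_⟩
  · exact ((N2_le oO.measurableSet (g := V) (c := M) fun z _ => by
      rw [norm_smul]; exact mul_le_mul_of_nonneg_right (b1 z) (norm_nonneg _)).trans_lt
        (ENNReal.mul_lt_top ENNReal.ofReal_lt_top h.2.1.lt_top)).ne
  · refine ((N2_two oO.measurableSet (Adm.m oO h.1).2 (h := V) (a := M) (b := M) fun z hz => ?_).trans_lt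
      (ENNReal.add_lt_top.2 ⟨ENNReal.mul_lt_top ENNReal.ofReal_lt_top h.2.2.lt_top,
      ENNReal.mul_lt_top ENNReal.ofReal_lt_top h.2.1.lt_top⟩)).ne
    rw [((hf.differentiable (by simp) z).hasFDerivAt.fun_smul (dif oO h.1 hz).hasFDerivAt).fderiv]
    refine (norm_add_le _ _).trans (add_le_add ?_ ?_)
    · rw [norm_smul]; exact mul_le_mul_of_nonneg_right (b1 z) (norm_nonneg _)
    · exact (ContinuousLinearMap.norm_smulRight_apply _ _).le.trans (mul_le_mul_of_nonneg_right (b2 z) (norm_nonneg _))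
lemma Cx.id2 (h : Cx lam mu p D₀ K r K' C u) (c : Cu D₀ θ) (T : Finset E3) :
    ∀ V, Adm (Om C) V → (∀ x ∈ T, x 2 ≤ 0 ∧ x ∉ C) → (∀ z ∈ Om C, V z ≠ 0 → ∃ x ∈ T, ‖z - x‖ ≤ r/12) →
    ∫ z in Om C, bil lam mu (Df u z) (Df V z) = p * Lf θ (Om C) V := by
  classical
  have oO := Om_open C
  have hr := h.r0
  induction T using Finset.induction_on with
  | empty =>
    intro V _ _ h0
    have V0 : ∀ z ∈ Om C, V z = 0 := fun z hz => by by_contra hc; simpa using h0 z hz hc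
    have V1 : ∀ z ∈ Om C, Df V z = 0 := fun z hz => by
      have : V =ᶠ[𝓝 z] fun _ => 0 := by filter_upwards [oO.mem_nhds hz] with y hy using V0 y hy
      rw [this.fderiv_eq]; simp
    rw [Lf, setIntegral_eq_zero_of_forall_eq_zero fun z hz => by rw [V1 z hz, map_zero],
      setIntegral_eq_zero_of_forall_eq_zero fun z hz => by rw [V1 z hz, map_zero],
      setIntegral_eq_zero_of_forall_eq_zero fun z hz => by rw [V0 z hz, map_zero]]
    simp
  | insert x T _ ih =>
    intro V hV hT h0
    obtain ⟨χ, M, M0, χC, χ1, χ0, χb, χd⟩ := bump_ex (ρ := r/12) (r := r/6) (by linarith) (by linarith)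
    set f : E3 → ℝ := fun z => χ (z - x) with hf
    have fC : ContDiff ℝ ∞ f := χC.comp (contDiff_id.sub contDiff_const)
    have fd : ∀ z, Df f z = Df χ (z - x) := fun z => fderiv_comp_sub x
    have A1 : Adm (Om C) (fun z => f z • V z) := hV.mul oO fC (M := 1 + M)
      (fun z => by rw [abs_of_nonneg (χb _).1]; linarith [(χb (z - x)).2]) fun z => by rw [fd]; linarith [χd (z - x)]
    have A2 : Adm (Om C) (fun z => (1 - f z) • V z) := hV.mul oO (contDiff_const.sub fC) (M := 1 + M)
      (fun z => by rw [abs_of_nonneg (by linarith [(χb (z - x)).2])]; linarith [(χb (z - x)).1])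
      fun z => by rw [fderiv_const_sub, norm_neg, fd]; linarith [χd (z - x)]
    have I1 := h.id1 c (hT x (by simp)).1 (hT x (by simp)).2 A1 fun z _ hz => by
      rw [show f z = 0 from χ0 _ (by linarith), zero_smul]
    have I2 := ih _ A2 (fun y hy => hT y (by simp [hy])) fun z hz hz' => by
      obtain ⟨y, hy, hy'⟩ := h0 z hz fun h' => hz' (by simp only [h', smul_zero])
      rcases Finset.mem_insert.1 hy with rfl | hy2
      · exact absurd (by simp only [show f z = 1 from χ1 _ hy', sub_self, zero_smul]) hz'
      · exact ⟨y, hy2, hy'⟩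
    have s0 : ∀ z, V z = f z • V z + (1 - f z) • V z := fun z => by rw [← add_smul]; simp
    have s1 : ∀ z ∈ Om C, Df V z = Df (fun z => f z • V z) z + Df (fun z => (1 - f z) • V z) z := fun z hz => by
      rw [← fderiv_fun_add (dif oO A1.1 hz) (dif oO A2.1 hz)]
      congr 1; exact funext s0
    have e1 : ∫ z in Om C, bil lam mu (Df u z) (Df V z) = p * Lf θ (Om C) (fun z => f z • V z) +
        p * Lf θ (Om C) (fun z => (1 - f z) • V z) := by
      rw [← I1, ← I2, ← integral_add (Adm.i3 oO h.sol.1 h.sol.2.2.1 A1) (Adm.i3 oO h.sol.1 h.sol.2.2.1 A2)]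
      refine setIntegral_congr_fun oO.measurableSet fun z hz => ?_
      simp only [s1 z hz, map_add]
    have e2 : ∫ z in Om C, (θ z • trL) (Df V z) = (∫ z in Om C, (θ z • trL) (Df (fun z => f z • V z) z)) +
        ∫ z in Om C, (θ z • trL) (Df (fun z => (1 - f z) • V z) z) := by
      rw [← integral_add (A1.i1 c oO) (A2.i1 c oO)]
      refine setIntegral_congr_fun oO.measurableSet fun z hz => ?_
      simp only [s1 z hz, map_add]
    have e3 : ∫ z in Om C, Df θ z (V z) = (∫ z in Om C, Df θ z (f z • V z)) +
        ∫ z in Om C, Df θ z ((1 - f z) • V z) := by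
      rw [← integral_add (A1.i2 c oO) (A2.i2 c oO)]
      refine setIntegral_congr_fun oO.measurableSet fun z hz => ?_
      simp only [← map_add, ← s0]
    rw [e1, Lf, Lf, Lf, e2, e3]; ring
variable {lam mu p D₀ K r : ℝ} {K' : ℝ≥0} {C : Set E3} {u : E3 → E3}
def wu (u : E3 → E3) (z : E3) : E3 := (√(1 + ‖z‖^2))⁻¹ • u z
lemma wu_n (u : E3 → E3) (z : E3) : ‖u z‖ = √(1 + ‖z‖^2) * ‖wu u z‖ := by
  have : 0 < √(1 + ‖z‖^2) := Real.sqrt_pos.2 (by positivity)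
  rw [wu, norm_smul, norm_inv, Real.norm_of_nonneg this.le, mul_inv_cancel_left₀ this.ne']
lemma Sol.wN (h : Sol lam mu p C u) : N2 (wu u) (Om C) ≠ ⊤ := by
  refine (ne_of_eq_of_ne ?_ h.2.1)
  refine lintegral_congr fun z => ?_
  rw [wu, enorm_smul, mul_pow]
  congr 1
  have : 0 < 1 + ‖z‖^2 := by positivity
  rw [Real.enorm_of_nonneg (by positivity), ← ENNReal.ofReal_pow (by positivity), inv_pow, Real.sq_sqrt this.le]
lemma eta_ex : ∃ M : ℝ, 0 ≤ M ∧ ∀ N : ℝ, 1 ≤ N → ∃ η : E3 → ℝ, ContDiff ℝ ∞ η ∧ (∀ z, ‖z‖ ≤ N → η z = 1) ∧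
    (∀ z, 2*N ≤ ‖z‖ → η z = 0) ∧ (∀ z, |η z| ≤ 1) ∧ ∀ z, ‖Df η z‖ * √(1 + ‖z‖^2) ≤ M := by
  obtain ⟨χ, M, M0, χC, χ1, χ0, χb, χd⟩ := bump_ex (ρ := 1) (r := 2) one_pos one_lt_two
  refine ⟨M * 3, by positivity, fun N hN => ⟨fun z => χ (N⁻¹ • z), χC.comp (contDiff_const_smul _), ?_, ?_, ?_, ?_⟩⟩
  all_goals have N0 : 0 < N := by linarith
  all_goals have nn : ∀ z : E3, ‖N⁻¹ • z‖ = N⁻¹ * ‖z‖ := fun z => by rw [norm_smul, Real.norm_of_nonneg (by positivity)]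
  · intro z hz; refine χ1 _ ?_; rw [nn, inv_mul_le_iff₀ N0]; linarith
  · intro z hz; refine χ0 _ ?_; rw [nn, le_inv_mul_iff₀ N0]; linarith
  · intro z; rw [abs_of_nonneg (χb _).1]; exact (χb _).2
  · intro z
    have hd : HasFDerivAt (fun z => χ (N⁻¹ • z)) ((Df χ (N⁻¹ • z)).comp (N⁻¹ • ContinuousLinearMap.id ℝ E3)) z :=
      (χC.differentiable (by simp) _).hasFDerivAt.comp z ((hasFDerivAt_id z).fun_const_smul N⁻¹)
    rw [hd.fderiv]
    by_cases hz : 2*N < ‖z‖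
    · have : Df χ (N⁻¹ • z) = 0 := by
        have : χ =ᶠ[𝓝 (N⁻¹ • z)] fun _ => 0 := by
          have o : IsOpen {y : E3 | 2 < ‖y‖} := isOpen_lt continuous_const continuous_norm
          filter_upwards [o.mem_nhds (show 2 < ‖N⁻¹ • z‖ by rw [nn, lt_inv_mul_iff₀ N0]; linarith)] with y hy
          exact χ0 y (by linarith [show 2 < ‖y‖ from hy])
        rw [this.fderiv_eq]; simp
      rw [this]; simp; positivity
    · have h1 : ‖(Df χ (N⁻¹ • z)).comp (N⁻¹ • ContinuousLinearMap.id ℝ E3)‖ ≤ M * N⁻¹ := by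
        refine (ContinuousLinearMap.opNorm_comp_le _ _).trans (mul_le_mul (χd _) ?_ (norm_nonneg _) M0)
        rw [norm_smul, Real.norm_of_nonneg (by positivity)]
        exact mul_le_of_le_one_right (by positivity) ContinuousLinearMap.norm_id_le
      have h2 : √(1 + ‖z‖^2) ≤ 3 * N := by
        rw [Real.sqrt_le_left (by positivity)]; nlinarith [norm_nonneg z]
      calc _ ≤ (M * N⁻¹) * (3 * N) := by gcongr
        _ = M * 3 := by field_simp
lemma Cx.energy (h : Cx lam mu p D₀ K r K' C u) (c : Cu D₀ θ) :
    ∫ z in Om C, bil lam mu (Df u z) (Df u z) = p * Lf θ (Om C) u := by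
  have oO := Om_open C
  have hr := h.r0
  have D1 := h.D1
  obtain ⟨M, M0, hη⟩ := eta_ex
  choose η ηC η1 η0 ηb ηd using fun n : ℕ => hη (n + 2*D₀ + 3) (by have : (0:ℝ) ≤ n := n.cast_nonneg; linarith)
  have Nn : ∀ n : ℕ, (0:ℝ) ≤ n := fun n => n.cast_nonneg
  have dV : ∀ n, ∀ z ∈ Om C, Df (fun z => η n z • u z) z = η n z • Df u z + (Df (η n) z).smulRight (u z) :=
    fun n z hz => (((ηC n).differentiable (by simp) z).hasFDerivAt.fun_smul (dif oO h.sol.1 hz).hasFDerivAt).fderiv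
  have bV : ∀ n, ∀ z ∈ Om C, ‖Df (fun z => η n z • u z) z‖ ≤ ‖Df u z‖ + M * ‖wu u z‖ := fun n z hz => by
    rw [dV n z hz]
    refine (norm_add_le _ _).trans (add_le_add ?_ ?_)
    · rw [norm_smul]; exact mul_le_of_le_one_left (norm_nonneg _) (ηb n z)
    · rw [ContinuousLinearMap.norm_smulRight_apply, wu_n u z, ← mul_assoc]
      exact mul_le_mul_of_nonneg_right (ηd n z) (norm_nonneg _)
  have mu' := Adm.m oO h.sol.1
  have A : ∀ n, Adm (Om C) fun z => η n z • u z := fun n => by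
    refine ⟨(((ηC n).of_le (leI 1)).contDiffOn).fun_smul h.sol.1, ?_, ?_⟩
    · refine ((N2_le oO.measurableSet (g := wu u) (c := √(1 + (2*(n + 2*D₀ + 3))^2)) fun z _ => ?_).trans_lt
        (ENNReal.mul_lt_top ENNReal.ofReal_lt_top h.sol.wN.lt_top)).ne
      by_cases hz : 2*(n + 2*D₀ + 3) ≤ ‖z‖
      · rw [η0 n z hz, zero_smul, norm_zero]; positivity
      · rw [norm_smul]
        refine (mul_le_of_le_one_left (norm_nonneg _) (ηb n z)).trans ?_
        rw [wu_n u z]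
        have := not_le.1 hz
        gcongr
    · refine ((N2_two oO.measurableSet mu'.2 (h := wu u) (a := 1) (b := M) fun z hz => ?_).trans_lt
        (ENNReal.add_lt_top.2 ⟨ENNReal.mul_lt_top ENNReal.ofReal_lt_top h.sol.2.2.1.lt_top,
        ENNReal.mul_lt_top ENNReal.ofReal_lt_top h.sol.wN.lt_top⟩)).ne
      rw [one_mul]; exact bV n z hz
  have near : ∀ n : ℕ, ∀ z, ‖z‖ < n + 2*D₀ + 3 → (fun z => η n z • u z) =ᶠ[𝓝 z] u := fun n z hz => by
    have o : IsOpen {y : E3 | ‖y‖ < n + 2*D₀ + 3} := isOpen_lt continuous_norm continuous_const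
    filter_upwards [o.mem_nhds hz] with y hy
    rw [η1 n y (le_of_lt hy), one_smul]
  have L : ∀ n, Lf θ (Om C) (fun z => η n z • u z) = Lf θ (Om C) u := fun n => by
    have z0 : ∀ z : E3, ¬ ‖z‖ < n + 2*D₀ + 3 → θ z = 0 ∧ Df θ z = 0 := fun z hz => by
      have hz' : 2*D₀+2 < ‖z‖ := by linarith [not_lt.1 hz, Nn n]
      refine ⟨c.far z hz'.le, ?_⟩
      have : θ =ᶠ[𝓝 z] fun _ => 0 := by
        filter_upwards [(isOpen_lt continuous_const continuous_norm).mem_nhds hz'] with y hy using c.far y (le_of_lt hy)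
      rw [this.fderiv_eq]; simp
    unfold Lf
    congr 1 <;> refine integral_congr_ae (.of_forall fun z => ?_) <;> by_cases hz : ‖z‖ < n + 2*D₀ + 3
    · simp only [(near n z hz).fderiv_eq]
    · simp only [(z0 z hz).1, zero_smul, _root_.zero_apply]
    · simp only [(near n z hz).eq_of_nhds]
    · simp only [(z0 z hz).2, _root_.zero_apply]
  have I : ∀ n, ∫ z in Om C, bil lam mu (Df u z) (Df (fun z => η n z • u z) z) = p * Lf θ (Om C) u := fun n => by
    have kc : IsCompact ((closedBall o3 (2*(n + 2*D₀ + 3)) ∩ {z : E3 | z 2 ≤ 0}) \ C) :=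
      IsCompact.diff ((isCompact_closedBall _ _).inter_right (isClosed_le (f := fun z : E3 => z 2)
        ((EuclideanSpace.proj (2:Fin 3) : E3 →L[ℝ] ℝ).continuous) continuous_const)) h.oC
    obtain ⟨t, ts, tf, tc⟩ := kc.finite_cover_balls (e := r/12) (by linarith)
    rw [← L n]
    refine h.id2 c tf.toFinset _ (A n) (fun x hx => ?_) fun z hz hz' => ?_
    · have := ts (tf.mem_toFinset.1 hx); exact ⟨this.1.2, this.2⟩
    · have : z ∈ (closedBall o3 (2*(n + 2*D₀ + 3)) ∩ {z : E3 | z 2 ≤ 0}) \ C := by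
        refine ⟨⟨?_, le_of_lt (show z 2 < 0 from hz.1)⟩, fun h' => hz.2 (subset_closure h')⟩
        rw [mem_closedBall_zero_iff]; by_contra h'
        exact hz' (by simp only [η0 n z (not_le.1 h').le, zero_smul])
      obtain ⟨x, hx, hx'⟩ := mem_iUnion₂.1 (tc this)
      exact ⟨x, tf.mem_toFinset.2 hx, by rw [mem_ball, dist_eq_norm] at hx'; exact hx'.le⟩
  have lim : Tendsto (fun n => ∫ z in Om C, bil lam mu (Df u z) (Df (fun z => η n z • u z) z)) atTop
      (𝓝 (∫ z in Om C, bil lam mu (Df u z) (Df u z))) := by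
    have i1 := (int_sq mu'.2 h.sol.2.2.1).1
    have mw : AEStronglyMeasurable (wu u) (volume.restrict (Om C)) :=
      (Continuous.aestronglyMeasurable (Continuous.inv₀ (f := fun z : E3 => √(1 + ‖z‖^2)) (by fun_prop) fun z =>
        (Real.sqrt_pos.2 (by positivity)).ne')).smul mu'.1
    have i2 := (int_sq mw h.sol.wN).1
    refine tendsto_integral_of_dominated_convergence (fun z => ‖bil lam mu‖ * (2 * ‖Df u z‖^2 + M^2 * ‖wu u z‖^2))
      (fun n => (Adm.i3 oO h.sol.1 h.sol.2.2.1 (A n)).aestronglyMeasurable) (((i1.const_mul 2).add (i2.const_mul (M^2))).const_mul _)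
      (fun n => ?_) ?_
    · filter_upwards [ae_restrict_mem oO.measurableSet] with z hz
      refine ((bil lam mu).le_opNorm₂ _ _).trans ?_
      rw [mul_assoc]
      refine mul_le_mul_of_nonneg_left ?_ (norm_nonneg _)
      nlinarith [mul_le_mul_of_nonneg_left (bV n z hz) (norm_nonneg (Df u z)), sq_nonneg (‖Df u z‖ - M * ‖wu u z‖)]
    · refine .of_forall fun z => tendsto_const_nhds.congr' ?_
      obtain ⟨k, hk⟩ := exists_nat_gt ‖z‖
      filter_upwards [eventually_ge_atTop k] with n hn
      have : (k:ℝ) ≤ n := by exact_mod_cast hn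
      rw [(near n z (by linarith)).fderiv_eq]
  simp only [I] at lim
  exact tendsto_nhds_unique lim tendsto_const_nhds
variable {lam mu p D₀ K r : ℝ} {K' : ℝ≥0} {C : Set E3} {u : E3 → E3}
lemma Pch.vis {ε : ℝ} {S : E3 ≃ₗᵢ[ℝ] E3} {g : E3 → ℝ} {s : ℝ} (h : Pch O ε K r x S g s)
    (he : ε ≤ 1/72) (hr : 0 < r) {a b : E3} (ha : ‖a‖ < r/2) (haO : x + S a ∈ O) (hb : ‖b + (r/4) • ee 2‖ < r/16) :
    ∀ c ∈ segment ℝ (x + S b) (x + S a), c ∈ O := by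
  rintro _ ⟨t', t, ht', ht, hs, rfl⟩
  obtain rfl : t' = 1 - t := by linarith
  have b2 : b 2 + r/4 ≤ r/16 := by
    have := PiLp.norm_apply_le (b + (r/4) • ee 2) (2:Fin 3)
    have e : (b + (r/4) • ee 2) 2 = b 2 + r/4 := by simp
    rw [e] at this
    exact (le_abs_self _).trans (this.trans hb.le)
  have nb : ‖b‖ ≤ 5*r/16 := by
    have := norm_sub_le (b + (r/4) • ee 2) ((r/4) • ee 2)
    rw [add_sub_cancel_right, ee_n 2 (by positivity)] at this
    linarith
  set c : E3 := (1 - t) • b + t • a with hc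
  have nc : ‖c‖ < r/2 := by
    have h1 := norm_add_le ((1-t) • b) (t • a)
    rw [norm_smul, norm_smul, Real.norm_of_nonneg ht', Real.norm_of_nonneg ht] at h1
    rcases eq_or_lt_of_le ht with h0 | h0
    · subst h0; simp [hc]; linarith
    · have := mul_lt_mul_of_pos_left ha h0
      have := mul_le_mul_of_nonneg_left nb ht'
      nlinarith
  have mb : ∀ {y : E3}, ‖y‖ < r/2 → y ∈ ball o3 r := fun hy => by rw [mem_ball_zero_iff]; linarith
  have e1 : (1 - t) • (x + S b) + t • (x + S a) = x + S c := by
    rw [hc, map_add, map_smul, map_smul]; module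
  rw [e1, h.mem c (mb nc)]
  have a2 := (h.mem a (mb ha)).1 haO
  have l1 := h.lip (mb ha) (mb nc)
  have l2 := h.gsm he (mb nc)
  have ac : a - c = (1 - t) • (a - b) := by rw [hc]; module
  have l3 : |g a - g c| ≤ (1 - t) * (r/24) := by
    refine l1.trans ?_
    rw [ac, norm_smul, Real.norm_of_nonneg ht']
    have : ‖a - b‖ ≤ r := by linarith [norm_sub_le a b]
    have h3 : 3 * ε * ‖a - b‖ ≤ 1/24 * r := by
      refine (mul_le_mul_of_nonneg_right (by linarith : 3 * ε ≤ 1/24) (norm_nonneg _)).trans ?_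
      linarith
    nlinarith
  have c2 : c 2 = (1 - t) * b 2 + t * a 2 := by simp [hc]
  have s0 := h.s0
  have := abs_le.1 l2
  have := abs_le.1 l3
  have f1 : (1 - t) * b 2 ≤ (1 - t) * (-(3*r/16)) := mul_le_mul_of_nonneg_left (by linarith) ht'
  have f2 : (1 - t) * (g c) ≥ (1 - t) * (-(r/48)) := mul_le_mul_of_nonneg_left (by linarith) ht'
  have f3 : 0 ≤ (1 - t) * s := mul_nonneg ht' s0
  rcases eq_or_lt_of_le ht with h0 | h0
  · subst h0; linarith
  · have f4 := mul_lt_mul_of_pos_left a2 h0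
    have f5 : t * (g a - g c) ≤ t * ((1 - t) * (r/24)) := mul_le_mul_of_nonneg_left (by linarith) ht
    have f6 : 0 ≤ (1 - t) * r := mul_nonneg ht' hr.le
    have f7 : t * ((1 - t) * r) ≤ (1 - t) * r := mul_le_of_le_one_left f6 (by linarith)
    rw [c2]; linarith
lemma hop (hr : 0 < r) : ∃ L : ℝ≥0, ∀ (lam mu p D₀ K : ℝ) (K' : ℝ≥0) (C : Set E3) (u : E3 → E3), Cx lam mu p D₀ K r K' C u →
    ∀ x y : E3, y 2 ≤ 0 → y ∉ C → ‖x - y‖ < r/8 →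
    N2 u (Om C ∩ ball y (r/2)) ≤ L * (N2 u (Om C ∩ ball x (r/2)) + N2 (fun x => sym (Df u x)) (Om C)) := by
  obtain ⟨L, hL⟩ := qlem (r/16) r (by positivity)
  refine ⟨L, fun lam mu p D₀ K K' C u h x y hy hyC hxy => ?_⟩
  obtain ⟨S, g, s, hP, -, -⟩ := h.pt y hy hyC
  have v := fun (a b : E3) => hP.vis (eps1_le _ _) hr (a := a) (b := b)
  set z : E3 := y + S (-((r/4) • ee 2)) with hz
  have back : ∀ w : E3, y + S (S.symm (w - y)) = w := fun w => by simp
  have nb : ∀ w ∈ ball z (r/16), ‖S.symm (w - y) + (r/4) • ee 2‖ < r/16 := fun w hw => by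
    rw [mem_ball, dist_eq_norm, hz] at hw
    rw [← S.norm_map, map_add, S.apply_symm_apply]
    rw [map_neg] at hw
    rwa [show w - y + S ((r/4) • ee 2) = w - (y + -S ((r/4) • ee 2)) by abel]
  have nz : ∀ w ∈ ball z (r/16), ‖w - y‖ < 5*r/16 := fun w hw => by
    have h1 := nb w hw
    have := norm_sub_le (S.symm (w - y) + (r/4) • ee 2) ((r/4) • ee 2)
    rw [add_sub_cancel_right, ee_n 2 (by positivity), S.symm.norm_map] at this
    linarith
  refine (hL (Om C) u (Om C ∩ ball y (r/2)) z (Om_open C) h.sol.1 ((Om_ne_meas C).inter measurableSet_ball)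
    fun ξ hξ w hw => ?_).trans ?_
  · have n1 := hξ.2
    rw [mem_ball, dist_eq_norm] at n1
    constructor
    · have := v (S.symm (ξ - y)) (S.symm (w - y)) (by rwa [S.symm.norm_map]) (by rw [back]; exact hξ.1) (nb w hw)
      rwa [back, back] at this
    · have := norm_sub_le (ξ - y) (w - y)
      rw [sub_sub_sub_cancel_right] at this
      linarith [nz w hw]
  · gcongr
    refine N2_mono fun w hw => ⟨?_, ?_⟩
    · have n2 := nz w hw
      have key := hP.mem (S.symm (w - y)) (by rw [mem_ball_zero_iff, S.symm.norm_map]; linarith)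
      rw [back] at key
      have n3 := nb w hw
      have b2 : (S.symm (w - y)) 2 + r/4 ≤ r/16 := by
        have := PiLp.norm_apply_le (S.symm (w - y) + (r/4) • ee 2) (2:Fin 3)
        rw [show (S.symm (w - y) + (r/4) • ee 2) 2 = (S.symm (w - y)) 2 + r/4 by simp] at this
        exact (le_abs_self _).trans (this.trans n3.le)
      have := abs_le.1 (hP.gsm (eps1_le _ _) (y := S.symm (w - y)) (by rw [mem_ball_zero_iff, S.symm.norm_map]; linarith))
      rw [S.symm.norm_map] at this
      exact key.2 (by linarith [hP.s0])
    · rw [mem_ball, dist_eq_norm]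
      have := norm_add_le (w - y) (y - x)
      rw [sub_add_sub_cancel, norm_sub_rev y x] at this
      linarith [nz w hw]
lemma net (R δ : ℝ) (hδ : 0 < δ) : ∃ T : Finset E3, closedBall o3 R ⊆ ⋃ x ∈ T, ball x δ := by
  obtain ⟨t, -, tf, tc⟩ := (isCompact_closedBall o3 R).finite_cover_balls hδ
  exact ⟨tf.toFinset, by simpa using tc⟩
lemma chain_lem (T : Finset E3) (δ : ℝ) (k : ℝ≥0) (n : ℕ) : ∀ c : ℝ≥0, ∃ c' : ℝ≥0, ∀ (A : Set E3) (m : E3 → ℝ≥0∞) (e : ℝ≥0∞) (G : Finset E3),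
    IsPreconnected A → A ⊆ (⋃ x ∈ T, ball x (δ/2)) → (∀ x ∈ A, ∀ y ∈ A, ‖x - y‖ < δ → m y ≤ k * (m x + e)) →
    G ⊆ T → (T \ G).card ≤ n → (A ∩ ⋃ x ∈ G, ball x (δ/2)).Nonempty →
    (∀ z ∈ A, z ∈ (⋃ x ∈ G, ball x (δ/2)) → m z ≤ c * e) → ∀ z ∈ A, m z ≤ c' * e := by
  classical
  induction n with
  | zero =>
    intro c
    refine ⟨c, fun A m e G _ hA _ hG hn _ hc z hz => hc z hz ?_⟩
    have : T ⊆ G := by simpa [Finset.sdiff_eq_empty_iff_subset] using hn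
    exact biUnion_subset_biUnion_left this (hA hz)
  | succ n ih =>
    intro c
    obtain ⟨c', hc'⟩ := ih (max c (k * (c + 1)))
    refine ⟨max c c', fun A m e G pA hA hm hG hn ne hc => ?_⟩
    set U := ⋃ x ∈ G, ball x (δ/2)
    set W := ⋃ x ∈ T \ G, ball x (δ/2) with hW
    have oU : IsOpen U := isOpen_biUnion fun _ _ => isOpen_ball
    have oW : IsOpen W := isOpen_biUnion fun _ _ => isOpen_ball
    have AU : A ⊆ U ∪ W := fun z hz => by
      obtain ⟨x, hx, hx'⟩ := mem_iUnion₂.1 (hA hz)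
      by_cases h : x ∈ G
      · exact Or.inl (mem_iUnion₂.2 ⟨x, h, hx'⟩)
      · exact Or.inr (mem_iUnion₂.2 ⟨x, Finset.mem_sdiff.2 ⟨hx, h⟩, hx'⟩)
    by_cases hAW : (A ∩ W).Nonempty
    · obtain ⟨z, zA, zU, zW⟩ := pA U W oU oW AU ne hAW
      obtain ⟨t, ht, hzt⟩ := mem_iUnion₂.1 zW
      obtain ⟨tT, tG⟩ := Finset.mem_sdiff.1 ht
      have main := hc' A m e (insert t G) pA hA hm (Finset.insert_subset tT hG) ?_ ?_ ?_
      · exact fun y hy => (main y hy).trans (by gcongr; exact le_max_right _ _)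
      · have h1 : (T \ insert t G).card < (T \ G).card := Finset.card_lt_card <| by
          refine (Finset.ssubset_iff_of_subset (Finset.sdiff_subset_sdiff le_rfl (Finset.subset_insert _ _))).2 ⟨t, ht, by simp⟩
        omega
      · exact ⟨z, zA, mem_iUnion₂.2 ⟨t, by simp, hzt⟩⟩
      · intro y hy hy'
        obtain ⟨x, hx, hx'⟩ := mem_iUnion₂.1 hy'
        rcases Finset.mem_insert.1 hx with rfl | hx
        · have h1 := hm z zA y hy (by
            rw [← dist_eq_norm]
            have := dist_triangle_right z y x
            rw [mem_ball] at hzt hx'; linarith)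
          calc m y ≤ k * (c * e + e) := h1.trans (by gcongr; exact hc z zA zU)
            _ = ((k * (c + 1) : ℝ≥0) : ℝ≥0∞) * e := by push_cast; ring
            _ ≤ _ := by gcongr; exact le_max_right _ _
        · exact (hc y hy (mem_iUnion₂.2 ⟨x, hx, hx'⟩)).trans (by gcongr; exact le_max_left _ _)
    · intro z hz
      refine (hc z hz ((AU hz).resolve_right fun h => hAW ⟨z, hz, h⟩)).trans (by gcongr; exact le_max_left _ _)
lemma Cx.clb (h : Cx lam mu p D₀ K r K' C u) {w : E3} (hw : w ∈ closure C) : ‖w‖ ≤ 2*D₀ :=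
  mem_closedBall_zero_iff.1 (closure_ball_subset_closedBall (closure_mono h.bC hw))
lemma Cx.conn (h : Cx lam mu p D₀ K r K' C u) {R : ℝ} (hR : 2*D₀ < R) : IsPreconnected (Om C ∩ closedBall 0 R) := by
  have D1 := h.D1
  have mp : ∀ z : E3, 0 < max R ‖z‖ := fun z => lt_of_lt_of_le (by linarith) (le_max_left _ _)
  have e : Om C ∩ closedBall 0 R = (fun z : E3 => (R / max R ‖z‖) • z) '' Om C := by
    ext y
    constructor
    · rintro ⟨h1, h2⟩
      refine ⟨y, h1, ?_⟩
      rw [mem_closedBall_zero_iff] at h2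
      simp only [max_eq_left h2, div_self (by linarith : R ≠ 0), one_smul]
    · rintro ⟨z, hz, rfl⟩
      simp only
      by_cases hc : ‖z‖ ≤ R
      · rw [max_eq_left hc, div_self (by linarith : R ≠ 0), one_smul]
        exact ⟨hz, mem_closedBall_zero_iff.2 hc⟩
      · have hc := not_le.1 hc
        have z0 : 0 < ‖z‖ := by linarith
        have nn : ‖(R / max R ‖z‖) • z‖ = R := by
          rw [max_eq_right hc.le, norm_smul, Real.norm_of_nonneg (div_nonneg (by linarith) z0.le), div_mul_cancel₀ _ z0.ne']
        refine ⟨⟨?_, fun h' => ?_⟩, mem_closedBall_zero_iff.2 nn.le⟩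
        · show ((R / max R ‖z‖) • z) 2 < 0
          have : z 2 < 0 := hz.1
          have hp : 0 < R / max R ‖z‖ := div_pos (by linarith) (mp z)
          simpa using mul_neg_of_pos_of_neg hp this
        · linarith [h.clb h']
  rw [e]
  refine h.CC.isPreconnected.image _ (Continuous.continuousOn ?_)
  exact (continuous_const.div (by fun_prop) fun z => (mp z).ne').smul continuous_id
lemma chain (hr : 0 < r) (D₀ R : ℝ) : ∃ L : ℝ≥0, ∀ (lam mu p K : ℝ) (K' : ℝ≥0) (C : Set E3) (u : E3 → E3),
    Cx lam mu p D₀ K r K' C u → N2 u (Om C ∩ ball 0 R) ≤ L * N2 (fun x => sym (Df u x)) (Om C) := by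
  classical
  obtain ⟨k1, hk1⟩ := hop hr
  obtain ⟨k2, hk2⟩ := cone
  set R' := max R (2*D₀+3)
  obtain ⟨T, hT⟩ := net R' (r/8/2) (by positivity)
  obtain ⟨c, hc⟩ := chain_lem T (r/8) k1 T.card (k1 * (k2 + 1))
  refine ⟨T.card * c, fun lam mu p K K' C u h => ?_⟩
  set e := N2 (fun x => sym (Df u x)) (Om C)
  have D1 := h.D1
  have r6 := h.r6
  set x₀ : E3 := (-(2*D₀+2)) • ee 2 with hx₀
  have x2 : x₀ 2 = -(2*D₀+2) := by simp [hx₀]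
  have deep : ∀ z : E3, z 2 < -(2*D₀) → z ∈ Om C := fun z hz => by
    refine ⟨show z 2 < 0 by linarith, fun h' => ?_⟩
    have := PiLp.norm_apply_le z (2:Fin 3)
    rw [Real.norm_eq_abs] at this
    linarith [h.clb h', neg_abs_le (z 2)]
  have x0n : ‖x₀‖ ≤ R' := by
    rw [hx₀, neg_smul, norm_neg, ee_n 2 (by linarith)]
    exact le_trans (by linarith) (le_max_right _ _)
  have m0 : N2 u (Om C ∩ ball x₀ (r/2)) ≤ k2 * e := by
    refine (N2_mono (inter_subset_right.trans (ball_subset_ball (by linarith)))).trans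
      (hk2 (Om C) u x₀ (-ee 2) (Om_open C) h.sol.1 (by simp) (fun ξ hξ q hq s hs => deep _ ?_) h.sol.2.1)
    have h1 := PiLp.norm_apply_le (ξ - x₀) (2:Fin 3)
    have h2 := PiLp.norm_apply_le (q - (-ee 2)) (2:Fin 3)
    rw [mem_ball, dist_eq_norm] at hξ hq
    rw [Real.norm_eq_abs, show (ξ - x₀) 2 = ξ 2 + (2*D₀+2) by rw [PiLp.sub_apply, x2]; ring] at h1
    rw [Real.norm_eq_abs, show (q - (-ee 2)) 2 = q 2 + 1 by simp] at h2
    have h3 : (ξ + s • q) 2 = ξ 2 + s * q 2 := by simp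
    rw [h3]
    have : s * q 2 ≤ 0 := mul_nonpos_of_nonneg_of_nonpos hs (by linarith [le_abs_self (q 2 + 1)])
    linarith [le_abs_self (ξ 2 + (2*D₀+2))]
  set A := Om C ∩ closedBall 0 R'
  have AT : A ⊆ ⋃ x ∈ T, ball x (r/8/2) := inter_subset_right.trans hT
  have hop' : ∀ x ∈ A, ∀ y ∈ A, ‖x - y‖ < r/8 → N2 u (Om C ∩ ball y (r/2)) ≤ k1 * (N2 u (Om C ∩ ball x (r/2)) + e) :=
    fun x _ y hy hxy => hk1 lam mu p D₀ K K' C u h x y (le_of_lt (show y 2 < 0 from hy.1.1))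
      (fun h' => hy.1.2 (subset_closure h')) hxy
  have x0A : x₀ ∈ A := ⟨deep x₀ (by rw [x2]; linarith), mem_closedBall_zero_iff.2 x0n⟩
  obtain ⟨t, ht, hxt⟩ := mem_iUnion₂.1 (AT x0A)
  have key : ∀ z ∈ A, N2 u (Om C ∩ ball z (r/2)) ≤ c * e := by
    refine hc A (fun z => N2 u (Om C ∩ ball z (r/2))) e {t} (h.conn (lt_of_lt_of_le (by linarith) (le_max_right _ _))) AT hop'
      (by simpa using ht) (Finset.card_le_card Finset.sdiff_subset) ⟨x₀, x0A, by simpa using hxt⟩ fun z hz hz' => ?_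
    have hz' : z ∈ ball t (r/8/2) := by simpa using hz'
    refine (hop' x₀ x0A z hz ?_).trans ?_
    · rw [← dist_eq_norm]
      have := dist_triangle_right x₀ z t
      rw [mem_ball] at hxt hz'; linarith
    · calc _ ≤ (k1:ℝ≥0∞) * (k2 * e + e) := by gcongr
        _ = _ := by push_cast; ring
  calc N2 u (Om C ∩ ball 0 R) ≤ N2 u (⋃ x ∈ T, A ∩ ball x (r/8/2)) := by
        refine N2_mono fun z hz => ?_
        have zA : z ∈ A := ⟨hz.1, mem_closedBall_zero_iff.2 ((mem_ball_zero_iff.1 hz.2).le.trans (le_max_left _ _))⟩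
        obtain ⟨x, hx, hx'⟩ := mem_iUnion₂.1 (AT zA)
        exact mem_iUnion₂.2 ⟨x, hx, zA, hx'⟩
    _ ≤ ∑ x ∈ T, N2 u (A ∩ ball x (r/8/2)) := by
        clear_value A
        clear hT hc AT ht hxt key
        induction T using Finset.induction_on with
        | empty => simp [N2]
        | insert a T ha ih =>
          rw [Finset.set_biUnion_insert, Finset.sum_insert ha]
          exact (lintegral_union_le _ _ _).trans (add_le_add le_rfl ih)
    _ ≤ ∑ x ∈ T, c * e := Finset.sum_le_sum fun x _ => by
        by_cases hne : (A ∩ ball x (r/8/2)).Nonempty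
        · obtain ⟨z, zA, zx⟩ := hne
          refine (N2_mono (T := Om C ∩ ball z (r/2)) fun w hw => ⟨hw.1.1, ?_⟩).trans (key z zA)
          have := dist_triangle_right w z x
          have h2 := hw.2
          rw [mem_ball] at zx h2 ⊢; linarith
        · rw [not_nonempty_iff_eq_empty.1 hne]; simp [N2]
    _ = _ := by simp [mul_assoc]
lemma eR {I a x : ℝ} (ha : 0 ≤ a) (h : ‖I‖ₑ^2 ≤ eO a * eO (x^2)) (hx : 0 ≤ x) : |I| ≤ √a * x := by
  rw [← ofReal_norm, ← ENNReal.ofReal_pow (norm_nonneg _), ← ENNReal.ofReal_mul ha,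
    ENNReal.ofReal_le_ofReal_iff (by positivity), Real.norm_eq_abs] at h
  refine abs_le_of_sq_le_sq (by rwa [mul_pow, Real.sq_sqrt ha, ← sq_abs]) (by positivity)
lemma ebd {lam mu r D₀ : ℝ} (c : Cu D₀ θ) (hr : 0 < r) (R : ℝ) : ∃ B : ℝ, 0 ≤ B ∧
    ∀ (p K : ℝ) (K' : ℝ≥0) (C : Set E3) (u : E3 → E3), Cx lam mu p D₀ K r K' C u →
    N2 u (Om C ∩ ball 0 R) ≤ eO ((B * p)^2) := by
  set R' := max R (2*D₀+3)
  obtain ⟨L, hL⟩ := chain hr D₀ R'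
  set a := (N2 (fun z => θ z • trL) univ).toReal
  set b := (N2 (Df θ) univ).toReal
  have ha := ENNReal.ofReal_toReal (c.T univ).2.1
  have hb := ENNReal.ofReal_toReal (c.T univ).2.2.2
  set A := √a + √(b * L)
  have A0 : 0 ≤ A := by positivity
  refine ⟨√L * (A / |cc0 lam mu|), by positivity, fun p K K' C u h => ?_⟩
  have oO := Om_open C
  have mU := Adm.m oO h.sol.1
  have c0 : 0 < cc0 lam mu := lt_min (by linarith [h.mu0]) h.lam0
  have ms : AEStronglyMeasurable (fun x => sym (Df u x)) (volume.restrict (Om C)) := sym_cont.comp_aestronglyMeasurable mU.2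
  have sn : ∀ A : M3, ‖sym A‖ ≤ 1 * ‖A‖ := fun A => by
    have := norm_add_le A (ContinuousLinearMap.adjoint A)
    rw [LinearIsometryEquiv.norm_map] at this
    rw [sym, norm_smul]; norm_num; linarith
  have fs : N2 (fun x => sym (Df u x)) (Om C) ≠ ⊤ :=
    ((N2_le oO.measurableSet fun z _ => sn _).trans_lt (ENNReal.mul_lt_top ENNReal.ofReal_lt_top h.sol.2.2.1.lt_top)).ne
  obtain ⟨is, es⟩ := int_sq ms fs
  set e := √(∫ x in Om C, ‖sym (Df u x)‖^2)
  have ee2 : e^2 = ∫ x in Om C, ‖sym (Df u x)‖^2 := Real.sq_sqrt (integral_nonneg fun _ => by positivity)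
  have e0 : 0 ≤ e := Real.sqrt_nonneg _
  rw [← ee2] at es
  have hN := hL lam mu p K K' C u h
  have es' : N2 (fun x => sym (Df u x)) (Om C) = eO (e^2) := es
  rw [es'] at hN
  have k1 : cc0 lam mu * e^2 ≤ p * Lf θ (Om C) u := by
    rw [← h.energy c, ee2, ← integral_const_mul]
    refine integral_mono (is.const_mul _) (pair_int ((bil lam mu).continuous.comp_aestronglyMeasurable mU.2) ?_ mU.2 h.sol.2.2.1) fun z =>
      (bil_coer _).resolve_right (not_lt.2 c0.le)
    exact ((N2_le oO.measurableSet fun z _ => (bil lam mu).le_opNorm _).trans_lt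
      (ENNReal.mul_lt_top ENNReal.ofReal_lt_top h.sol.2.2.1.lt_top)).ne
  have t1 : |∫ z in Om C, (θ z • trL) (Df u z)| ≤ √a * e := by
    have : ∀ z, (θ z • trL) (Df u z) = (θ z • trL) (sym (Df u z)) := fun z => by
      rw [_root_.smul_apply, _root_.smul_apply, trL_app, trL_app, trc, trc]
      simp only [sym_coord]; congr 1; refine Finset.sum_congr rfl fun i _ => by ring
    simp only [this]
    refine eR ENNReal.toReal_nonneg ((pair_cs (c.T _).1 ms).trans ?_) e0
    rw [ha, es]
    exact mul_le_mul_left (N2_mono (subset_univ _)) _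
  have t2 : |∫ z in Om C, Df θ z (u z)| ≤ √(b * L) * e := by
    rw [setIntegral_eq_of_subset_of_forall_sdiff_eq_zero oO.measurableSet (s := Om C ∩ ball 0 R') inter_subset_left fun z hz => ?_]
    · refine eR (by positivity) ((pair_cs (c.T _).2.2.1 (mU.1.mono_measure (Measure.restrict_mono inter_subset_left le_rfl))).trans ?_) e0
      rw [ENNReal.ofReal_mul ENNReal.toReal_nonneg, hb, mul_assoc, ENNReal.ofReal_coe_nnreal]
      exact mul_le_mul' (N2_mono (subset_univ _)) hN
    · have hz' : 2*D₀+2 < ‖z‖ := by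
        have := hz.2
        have h2 := le_max_right R (2*D₀+3)
        by_contra h'
        exact this ⟨hz.1, mem_ball_zero_iff.2 (by linarith)⟩
      have : θ =ᶠ[𝓝 z] fun _ => 0 := by
        filter_upwards [(isOpen_lt continuous_const continuous_norm).mem_nhds hz'] with y hy using c.far y (le_of_lt hy)
      rw [this.fderiv_eq]; simp
  have k2 : cc0 lam mu * e^2 ≤ p * (A * e) := k1.trans (mul_le_mul_of_nonneg_left
    (by rw [Lf, add_mul]; exact add_le_add ((le_abs_self _).trans t1) ((le_abs_self _).trans t2)) h.p0.le)
  have p0 := h.p0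
  have k3 : e ≤ A / cc0 lam mu * p := by
    rcases e0.eq_or_lt with h0 | h0
    · rw [← h0]; positivity
    · rw [div_mul_eq_mul_div, le_div_iff₀ c0]
      nlinarith
  refine (N2_mono (inter_subset_inter_right _ (ball_subset_ball (le_max_left _ _)))).trans (hN.trans ?_)
  rw [abs_of_pos c0, ← ENNReal.ofReal_coe_nnreal, ← ENNReal.ofReal_mul L.coe_nonneg]
  refine ENNReal.ofReal_le_ofReal ?_
  rw [mul_assoc, mul_pow, Real.sq_sqrt L.coe_nonneg]
  gcongr
variable {lam mu r D₀ K : ℝ} {K' : ℝ≥0}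
lemma cj_le (S : E3 ≃ₗᵢ[ℝ] E3) (X : M3) : ‖cj S X‖ ≤ ‖X‖ :=
  ContinuousLinearMap.opNorm_le_bound _ (norm_nonneg _) fun y => by
    rw [cj_app, S.norm_map]; exact (X.le_opNorm _).trans_eq (by rw [S.symm.norm_map])
lemma Pch.Lm_lip {ε : ℝ} {S : E3 ≃ₗᵢ[ℝ] E3} {g : E3 → ℝ} {s : ℝ} (h : Pch O ε K r x S g s)
    {y z : E3} (hy : y ∈ ball o3 r) (hz : z ∈ ball o3 r) : ‖Lm g y - Lm g z‖ ≤ 9 * K * ‖y - z‖ := by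
  refine (convex_ball o3 r).norm_image_sub_le_of_norm_fderiv_le (𝕜 := ℝ) (fun w _ => h.Lm_C.differentiable (by simp) w)
    (fun w hw => (nrm_basis _).trans ?_) hz hy
  have a := (h.Lm_b hw).2.1
  have a0 := a 0
  have a1 := a 1
  have a2 := a 2
  simp only [dd] at a0 a1 a2
  simp only [Fin.sum_univ_three]; linarith
set_option maxHeartbeats 1000000 in
lemma locb (c : Cu D₀ θ) (hr : 0 < r) (hmu : 0 < mu) (hlam : 0 < 3*lam+2*mu) (hK : 0 ≤ K) (K' : ℝ≥0) (R : ℝ) (hR : 0 ≤ R) :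
    ∃ B : ℝ, 0 ≤ B ∧ ∀ (p : ℝ) (C : Set E3) (u : E3 → E3), Cx lam mu p D₀ K r K' C u → ∀ x ∈ Om C, ‖x‖ ≤ R →
    ‖u x‖ ≤ B * p ∧ ‖Df u x‖ ≤ B * p ∧ ∀ z ∈ Om C, ‖z - x‖ < r/8 →
    ‖u x - u z‖ ≤ B * p * √‖x - z‖ ∧ ‖Df u x - Df u z‖ ≤ B * p * √‖x - z‖ := by
  obtain ⟨b, b0, hb⟩ := ebd (lam := lam) (mu := mu) c hr (R + 1)
  obtain ⟨q, q0, hq⟩ := RR hmu hlam (ρ := r/4) (r := r/2) (by linarith) (by linarith) K'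
  set k := 1 / (3*lam+2*mu)
  have k0 : 0 ≤ k := by positivity
  set v := (volume (ball o3 (R+1))).toReal
  set m := √(2 * b^2 + 2 * k^2 * ((R+1)^2 * v))
  refine ⟨q * m * (4 + 18 * K) + k * (R + 1), by positivity, fun p C u h x hx xR => ?_⟩
  have p0 := h.p0
  have r6 := h.r6
  have oO := Om_open C
  have he := eps1_le lam mu
  obtain ⟨S, g, s, κ, P, hG, hW, hκ⟩ := h.loc c (le_of_lt (show x 2 < 0 from hx.1)) fun h' => hx.2 (subset_closure h')
  have κb : |κ| ≤ k * p := by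
    rcases hκ with h' | h'
    · rw [h'.1, abs_zero]; positivity
    · rw [← h'.1, mul_comm κ, ← mul_assoc, one_div_mul_cancel hlam.ne', one_mul, abs_of_nonneg]
      by_contra hn
      nlinarith [not_le.1 hn, h'.1]
  have C3 := h.sol.C3 hmu hlam
  have sub : Om C ∩ ball x r ⊆ Om C ∩ ball 0 (R+1) := fun z hz => ⟨hz.1, by
    have h1 := hz.2
    rw [mem_ball, dist_eq_norm] at h1
    rw [mem_ball_zero_iff]
    linarith [norm_le_norm_add_norm_sub' z x]⟩
  have mT : MeasurableSet (Om C ∩ ball o3 (R+1)) := oO.measurableSet.inter measurableSet_ball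
  have Nw : N2 (pb x S g (uk κ u)) (DD s (r/2)) ≤ eO ((m * p)^2) := by
    refine (P.N_comp he (fun z => S.symm (uk κ u z))).trans ((N2_mono sub).trans ?_)
    refine (N2_two mT (g := u) (h := fun z : E3 => z) (a := 1) (b := k * p)
      ((Adm.m oO h.sol.1).1.mono_measure (Measure.restrict_mono inter_subset_left le_rfl)) fun z _ => ?_).trans ?_
    · rw [S.symm.norm_map, one_mul]
      refine (norm_sub_le _ _).trans (add_le_add le_rfl ?_)
      rw [norm_smul]; exact mul_le_mul_of_nonneg_right κb (norm_nonneg _)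
    · have e1 := hb p K K' C u h
      have e2 : N2 (fun z : E3 => z) (Om C ∩ ball 0 (R+1)) ≤ eO ((R+1)^2 * v) := by
        refine (N2_bdd mT (M := R+1) fun z hz => (mem_ball_zero_iff.1 hz.2).le).trans ?_
        rw [ENNReal.ofReal_mul (by positivity), ENNReal.ofReal_toReal measure_ball_lt_top.ne]
        exact mul_le_mul' le_rfl (measure_mono inter_subset_right)
      refine (add_le_add (mul_le_mul' le_rfl e1) (mul_le_mul' le_rfl e2)).trans_eq ?_
      rw [← ENNReal.ofReal_mul (by positivity), ← ENNReal.ofReal_mul (by positivity), ← ENNReal.ofReal_add (by positivity) (by positivity),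
        mul_pow m, Real.sq_sqrt (by positivity)]
      congr 1; ring
  have W := hq s (Bg lam mu g) (pb x S g (uk κ u)) (m * p) P.s0 (by positivity) (hG.mono (by linarith))
    (P.pb_C he le_rfl (uk_C C3)) ((P.pb_N he oO (uk_C h.sol.1)).trans_lt (ENNReal.mul_lt_top ENNReal.ofReal_lt_top
      (uk_N oO h.sol.1 h.sol.2.2.1 inter_subset_left (oO.measurableSet.inter measurableSet_ball)
        ((measure_mono inter_subset_right).trans_lt measure_ball_lt_top).ne).lt_top)).ne Nw hW
  set w := pb x S g (uk κ u) with hw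
  have yD : ∀ z ∈ Om C, ‖z - x‖ < r/8 → Xi x S g z ∈ DD s (r/4) := fun z hz hzx => by
    have h1 := P.Xi_ball he (t := r) le_rfl (z := z) (by rw [mem_ball, dist_eq_norm]; linarith)
    refine ⟨(P.Th_mem he (by rw [mem_ball_zero_iff]; linarith)).1 (by rwa [P.ThXi]), by rw [mem_ball_zero_iff]; linarith⟩
  have uz : ∀ z, u z = S (w (Xi x S g z)) + κ • z := fun z => by
    simp only [hw, pb, P.ThXi, uk]; simp
  have Dz : ∀ z ∈ Om C, Df u z = cj S ((Df w (Xi x S g z)).comp (Lm g (Xi x S g z))) + κ • ContinuousLinearMap.id ℝ E3 := fun z hz => by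
    have d := dif oO h.sol.1 hz
    rw [hw, P.pb_L (by rw [P.ThXi]; exact dif oO (uk_C h.sol.1) hz), P.ThXi, uk_fd d]
    ext1 y; simp [cj_app]
  have cja : ∀ X Y : M3, cj S X - cj S Y = cj S (X - Y) := fun X Y => by ext1 y; simp [cj_app]
  have Lb : ∀ y ∈ DD s (r/4), ‖Lm g y‖ ≤ 2 := fun y hy => by
    have := (P.Lm_b (ball_subset_ball (by linarith) hy.2)).1
    have h2 := norm_le_norm_add_norm_sub' (Lm g y) (ContinuousLinearMap.id ℝ E3)
    have h3 := ContinuousLinearMap.norm_id_le (𝕜 := ℝ) (E := E3)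
    linarith
  set N := q * (m * p)
  have N0 : 0 ≤ N := by positivity
  have xx : ‖x - x‖ < r/8 := by simp; linarith
  have y0 := yD x hx xx
  obtain ⟨W1, W2, W3⟩ := W _ y0
  have Bp : (q * m * (4 + 18 * K) + k * (R + 1)) * p = 4 * N + 18 * (N * K) + k * p * R + k * p := by simp only [N]; ring
  have n1 : 0 ≤ N * K := by positivity
  have n2 : 0 ≤ k * p := by positivity
  have n3 : 0 ≤ k * p * R := by positivity
  rw [Bp]
  refine ⟨?_, ?_, fun z hz hzx => ?_⟩
  · rw [uz x]
    have h1 : ‖κ • x‖ ≤ k * p * R := by rw [norm_smul]; exact mul_le_mul κb xR (norm_nonneg _) n2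
    refine (norm_add_le _ _).trans ?_
    rw [S.norm_map]; linarith
  · rw [Dz x hx]
    refine (norm_add_le _ _).trans ?_
    have h1 := (cj_le S _).trans ((ContinuousLinearMap.opNorm_comp_le _ _).trans (mul_le_mul W2 (Lb _ y0) (norm_nonneg _) N0))
    have h2 : ‖κ • ContinuousLinearMap.id ℝ E3‖ ≤ k * p * 1 := by
      rw [norm_smul]; exact mul_le_mul κb ContinuousLinearMap.norm_id_le (norm_nonneg _) n2
    linarith
  · have y1 := yD z hz hzx
    rw [norm_sub_rev] at hzx
    set y := Xi x S g x
    set y' := Xi x S g z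
    set t := ‖x - z‖
    have t0 : 0 ≤ t := norm_nonneg _
    have τ2 : √t * √t = t := Real.mul_self_sqrt t0
    have τ1 : √t ≤ 1 := Real.sqrt_le_one.2 (by linarith)
    have tτ : t ≤ √t := by nlinarith [Real.sqrt_nonneg t]
    have ys : ‖y - y'‖ ≤ 2 * t := by
      have e : ‖S.symm (x - x) - S.symm (z - x)‖ = t := by rw [← map_sub, S.symm.norm_map]; congr 1; abel
      have l := P.lip (y := S.symm (x - x)) (z := S.symm (z - x)) (by simpa using hr)
        (by rw [mem_ball_zero_iff, S.symm.norm_map, norm_sub_rev]; linarith)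
      have : y - y' = (S.symm (x - x) - S.symm (z - x)) - (g (S.symm (x - x)) - g (S.symm (z - x))) • ee 2 := by
        simp only [y, y', Xi]; module
      rw [this]
      refine (norm_sub_le _ _).trans ?_
      rw [norm_smul, e, show ‖ee 2‖ = 1 by simp, Real.norm_eq_abs]
      rw [e] at l
      nlinarith
    have h1 : ‖w y - w y'‖ ≤ N * ‖y - y'‖ := (DD_convex s (r/4)).norm_image_sub_le_of_norm_fderiv_le (𝕜 := ℝ)
      (fun a ha => dif (DD_open s (r/2)) (P.pb_C he (by norm_num) (uk_C h.sol.1)) ⟨ha.1, ball_subset_ball (by linarith) ha.2⟩)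
      (fun a ha => (W a ha).2.1) y1 y0
    constructor
    · have : u x - u z = S (w y - w y') + κ • (x - z) := by rw [uz x, uz z, map_sub, smul_sub]; abel
      rw [this]
      refine (norm_add_le _ _).trans ?_
      rw [S.norm_map, norm_smul]
      have h2 := mul_le_mul_of_nonneg_right κb t0
      have h3 := mul_le_mul_of_nonneg_left ys N0
      have h4 := mul_le_mul_of_nonneg_left tτ N0
      have h5 := mul_le_mul_of_nonneg_left tτ n2
      have h6 := mul_nonneg n1 (Real.sqrt_nonneg t)
      have h7 := mul_nonneg n3 (Real.sqrt_nonneg t)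
      have h8 := mul_nonneg N0 (Real.sqrt_nonneg t)
      rw [Real.norm_eq_abs]
      linarith
    · rw [Dz x hx, Dz z hz, add_sub_add_right_eq_sub, cja]
      refine (cj_le S _).trans ?_
      have : (Df w y).comp (Lm g y) - (Df w y').comp (Lm g y') =
          (Df w y - Df w y').comp (Lm g y) + (Df w y').comp (Lm g y - Lm g y') := by
        ext1 a; simp
      rw [this]
      refine (norm_add_le _ _).trans ?_
      have h2 : √‖y - y'‖ ≤ 2 * √t := by
        rw [Real.sqrt_le_left (by positivity)]; nlinarith
      have h3 := (ContinuousLinearMap.opNorm_comp_le (Df w y - Df w y') (Lm g y)).trans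
        (mul_le_mul ((W3 _ y1).trans (mul_le_mul_of_nonneg_left h2 N0)) (Lb _ y0) (norm_nonneg _) (by positivity))
      have h4 := (ContinuousLinearMap.opNorm_comp_le (Df w y') (Lm g y - Lm g y')).trans
        (mul_le_mul (W _ y1).2.1 (P.Lm_lip (ball_subset_ball (by linarith) y0.2) (ball_subset_ball (by linarith) y1.2)) (norm_nonneg _) N0)
      have h5 := mul_le_mul_of_nonneg_left (ys.trans (mul_le_mul_of_nonneg_left tτ zero_le_two)) n1
      have h6 := mul_nonneg n2 (Real.sqrt_nonneg t)
      have h7 := mul_nonneg n3 (Real.sqrt_nonneg t)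
      linarith
lemma hext {W : Type*} [NormedAddCommGroup W] [CompleteSpace W] {A : Set E3} {f : E3 → W} {M c : ℝ}
    (hM : ∀ z ∈ A, ‖f z‖ ≤ M) (h : ∀ z ∈ A, ∀ z' ∈ A, ‖f z - f z'‖ ≤ c * √‖z - z'‖) :
    ∃ F : E3 → W, ContinuousOn F (closure A) ∧ (∀ x ∈ closure A, Tendsto f (𝓝[A] x) (𝓝 (F x))) ∧
    ∀ x ∈ closure A, ‖F x‖ ≤ M ∧ ∀ y ∈ closure A, ‖F x - F y‖ ≤ c * √‖x - y‖ := by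
  have lim : ∀ x ∈ closure A, ∃ l, Tendsto f (𝓝[A] x) (𝓝 l) := fun x hx => by
    have := mem_closure_iff_nhdsWithin_neBot.1 hx
    refine CompleteSpace.complete (f := map f (𝓝[A] x)) (cauchy_map_iff.2 ⟨this, ?_⟩)
    rw [tendsto_uniformity_iff_dist_tendsto_zero]
    have n1 : Tendsto (fun q : E3 × E3 => q.1) (𝓝[A] x ×ˢ 𝓝[A] x) (𝓝 x) := tendsto_fst.mono_right nhdsWithin_le_nhds
    have n2 : Tendsto (fun q : E3 × E3 => q.2) (𝓝[A] x ×ˢ 𝓝[A] x) (𝓝 x) := tendsto_snd.mono_right nhdsWithin_le_nhds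
    have n3 := ((n1.sub n2).norm.sqrt).const_mul c
    rw [sub_self, norm_zero, Real.sqrt_zero, mul_zero] at n3
    refine squeeze_zero' (.of_forall fun _ => dist_nonneg) ?_ n3
    filter_upwards [prod_mem_prod self_mem_nhdsWithin self_mem_nhdsWithin] with q hq
    rw [dist_eq_norm]; exact h _ hq.1 _ hq.2
  have T : ∀ x ∈ closure A, Tendsto f (𝓝[A] x) (𝓝 (extendFrom A f x)) := fun x hx => tendsto_extendFrom (lim x hx)
  refine ⟨extendFrom A f, continuousOn_extendFrom subset_rfl lim, T, fun x hx => ?_⟩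
  have := mem_closure_iff_nhdsWithin_neBot.1 hx
  refine ⟨le_of_tendsto (T x hx).norm (by filter_upwards [self_mem_nhdsWithin] with z hz using hM z hz), fun y hy => ?_⟩
  have := mem_closure_iff_nhdsWithin_neBot.1 hy
  have n1 : Tendsto (fun q : E3 × E3 => q.1) (𝓝[A] x ×ˢ 𝓝[A] y) (𝓝 x) := tendsto_fst.mono_right nhdsWithin_le_nhds
  have n2 : Tendsto (fun q : E3 × E3 => q.2) (𝓝[A] x ×ˢ 𝓝[A] y) (𝓝 y) := tendsto_snd.mono_right nhdsWithin_le_nhds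
  refine le_of_tendsto_of_tendsto (((T x hx).comp tendsto_fst).sub ((T y hy).comp tendsto_snd)).norm
    (((n1.sub n2).norm.sqrt).const_mul c) ?_
  filter_upwards [prod_mem_prod self_mem_nhdsWithin self_mem_nhdsWithin] with q hq using h _ hq.1 _ hq.2
def mtx (X : M3) : Matrix (Fin 3) (Fin 3) ℝ := fun i j => X (ee j) i
lemma mtx_le {X : M3} {c : ℝ} (h : ‖X‖ ≤ c) : frob2 (mtx X) ≤ 3 * c^2 := by
  have e : frob2 (mtx X) = hs X := by rw [hs_coord, Finset.sum_comm]; rfl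
  rw [e]
  have := pow_le_pow_left₀ (norm_nonneg X) h 2
  linarith [hs_le_op X]
lemma Cx.acc {lam mu p D₀ K r R : ℝ} {K' : ℝ≥0} (h : Cx lam mu p D₀ K r K' C u)
    (hx : x 2 ≤ 0) (hxC : x ∉ C) (hR : ‖x‖ < R) : x ∈ closure (Om C ∩ ball 0 R) := by
  obtain ⟨S, g, s, P, -⟩ := h.pt x hx hxC
  have hr := h.r0
  refine Metric.mem_closure_iff.2 fun ε hε => ?_
  set t := min (ε/2) (min (r/2) ((R - ‖x‖)/2))
  have t0 : 0 < t := lt_min (by linarith) (lt_min (by linarith) (by linarith))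
  have t1 : t ≤ ε/2 := min_le_left _ _
  have t2 : t ≤ r/2 := (min_le_right _ _).trans (min_le_left _ _)
  have t3 : t ≤ (R - ‖x‖)/2 := (min_le_right _ _).trans (min_le_right _ _)
  have n : ‖(-t) • ee 2‖ = t := by rw [neg_smul, norm_neg, ee_n 2 t0.le]
  refine ⟨x + S ((-t) • ee 2), ⟨(P.mem _ ?_).2 ?_, ?_⟩, ?_⟩
  · rw [mem_ball_zero_iff, n]; linarith
  · have := P.gi 0 (-t)
    rw [zero_add, P.g0] at this
    rw [this]
    have := P.s0
    simp; linarith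
  · rw [mem_ball_zero_iff]
    refine (norm_add_le _ _).trans_lt ?_
    rw [S.norm_map, n]; linarith
  · rw [dist_self_add_right, S.norm_map, n]; linarith
open Filter Topology in
set_option maxHeartbeats 1000000 in
end
theorem regularity_estimate (lam mu r₀ E₀ D₀ α β : ℝ)
    (hmu : 0 < mu) (hlam : 0 < 3*lam + 2*mu) (hr₀ : 0 < r₀) (hE₀ : 0 < E₀) (hD₀ : 1 < D₀)
    (hα : 2 < α) (hβ : 3 ≤ β) (hαβ : α < β) :
    ∃ c : ℝ, 0 < c ∧ ∀ C : Set E3, IsC3Cavity r₀ E₀ D₀ C →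
      ∀ Q : Set E3, IsOpen Q → Bornology.IsBounded Q → Q ⊆ lowerHalf →
      HasC3Boundary r₀ E₀ Q →
      closure (negBall (α*D₀)) ⊆ closure Q → closure Q ⊆ closure (negBall (β*D₀)) →
      ∀ p : ℝ, 0 < p → ∀ u : E3 → E3, IsWeakSolution lam mu p C u →
      ∃ (v : E3 → E3) (g : E3 → Matrix (Fin 3) (Fin 3) ℝ),
        ContinuousOn v (closure Q \ C) ∧ ContinuousOn g (closure Q \ C) ∧
        (∀ x ∈ (closure Q \ C) ∩ (lowerHalf \ closure C), v x = u x ∧ g x = jac u x) ∧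
        (∀ x ∈ closure Q \ C, ‖v x‖ ≤ c * p) ∧
        (∀ x ∈ closure Q \ C, frob2 (g x) ≤ (c * p)^2) ∧
        (∀ x ∈ closure Q \ C, ∀ y ∈ closure Q \ C,
          frob2 (g x - g y) ≤ (c * p)^2 * dist x y) := by
  obtain ⟨r, r0, r6, hp⟩ := patch hr₀ hE₀ hD₀ (eps1_pos hmu hlam)
  obtain ⟨K', hK'⟩ := Bg_Gd hmu hlam (r := r) hE₀.le
  obtain ⟨θ, c⟩ := Cu_ex hD₀
  set R := β * D₀ + 1
  have R0 : 0 ≤ R := by simp only [R]; nlinarith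
  obtain ⟨B, B0, hB⟩ := locb c r0 hmu hlam hE₀.le K' R R0
  set σ := √(r/8)
  have σ0 : 0 < σ := Real.sqrt_pos.2 (by linarith)
  set b := B + 2 * B / σ
  have b0 : 0 ≤ b := by positivity
  have Bb : B ≤ b := le_add_of_nonneg_right (by positivity)
  refine ⟨2 * b + 1, by positivity, fun C hC Q _ _ _ _ _ hQ p p0 u hu => ?_⟩
  have h : Cx lam mu p D₀ E₀ r K' C u := {
    mu0 := hmu, lam0 := hlam, D1 := hD₀, oC := hC.1.1, nC := fr_null hr₀ hC.1.1 hC.2, cC := hC.1.2.2.1, CC := hC.1.2.2.2.1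
    bC := fun x hx => mem_ball_zero_iff.2 (hC.1.2.2.2.2.1 hx).1
    r0 := r0, r6 := r6, p0 := p0, sol := weak1 hC.1.2.1 hu
    pt := fun x hx hxC => by
      obtain ⟨S, g, s, P, d⟩ := hp C hC x hx hxC
      exact ⟨S, g, s, P, hK' _ x S g s P, d⟩ }
  have hb := hB p C u h
  set A := Om C ∩ ball 0 R
  have AR : ∀ z ∈ A, ‖z‖ ≤ R := fun z hz => (mem_ball_zero_iff.1 hz.2).le
  have Bp : B * p ≤ b * p := mul_le_mul_of_nonneg_right Bb p0.le
  have hol : ∀ {W : Type} [NormedAddCommGroup W] (f : E3 → W), (∀ z ∈ A, ‖f z‖ ≤ B * p) →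
      (∀ x ∈ A, ∀ z ∈ A, ‖z - x‖ < r/8 → ‖f x - f z‖ ≤ B * p * √‖x - z‖) → ∀ x ∈ A, ∀ z ∈ A, ‖f x - f z‖ ≤ b * p * √‖x - z‖ := by
    intro W _ f h1 h2 x hx z hz
    rcases lt_or_ge ‖z - x‖ (r/8) with hl | hl
    · exact (h2 x hx z hz hl).trans (mul_le_mul_of_nonneg_right Bp (Real.sqrt_nonneg _))
    · rw [norm_sub_rev] at hl
      have h3 : σ ≤ √‖x - z‖ := Real.sqrt_le_sqrt hl
      have h5 : 2 * B * p ≤ 2 * B / σ * p * √‖x - z‖ := by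
        calc 2 * B * p = 2 * B / σ * p * σ := by field_simp
          _ ≤ _ := by gcongr
      have h6 : 0 ≤ B * p * √‖x - z‖ := by positivity
      have := norm_sub_le (f x) (f z)
      have e : b * p * √‖x - z‖ = B * p * √‖x - z‖ + 2 * B / σ * p * √‖x - z‖ := by simp only [b]; ring
      linarith [h1 x hx, h1 z hz]
  obtain ⟨v, vc, vt, vb⟩ := hext (fun z hz => (hb z hz.1 (AR z hz)).1) (hol u (fun z hz => (hb z hz.1 (AR z hz)).1)
    fun x hx z hz hxz => ((hb x hx.1 (AR x hx)).2.2 z hz.1 hxz).1)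
  obtain ⟨G, Gc, Gt, Gb⟩ := hext (fun z hz => (hb z hz.1 (AR z hz)).2.1) (hol (fderiv ℝ u) (fun z hz => (hb z hz.1 (AR z hz)).2.1)
    fun x hx z hz hxz => ((hb x hx.1 (AR x hx)).2.2 z hz.1 hxz).2)
  have hc : closure (negBall (β*D₀)) ⊆ {x | ‖x‖ ≤ β*D₀ ∧ x 2 ≤ 0} := closure_minimal (fun x hx => ⟨hx.1.le, hx.2.le⟩)
    ((isClosed_le continuous_norm continuous_const).and (isClosed_le (f := fun z : E3 => z 2) (EuclideanSpace.proj 2).continuous continuous_const))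
  have lt : ∀ x ∈ closure Q, ‖x‖ < R := fun x hx => (hc (hQ hx)).1.trans_lt (by simp [R])
  have sub : closure Q \ C ⊆ closure A := fun x hx => h.acc (hc (hQ hx.1)).2 hx.2 (lt x hx.1)
  have bp0 : 0 ≤ b * p := by positivity
  have Bc : B * p ≤ (2 * b + 1) * p := Bp.trans (by nlinarith)
  refine ⟨v, fun x => mtx (G x), vc.mono sub, ?_, fun x hx => ?_, fun x hx => (vb x (sub hx)).1.trans Bc, fun x hx => ?_, fun x hx y hy => ?_⟩
  · refine continuousOn_pi.2 fun i => continuousOn_pi.2 fun j => ?_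
    exact ((EuclideanSpace.proj i).continuous.comp (ContinuousLinearMap.apply ℝ E3 (ee j)).continuous).comp_continuousOn (Gc.mono sub)
  · have xA : x ∈ A := ⟨hx.2, mem_ball_zero_iff.2 (lt x hx.1.1)⟩
    have := mem_closure_iff_nhdsWithin_neBot.1 (subset_closure xA)
    have oO := (Om_open C).mem_nhds hx.2
    have e1 := tendsto_nhds_unique (vt x (sub hx.1)) ((h.sol.1.continuousOn.continuousAt oO).tendsto.mono_left nhdsWithin_le_nhds)
    have e2 := tendsto_nhds_unique (Gt x (sub hx.1)) (((h.sol.1.continuousOn_fderiv_of_isOpen (Om_open C) le_rfl).continuousAt oO).tendsto.mono_left nhdsWithin_le_nhds)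
    refine ⟨e1, ?_⟩
    show mtx (G x) = _; rw [e2]; rfl
  · refine (mtx_le (Gb x (sub hx)).1).trans ?_
    have : 0 ≤ B * p := by positivity
    nlinarith
  · have e : mtx (G x) - mtx (G y) = mtx (G x - G y) := rfl
    rw [e]
    refine (mtx_le ((Gb x (sub hx)).2 y (sub hy))).trans ?_
    rw [mul_pow, Real.sq_sqrt (norm_nonneg _), ← mul_assoc, dist_eq_norm]
    refine mul_le_mul_of_nonneg_right ?_ (norm_nonneg _)
    nlinarith
end
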